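/- Let c satisfy (B0)–(B3) and (B2s). Fix probability densities f⁺ ∈ L¹(U) and f⁻ ∈ L¹(V) with f⁺(x)/f⁻(y) ∈ L∞(U × V), and set dμ± := f± dLebⁿ. If moreover f⁻(y)/f⁺(x) ∈ L∞(U′ × V) for some open set U′ ⊂ U, then the infimum of Monge's problem inf_{G_#μ⁺=μ⁻} ∫ c(x, G(x)) dμ⁺(x) is attained by a Borel map G : cl U → cl V whose restriction to U′ is locally Hölder continuous and one-to-one; moreover the Hölder exponent depends only on the dimension n and on ‖log(f⁺/f⁻)‖_{L∞(U′ × V)}. -/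

import Mathlib

open Set MeasureTheory Metric Bornology
open scoped ENNReal NNReal Pointwise

noncomputable section

abbrev Euc (n : ℕ) := EuclideanSpace ℝ (Fin n)

/-- Partial gradient of the cost in the first variable: `D_x c(x,y)`. -/
noncomputable def gradX (n : ℕ) (c : Euc n → Euc n → ℝ) (x y : Euc n) : Euc n :=
  gradient (fun x' => c x' y) x

/-- Partial gradient of the cost in the second variable: `D_y c(x,y)`. -/
noncomputable def gradY (n : ℕ) (c : Euc n → Euc n → ℝ) (x y : Euc n) : Euc n :=
  gradient (fun y' => c x y') y

/-- Mixed second derivative `D²_{xy} c` as a continuous linear map. -/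
noncomputable def DxyC (n : ℕ) (c : Euc n → Euc n → ℝ) (x y : Euc n) : Euc n →L[ℝ] Euc n :=
  fderiv ℝ (fun x' => gradY n c x' y) x

/-- Second derivative `D²_{xx} c`. -/
noncomputable def DxxC (n : ℕ) (c : Euc n → Euc n → ℝ) (x y : Euc n) : Euc n →L[ℝ] Euc n :=
  fderiv ℝ (fun x' => gradX n c x' y) x

/-- Third derivative `D²_{xx} D_y c`. -/
noncomputable def DxxyC (n : ℕ) (c : Euc n → Euc n → ℝ) (x y : Euc n) :
    Euc n →L[ℝ] Euc n →L[ℝ] Euc n :=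
  fderiv ℝ (fun x' => DxyC n c x' y) x

/-- `β⁺_c = ‖D²_{xy} c‖_{L∞(U×V)}`. -/
noncomputable def betaPlus (n : ℕ) (c : Euc n → Euc n → ℝ) (U V : Set (Euc n)) : ℝ :=
  sSup ((fun p : Euc n × Euc n => ‖DxyC n c p.1 p.2‖) '' (U ×ˢ V))

/-- `β⁻_c = ‖(D²_{xy} c)⁻¹‖_{L∞(U×V)}`. -/
noncomputable def betaMinus (n : ℕ) (c : Euc n → Euc n → ℝ) (U V : Set (Euc n)) : ℝ :=
  sSup ((fun p : Euc n × Euc n => ‖(DxyC n c p.1 p.2).inverse‖) '' (U ×ˢ V))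

/-- `γ⁺_c = ‖det D²_{xy} c‖_{L∞(U×V)}`. -/
noncomputable def gammaPlus (n : ℕ) (c : Euc n → Euc n → ℝ) (U V : Set (Euc n)) : ℝ :=
  sSup ((fun p : Euc n × Euc n =>
    |LinearMap.det ((DxyC n c p.1 p.2 : Euc n →L[ℝ] Euc n) : Euc n →ₗ[ℝ] Euc n)|) '' (U ×ˢ V))

/-- `γ⁻_c = ‖(det D²_{xy} c)⁻¹‖_{L∞(U×V)}`. -/
noncomputable def gammaMinus (n : ℕ) (c : Euc n → Euc n → ℝ) (U V : Set (Euc n)) : ℝ :=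
  sSup ((fun p : Euc n × Euc n =>
    |LinearMap.det ((DxyC n c p.1 p.2 : Euc n →L[ℝ] Euc n) : Euc n →ₗ[ℝ] Euc n)|⁻¹) '' (U ×ˢ V))

noncomputable def supDxx (n : ℕ) (c : Euc n → Euc n → ℝ) (U V : Set (Euc n)) : ℝ :=
  sSup ((fun p : Euc n × Euc n => ‖DxxC n c p.1 p.2‖) '' (U ×ˢ V))

noncomputable def supDx (n : ℕ) (c : Euc n → Euc n → ℝ) (U V : Set (Euc n)) : ℝ :=
  sSup ((fun p : Euc n × Euc n => ‖gradX n c p.1 p.2‖) '' (U ×ˢ V))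

noncomputable def supDxxy (n : ℕ) (c : Euc n → Euc n → ℝ) (U V : Set (Euc n)) : ℝ :=
  sSup ((fun p : Euc n × Euc n => ‖DxxyC n c p.1 p.2‖) '' (U ×ˢ V))

/-- The constant `M_c` from Theorem 4.3. -/
noncomputable def Mconst (n : ℕ) (c : Euc n → Euc n → ℝ) (U V : Set (Euc n)) : ℝ :=
  (betaMinus n c U V) ^ 2 * supDxx n c U V +
    (betaMinus n c U V) ^ 3 * supDx n c U V * supDxxy n c U V

/-- The constant `ε_c` of Lemma 6.1: `1/ε_c = 2 (β⁺)⁴ (β⁻)⁶ ‖D³_{xxy} c‖_∞`. -/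
noncomputable def epsC (n : ℕ) (c : Euc n → Euc n → ℝ) (U V : Set (Euc n)) : ℝ :=
  (2 * (betaPlus n c U V) ^ 4 * (betaMinus n c U V) ^ 6 * supDxxy n c U V)⁻¹

/-- Condition (B0). -/
def B0cond (n : ℕ) (c : Euc n → Euc n → ℝ) (U V : Set (Euc n)) : Prop :=
  IsOpen U ∧ IsBounded U ∧ IsOpen V ∧ IsBounded V ∧
    ContDiffOn ℝ 4 (Function.uncurry c) (closure U ×ˢ closure V)

/-- `f` is a (C¹-) diffeomorphism from `S` onto its range. -/
def DiffeoOnto (n : ℕ) (f : Euc n → Euc n) (S : Set (Euc n)) : Prop :=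
  Set.InjOn f S ∧ ContDiffOn ℝ 1 f S ∧ ContDiffOn ℝ 1 (Function.invFunOn f S) (f '' S)

/-- Condition (B1) (bi-twist). -/
def B1cond (n : ℕ) (c : Euc n → Euc n → ℝ) (U V : Set (Euc n)) : Prop :=
  (∀ y ∈ closure V, DiffeoOnto n (fun x => -gradY n c x y) (closure U)) ∧
  (∀ x ∈ closure U, DiffeoOnto n (fun y => -gradX n c x y) (closure V))

/-- `U_ȳ := -D_y c(U, ȳ)`. -/
def Uyset (n : ℕ) (c : Euc n → Euc n → ℝ) (U : Set (Euc n)) (ybar : Euc n) : Set (Euc n) :=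
  (fun x => -gradY n c x ybar) '' U

/-- `V_x̄ := -D_x c(x̄, V)`. -/
def Vxset (n : ℕ) (c : Euc n → Euc n → ℝ) (V : Set (Euc n)) (xbar : Euc n) : Set (Euc n) :=
  (fun y => -gradX n c xbar y) '' V

/-- Condition (B2) (bi-convexity). -/
def B2cond (n : ℕ) (c : Euc n → Euc n → ℝ) (U V : Set (Euc n)) : Prop :=
  (∀ y ∈ closure V, Convex ℝ (Uyset n c U y)) ∧ (∀ x ∈ closure U, Convex ℝ (Vxset n c V x))

/-- A strongly convex set: each boundary point is touched from outside by a sphere of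
radius `R` enclosing the set. -/
def StronglyConvexSet (n : ℕ) (Q : Set (Euc n)) : Prop :=
  Convex ℝ Q ∧ ∃ R : ℝ, 0 < R ∧ ∀ x ∈ frontier Q, ∃ z : Euc n, dist x z = R ∧ Q ⊆ closedBall z R

/-- Condition (B2s). -/
def B2scond (n : ℕ) (c : Euc n → Euc n → ℝ) (U V : Set (Euc n)) : Prop :=
  (∀ y ∈ closure V, StronglyConvexSet n (Uyset n c U y)) ∧
  (∀ x ∈ closure U, StronglyConvexSet n (Vxset n c V x))

/-- An affinely parameterized line segment on `[-1,1]`. -/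
def IsAffineSeg (n : ℕ) (F : ℝ → Euc n × Euc n) : Prop :=
  ∃ a b : Euc n × Euc n, ∀ t ∈ Icc (-1 : ℝ) 1, F t = a + t • b

/-- `∂²/∂s∂t c(x(s), y(t))` at `(0,0)`. -/
noncomputable def crossDiff2 (n : ℕ) (c : Euc n → Euc n → ℝ) (x y : ℝ → Euc n) : ℝ :=
  deriv (fun s => deriv (fun t => c (x s) (y t)) 0) 0

/-- `∂⁴/∂s²∂t² c(x(s), y(t))` at `(0,0)`. -/
noncomputable def crossDiff4 (n : ℕ) (c : Euc n → Euc n → ℝ) (x y : ℝ → Euc n) : ℝ :=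
  deriv (deriv (fun s => deriv (deriv (fun t => c (x s) (y t))) 0)) 0

/-- Condition (B3) (= A3w). -/
def B3cond (n : ℕ) (c : Euc n → Euc n → ℝ) (U V : Set (Euc n)) : Prop :=
  ∀ x y : ℝ → Euc n, (∀ t ∈ Icc (-1 : ℝ) 1, x t ∈ closure U) →
    (∀ t ∈ Icc (-1 : ℝ) 1, y t ∈ closure V) →
    IsAffineSeg n (fun t => (gradY n c (x t) (y 0), gradX n c (x 0) (y t))) →
    crossDiff2 n c x y = 0 → crossDiff4 n c x y ≤ 0

/-- Condition (B4) (non-negative cross-curvature). -/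
def B4cond (n : ℕ) (c : Euc n → Euc n → ℝ) (U V : Set (Euc n)) : Prop :=
  ∀ x y : ℝ → Euc n, (∀ t ∈ Icc (-1 : ℝ) 1, x t ∈ closure U) →
    (∀ t ∈ Icc (-1 : ℝ) 1, y t ∈ closure V) →
    IsAffineSeg n (fun t => (gradY n c (x t) (y 0), gradX n c (x 0) (y t))) →
    crossDiff4 n c x y ≤ 0

/-- The `c*`-transform `u^{c*}(y) = sup_{x ∈ A} (-c(x,y) - u(x))`. -/
noncomputable def cStarT (n : ℕ) (c : Euc n → Euc n → ℝ) (A : Set (Euc n)) (u : Euc n → ℝ)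
    (y : Euc n) : ℝ :=
  sSup ((fun x => -c x y - u x) '' A)

/-- `u` is `c`-convex on `A` (relative to the target set `B`): `u = (u^{c*})^c`. -/
def CConvexOn (n : ℕ) (c : Euc n → Euc n → ℝ) (A B : Set (Euc n)) (u : Euc n → ℝ) : Prop :=
  ∀ x ∈ A, u x = sSup ((fun y => -c x y - cStarT n c A u y) '' B)

/-- The `c`-subdifferential `∂ᶜu ⊂ A × B`. -/
def cSubdiff (n : ℕ) (c : Euc n → Euc n → ℝ) (A B : Set (Euc n)) (u : Euc n → ℝ) :
    Set (Euc n × Euc n) :=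
  {p | p.1 ∈ A ∧ p.2 ∈ B ∧ u p.1 + cStarT n c A u p.2 + c p.1 p.2 = 0}

def cSubdiffAt (n : ℕ) (c : Euc n → Euc n → ℝ) (A B : Set (Euc n)) (u : Euc n → ℝ)
    (x : Euc n) : Set (Euc n) :=
  {y | (x, y) ∈ cSubdiff n c A B u}

def cSubdiffImg (n : ℕ) (c : Euc n → Euc n → ℝ) (A B : Set (Euc n)) (u : Euc n → ℝ)
    (X : Set (Euc n)) : Set (Euc n) :=
  ⋃ x ∈ X, cSubdiffAt n c A B u x

/-- `∂^{c*}u^{c*}(Y) = {x : ∃ y ∈ Y, (x,y) ∈ ∂ᶜu}`. -/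
def cSubdiffPre (n : ℕ) (c : Euc n → Euc n → ℝ) (A B : Set (Euc n)) (u : Euc n → ℝ)
    (Y : Set (Euc n)) : Set (Euc n) :=
  {x | ∃ y ∈ Y, (x, y) ∈ cSubdiff n c A B u}

/-- `|∂ᶜu| ≥ lam` on `S`. -/
def MAge (n : ℕ) (c : Euc n → Euc n → ℝ) (A B : Set (Euc n)) (u : Euc n → ℝ) (lam : ℝ)
    (S : Set (Euc n)) : Prop :=
  ∀ X : Set (Euc n), X ⊆ S → MeasurableSet X →
    ENNReal.ofReal lam * volume X ≤ volume (cSubdiffImg n c A B u X)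

/-- `|∂ᶜu| ≤ lam` on `S`. -/
def MAle (n : ℕ) (c : Euc n → Euc n → ℝ) (A B : Set (Euc n)) (u : Euc n → ℝ) (lam : ℝ)
    (S : Set (Euc n)) : Prop :=
  ∀ X : Set (Euc n), X ⊆ S → MeasurableSet X →
    volume (cSubdiffImg n c A B u X) ≤ ENNReal.ofReal lam * volume X

/-- The inverse of the cost-exponential coordinate change `q(x) = -D_y c(x, ȳ)`. -/
noncomputable def xOf (n : ℕ) (c : Euc n → Euc n → ℝ) (U : Set (Euc n)) (ybar : Euc n) :
    Euc n → Euc n :=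
  Function.invFunOn (fun x => -gradY n c x ybar) (closure U)

/-- `cl U_ȳ := -D_y c(cl U, ȳ)`. -/
def clUy (n : ℕ) (c : Euc n → Euc n → ℝ) (U : Set (Euc n)) (ybar : Euc n) : Set (Euc n) :=
  (fun x => -gradY n c x ybar) '' closure U

/-- The modified cost `c̃(q,y) = c(x(q), y) - c(x(q), ȳ)`. -/
noncomputable def modCost (n : ℕ) (c : Euc n → Euc n → ℝ) (U : Set (Euc n)) (ybar : Euc n)
    (q y : Euc n) : ℝ :=
  c (xOf n c U ybar q) y - c (xOf n c U ybar q) ybar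

/-- The modified potential `ũ(q) = u(x(q)) + c(x(q), ȳ)`. -/
noncomputable def modPot (n : ℕ) (c : Euc n → Euc n → ℝ) (U : Set (Euc n)) (ybar : Euc n)
    (u : Euc n → ℝ) (q : Euc n) : ℝ :=
  u (xOf n c U ybar q) + c (xOf n c U ybar q) ybar

/-- The `c̃`-cone generated by `qt` and `Q` with height `-h0 > 0`. -/
noncomputable def cConeFun (n : ℕ) (ct : Euc n → Euc n → ℝ) (B Q : Set (Euc n)) (qt : Euc n)
    (h0 : ℝ) (q : Euc n) : ℝ :=
  sSup {r : ℝ | ∃ y ∈ B, r = -ct q y + ct qt y + h0 ∧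
    ∀ p ∈ frontier Q, -ct p y + ct qt y + h0 ≤ 0}

/-- The ordinary subdifferential `∂u(x)` relative to a domain `A`. -/
def subdiffAt (n : ℕ) (A : Set (Euc n)) (u : Euc n → ℝ) (x : Euc n) : Set (Euc n) :=
  {p | ∀ ε > 0, ∃ δ > 0, ∀ x' ∈ A, ‖x' - x‖ < δ →
    u x + @inner ℝ _ _ p (x' - x) - ε * ‖x' - x‖ ≤ u x'}

/-- The dual norm `‖v‖*_K = sup_{w ∈ K} ⟨w, v⟩`. -/
noncomputable def dualNorm (n : ℕ) (K : Set (Euc n)) (v : Euc n) : ℝ :=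
  sSup ((fun w => (@inner ℝ _ _ w v : ℝ)) '' K)

/-- The section `S(x̄, ȳ, τ)`. -/
def sectS (n : ℕ) (c : Euc n → Euc n → ℝ) (U : Set (Euc n)) (u : Euc n → ℝ)
    (xbar ybar : Euc n) (τ : ℝ) : Set (Euc n) :=
  {x ∈ U | u x ≤ u xbar - c x ybar + c xbar ybar + τ}

/-- The measure with density `f` restricted to `A`. -/
noncomputable def densMeasure (n : ℕ) (A : Set (Euc n)) (f : Euc n → ℝ) : Measure (Euc n) :=
  (volume.restrict A).withDensity fun x => ENNReal.ofReal (f x)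

end

open Set MeasureTheory Metric Bornology
open scoped ENNReal NNReal Pointwise

namespace FKM
open scoped RealInnerProductSpace

/-- Determinant of a frame (rows). -/
noncomputable def dt {n : ℕ} (d : Fin n → Euc n) : ℝ := (Matrix.of fun i j => d i j).det

noncomputable def Lr {n : ℕ} (d : Fin n → Euc n) : Euc n →ₗ[ℝ] Euc n :=
  Matrix.toEuclideanLin (Matrix.of fun i j => d i j)

noncomputable def Lc {n : ℕ} (d : Fin n → Euc n) : Euc n →ₗ[ℝ] Euc n :=
  Matrix.toEuclideanLin (Matrix.of fun i j => d i j).transpose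

lemma det_toEuc {n : ℕ} (A : Matrix (Fin n) (Fin n) ℝ) :
    LinearMap.det (Matrix.toEuclideanLin A) = A.det := by
  rw [Matrix.toEuclideanLin_eq_toLin]
  exact LinearMap.det_toLin _ _

lemma Lr_apply {n : ℕ} (d : Fin n → Euc n) (p : Euc n) (i : Fin n) : Lr d p i = ⟪d i, p⟫ := by
  simp [Lr, Matrix.toEuclideanLin, Matrix.mulVec, dotProduct, PiLp.inner_apply, mul_comm]

lemma Lc_apply {n : ℕ} (d : Fin n → Euc n) (s : Euc n) : Lc d s = ∑ i, s i • d i := by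
  ext j
  simp [Lc, Matrix.toEuclideanLin, Matrix.mulVec, dotProduct, mul_comm]

lemma det_Lr {n : ℕ} (d : Fin n → Euc n) : LinearMap.det (Lr d) = dt d := det_toEuc _
lemma det_Lc {n : ℕ} (d : Fin n → Euc n) : LinearMap.det (Lc d) = dt d := by
  rw [Lc, det_toEuc, Matrix.det_transpose]; rfl

lemma vol_box {n : ℕ} (l u : ℝ) :
    volume {s : Euc n | ∀ i, s i ∈ Icc l u} = ENNReal.ofReal (u - l) ^ n := by
  have h := EuclideanSpace.volume_preserving_symm_measurableEquiv_toLp (Fin n)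
  have h2 := h.measure_preimage (s := Set.pi univ fun _ => Icc l u)
    (MeasurableSet.univ_pi fun _ => measurableSet_Icc).nullMeasurableSet
  have : {s : Euc n | ∀ i, s i ∈ Icc l u} =
    (MeasurableEquiv.toLp 2 (Fin n → ℝ)).symm ⁻¹' (Set.pi univ fun _ => Icc l u) := by
    ext s; simp [Pi.le_def, forall_and]
  rw [this, h2, volume_pi_pi]
  simp [Real.volume_Icc]

lemma vol_par {n : ℕ} (d : Fin n → Euc n) (x : Euc n) (l u : ℝ) :
    volume ((fun s : Euc n => x + ∑ i, s i • d i) '' {s : Euc n | ∀ i, s i ∈ Icc l u}) =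
      ENNReal.ofReal |dt d| * ENNReal.ofReal (u - l) ^ n := by
  have : (fun s : Euc n => x + ∑ i, s i • d i) '' {s : Euc n | ∀ i, s i ∈ Icc l u} =
      (fun z => x + z) '' (Lc d '' {s : Euc n | ∀ i, s i ∈ Icc l u}) := by
    rw [image_image]; simp [Lc_apply]
  rw [this, image_add_left, measure_preimage_add, Measure.addHaar_image_linearMap, det_Lc, vol_box]

lemma vol_dual {n : ℕ} (d : Fin n → Euc n) (hd : dt d ≠ 0) (r : ℝ) :
    volume {p : Euc n | ∀ i, |⟪d i, p⟫| ≤ r} =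
      ENNReal.ofReal |(dt d)⁻¹| * ENNReal.ofReal (2 * r) ^ n := by
  have : {p : Euc n | ∀ i, |⟪d i, p⟫| ≤ r} = Lr d ⁻¹' {s : Euc n | ∀ i, s i ∈ Icc (-r) r} := by
    ext p; simp [Lr_apply, abs_le]
  rw [this, Measure.addHaar_preimage_linearMap _ (by rwa [det_Lr]), det_Lr, vol_box]
  congr 3; ring

lemma dt_smul {n : ℕ} (t : Fin n → ℝ) (d : Fin n → Euc n) :
    dt (fun i => t i • d i) = (∏ i, t i) * dt d := by
  rw [dt, dt, ← Matrix.det_mul_column]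
  congr 1

lemma dt_smul_const {n : ℕ} (t : ℝ) (d : Fin n → Euc n) :
    dt (fun i => t • d i) = t ^ n * dt d := by
  rw [dt_smul (fun _ => t)]; simp

lemma continuous_dt {n : ℕ} : Continuous (dt (n := n)) := by
  unfold dt
  apply Continuous.matrix_det
  refine continuous_matrix fun i j => ?_
  simp only [Matrix.of_apply]
  fun_prop

/-- Perturbation of frames. -/
lemma dt_perturb (n : ℕ) (δ : ℝ) (hδ : 0 < δ) : ∃ ε : ℝ, 0 < ε ∧ ε ≤ 1 ∧
    ∀ e e' : Fin n → Euc n, (∀ i, ‖e i‖ ≤ 1) → δ ≤ |dt e| → (∀ i, ‖e' i - e i‖ ≤ ε) →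
      δ / 2 ≤ |dt e'| := by
  have hK : IsCompact (Set.pi univ fun _ : Fin n => closedBall (0 : Euc n) 2) :=
    isCompact_univ_pi fun _ => isCompact_closedBall _ _
  have hu := hK.uniformContinuousOn_of_continuous (continuous_dt (n := n)).continuousOn
  rw [Metric.uniformContinuousOn_iff] at hu
  obtain ⟨η, hη, h⟩ := hu (δ/2) (by positivity)
  refine ⟨min 1 (η/2), by positivity, min_le_left _ _, fun e e' he hd hee => ?_⟩
  have h1 : e ∈ Set.pi univ fun _ : Fin n => closedBall (0 : Euc n) 2 := by
    intro i _; simp; linarith [he i]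
  have h2 : e' ∈ Set.pi univ fun _ : Fin n => closedBall (0 : Euc n) 2 := by
    intro i _; simp
    have := norm_sub_norm_le (e' i) (e i)
    have := (hee i).trans (min_le_left _ _)
    linarith [he i]
  have := h e' h2 e h1 (by
    rw [dist_eq_norm]
    refine lt_of_le_of_lt ((pi_norm_le_iff_of_nonneg (by positivity : 0 ≤ η/2)).2 fun i => ?_)
      (by linarith : η/2 < η)
    exact (hee i).trans (min_le_right _ _))
  rw [Real.dist_eq] at this
  have h3 := abs_sub_abs_le_abs_sub (dt e) (dt e')
  rw [abs_sub_comm] at h3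
  linarith

lemma abs_dt_onb {n : ℕ} (e : OrthonormalBasis (Fin n) ℝ (Euc n)) : |dt (fun i => e i)| = 1 := by
  have h : (Matrix.of fun i j => e i j) * (Matrix.of fun i j => e i j).transpose = 1 := by
    ext i j
    have := e.inner_eq_ite i j
    rw [PiLp.inner_apply] at this
    simp only [Matrix.mul_apply, Matrix.transpose_apply, Matrix.of_apply, Matrix.one_apply]
    rw [← this]; simp [mul_comm]
  have h2 := congrArg Matrix.det h
  rw [Matrix.det_mul, Matrix.det_transpose, Matrix.det_one] at h2
  have : dt (fun i => e i) * dt (fun i => e i) = 1 := h2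
  rw [← abs_mul_abs_self] at this
  nlinarith [abs_nonneg (dt fun i => e i)]

lemma dt_update {n : ℕ} (d : Fin n → Euc n) (k : Fin n) (c : Fin n → ℝ) :
    dt (Function.update d k (∑ i, c i • d i)) = c k * dt d := by
  have := Matrix.det_updateRow_sum (Matrix.of fun i j => d i j) k c
  rw [dt, dt, ← smul_eq_mul, ← this]
  congr 1
  ext i j
  by_cases h : i = k
  · subst h; simp
  · simp [h]

end FKM

open Set MeasureTheory Metric Bornology
open scoped ENNReal NNReal Pointwise

namespace FKM
open scoped RealInnerProductSpace

/-- max-volume frame in `Q - Q`. -/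
lemma max_frame {n : ℕ} {Q : Set (Euc n)} (hQ : IsCompact Q) (hne : (interior Q).Nonempty) :
    ∃ a b : Fin n → Euc n, (∀ i, a i ∈ Q) ∧ (∀ i, b i ∈ Q) ∧ dt (fun i => a i - b i) ≠ 0 ∧
      ∀ q ∈ Q, ∀ q' ∈ Q, ∃ t : Fin n → ℝ, (∀ i, |t i| ≤ 1) ∧
        q - q' = ∑ i, t i • (a i - b i) := by
  have hK : IsCompact ((Set.pi univ fun _ : Fin n => Q) ×ˢ (Set.pi univ fun _ : Fin n => Q)) :=
    (isCompact_univ_pi fun _ => hQ).prod (isCompact_univ_pi fun _ => hQ)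
  obtain ⟨x0, hx0⟩ := hne
  have hx0Q := interior_subset hx0
  have hcont : Continuous fun p : (Fin n → Euc n) × (Fin n → Euc n) =>
      |dt (fun i => p.1 i - p.2 i)| := by
    refine (continuous_dt.comp ?_).abs
    fun_prop
  obtain ⟨⟨a, b⟩, hab, hmax⟩ := hK.exists_isMaxOn ⟨(fun _ => x0, fun _ => x0), by
    constructor <;> intro i _ <;> exact hx0Q⟩ hcont.continuousOn
  have ha : ∀ i, a i ∈ Q := fun i => hab.1 i trivial
  have hb : ∀ i, b i ∈ Q := fun i => hab.2 i trivial
  have hm : ∀ a' b' : Fin n → Euc n, (∀ i, a' i ∈ Q) → (∀ i, b' i ∈ Q) →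
      |dt (fun i => a' i - b' i)| ≤ |dt (fun i => a i - b i)| := by
    intro a' b' ha' hb'
    exact hmax (show (a', b') ∈ _ from ⟨fun i _ => ha' i, fun i _ => hb' i⟩)
  have hne : dt (fun i => a i - b i) ≠ 0 := by
    obtain ⟨r, hr, hball⟩ := Metric.isOpen_iff.1 isOpen_interior x0 hx0
    let e := EuclideanSpace.basisFun (Fin n) ℝ
    have := hm (fun i => x0 + (r/2) • e i) (fun _ => x0) (fun i => by
      apply interior_subset; apply hball
      rw [mem_ball, dist_eq_norm, add_sub_cancel_left, norm_smul, e.norm_eq_one]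
      rw [Real.norm_of_nonneg (by positivity)]; linarith) (fun _ => hx0Q)
    simp only [add_sub_cancel_left] at this
    rw [dt_smul_const, abs_mul, abs_dt_onb] at this
    intro h0
    rw [h0] at this
    have h3 : 0 < |(r/2)^n| := by positivity
    rw [abs_zero, mul_one] at this
    linarith
  refine ⟨a, b, ha, hb, hne, fun q hq q' hq' => ?_⟩
  set d : Fin n → Euc n := fun i => a i - b i with hd
  have hsurj : Function.Surjective (Lc d) := by
    have : IsUnit (LinearMap.det (Lc d)) := by rw [det_Lc]; exact hne.isUnit
    intro z
    obtain ⟨t, ht⟩ := (LinearMap.equivOfIsUnitDet this).surjective z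
    exact ⟨t, by simpa using ht⟩
  obtain ⟨t, ht⟩ := hsurj (q - q')
  rw [Lc_apply] at ht
  refine ⟨fun i => t i, fun k => ?_, ht.symm⟩
  have h1 := hm (Function.update a k q) (Function.update b k q')
    (fun i => by by_cases h : i = k <;> [(subst h; simpa); simp [h, ha i]])
    (fun i => by by_cases h : i = k <;> [(subst h; simpa); simp [h, hb i]])
  have h2 : (fun i => Function.update a k q i - Function.update b k q' i) =
      Function.update d k (∑ i, t i • d i) := by
    rw [ht]
    funext i
    by_cases h : i = k
    · subst h; simp
    · simp [h, hd]
  rw [h2, dt_update, abs_mul] at h1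
  have : 0 < |dt d| := abs_pos.2 hne
  by_contra hc
  push Not at hc
  nlinarith

/-- Orthonormal frame adapted to a convex body. -/
lemma body_frame {n : ℕ} (hn : 0 < n) {Q : Set (Euc n)} (hQ : IsCompact Q) (hc : Convex ℝ Q)
    (hne : (interior Q).Nonempty) :
    ∃ (e : OrthonormalBasis (Fin n) ℝ (Euc n)) (w : Fin n → ℝ) (x : Euc n) (d : Fin n → Euc n)
      (Δ : ℝ), 0 < Δ ∧ (∀ i, 0 < w i) ∧ (∀ i, ∀ q ∈ Q, ∀ q' ∈ Q, |⟪q - q', e i⟫| ≤ w i) ∧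
      (∏ i, w i) = (n : ℝ) ^ n * Δ ∧
      volume Q ≤ ENNReal.ofReal (2 ^ n * Δ) ∧ |dt d| = Δ / (2 * n) ^ n ∧
      ∀ s : Fin n → ℝ, (∀ i, |s i| ≤ 1) → x + ∑ i, s i • d i ∈ Q := by
  obtain ⟨a, b, ha, hb, hd0, hrep⟩ := max_frame hQ hne
  set d : Fin n → Euc n := fun i => a i - b i with hd
  have hn' : (0:ℝ) < n := by exact_mod_cast hn
  let T : Euc n →ₗ[ℝ] Euc n := Lc d ∘ₗ Lr d
  have hTi : ∀ x y, ⟪T x, y⟫ = ∑ i, ⟪d i, x⟫ * ⟪d i, y⟫ := by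
    intro x y
    simp only [T, LinearMap.comp_apply, Lc_apply, Lr_apply, sum_inner, inner_smul_left]
    simp
  have hT : T.IsSymmetric := by
    intro x y
    rw [hTi, real_inner_comm, hTi]
    simp [mul_comm]
  have hfr : Module.finrank ℝ (Euc n) = n := by simp
  let e := hT.eigenvectorBasis hfr
  let σ := hT.eigenvalues hfr
  have hσ : ∀ i, σ i = ∑ j, ⟪d j, e i⟫ ^ 2 := by
    intro i
    have h1 := hTi (e i) (e i)
    rw [hT.apply_eigenvectorBasis hfr i, inner_smul_left] at h1
    have h2 : ⟪e i, e i⟫ = 1 := by rw [real_inner_self_eq_norm_sq, e.norm_eq_one]; norm_num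
    change (starRingEnd ℝ) (σ i : ℝ) * ⟪e i, e i⟫ = _ at h1
    rw [h2] at h1
    simp at h1
    rw [h1]; simp [pow_two]
  have hσ0 : ∀ i, 0 ≤ σ i := fun i => by rw [hσ]; positivity
  have hprod : ∏ i, σ i = dt d ^ 2 := by
    have h1 := hT.det_eq_prod_eigenvalues hfr
    have h2 : LinearMap.det T = dt d * dt d := by
      rw [LinearMap.det_comp, det_Lc, det_Lr]
    rw [h2] at h1
    rw [pow_two]; exact h1.symm
  have hσpos : ∀ i, 0 < σ i := by
    intro i
    refine lt_of_le_of_ne (hσ0 i) fun h => ?_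
    have := Finset.prod_eq_zero (Finset.mem_univ i) h.symm
    rw [hprod] at this
    exact hd0 (by simpa using this)
  refine ⟨e, fun i => n * Real.sqrt (σ i), ∑ i, (1/n : ℝ) • ((1/2:ℝ) • (a i + b i)),
    fun i => (1/(2*n) : ℝ) • d i, |dt d|, abs_pos.2 hd0,
    fun i => mul_pos hn' (Real.sqrt_pos.2 (hσpos i)), ?_, ?_, ?_, ?_, ?_⟩
  · intro i q hq q' hq'
    obtain ⟨t, ht, hqq⟩ := hrep q hq q' hq'
    rw [hqq, sum_inner]
    refine (Finset.abs_sum_le_sum_abs _ _).trans ?_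
    have : ∀ j ∈ Finset.univ, |⟪t j • (a j - b j), e i⟫| ≤ Real.sqrt (σ i) := by
      intro j _
      rw [inner_smul_left, abs_mul]
      simp only [conj_trivial]
      have h1 : |⟪a j - b j, e i⟫| ≤ Real.sqrt (σ i) := by
        apply Real.abs_le_sqrt
        rw [hσ]
        exact Finset.single_le_sum (f := fun j => ⟪d j, e i⟫ ^ 2) (fun _ _ => sq_nonneg _)
          (Finset.mem_univ j)
      calc _ ≤ 1 * |⟪a j - b j, e i⟫| := by gcongr; exact ht j
        _ ≤ _ := by linarith
    refine (Finset.sum_le_sum this).trans ?_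
    simp
  · rw [Finset.prod_mul_distrib]
    simp only [Finset.prod_const, Finset.card_univ, Fintype.card_fin]
    congr 1
    have h1 : (∏ i, Real.sqrt (σ i)) ^ 2 = dt d ^ 2 := by
      rw [← Finset.prod_pow, ← hprod]
      exact Finset.prod_congr rfl fun i _ => Real.sq_sqrt (hσ0 i)
    have h2 : 0 ≤ ∏ i, Real.sqrt (σ i) := Finset.prod_nonneg fun i _ => Real.sqrt_nonneg _
    rw [← abs_of_nonneg h2]
    exact (sq_eq_sq_iff_abs_eq_abs _ _).1 h1
  · obtain ⟨x0, hx0⟩ := hne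
    have hx0 := interior_subset hx0
    have : Q ⊆ (fun s : Euc n => x0 + ∑ i, s i • d i) '' {s : Euc n | ∀ i, s i ∈ Icc (-1:ℝ) 1} := by
      intro q hq
      obtain ⟨t, ht, hqq⟩ := hrep q hq x0 hx0
      refine ⟨WithLp.toLp 2 t, fun i => abs_le.1 (ht i), ?_⟩
      simp only
      rw [← hqq]; abel
    refine (measure_mono this).trans ?_
    rw [vol_par, ENNReal.ofReal_mul (by positivity), ENNReal.ofReal_pow (by positivity), mul_comm]
    norm_num
  · rw [dt_smul_const, abs_mul, abs_of_pos (by positivity)]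
    rw [div_pow, one_pow, one_div, div_eq_inv_mul]
  · intro s hs
    have : (∑ i, (1/n : ℝ) • ((1/2:ℝ) • (a i + b i))) + ∑ i, s i • (1/(2*n) : ℝ) • d i =
      ∑ i, (1/n : ℝ) • (((1 + s i)/2) • a i + ((1 - s i)/2) • b i) := by
      rw [← Finset.sum_add_distrib]
      refine Finset.sum_congr rfl fun i _ => ?_
      simp only [hd]
      have : (1/(2*n):ℝ) = (1/n) * (1/2) := by field_simp
      rw [this]
      module
    rw [this]
    refine hc.sum_mem (fun _ _ => by positivity) (by simp; field_simp) fun i _ => ?_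
    have := abs_le.1 (hs i)
    exact hc (ha i) (hb i) (by linarith) (by linarith) (by ring)

end FKM

open Set MeasureTheory Metric Bornology
open scoped ENNReal NNReal Pointwise

namespace FKM
open scoped RealInnerProductSpace
open Filter Topology

/-- Abstract modified optimal transport system (in `ȳ`-exponential coordinates). -/
structure Sys (n : ℕ) where
  O : Set (Euc n)
  Y : Set (Euc n)
  yb : Euc n
  b : Euc n → Euc n → ℝ
  P : Euc n → Euc n → Euc n
  u : Euc n → ℝ
  a : Euc n → ℝ
  m0 : ℝ
  hO : IsOpen O
  hOc : Convex ℝ O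
  hY : IsCompact Y
  hyb : yb ∈ Y
  hb0 : ∀ q ∈ O, b q yb = 0
  hg : ∀ q ∈ O, ∀ y ∈ Y, HasGradientAt (fun q => b q y) (P q y) q
  hPc : ContinuousOn (Function.uncurry P) (O ×ˢ Y)
  hbc : ContinuousOn (Function.uncurry b) (O ×ˢ Y)
  hac : ContinuousOn a Y
  ha0 : a yb = 0
  hu : ContinuousOn u O
  hle : ∀ q ∈ O, ∀ y ∈ Y, b q y - a y ≤ u q
  hex : ∀ q ∈ O, ∃ y ∈ Y, u q = b q y - a y
  hm0 : 0 < m0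
  hm1 : m0 ≤ 1
  star : ∀ q ∈ O, ∀ q' ∈ O, ∀ y ∈ Y, 0 < ⟪P q y, q' - q⟫ →
    m0 * ⟪P q y, q' - q⟫ ≤ ⟪P q' y, q' - q⟫
  inj : ∀ q ∈ O, ∀ y ∈ Y, ∀ y' ∈ Y, P q y = P q y' → y = y'
  gconv : ∀ q ∈ O, Convex ℝ (P q '' {y ∈ Y | u q = b q y - a y})
  cseg : ∀ q ∈ O, ∀ y0 ∈ Y, ∀ y1 ∈ Y, ∀ t ∈ Icc (0:ℝ) 1, ∃ z ∈ Y,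
    P q z = (1 - t) • P q y0 + t • P q y1 ∧
    ∀ q' ∈ O, b q' z - b q z ≤ max (b q' y0 - b q y0) (b q' y1 - b q y1)

namespace Sys
variable {n : ℕ} (S : Sys n)

/-- contact set -/
def G (q : Euc n) : Set (Euc n) := {y ∈ S.Y | S.u q = S.b q y - S.a y}

/-- image of a set -/
def GI (A : Set (Euc n)) : Set (Euc n) := {y | ∃ q ∈ A, y ∈ S.G q}

/-- sublevel set -/
def Q (h : ℝ) : Set (Euc n) := {q ∈ S.O | S.u q ≤ h}

variable {S}

lemma P_yb {q : Euc n} (hq : q ∈ S.O) : S.P q S.yb = 0 := by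
  have h1 := S.hg q hq _ S.hyb
  have h2 : HasGradientAt (fun _ : Euc n => (0:ℝ)) 0 q := by
    rw [hasGradientAt_iff_hasFDerivAt]; simpa using hasFDerivAt_const (0:ℝ) q
  have h3 : (fun q => S.b q S.yb) =ᶠ[𝓝 q] fun _ => (0:ℝ) := by
    filter_upwards [S.hO.mem_nhds hq] with q' hq' using S.hb0 q' hq'
  exact h1.unique (h2.congr_of_eventuallyEq h3)

lemma u_nonneg {q : Euc n} (hq : q ∈ S.O) : 0 ≤ S.u q := by
  have := S.hle q hq _ S.hyb
  rwa [S.hb0 q hq, S.ha0, sub_zero] at this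

lemma seg_mem {q q' : Euc n} (hq : q ∈ S.O) (hq' : q' ∈ S.O) {s : ℝ} (h0 : 0 ≤ s) (h1 : s ≤ 1) :
    q + s • (q' - q) ∈ S.O := S.hOc.add_smul_sub_mem hq hq' ⟨h0, h1⟩

lemma hasDerivAt_line {q w y : Euc n} {s : ℝ} (hq : q + s • w ∈ S.O) (hy : y ∈ S.Y) :
    HasDerivAt (fun s => S.b (q + s • w) y) ⟪S.P (q + s • w) y, w⟫ s := by
  have h1 := (S.hg _ hq y hy).hasFDerivAt
  have h2 : HasDerivAt (fun s : ℝ => q + s • w) w s := by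
    simpa using ((hasDerivAt_id s).smul_const w).const_add q
  have h3 := h1.comp_hasDerivAt s h2
  rw [InnerProductSpace.toDual_apply_apply] at h3
  exact h3

lemma mvt {q q' y : Euc n} (hq : q ∈ S.O) (hq' : q' ∈ S.O) (hy : y ∈ S.Y) :
    ∃ s ∈ Ioo (0:ℝ) 1, S.b q' y - S.b q y = ⟪S.P (q + s • (q' - q)) y, q' - q⟫ := by
  have hd : ∀ s ∈ Icc (0:ℝ) 1, HasDerivAt (fun s => S.b (q + s • (q' - q)) y)
      ⟪S.P (q + s • (q' - q)) y, q' - q⟫ s := fun s hs =>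
    hasDerivAt_line (seg_mem hq hq' hs.1 hs.2) hy
  obtain ⟨s, hs, h⟩ := exists_hasDerivAt_eq_slope (fun s => S.b (q + s • (q' - q)) y)
    (fun s => ⟪S.P (q + s • (q' - q)) y, q' - q⟫) zero_lt_one
    (fun s hs => (hd s hs).continuousAt.continuousWithinAt)
    (fun s hs => hd s (Ioo_subset_Icc_self hs))
  refine ⟨s, hs, ?_⟩
  rw [h]; simp

lemma up {q q' y : Euc n} (hq : q ∈ S.O) (hq' : q' ∈ S.O) (hy : y ∈ S.Y)
    (h : 0 < S.b q' y - S.b q y) : S.m0 * (S.b q' y - S.b q y) ≤ ⟪S.P q' y, q' - q⟫ := by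
  obtain ⟨s, hs, he⟩ := mvt hq hq' hy
  have hr := seg_mem hq hq' hs.1.le hs.2.le
  have e1 : q' - (q + s • (q' - q)) = (1 - s) • (q' - q) := by module
  have h1s : 0 < 1 - s := by linarith [hs.2]
  have h2 := S.star _ hr q' hq' y hy (by
    rw [e1, inner_smul_right, ← he]; positivity)
  rw [e1, inner_smul_right, inner_smul_right, ← he] at h2
  have : (1 - s) * (S.m0 * (S.b q' y - S.b q y)) ≤ (1 - s) * ⟪S.P q' y, q' - q⟫ := by linarith
  exact le_of_mul_le_mul_left this h1s

lemma low {q q' y : Euc n} (hq : q ∈ S.O) (hq' : q' ∈ S.O) (hy : y ∈ S.Y)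
    (h : 0 < ⟪S.P q y, q' - q⟫) : S.m0 * ⟪S.P q y, q' - q⟫ ≤ S.b q' y - S.b q y := by
  obtain ⟨s, hs, he⟩ := mvt hq hq' hy
  have hr := seg_mem hq hq' hs.1.le hs.2.le
  have e1 : (q + s • (q' - q)) - q = s • (q' - q) := by module
  have h2 := S.star q hq _ hr y hy (by
    rw [e1, inner_smul_right]; exact mul_pos hs.1 h)
  rw [e1, inner_smul_right, inner_smul_right, ← he] at h2
  have : s * (S.m0 * ⟪S.P q y, q' - q⟫) ≤ s * (S.b q' y - S.b q y) := by linarith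
  exact le_of_mul_le_mul_left this hs.1

lemma strict {q0 q : Euc n} {h s : ℝ} (hq0 : q0 ∈ S.O) (hq : q ∈ S.O) (h0 : S.u q0 < h)
    (h1 : S.u q ≤ h) (hs0 : 0 ≤ s) (hs1 : s < 1) : S.u (q0 + s • (q - q0)) < h := by
  rcases hs0.eq_or_lt with rfl | hs0
  · simpa
  by_contra hc
  push Not at hc
  have hr := seg_mem hq0 hq hs0.le hs1.le
  set r := q0 + s • (q - q0) with hrdef
  obtain ⟨y, hy, he⟩ := S.hex r hr
  have h2 := S.hle q0 hq0 y hy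
  have h3 := S.hle q hq y hy
  have hpos : 0 < S.b r y - S.b q0 y := by linarith
  have h4 := up hq0 hr hy hpos
  have h5 : 0 < ⟪S.P r y, r - q0⟫ := lt_of_lt_of_le (mul_pos S.hm0 hpos) h4
  have e1 : r - q0 = s • (q - q0) := by rw [hrdef]; module
  have e2 : q - r = (1 - s) • (q - q0) := by rw [hrdef]; module
  rw [e1, inner_smul_right] at h5
  have h6 : 0 < ⟪S.P r y, q - q0⟫ := (pos_iff_pos_of_mul_pos h5).1 hs0
  have h7 : 0 < ⟪S.P r y, q - r⟫ := by
    rw [e2, inner_smul_right]; exact mul_pos (by linarith) h6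
  have h8 := low hr hq hy h7
  have := mul_pos S.hm0 h7
  linarith

lemma Q_convex (h : ℝ) : Convex ℝ (S.Q h) := by
  rw [convex_iff_add_mem]
  intro q hq q' hq' a b ha hb hab
  refine ⟨S.hOc hq.1 hq'.1 ha hb hab, ?_⟩
  have e : a • q + b • q' = q + b • (q' - q) := by
    have : a = 1 - b := by linarith
    rw [this]; module
  by_contra hc
  push Not at hc
  rcases eq_or_lt_of_le (show b ≤ 1 by linarith) with h1 | h1
  · have : a = 0 := by linarith
    rw [this, h1] at hc; simp at hc; linarith [hq'.2]
  · have := strict (h := S.u (a • q + b • q')) hq.1 hq'.1 (by linarith [hq.2]) (by linarith [hq'.2])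
      hb h1
    rw [← e] at this; exact lt_irrefl _ this

lemma G_compact {q : Euc n} (hq : q ∈ S.O) : IsCompact (S.G q) := by
  have hc : ContinuousOn (fun y => S.b q y - S.a y) S.Y := by
    refine ContinuousOn.sub ?_ S.hac
    exact S.hbc.comp (f := fun y => (q, y)) (by fun_prop) (fun y hy => ⟨hq, hy⟩)
  have : S.G q = S.Y ∩ (fun y => S.b q y - S.a y) ⁻¹' {S.u q} := by
    ext y; simp [G, eq_comm]
  rw [this]
  exact S.hY.of_isClosed_subset (hc.preimage_isClosed_of_isClosed S.hY.isClosed isClosed_singleton)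
    inter_subset_left

lemma P_cont {q : Euc n} (hq : q ∈ S.O) : ContinuousOn (S.P q) S.Y :=
  S.hPc.comp (f := fun y => (q, y)) (by fun_prop) (fun y hy => ⟨hq, hy⟩)

/-- directional derivative upper bound -/
lemma dirder {q w : Euc n} {r : ℝ} (hq : q ∈ S.O) (h : ∀ y ∈ S.G q, ⟪S.P q y, w⟫ < r) :
    ∀ᶠ s in 𝓝[>] (0:ℝ), q + s • w ∈ S.O ∧ S.u (q + s • w) ≤ S.u q + s * r := by
  have hline : Tendsto (fun s : ℝ => q + s • w) (𝓝 0) (𝓝 q) := by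
    have : Continuous fun s : ℝ => q + s • w := by fun_prop
    simpa using this.tendsto 0
  obtain ⟨δ, hδ, hball⟩ := Metric.eventually_nhds_iff.1 (hline.eventually (S.hO.mem_nhds hq))
  have hin : ∀ s : ℝ, 0 ≤ s → s < δ → q + s • w ∈ S.O := fun s h0 h1 => hball (by
    rw [Real.dist_eq, sub_zero, abs_of_nonneg h0]; exact h1)
  by_contra hc
  have hfr : ∃ᶠ s in 𝓝[>] (0:ℝ), ¬ (q + s • w ∈ S.O ∧ S.u (q + s • w) ≤ S.u q + s * r) :=
    Filter.not_eventually.1 hc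
  have hk : ∀ k : ℕ, ∃ s, 0 < s ∧ s < min δ (1/(k+1:ℝ)) ∧
      ¬ (q + s • w ∈ S.O ∧ S.u (q + s • w) ≤ S.u q + s * r) := by
    intro k
    have h1 : Ioo (0:ℝ) (min δ (1/(k+1:ℝ))) ∈ 𝓝[>] (0:ℝ) := Ioo_mem_nhdsGT (by positivity)
    obtain ⟨s, hs, hs2⟩ := (hfr.and_eventually h1).exists
    exact ⟨s, hs2.1, hs2.2, hs⟩
  have hk2 : ∀ k : ℕ, ∃ σ : ℝ, ∃ s : ℝ, ∃ y ∈ S.Y, 0 < σ ∧ σ < s ∧ s < δ ∧ s < 1/(k+1:ℝ) ∧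
      r ≤ ⟪S.P (q + σ • w) y, w⟫ ∧ S.u (q + s • w) = S.b (q + s • w) y - S.a y := by
    intro k
    obtain ⟨s, hs0, hs1, hs2⟩ := hk k
    have hsδ := hs1.trans_le (min_le_left _ _)
    have hO := hin s hs0.le hsδ
    have hgt : S.u q + s * r < S.u (q + s • w) := by
      by_contra hh; exact hs2 ⟨hO, not_lt.1 hh⟩
    obtain ⟨y, hy, he⟩ := S.hex _ hO
    obtain ⟨t, ht, hm⟩ := mvt hq hO hy
    have := S.hle q hq y hy
    rw [add_sub_cancel_left, smul_smul, inner_smul_right] at hm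
    refine ⟨t * s, s, y, hy, mul_pos ht.1 hs0, by nlinarith [ht.2], hsδ,
      hs1.trans_le (min_le_right _ _), ?_, he⟩
    have : s * r ≤ s * ⟪S.P (q + (t * s) • w) y, w⟫ := by linarith
    exact le_of_mul_le_mul_left this hs0
  choose σ s y hy hσ hσs hsδ hs hr hu using hk2
  obtain ⟨y0, hy0, φ, hφ, hlim⟩ := S.hY.tendsto_subseq hy
  have hs0 : Tendsto s atTop (𝓝 0) :=
    squeeze_zero (fun k => ((hσ k).trans (hσs k)).le) (fun k => (hs k).le)
      tendsto_one_div_add_atTop_nhds_zero_nat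
  have hσ0 : Tendsto σ atTop (𝓝 0) :=
    squeeze_zero (fun k => (hσ k).le) (fun k => (hσs k).le) hs0
  have l1 : Tendsto (fun k => (q + s (φ k) • w, y (φ k))) atTop (𝓝[S.O ×ˢ S.Y] (q, y0)) := by
    refine tendsto_nhdsWithin_iff.2 ⟨?_, Eventually.of_forall fun k =>
      ⟨hin _ ((hσ _).trans (hσs _)).le (hsδ _), hy _⟩⟩
    exact (hline.comp (hs0.comp hφ.tendsto_atTop)).prodMk_nhds hlim
  have l2 : Tendsto (fun k => (q + σ (φ k) • w, y (φ k))) atTop (𝓝[S.O ×ˢ S.Y] (q, y0)) := by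
    refine tendsto_nhdsWithin_iff.2 ⟨?_, Eventually.of_forall fun k =>
      ⟨hin _ (hσ _).le ((hσs _).trans (hsδ _)), hy _⟩⟩
    exact (hline.comp (hσ0.comp hφ.tendsto_atTop)).prodMk_nhds hlim
  have c1 : Tendsto (fun k => S.b (q + s (φ k) • w) (y (φ k))) atTop (𝓝 (S.b q y0)) :=
    (S.hbc (q, y0) ⟨hq, hy0⟩).tendsto.comp l1
  have c2 : Tendsto (fun k => S.P (q + σ (φ k) • w) (y (φ k))) atTop (𝓝 (S.P q y0)) :=
    (S.hPc (q, y0) ⟨hq, hy0⟩).tendsto.comp l2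
  have c3 : Tendsto (fun k => S.a (y (φ k))) atTop (𝓝 (S.a y0)) :=
    (S.hac y0 hy0).tendsto.comp (tendsto_nhdsWithin_iff.2 ⟨hlim, Eventually.of_forall fun k => hy _⟩)
  have c4 : Tendsto (fun k => S.u (q + s (φ k) • w)) atTop (𝓝 (S.u q)) :=
    (S.hu q hq).tendsto.comp (tendsto_nhdsWithin_iff.2
      ⟨hline.comp (hs0.comp hφ.tendsto_atTop), Eventually.of_forall fun k =>
        hin _ ((hσ _).trans (hσs _)).le (hsδ _)⟩)
  have e1 : S.u q = S.b q y0 - S.a y0 := by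
    refine tendsto_nhds_unique c4 ?_
    simp only [hu]
    exact c1.sub c3
  have e2 : r ≤ ⟪S.P q y0, w⟫ :=
    ge_of_tendsto (c2.inner tendsto_const_nhds) (Eventually.of_forall fun k => hr _)
  exact absurd (h y0 ⟨hy0, e1⟩) (not_lt.2 e2)

lemma sep {D F : Set (Euc n)} (hD : Convex ℝ D) (hDc : IsCompact D) (hF : Convex ℝ F)
    (hFc : IsClosed F) (hd : Disjoint D F) :
    ∃ (w : Euc n) (r : ℝ), (∀ d ∈ D, ⟪d, w⟫ < r) ∧ ∀ f ∈ F, r < ⟪f, w⟫ := by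
  obtain ⟨f, u, v, h1, h2, h3⟩ := geometric_hahn_banach_compact_closed hD hDc hF hFc hd
  refine ⟨(InnerProductSpace.toDual ℝ (Euc n)).symm f, u, fun d hd => ?_, fun d hd => ?_⟩
  · rw [real_inner_comm, InnerProductSpace.toDual_symm_apply]; exact h1 d hd
  · rw [real_inner_comm, InnerProductSpace.toDual_symm_apply]; exact h2.trans (h3 d hd)

/-- local support implies contact -/
lemma local_support {q y : Euc n} (hq : q ∈ S.O) (hy : y ∈ S.Y)
    (h : ∀ᶠ q' in 𝓝 q, S.b q' y - S.b q y ≤ S.u q' - S.u q) : y ∈ S.G q := by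
  by_contra hc
  have hni : S.P q y ∉ S.P q '' S.G q := by
    rintro ⟨z, hz, he⟩
    exact hc (S.inj q hq z hz.1 y hy he ▸ hz)
  have hcomp : IsCompact (S.P q '' S.G q) :=
    (G_compact hq).image_of_continuousOn ((P_cont hq).mono fun y hy => hy.1)
  obtain ⟨w, r, h1, h2⟩ := sep (S.gconv q hq) hcomp (convex_singleton (S.P q y)) isClosed_singleton
    (disjoint_singleton_right.2 hni)
  have h2 := h2 _ rfl
  have h3 := dirder hq fun y hy => h1 _ (mem_image_of_mem _ hy)
  have hder := hasDerivAt_line (S := S) (q := q) (w := w) (y := y) (s := 0) (by simpa) hy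
  simp only [zero_smul, add_zero] at hder
  have h4 := hder.tendsto_slope_zero_right
  have h5 := h4.eventually (lt_mem_nhds h2)
  have hline : Tendsto (fun s : ℝ => q + s • w) (𝓝[>] 0) (𝓝 q) := by
    have : Continuous fun s : ℝ => q + s • w := by fun_prop
    simpa using (this.tendsto 0).mono_left nhdsWithin_le_nhds
  obtain ⟨s, ⟨⟨ha, hb⟩, hcs⟩, hs⟩ := (((h3.and h5).and (hline.eventually h)).and
    self_mem_nhdsWithin).exists
  have hs : 0 < s := hs
  simp only [zero_add, zero_smul, add_zero, smul_eq_mul] at hb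
  have : s * r < s * (s⁻¹ * (S.b (q + s • w) y - S.b q y)) := mul_lt_mul_of_pos_left hb hs
  rw [← mul_assoc, mul_inv_cancel₀ hs.ne', one_mul] at this
  linarith [ha.2]

lemma interior_of_lt {q : Euc n} {h : ℝ} (hq : q ∈ S.O) (hh : S.u q < h) :
    ∀ᶠ q' in 𝓝 q, q' ∈ S.Q h := by
  have h1 := S.hu.continuousAt (S.hO.mem_nhds hq)
  filter_upwards [S.hO.mem_nhds hq, h1.eventually (gt_mem_nhds hh)] with q' h2 h3
  exact ⟨h2, h3.le⟩

lemma not_max_of_nhds {q e : Euc n} {A : Set (Euc n)} (he : e ≠ 0) (h : ∀ᶠ q' in 𝓝 q, q' ∈ A)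
    (hm : ∀ q' ∈ A, ⟪q', e⟫ ≤ ⟪q, e⟫) : False := by
  have hline : Tendsto (fun s : ℝ => q + s • e) (𝓝[>] 0) (𝓝 q) := by
    have : Continuous fun s : ℝ => q + s • e := by fun_prop
    simpa using (this.tendsto 0).mono_left nhdsWithin_le_nhds
  obtain ⟨s, h1, hs⟩ := ((hline.eventually h).and self_mem_nhdsWithin).exists
  have hs : 0 < s := hs
  have := hm _ h1
  rw [inner_add_left, inner_smul_left] at this
  simp only [conj_trivial] at this
  have h3 : 0 < ⟪e, e⟫ := real_inner_self_pos.2 he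
  nlinarith

/-- at an extreme point there is a contact point with gradient along the normal -/
lemma normal_contact {qb e : Euc n} {h : ℝ} (hh : 0 < h) (he : e ≠ 0) (hqb : qb ∈ S.Q h)
    (hmax : ∀ q ∈ S.Q h, ⟪q, e⟫ ≤ ⟪qb, e⟫) :
    ∃ y ∈ S.G qb, ∃ μ : ℝ, 0 < μ ∧ S.P qb y = μ • e := by
  have hO := hqb.1
  have hcomp : IsCompact (S.P qb '' S.G qb) :=
    (G_compact hO).image_of_continuousOn ((P_cont hO).mono fun y hy => hy.1)
  let R : Set (Euc n) := (fun μ : ℝ => μ • e) '' Ici 0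
  have hR : Convex ℝ R := by
    have : R = (LinearMap.toSpanSingleton ℝ (Euc n) e) '' Ici 0 := rfl
    rw [this]; exact (convex_Ici 0).linear_image _
  have hRc : IsClosed R := by
    have : Topology.IsClosedEmbedding (fun μ : ℝ => μ • e) :=
      isClosedEmbedding_smul_left he
    exact this.isClosedMap _ isClosed_Ici
  by_cases hd : Disjoint (S.P qb '' S.G qb) R
  · exfalso
    obtain ⟨w, r, h1, h2⟩ := sep (S.gconv qb hO) hcomp hR hRc hd
    have hr : r < 0 := by
      have := h2 0 ⟨0, by simp, by simp⟩
      simpa using this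
    have hew : 0 ≤ ⟪e, w⟫ := by
      by_contra hneg
      push Not at hneg
      have := h2 ((r / ⟪e, w⟫) • e) ⟨r / ⟪e, w⟫, div_nonneg_of_nonpos hr.le hneg.le, rfl⟩
      rw [inner_smul_left] at this
      simp only [conj_trivial] at this
      rw [div_mul_cancel₀ _ hneg.ne] at this
      exact lt_irrefl _ this
    obtain ⟨B, hB⟩ := hcomp.isBounded.exists_norm_le
    have hBpos : 0 < |B| + 1 := by positivity
    have hepos : 0 < ‖e‖ := norm_pos_iff.2 he
    set η : ℝ := -r / 2 / ((|B| + 1) * ‖e‖) with hη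
    have hηpos : 0 < η := by rw [hη]; apply div_pos <;> [linarith; positivity]
    have h3 : ∀ y ∈ S.G qb, ⟪S.P qb y, w + η • e⟫ < 0 := by
      intro y hy
      have a1 := h1 _ (mem_image_of_mem _ hy)
      have a2 : ⟪S.P qb y, e⟫ ≤ (|B| + 1) * ‖e‖ := by
        refine (real_inner_le_norm _ _).trans ?_
        gcongr
        have := hB _ (mem_image_of_mem _ hy)
        linarith [le_abs_self B]
      have a3 : η * ⟪S.P qb y, e⟫ ≤ -r / 2 := by
        calc _ ≤ η * ((|B| + 1) * ‖e‖) := by gcongr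
          _ = -r / 2 := by rw [hη]; field_simp
      rw [inner_add_right, inner_smul_right]
      linarith
    obtain ⟨s, ⟨hsO, hsu⟩, hs⟩ := ((dirder hO h3).and self_mem_nhdsWithin).exists
    have hs : 0 < s := hs
    have h4 := hmax (qb + s • (w + η • e)) ⟨hsO, by linarith [hqb.2]⟩
    rw [inner_add_left, inner_smul_left, inner_add_left, inner_smul_left, real_inner_comm] at h4
    simp only [conj_trivial] at h4
    have h5 : 0 < ⟪e, e⟫ := real_inner_self_pos.2 he
    rw [real_inner_comm] at hew
    have h6 : 0 < s * (⟪w, e⟫ + η * ⟪e, e⟫) := by positivity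
    rw [real_inner_comm] at h4
    linarith
  · obtain ⟨_, ⟨y, hy, rfl⟩, μ, hμ, hμe⟩ := Set.not_disjoint_iff.1 hd
    have hμ : 0 ≤ μ := hμ
    rcases hμ.eq_or_lt with h0 | h0
    · exfalso
      subst h0
      have : S.P qb y = S.P qb S.yb := by rw [P_yb hO, ← hμe]; simp
      have hyy := S.inj qb hO y hy.1 _ S.hyb this
      have hu0 : S.u qb = 0 := by rw [hy.2, hyy, S.hb0 qb hO, S.ha0, sub_zero]
      exact not_max_of_nhds he (interior_of_lt hO (by linarith)) hmax
    · exact ⟨y, hy, μ, h0, hμe.symm⟩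

end Sys
end FKM

open Set MeasureTheory Metric Bornology
open scoped ENNReal NNReal Pointwise

namespace FKM
open scoped RealInnerProductSpace
open Filter Topology

namespace Sys
variable {n : ℕ} {S : Sys n}

lemma good_z {h t1 κ ε A : ℝ} (hh : 0 < h) (hQ : IsCompact (S.Q h))
    (hκ0 : 0 < κ) (hκ1 : κ ≤ 1) (hε1 : ε ≤ 1)
    (hnear : ∀ q ∈ S.Q h, ∀ q' ∈ S.Q h, ∀ z ∈ S.Y, ‖S.P q z‖ ≤ t1 →
      ‖S.P q' z - S.P q z‖ ≤ ε * ‖S.P q z‖)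
    (hκ : ∀ q ∈ S.Q h, ∀ y ∈ S.G q, κ * ‖S.P q y‖ ≤ t1)
    {qt e : Euc n} (hqt : qt ∈ S.Q h) (hqth : S.u qt ≤ h / 2) (he : ‖e‖ = 1)
    (hA : 0 < A) (hAw : ∀ q ∈ S.Q h, ⟪q - qt, e⟫ ≤ A) :
    ∃ z ∈ S.Y, (∀ q ∈ S.Q h, S.b q z - S.b qt z ≤ h / 2) ∧
      ‖S.P qt z - (κ * S.m0 * h / (2 * A)) • e‖ ≤ ε * (κ * S.m0 * h / (2 * A)) ∧
      ‖S.P qt z‖ ≤ 2 * t1 := by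
  have he0 : e ≠ 0 := by rintro rfl; simp at he
  obtain ⟨qb, hqb, hmax⟩ := hQ.exists_isMaxOn ⟨qt, hqt⟩
    (f := fun q => ⟪q, e⟫) (by fun_prop)
  have hmax : ∀ q ∈ S.Q h, ⟪q, e⟫ ≤ ⟪qb, e⟫ := fun q hq => hmax hq
  have hub : S.u qb = h := by
    by_contra hne
    exact not_max_of_nhds he0 (interior_of_lt hqb.1 (lt_of_le_of_ne hqb.2 hne)) hmax
  obtain ⟨y, hy, μ, hμ, hPy⟩ := normal_contact hh he0 hqb hmax
  have hm0 := S.hm0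
  have hF1 := S.hle qt hqt.1 y hy.1
  have hdiff : h / 2 ≤ S.b qb y - S.b qt y := by
    have := hy.2; linarith
  have h1 := up hqt.1 hqb.1 hy.1 (by linarith)
  rw [hPy, inner_smul_left] at h1
  simp only [conj_trivial] at h1
  set a := ⟪qb - qt, e⟫ with ha
  rw [real_inner_comm] at h1
  rw [← ha] at h1
  have haA : a ≤ A := hAw qb hqb
  have hμa : S.m0 * h / 2 ≤ μ * a := by nlinarith
  have hμA : S.m0 * h / 2 ≤ μ * A := hμa.trans (by gcongr)
  set s := κ * S.m0 * h / (2 * A) / μ with hs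
  have hsμ : s * μ = κ * S.m0 * h / (2 * A) := by rw [hs]; field_simp
  have hs0 : 0 < s := by rw [hs]; positivity
  have hsκ : s ≤ κ := by
    rw [hs, div_div, div_le_iff₀ (by positivity)]
    nlinarith
  obtain ⟨z, hz, hPz, hzb⟩ := S.cseg qb hqb.1 S.yb S.hyb y hy.1 s ⟨hs0.le, hsκ.trans hκ1⟩
  rw [P_yb hqb.1, smul_zero, zero_add, hPy, smul_smul, hsμ] at hPz
  set cc := κ * S.m0 * h / (2 * A) with hcc
  have hcc0 : 0 < cc := by rw [hcc]; positivity
  have hnorm : ‖S.P qb z‖ = cc := by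
    rw [hPz, norm_smul, he, mul_one, Real.norm_of_nonneg hcc0.le]
  have hle0 : ∀ q ∈ S.Q h, S.b q z - S.b qb z ≤ 0 := by
    intro q hq
    refine (hzb q hq.1).trans (max_le ?_ ?_)
    · rw [S.hb0 q hq.1, S.hb0 qb hqb.1]; simp
    · have := S.hle q hq.1 y hy.1
      have := hy.2
      linarith [hq.2]
  have hb2 : S.b qb z - S.b qt z ≤ h / 2 := by
    by_cases hp : 0 < S.b qb z - S.b qt z
    · have h2 := up hqt.1 hqb.1 hz hp
      rw [hPz, inner_smul_left, real_inner_comm, ← ha] at h2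
      simp only [conj_trivial] at h2
      have h3 : cc * a ≤ S.m0 * (h / 2) := by
        calc cc * a ≤ cc * A := by gcongr
          _ = κ * (S.m0 * (h/2)) := by rw [hcc]; field_simp
          _ ≤ 1 * (S.m0 * (h/2)) := by gcongr
          _ = _ := one_mul _
      exact le_of_mul_le_mul_left (h2.trans h3) hm0
    · linarith
  have ht1 : cc ≤ t1 := by
    have := hκ qb hqb y hy
    rw [hPy, norm_smul, he, mul_one, Real.norm_of_nonneg hμ.le] at this
    rw [← hsμ]
    exact (mul_le_mul_of_nonneg_right hsκ hμ.le).trans this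
  have hn1 := hnear qb hqb qt hqt z hz (by rw [hnorm]; exact ht1)
  rw [hnorm] at hn1
  refine ⟨z, hz, fun q hq => by linarith [hle0 q hq], by rw [← hPz]; exact hn1, ?_⟩
  have := norm_sub_norm_le (S.P qt z) (S.P qb z)
  rw [hnorm] at this
  nlinarith

/-- points whose support function has height at most h/2 are in the image of Q. -/
lemma mem_GI {h : ℝ} (hh : 0 < h) (hQ : IsCompact (S.Q h)) {qt z : Euc n} (hqt : qt ∈ S.Q h)
    (hqth : S.u qt ≤ h / 2) (hz : z ∈ S.Y) (hzb : ∀ q ∈ S.Q h, S.b q z - S.b qt z ≤ h / 2) :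
    z ∈ S.GI (S.Q h) := by
  have hc : ContinuousOn (fun q => S.u q - S.b q z) (S.Q h) := by
    refine ContinuousOn.sub (S.hu.mono fun q hq => hq.1) ?_
    exact S.hbc.comp (f := fun q => (q, z)) (by fun_prop) (fun q hq => ⟨hq.1, hz⟩)
  obtain ⟨qm, hqm, hmin⟩ := hQ.exists_isMinOn ⟨qt, hqt⟩ hc
  have hmin : ∀ q ∈ S.Q h, S.u qm - S.b qm z ≤ S.u q - S.b q z := fun q hq => hmin hq
  have key : ∀ q1 ∈ S.Q h, S.u q1 < h → (∀ q ∈ S.Q h, S.u q1 - S.b q1 z ≤ S.u q - S.b q z) →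
      z ∈ S.GI (S.Q h) := by
    intro q1 h1 h2 h3
    refine ⟨q1, h1, local_support h1.1 hz ?_⟩
    filter_upwards [interior_of_lt h1.1 h2] with q' hq'
    linarith [h3 q' hq']
  by_cases hlt : S.u qm < h
  · exact key qm hqm hlt hmin
  · refine key qt hqt (by linarith) fun q hq => ?_
    have := hmin q hq
    have := hzb qm hqm
    linarith

lemma P_half_convex {h : ℝ} {qt : Euc n} (hqt : qt ∈ S.Q h) :
    Convex ℝ (S.P qt '' {z ∈ S.Y | ∀ q ∈ S.Q h, S.b q z - S.b qt z ≤ h / 2}) := by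
  rw [convex_iff_add_mem]
  rintro _ ⟨z0, hz0, rfl⟩ _ ⟨z1, hz1, rfl⟩ a b ha hb hab
  obtain ⟨z, hz, hP, hzb⟩ := S.cseg qt hqt.1 z0 hz0.1 z1 hz1.1 b ⟨hb, by linarith⟩
  refine ⟨z, ⟨hz, fun q hq => (hzb q hq.1).trans (max_le (hz0.2 q hq) (hz1.2 q hq))⟩, ?_⟩
  rw [hP, show (1 - b) = a by linarith]

lemma lower_image (hn : 0 < n) {h t1 κ ε J δ : ℝ} (hh : 0 < h) (hQ : IsCompact (S.Q h))
    (hκ0 : 0 < κ) (hκ1 : κ ≤ 1) (hε1 : ε ≤ 1)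
    (hpert : ∀ e e' : Fin n → Euc n, (∀ i, ‖e i‖ ≤ 1) → δ ≤ |dt e| → (∀ i, ‖e' i - e i‖ ≤ ε) →
      δ / 2 ≤ |dt e'|)
    (hnear : ∀ q ∈ S.Q h, ∀ q' ∈ S.Q h, ∀ z ∈ S.Y, ‖S.P q z‖ ≤ t1 →
      ‖S.P q' z - S.P q z‖ ≤ ε * ‖S.P q z‖)
    (hκ : ∀ q ∈ S.Q h, ∀ y ∈ S.G q, κ * ‖S.P q y‖ ≤ t1)
    (hvolL : ∀ q ∈ S.Q h, ∀ T ⊆ S.Y, (∀ z ∈ T, ‖S.P q z‖ ≤ 2 * t1) →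
      volume (S.P q '' T) ≤ ENNReal.ofReal J * volume T)
    {qt : Euc n} (hqt : qt ∈ S.Q h) (hqth : S.u qt ≤ h / 2) (e : Fin n → Euc n)
    (he : ∀ i, ‖e i‖ = 1) (hdt : δ ≤ |dt e|) (A : Fin n → ℝ) (hA : ∀ i, 0 < A i)
    (hAw : ∀ i, ∀ q ∈ S.Q h, ⟪q - qt, e i⟫ ≤ A i) :
    ENNReal.ofReal ((1 / n : ℝ) ^ n * ((∏ i, (κ * S.m0 * h / (2 * A i))) * (δ / 2))) ≤
      ENNReal.ofReal J * volume (S.GI (S.Q h)) := by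
  choose z hz hzb hzP hzn using fun i =>
    good_z hh hQ hκ0 hκ1 hε1 hnear hκ hqt hqth (he i) (hA i) (hAw i)
  have hm0 := S.hm0
  have hn' : (0:ℝ) < n := by exact_mod_cast hn
  set cc : Fin n → ℝ := fun i => κ * S.m0 * h / (2 * A i) with hcc
  have hcc0 : ∀ i, 0 < cc i := fun i => by have := hA i; simp only [hcc]; positivity
  set v : Fin n → Euc n := fun i => S.P qt (z i) with hv
  have hdv : (∏ i, cc i) * (δ / 2) ≤ |dt v| := by
    have h1 : v = fun i => cc i • ((cc i)⁻¹ • v i) := by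
      funext i; rw [smul_smul, mul_inv_cancel₀ (hcc0 i).ne', one_smul]
    have h2 := hpert e (fun i => (cc i)⁻¹ • v i) (fun i => (he i).le) hdt fun i => by
      have : (cc i)⁻¹ • v i - e i = (cc i)⁻¹ • (v i - cc i • e i) := by
        rw [smul_sub, smul_smul, inv_mul_cancel₀ (hcc0 i).ne', one_smul]
      rw [this, norm_smul, Real.norm_of_nonneg (inv_pos.2 (hcc0 i)).le, inv_mul_le_iff₀ (hcc0 i),
        mul_comm]
      exact hzP i
    rw [h1, dt_smul, abs_mul, abs_of_pos (Finset.prod_pos fun i _ => hcc0 i)]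
    exact mul_le_mul_of_nonneg_left h2 (Finset.prod_nonneg fun i _ => (hcc0 i).le)
  set Par := (fun s : Euc n => (0 : Euc n) + ∑ i, s i • v i) ''
    {s : Euc n | ∀ i, s i ∈ Icc (0:ℝ) (1/n)} with hPar
  set HH := {z ∈ S.Y | ∀ q ∈ S.Q h, S.b q z - S.b qt z ≤ h / 2} with hHH
  have hconv : Convex ℝ (S.P qt '' HH) := P_half_convex hqt
  have h0 : (0 : Euc n) ∈ S.P qt '' HH := ⟨S.yb, ⟨S.hyb, fun q hq => by
    rw [S.hb0 q hq.1, S.hb0 qt hqt.1]; linarith⟩, P_yb hqt.1⟩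
  have hvm : ∀ i, v i ∈ S.P qt '' HH := fun i => ⟨z i, ⟨hz i, hzb i⟩, rfl⟩
  have ht1 : 0 ≤ 2 * t1 := (norm_nonneg _).trans (hzn ⟨0, hn⟩)
  have hsub : Par ⊆ S.P qt '' (HH ∩ {z | ‖S.P qt z‖ ≤ 2 * t1}) := by
    rintro _ ⟨s, hs, rfl⟩
    have e1 : (0 : Euc n) + ∑ i, s i • v i = ∑ i, (1/n : ℝ) • ((n * s i) • v i) := by
      rw [zero_add]
      refine Finset.sum_congr rfl fun i _ => ?_
      rw [smul_smul]; congr 1; field_simp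
    have hns : ∀ i, n * s i ∈ Icc (0:ℝ) 1 := fun i => by
      refine ⟨mul_nonneg hn'.le (hs i).1, ?_⟩
      have := mul_le_mul_of_nonneg_left (hs i).2 hn'.le
      rwa [mul_one_div_cancel hn'.ne'] at this
    have hmem : ∀ i, (n * s i) • v i ∈ S.P qt '' HH := fun i => by
      have := hconv h0 (hvm i) (a := 1 - n * s i) (b := n * s i) (by linarith [(hns i).2]) (hns i).1
        (by ring)
      simpa using this
    have hsum := hconv.sum_mem (t := Finset.univ) (w := fun _ : Fin n => (1/n : ℝ))
      (fun _ _ => by positivity) (by simp; field_simp) fun i _ => hmem i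
    simp only
    rw [e1]
    obtain ⟨zz, hzz, hzze⟩ := hsum
    refine ⟨zz, ⟨hzz, ?_⟩, hzze⟩
    change ‖S.P qt zz‖ ≤ 2 * t1
    rw [hzze]
    refine (norm_sum_le _ _).trans ?_
    have : ∀ i ∈ Finset.univ, ‖(1/n : ℝ) • ((n * s i) • v i)‖ ≤ (1/n : ℝ) * (2 * t1) := by
      intro i _
      rw [norm_smul, norm_smul, Real.norm_of_nonneg (by positivity), Real.norm_of_nonneg (hns i).1]
      refine mul_le_mul_of_nonneg_left ?_ (by positivity)
      calc _ ≤ 1 * (2 * t1) := mul_le_mul (hns i).2 (hzn i) (norm_nonneg _) zero_le_one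
        _ = _ := one_mul _
    refine (Finset.sum_le_sum this).trans ?_
    simp; field_simp; rfl
  have hT : HH ∩ {z | ‖S.P qt z‖ ≤ 2 * t1} ⊆ S.GI (S.Q h) := fun z hz =>
    mem_GI hh hQ hqt hqth hz.1.1 hz.1.2
  calc ENNReal.ofReal ((1 / n : ℝ) ^ n * ((∏ i, cc i) * (δ / 2)))
      ≤ ENNReal.ofReal ((1 / n : ℝ) ^ n * |dt v|) := by gcongr
    _ = volume Par := by
        rw [hPar, vol_par, ENNReal.ofReal_mul (by positivity), ENNReal.ofReal_pow (by positivity),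
          mul_comm, sub_zero]
    _ ≤ volume (S.P qt '' (HH ∩ {z | ‖S.P qt z‖ ≤ 2 * t1})) := measure_mono hsub
    _ ≤ ENNReal.ofReal J * volume (HH ∩ {z | ‖S.P qt z‖ ≤ 2 * t1}) :=
        hvolL qt hqt _ (fun z hz => hz.1.1) fun z hz => hz.2
    _ ≤ _ := by gcongr

lemma upper_image {h J lam : ℝ} (hh : 0 < h) (hlam : 0 ≤ lam)
    (hvolU : ∀ q ∈ S.Q h, ∀ T ⊆ S.GI (S.Q h), volume T ≤ ENNReal.ofReal J * volume (S.P q '' T))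
    (hJ : 0 ≤ J) (x1 : Euc n) (d : Fin n → Euc n) (hd : dt d ≠ 0)
    (hdQ : ∀ s : Fin n → ℝ, (∀ i, |s i| ≤ 1) → x1 + ∑ i, s i • d i ∈ S.Q h)
    (hlow : ENNReal.ofReal lam * volume ((fun s : Euc n => x1 + ∑ i, s i • d i) ''
        {s : Euc n | ∀ i, s i ∈ Icc (-(S.m0 ^ 2 / 2)) (S.m0 ^ 2 / 2)}) ≤
      volume (S.GI ((fun s : Euc n => x1 + ∑ i, s i • d i) ''
        {s : Euc n | ∀ i, s i ∈ Icc (-(S.m0 ^ 2 / 2)) (S.m0 ^ 2 / 2)}))) :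
    lam * (S.m0 ^ 2) ^ n * |dt d| ^ 2 ≤ J * (4 * h / S.m0) ^ n := by
  have hm0 := S.hm0
  have hm1 := S.hm1
  set A := (fun s : Euc n => x1 + ∑ i, s i • d i) ''
        {s : Euc n | ∀ i, s i ∈ Icc (-(S.m0 ^ 2 / 2)) (S.m0 ^ 2 / 2)} with hAdef
  have hm2 : S.m0 ^ 2 ≤ 1 := by nlinarith
  have hx1 : x1 ∈ S.Q h := by simpa using hdQ (fun _ => 0) (by simp)
  have hAQ : A ⊆ S.Q h := by
    rintro _ ⟨s, hs, rfl⟩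
    exact hdQ (fun i => s i) fun i => abs_le.2 ⟨by linarith [(hs i).1], by linarith [(hs i).2]⟩
  have key : S.P x1 '' S.GI A ⊆ {p : Euc n | ∀ i, |⟪d i, p⟫| ≤ 2 * h / S.m0} := by
    rintro _ ⟨y, ⟨x, hx, hy⟩, rfl⟩ i
    have hxQ := hAQ hx
    have hYy := hy.1
    have hFx : 0 ≤ S.b x y - S.a y := by rw [← hy.2]; exact u_nonneg hxQ.1
    have step1 : -h ≤ S.b x1 y - S.a y := by
      by_cases hp : 0 < S.b x y - S.b x1 y
      · obtain ⟨s, hs, rfl⟩ := hx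
        simp only at *
        set x := x1 + ∑ i, s i • d i with hxd
        have h1 := up hx1.1 hxQ.1 hYy hp
        set x2 := x1 + ∑ i, ((2 / S.m0 ^ 2) * s i) • d i with hx2
        have hx2Q : x2 ∈ S.Q h := hdQ _ fun i => by
          rw [abs_mul, abs_of_pos (by positivity)]
          have := abs_le.2 (hs i)
          calc _ ≤ (2 / S.m0 ^ 2) * (S.m0 ^ 2 / 2) := by gcongr
            _ = 1 := by field_simp
        have hx2x : x2 - x = (2 / S.m0 ^ 2 - 1) • (x - x1) := by
          rw [hx2, hxd]
          simp only [mul_smul, ← Finset.smul_sum]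
          module
        have hc : 0 < 2 / S.m0 ^ 2 - 1 := by
          rw [sub_pos, lt_div_iff₀ (by positivity)]; linarith
        have hpos : 0 < ⟪S.P x y, x - x1⟫ := lt_of_lt_of_le (mul_pos hm0 hp) h1
        have h2 := low hxQ.1 hx2Q.1 hYy (by rw [hx2x, inner_smul_right]; positivity)
        rw [hx2x, inner_smul_right] at h2
        have h3 := S.hle x2 hx2Q.1 y hYy
        have h4 := hx2Q.2
        have h5 : S.m0 * ((2 / S.m0 ^ 2 - 1) * (S.m0 * (S.b x y - S.b x1 y))) ≤
            S.m0 * ((2 / S.m0 ^ 2 - 1) * ⟪S.P x y, x - x1⟫) := by gcongr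
        have h6 : S.m0 * ((2 / S.m0 ^ 2 - 1) * (S.m0 * (S.b x y - S.b x1 y))) =
          (2 - S.m0 ^ 2) * (S.b x y - S.b x1 y) := by field_simp
        have h7 : (S.b x y - S.b x1 y) ≤ (2 - S.m0 ^ 2) * (S.b x y - S.b x1 y) := by nlinarith
        linarith
      · linarith
    have step2 : ∀ σ : ℝ, |σ| = 1 → σ * ⟪d i, S.P x1 y⟫ ≤ 2 * h / S.m0 := by
      intro σ hσ
      have hq : x1 + σ • d i ∈ S.Q h := by
        have := hdQ (fun j => if j = i then σ else 0) fun j => by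
          split_ifs <;> simp [hσ]
        simpa [ite_smul] using this
      have e1 : (x1 + σ • d i) - x1 = σ • d i := by module
      by_cases hp : 0 < σ * ⟪d i, S.P x1 y⟫
      · have h2 := low hx1.1 hq.1 hYy (by
          rw [e1, inner_smul_right, real_inner_comm]; exact hp)
        rw [e1, inner_smul_right, real_inner_comm] at h2
        have h3 := S.hle _ hq.1 y hYy
        have h4 := hq.2
        rw [le_div_iff₀ hm0]
        linarith
      · exact (not_lt.1 hp).trans (by positivity)
    rw [abs_le]
    have a1 := step2 1 (by simp)
    have a2 := step2 (-1) (by simp)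
    constructor <;> linarith
  have hGA : S.GI A ⊆ S.GI (S.Q h) := fun y ⟨q, hq, hy⟩ => ⟨q, hAQ hq, hy⟩
  have h1 := hlow.trans ((hvolU x1 hx1 _ hGA).trans
    (mul_le_mul_right (measure_mono key) (ENNReal.ofReal J)))
  rw [hAdef, vol_par, vol_dual d hd] at h1
  rw [← ENNReal.ofReal_pow (by nlinarith), ← ENNReal.ofReal_pow (by positivity),
    ← ENNReal.ofReal_mul (by positivity), ← ENNReal.ofReal_mul (by positivity),
    ← ENNReal.ofReal_mul (by positivity), ← ENNReal.ofReal_mul (by positivity),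
    ENNReal.ofReal_le_ofReal_iff (by positivity)] at h1
  have hdpos : 0 < |dt d| := abs_pos.2 hd
  rw [abs_inv] at h1
  have h2 := mul_le_mul_of_nonneg_right h1 hdpos.le
  have e1 : J * (|dt d|⁻¹ * (2 * (2 * h / S.m0)) ^ n) * |dt d| = J * (4 * h / S.m0) ^ n := by
    rw [show 2 * (2 * h / S.m0) = 4 * h / S.m0 by ring]
    field_simp
  rw [e1] at h2
  refine le_trans (le_of_eq ?_) h2
  rw [show S.m0 ^ 2 / 2 - -(S.m0 ^ 2 / 2) = S.m0 ^ 2 by ring]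
  ring

end Sys

lemma gap {n : ℕ} (b : Fin n → ℝ) (m : Fin n) (hm : 0 < b m) {R : ℝ} (hR : 1 ≤ R) :
    ∃ j : ℕ, j < n ∧ ∀ i, b i < (R ^ (j+1))⁻¹ * b m ∨ (R ^ j)⁻¹ * b m ≤ b i := by
  by_contra hc
  push Not at hc
  have : ∀ j : Fin n, ∃ i, (R ^ ((j:ℕ)+1))⁻¹ * b m ≤ b i ∧ b i < (R ^ (j:ℕ))⁻¹ * b m :=
    fun j => hc j j.2
  choose f hf1 hf2 using this
  have hR0 : 0 < R := by linarith
  have hlt : ∀ j j' : Fin n, j < j' → f j ≠ f j' := by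
    intro j j' hjj he
    have h1 := hf1 j
    have h2 := hf2 j'
    rw [← he] at h2
    have h3 : R ^ ((j:ℕ)+1) ≤ R ^ (j':ℕ) := pow_le_pow_right₀ hR (by exact hjj)
    have h4 : (R ^ (j':ℕ))⁻¹ ≤ (R ^ ((j:ℕ)+1))⁻¹ := inv_anti₀ (by positivity) h3
    have := mul_le_mul_of_nonneg_right h4 hm.le
    linarith
  have hinj : Function.Injective f := by
    intro j j' he
    rcases lt_trichotomy j j' with h | h | h
    · exact absurd he (hlt _ _ h)
    · exact h
    · exact absurd he.symm (hlt _ _ h)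
  obtain ⟨j, hj⟩ := (Finite.injective_iff_surjective.1 hinj) m
  have := hf2 j
  rw [hj] at this
  have h1 : (R ^ (j:ℕ))⁻¹ ≤ 1 := inv_le_one_of_one_le₀ (one_le_pow₀ hR)
  nlinarith

lemma frame_choice {n : ℕ} (hn : 0 < n) (e : OrthonormalBasis (Fin n) ℝ (Euc n)) (w : Fin n → ℝ)
    (hw : ∀ i, 0 < w i) (D : Set (Euc n)) (hD : ∀ i, ∀ q ∈ D, |⟪q, e i⟫| ≤ w i) (ν : Euc n)
    (hν : ν ≠ 0) {ρ R : ℝ} (hρ : 0 ≤ ρ) (hR : 1 ≤ R)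
    (hDν : ∀ q ∈ D, ⟪q, ν⟫ ≤ ρ * ∑ i, |⟪ν, e i⟫| * w i) :
    ∃ (k : Fin n) (eb : Euc n), ‖eb‖ = 1 ∧
      (1 / n : ℝ) ≤ |dt (Function.update (fun i => e i) k eb)| ∧
      ∀ q ∈ D, ⟪q, eb⟫ ≤ (ρ * n * R ^ n + n / R) * w k := by
  classical
  have hn' : (0:ℝ) < n := by exact_mod_cast hn
  have : Nonempty (Fin n) := ⟨⟨0, hn⟩⟩
  set b : Fin n → ℝ := fun i => |⟪ν, e i⟫| * w i with hb
  obtain ⟨m, hm⟩ := Finite.exists_max b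
  have hν' : ∃ i, ⟪ν, e i⟫ ≠ 0 := by
    by_contra hc
    push Not at hc
    apply hν
    rw [← e.sum_repr' ν]
    exact Finset.sum_eq_zero fun i _ => by rw [real_inner_comm, hc i, zero_smul]
  have hbm : 0 < b m := by
    obtain ⟨i, hi⟩ := hν'
    exact lt_of_lt_of_le (mul_pos (abs_pos.2 hi) (hw i)) (hm i)
  obtain ⟨j, hj, hgap⟩ := gap b m hbm hR
  have hR0 : 0 < R := by linarith
  set I : Finset (Fin n) := Finset.univ.filter fun i => (R ^ j)⁻¹ * b m ≤ b i with hI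
  have hmI : m ∈ I := by
    rw [hI, Finset.mem_filter]
    refine ⟨Finset.mem_univ _, ?_⟩
    have : (R ^ j)⁻¹ ≤ 1 := inv_le_one_of_one_le₀ (one_le_pow₀ hR)
    nlinarith
  obtain ⟨k, hkI, hk⟩ := I.exists_max_image (fun i => |⟪ν, e i⟫|) ⟨m, hmI⟩
  have hkb : (R ^ j)⁻¹ * b m ≤ b k := (Finset.mem_filter.1 hkI).2
  have hνk : 0 < |⟪ν, e k⟫| := by
    have : 0 < b k := lt_of_lt_of_le (by positivity) hkb
    exact (pos_iff_pos_of_mul_pos this).2 (hw k)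
  set νI : Euc n := ∑ i, (if i ∈ I then ⟪ν, e i⟫ else 0) • e i with hνI
  have hin : ∀ i, ⟪νI, e i⟫ = if i ∈ I then ⟪ν, e i⟫ else 0 := by
    intro i
    rw [hνI, sum_inner]
    simp only [inner_smul_left, conj_trivial, e.inner_eq_ite]
    simp
  have hnsq : ‖νI‖ ^ 2 = ∑ i ∈ I, ⟪ν, e i⟫ ^ 2 := by
    rw [← e.sum_sq_norm_inner_left]
    rw [← Finset.sum_filter_add_sum_filter_not Finset.univ (fun i => i ∈ I)]
    have z2 : ∑ i ∈ Finset.univ.filter (fun i => i ∉ I), ‖⟪νI, e i⟫‖ ^ 2 = 0 := by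
      apply Finset.sum_eq_zero
      intro i hi
      rw [hin, if_neg (Finset.mem_filter.1 hi).2]; simp
    rw [z2, add_zero, Finset.filter_univ_mem]
    refine Finset.sum_congr rfl fun i hi => ?_
    rw [hin, if_pos hi]; simp
  have hNk : |⟪ν, e k⟫| ≤ ‖νI‖ := by
    apply abs_le_of_sq_le_sq' _ (norm_nonneg _) |> abs_le.2
    rw [hnsq]
    exact Finset.single_le_sum (f := fun i => ⟪ν, e i⟫ ^ 2) (fun _ _ => sq_nonneg _) hkI
  have hNpos : 0 < ‖νI‖ := hνk.trans_le hNk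
  have hNle : ‖νI‖ ≤ n * |⟪ν, e k⟫| := by
    apply le_of_sq_le_sq _ (by positivity)
    rw [hnsq]
    calc ∑ i ∈ I, ⟪ν, e i⟫ ^ 2 ≤ ∑ i ∈ I, |⟪ν, e k⟫| ^ 2 := by
          refine Finset.sum_le_sum fun i hi => ?_
          rw [← sq_abs]
          exact pow_le_pow_left₀ (abs_nonneg _) (hk i hi) 2
      _ = I.card * |⟪ν, e k⟫| ^ 2 := by simp
      _ ≤ n * |⟪ν, e k⟫| ^ 2 := by
          gcongr
          simpa using I.card_le_univ
      _ ≤ (n * |⟪ν, e k⟫|) ^ 2 := by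
          rw [mul_pow]
          gcongr
          have : (1:ℝ) ≤ n := by exact_mod_cast hn
          nlinarith
  refine ⟨k, ‖νI‖⁻¹ • νI, ?_, ?_, ?_⟩
  · rw [norm_smul, norm_inv, norm_norm, inv_mul_cancel₀ hNpos.ne']
  · have e1 : ‖νI‖⁻¹ • νI = ∑ i, (‖νI‖⁻¹ * (if i ∈ I then ⟪ν, e i⟫ else 0)) • e i := by
      conv_lhs => rw [hνI]
      rw [Finset.smul_sum]
      simp only [smul_smul]
      rw [← hνI]
    rw [e1, dt_update, abs_mul, abs_dt_onb, mul_one, if_pos hkI, abs_mul, abs_inv, abs_norm]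
    rw [div_le_iff₀ hn', ← div_eq_inv_mul, div_mul_eq_mul_div, le_div_iff₀ hNpos]
    linarith
  · intro q hq
    rw [inner_smul_right]
    have hsplit : ⟪q, νI⟫ = ⟪q, ν⟫ - ∑ i, (if i ∈ I then 0 else ⟪ν, e i⟫ * ⟪q, e i⟫) := by
      rw [← e.sum_inner_mul_inner q ν, hνI, inner_sum, ← Finset.sum_sub_distrib]
      refine Finset.sum_congr rfl fun i _ => ?_
      rw [inner_smul_right, real_inner_comm ν (e i)]
      split_ifs <;> ring
    have hrest : |∑ i, (if i ∈ I then 0 else ⟪ν, e i⟫ * ⟪q, e i⟫)| ≤ n * ((R ^ (j+1))⁻¹ * b m) := by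
      refine (Finset.abs_sum_le_sum_abs _ _).trans ?_
      have : ∀ i ∈ Finset.univ, |(if i ∈ I then 0 else ⟪ν, e i⟫ * ⟪q, e i⟫)| ≤
          (R ^ (j+1))⁻¹ * b m := by
        intro i _
        split_ifs with h
        · simp; positivity
        · rw [abs_mul]
          have h1 : |⟪ν, e i⟫| * |⟪q, e i⟫| ≤ b i := by
            exact mul_le_mul_of_nonneg_left (hD i q hq) (abs_nonneg _)
          rcases hgap i with h2 | h2
          · linarith
          · exact absurd (Finset.mem_filter.2 ⟨Finset.mem_univ i, h2⟩ : i ∈ I) h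
      refine (Finset.sum_le_sum this).trans ?_
      simp
    have hsum : ∑ i, b i ≤ n * b m := by
      refine (Finset.sum_le_sum fun i _ => hm i).trans ?_
      simp
    have h1 : ⟪q, νI⟫ ≤ ρ * (n * b m) + n * ((R ^ (j+1))⁻¹ * b m) := by
      rw [hsplit]
      have := hDν q hq
      have h3 : ρ * ∑ i, b i ≤ ρ * (n * b m) := by gcongr
      have := neg_abs_le (∑ i, (if i ∈ I then 0 else ⟪ν, e i⟫ * ⟪q, e i⟫))
      linarith
    have hbm' : b m ≤ R ^ j * (‖νI‖ * w k) := by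
      have h2 : b k ≤ ‖νI‖ * w k := by
        rw [hb]
        exact mul_le_mul_of_nonneg_right hNk (hw k).le
      have := hkb.trans h2
      rwa [inv_mul_le_iff₀ (by positivity)] at this
    have h2 : ⟪q, νI⟫ ≤ (ρ * n * R ^ n + n / R) * (‖νI‖ * w k) := by
      have hwk := hw k
      have a1 : ρ * (n * b m) ≤ ρ * n * R ^ n * (‖νI‖ * w k) := by
        have : R ^ j ≤ R ^ n := pow_le_pow_right₀ hR hj.le
        calc ρ * (n * b m) ≤ ρ * (n * (R ^ j * (‖νI‖ * w k))) := by gcongr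
          _ ≤ ρ * (n * (R ^ n * (‖νI‖ * w k))) := by gcongr
          _ = _ := by ring
      have a2 : n * ((R ^ (j+1))⁻¹ * b m) ≤ n / R * (‖νI‖ * w k) := by
        calc n * ((R ^ (j+1))⁻¹ * b m) ≤ n * ((R ^ (j+1))⁻¹ * (R ^ j * (‖νI‖ * w k))) := by gcongr
          _ = _ := by rw [pow_succ]; field_simp
      linarith
    rw [inv_mul_le_iff₀ hNpos]
    linarith

end FKM

open Set MeasureTheory Metric Bornology
open scoped ENNReal NNReal Pointwise

namespace FKM
open scoped RealInnerProductSpace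
open Filter Topology

/-- Standing hypotheses for a section `Q = {u ≤ h}`. -/
structure SecHyp {n : ℕ} (S : Sys n) (ε h t1 κ J : ℝ) : Prop where
  hh : 0 < h
  hQ : IsCompact (S.Q h)
  hnear : ∀ q ∈ S.Q h, ∀ q' ∈ S.Q h, ∀ z ∈ S.Y, ‖S.P q z‖ ≤ t1 →
      ‖S.P q' z - S.P q z‖ ≤ ε * ‖S.P q z‖
  hκ : ∀ q ∈ S.Q h, ∀ y ∈ S.G q, κ * ‖S.P q y‖ ≤ t1
  hvolL : ∀ q ∈ S.Q h, ∀ T ⊆ S.Y, (∀ z ∈ T, ‖S.P q z‖ ≤ 2 * t1) →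
      volume (S.P q '' T) ≤ ENNReal.ofReal J * volume T
  hvolU : ∀ q ∈ S.Q h, ∀ T ⊆ S.GI (S.Q h),
      volume T ≤ ENNReal.ofReal J * volume (S.P q '' T)

lemma Sys.exists_support {n : ℕ} {S : Sys n} {h : ℝ} {q0 qs : Euc n} (hq0 : q0 ∈ S.Q h)
    (hq0h : S.u q0 < h) (hqs : S.u qs = h) :
    ∃ ν : Euc n, ν ≠ 0 ∧ ∀ q ∈ S.Q h, ⟪q, ν⟫ ≤ ⟪qs, ν⟫ := by
  set D : Set (Euc n) := {q ∈ S.O | S.u q < h} with hD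
  have hDo : IsOpen D := by
    have : D = S.O ∩ S.u ⁻¹' (Iio h) := rfl
    rw [this]
    exact S.hu.isOpen_inter_preimage S.hO isOpen_Iio
  have hDc : Convex ℝ D := by
    rw [convex_iff_add_mem]
    intro q hq q' hq' a b ha hb hab
    have h1 := Sys.Q_convex (S := S) (max (S.u q) (S.u q')) ⟨hq.1, le_max_left _ _⟩
      ⟨hq'.1, le_max_right _ _⟩ ha hb hab
    exact ⟨h1.1, h1.2.trans_lt (max_lt hq.2 hq'.2)⟩
  obtain ⟨f, hf⟩ := geometric_hahn_banach_open_point hDc hDo (x := qs)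
    (fun hm => by have := hm.2; linarith)
  have hin : ∀ q, ⟪q, (InnerProductSpace.toDual ℝ (Euc n)).symm f⟫ = f q := fun q => by
    rw [real_inner_comm, InnerProductSpace.toDual_symm_apply]
  refine ⟨(InnerProductSpace.toDual ℝ (Euc n)).symm f, ?_, fun q hq => ?_⟩
  · intro h0
    have := hf q0 ⟨hq0.1, hq0h⟩
    rw [← hin, ← hin, h0] at this
    simp at this
  · rw [hin, hin]
    have hlim : Tendsto (fun s : ℝ => f (q0 + s • (q - q0))) (𝓝[<] 1) (𝓝 (f q)) := by
      have hc : Continuous fun s : ℝ => f (q0 + s • (q - q0)) := by fun_prop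
      have := (hc.tendsto 1).mono_left (nhdsWithin_le_nhds (s := Iio 1))
      simpa using this
    refine le_of_tendsto hlim ?_
    filter_upwards [Ioo_mem_nhdsLT (show (0:ℝ) < 1 by norm_num)] with s hs
    exact (hf _ ⟨Sys.seg_mem hq0.1 hq.1 hs.1.le hs.2.le,
      Sys.strict hq0.1 hq.1 hq0h hq.2 hs.1.le hs.2⟩).le

set_option maxHeartbeats 2000000 in
theorem main6 (n : ℕ) (hn : 0 < n) : ∃ ε : ℝ, 0 < ε ∧ ε ≤ 1 ∧
    ∀ m κ J θ C : ℝ, 0 < m → 0 < κ → κ ≤ 1 → 0 < J → 0 < θ → θ ≤ 1 → 0 < C →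
    ∃ ρ : ℝ, 0 < ρ ∧ ρ < 1 ∧ ∀ (S : Sys n) (h t1 lam Lam : ℝ), S.m0 = m →
      SecHyp S ε h t1 κ J → 0 < lam → Lam ≤ C * lam →
      ∀ q0 ∈ S.Q h, S.u q0 < h →
      (∀ A : Set (Euc n), IsCompact A → A ⊆ (fun q => q0 + θ • (q - q0)) '' S.Q h →
        ENNReal.ofReal lam * volume A ≤ volume (S.GI A)) →
      volume (S.GI (S.Q h)) ≤ ENNReal.ofReal Lam * volume (S.Q h) →
      ∀ qs ∈ S.Q h, S.u qs = h → h / 2 < S.u (qs - ρ • (qs - q0)) := by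
  have hn' : (0:ℝ) < n := by exact_mod_cast hn
  obtain ⟨ε, hε0, hε1, hpert⟩ := dt_perturb n (1 / n : ℝ) (by positivity)
  refine ⟨ε, hε0, hε1, fun m κ J θ C hm hκ0 hκ1 hJ hθ0 hθ1 hC => ?_⟩
  set c1 : ℝ := (m ^ 2) ^ n * (θ ^ n / (2 * n) ^ n) ^ 2 with hc1
  have hc1p : 0 < c1 := by positivity
  set c2 : ℝ := (1 / n : ℝ) ^ n * ((κ * m / 2) ^ n * ((1 / n : ℝ) / 2)) with hc2
  have hc2p : 0 < c2 := by positivity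
  set K : ℝ := (n:ℝ) ^ n * 2 ^ n * J * C * (J * (4 / m) ^ n) with hK
  have hKp : 0 < K := by positivity
  set η0 : ℝ := c1 * c2 / (2 * K) with hη0
  have hηpos : 0 < η0 := by positivity
  set R : ℝ := max 1 (2 * n / η0) with hR
  have hR1 : 1 ≤ R := le_max_left _ _
  have hR0 : 0 < R := by linarith
  have hnR : n / R ≤ η0 / 2 := by
    rw [div_le_iff₀ hR0]
    have : 2 * n / η0 ≤ R := le_max_right _ _
    rw [div_le_iff₀ hηpos] at this
    linarith
  set ρ : ℝ := min (1/2) (η0 / (2 * n * R ^ n)) with hρ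
  have hρ0 : 0 < ρ := by positivity
  have hρ1 : ρ < 1 := (min_le_left _ _).trans_lt (by norm_num)
  have hρR : ρ * n * R ^ n ≤ η0 / 2 := by
    have : ρ ≤ η0 / (2 * n * R ^ n) := min_le_right _ _
    rw [le_div_iff₀ (by positivity)] at this
    linarith
  refine ⟨ρ, hρ0, hρ1, fun S h t1 lam Lam hSm H hlam hLam q0 hq0 hq0h hlow hupp qs hqs hqsh => ?_⟩
  by_contra hcon
  push Not at hcon
  have hh := H.hh
  set qc := qs - ρ • (qs - q0) with hqc
  have hqc' : qc = qs + ρ • (q0 - qs) := by rw [hqc]; module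
  have hcQ := Sys.Q_convex (S := S) h
  have hqcQ : qc ∈ S.Q h := by
    rw [hqc']; exact hcQ.add_smul_sub_mem hqs hq0 ⟨hρ0.le, hρ1.le⟩
  have hinterior : (interior (S.Q h)).Nonempty :=
    ⟨q0, mem_interior_iff_mem_nhds.2 (Sys.interior_of_lt hq0.1 hq0h)⟩
  obtain ⟨e, w, x, d, Δ, hΔ, hw, hwid, hprod, hvol, hdt, hpar⟩ := body_frame hn H.hQ hcQ hinterior
  obtain ⟨ν, hν, hsup⟩ := Sys.exists_support hq0 hq0h hqsh
  obtain ⟨k, eb, heb, hdte, hebw⟩ := frame_choice hn e w hw ((fun q => q - qc) '' S.Q h)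
    (by rintro i _ ⟨q, hq, rfl⟩; exact hwid i q hq qc hqcQ) ν hν hρ0.le hR1 (by
      rintro _ ⟨q, hq, rfl⟩
      have h1 : ⟪q - qc, ν⟫ ≤ ρ * ⟪qs - q0, ν⟫ := by
        have := hsup q hq
        rw [hqc, inner_sub_left, inner_sub_left, inner_smul_left]
        simp only [conj_trivial]
        linarith
      refine h1.trans ?_
      gcongr
      rw [← e.sum_inner_mul_inner (qs - q0) ν]
      refine Finset.sum_le_sum fun i _ => ?_
      refine (le_abs_self _).trans ?_
      rw [abs_mul, mul_comm, real_inner_comm]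
      gcongr
      exact hwid i _ hqs _ hq0)
  set η : ℝ := ρ * n * R ^ n + n / R with hη
  have hηp : 0 < η := by positivity
  have hηle : η ≤ η0 := by linarith
  set A : Fin n → ℝ := fun i => (if i = k then η else 1) * w i with hA
  have hAp : ∀ i, 0 < A i := fun i => by
    have := hw i
    simp only [hA]; split_ifs <;> positivity
  have hAprod : ∏ i, A i = η * ((n:ℝ) ^ n * Δ) := by
    rw [hA, Finset.prod_mul_distrib, hprod]
    simp
  have h5 := Sys.lower_image (S := S) hn hh H.hQ hκ0 hκ1 hε1 hpert H.hnear H.hκ H.hvolL hqcQ hcon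
    (Function.update (fun i => e i) k eb) (fun i => by
      by_cases hi : i = k
      · subst hi; simpa
      · simp [hi]) hdte A hAp (fun i q hq => by
      by_cases hi : i = k
      · subst hi
        simp only [Function.update_self, hA, if_true]
        exact hebw _ ⟨q, hq, rfl⟩
      · simp only [Function.update_of_ne hi, hA, if_neg hi, one_mul]
        exact (le_abs_self _).trans (hwid i q hq qc hqcQ))
  have h6 := Sys.upper_image (S := S) hh hlam.le H.hvolU hJ.le (q0 + θ • (x - q0))
    (fun i => θ • d i) (by
      rw [dt_smul_const]
      have : 0 < |dt d| := by rw [hdt]; positivity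
      have := abs_pos.1 this
      positivity) (fun s hs => by
      have := hcQ.add_smul_sub_mem hq0 (hpar s hs) ⟨hθ0.le, hθ1⟩
      convert this using 1
      simp only [smul_comm _ θ, ← Finset.smul_sum]
      module) (hlow _ (by
        refine IsCompact.image ?_ ?_
        · have : {s : Euc n | ∀ i, s i ∈ Icc (-(S.m0 ^ 2 / 2)) (S.m0 ^ 2 / 2)} =
            (MeasurableEquiv.toLp 2 (Fin n → ℝ)) '' (Set.pi univ fun _ =>
              Icc (-(S.m0 ^ 2 / 2)) (S.m0 ^ 2 / 2)) := by
            ext s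
            constructor
            · intro hs
              exact ⟨s.ofLp, fun i _ => hs i, by simp⟩
            · rintro ⟨t, ht, rfl⟩ i
              exact ht i trivial
          rw [this]
          exact (isCompact_univ_pi fun _ => isCompact_Icc).image (PiLp.continuous_toLp 2 _)
        · fun_prop) (by
        rintro _ ⟨s, hs, rfl⟩
        refine ⟨x + ∑ i, s i • d i, hpar (fun i => s i) (fun i => ?_), ?_⟩
        · have := S.hm1
          have := S.hm0
          have h1 := hs i
          rw [abs_le]
          constructor <;> nlinarith [h1.1, h1.2]
        · simp only [smul_comm _ θ, ← Finset.smul_sum]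
          module))
  rw [hSm] at h5 h6
  rw [dt_smul_const, abs_mul, hdt, abs_of_pos (by positivity : 0 < θ ^ n)] at h6
  have h7 := h5.trans ((mul_le_mul_right hupp (ENNReal.ofReal J)).trans
    (mul_le_mul_right (mul_le_mul_right hvol _) _))
  have hLam0 : 0 ≤ Lam ∨ Lam ≤ 0 := le_total _ _
  have hLC : ENNReal.ofReal Lam ≤ ENNReal.ofReal (C * lam) := ENNReal.ofReal_le_ofReal hLam
  have h8 := h7.trans (mul_le_mul_right (mul_le_mul_left hLC _) _)
  rw [← ENNReal.ofReal_mul (by positivity), ← ENNReal.ofReal_mul (by positivity),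
    ENNReal.ofReal_le_ofReal_iff (by positivity)] at h8
  have e1 : ∏ i, (κ * m * h / (2 * A i)) = (κ * m / 2) ^ n * h ^ n / (η * ((n:ℝ) ^ n * Δ)) := by
    rw [← hAprod, ← mul_pow]
    have : ∀ i, κ * m * h / (2 * A i) = (κ * m / 2 * h) / A i := fun i => by
      have := (hAp i).ne'
      field_simp
    simp only [this]
    rw [Finset.prod_div_distrib]
    simp
  rw [e1] at h8
  have h9 : c2 * h ^ n ≤ J * (C * lam * (2 ^ n * Δ)) * (η * ((n:ℝ) ^ n * Δ)) := by
    have := mul_le_mul_of_nonneg_right h8 (by positivity : 0 ≤ η * ((n:ℝ) ^ n * Δ))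
    refine le_trans (le_of_eq ?_) this
    rw [hc2]
    field_simp
  have h10 : lam * c1 * Δ ^ 2 ≤ J * (4 / m) ^ n * h ^ n := by
    calc _ = lam * (m ^ 2) ^ n * (θ ^ n * (Δ / (2 * n) ^ n)) ^ 2 := by rw [hc1]; ring
      _ ≤ J * (4 * h / m) ^ n := h6
      _ = _ := by rw [mul_assoc, ← mul_pow]; congr 2; ring
  have h11 : c1 * c2 * h ^ n ≤ η * K * h ^ n := by
    have h12 := mul_le_mul_of_nonneg_left h9 hc1p.le
    have h13 := mul_le_mul_of_nonneg_left h10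
      (by positivity : 0 ≤ (n:ℝ) ^ n * 2 ^ n * J * C * η)
    calc c1 * c2 * h ^ n = c1 * (c2 * h ^ n) := by ring
      _ ≤ _ := h12
      _ = (n:ℝ) ^ n * 2 ^ n * J * C * η * (lam * c1 * Δ ^ 2) := by ring
      _ ≤ _ := h13
      _ = _ := by rw [hK]; ring
  have h14 := le_of_mul_le_mul_right h11 (by positivity : 0 < h ^ n)
  have h15 : η * K ≤ η0 * K := by gcongr
  have h16 : η0 * K = c1 * c2 / 2 := by rw [hη0]; field_simp
  have : 0 < c1 * c2 := by positivity
  linarith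

end FKM

open Set MeasureTheory Metric Bornology
open scoped ENNReal NNReal Pointwise

namespace FKM
open scoped RealInnerProductSpace
open Filter Topology

lemma iterated_bound {F : Type*} [NormedAddCommGroup F] [NormedSpace ℝ F] {f : F → ℝ} {S W : Set F}
    (hS : IsCompact S) (hW : IsOpen W) (hWS : W ⊆ S) {N : ℕ} (hf : ContDiffOn ℝ N f S) {k : ℕ}
    (hk : k ≤ N) : ∃ C : ℝ, 0 ≤ C ∧ ∀ z ∈ W, ‖iteratedFDeriv ℝ k f z‖ ≤ C := by
  have key : ∃ C : ℝ, 0 ≤ C ∧ ∀ z ∈ S ∩ W, ‖iteratedFDeriv ℝ k f z‖ ≤ C := by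
    refine hS.induction_on (p := fun s => ∃ C : ℝ, 0 ≤ C ∧ ∀ z ∈ s ∩ W,
      ‖iteratedFDeriv ℝ k f z‖ ≤ C) ?_ ?_ ?_ ?_
    · exact ⟨0, le_rfl, by simp⟩
    · rintro s t hst ⟨C, hC, h⟩
      exact ⟨C, hC, fun z hz => h z ⟨hst hz.1, hz.2⟩⟩
    · rintro s t ⟨C, hC, h⟩ ⟨C', hC', h'⟩
      refine ⟨max C C', le_max_of_le_left hC, ?_⟩
      rintro z ⟨hz | hz, hzW⟩
      · exact (h z ⟨hz, hzW⟩).trans (le_max_left _ _)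
      · exact (h' z ⟨hz, hzW⟩).trans (le_max_right _ _)
    · intro z hz
      obtain ⟨u, hu, p, hp⟩ := contDiffWithinAt_nat.1 (hf z hz)
      rw [insert_eq_of_mem hz] at hu
      have hzu : z ∈ u := mem_of_mem_nhdsWithin hz hu
      have hc : ContinuousWithinAt (fun x => ‖p x k‖) u z :=
        ((hp.cont k (by exact_mod_cast hk)) z hzu).norm
      have h1 : ∀ᶠ x in 𝓝[u] z, ‖p x k‖ < ‖p z k‖ + 1 := hc.eventually_lt_const (by linarith)
      have h2 : {x | ‖p x k‖ < ‖p z k‖ + 1} ∩ u ∈ 𝓝[S] z := by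
        obtain ⟨o, ho, hzo, hoS⟩ := mem_nhdsWithin.1 hu
        obtain ⟨o', ho', hzo', hoS'⟩ := mem_nhdsWithin.1 h1
        refine mem_nhdsWithin.2 ⟨o ∩ o', ho.inter ho', ⟨hzo, hzo'⟩, ?_⟩
        rintro x ⟨⟨h1, h2⟩, h3⟩
        exact ⟨hoS' ⟨h2, hoS ⟨h1, h3⟩⟩, hoS ⟨h1, h3⟩⟩
      obtain ⟨o, ho, hzo, hoS⟩ := mem_nhdsWithin.1 h2
      refine ⟨o ∩ S, mem_nhdsWithin.2 ⟨o, ho, hzo, subset_rfl⟩, ‖p z k‖ + 1, by positivity, ?_⟩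
      rintro x ⟨⟨hxo, hxS⟩, hxW⟩
      have hoW : IsOpen (o ∩ W) := ho.inter hW
      have hsub : o ∩ W ⊆ u := fun y hy => (hoS ⟨hy.1, hWS hy.2⟩).2
      have := (hp.mono hsub).eq_iteratedFDerivWithin_of_uniqueDiffOn (m := k)
        (by exact_mod_cast hk) hoW.uniqueDiffOn ⟨hxo, hxW⟩
      rw [iteratedFDerivWithin_of_isOpen k hoW ⟨hxo, hxW⟩] at this
      rw [← this]
      exact (hoS ⟨hxo, hxS⟩).1.le
  obtain ⟨C, hC, h⟩ := key
  exact ⟨C, hC, fun z hz => h z ⟨hWS hz, hz⟩⟩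


section generic
set_option maxSynthPendingDepth 3
variable {F : Type*} [NormedAddCommGroup F] [NormedSpace ℝ F]

/-- First derivative. -/
noncomputable def d1 (f : F → ℝ) (z v : F) : ℝ := fderiv ℝ f z v
/-- Second derivative. -/
noncomputable def d2 (f : F → ℝ) (z v w : F) : ℝ := fderiv ℝ (fderiv ℝ f) z v w
/-- Third derivative. -/
noncomputable def d3 (f : F → ℝ) (z v w a : F) : ℝ := fderiv ℝ (fderiv ℝ (fderiv ℝ f)) z v w a
/-- Fourth derivative. -/
noncomputable def d4 (f : F → ℝ) (z v w a b : F) : ℝ :=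
  fderiv ℝ (fderiv ℝ (fderiv ℝ (fderiv ℝ f))) z v w a b

/-- `f` is `C⁴` on the open set `W`. -/
structure Sm (f : F → ℝ) (W : Set F) : Prop where
  op : IsOpen W
  cf : ContDiffOn ℝ 4 f W

variable {f : F → ℝ} {W : Set F} {z : F}

lemma Sm.c1 (h : Sm f W) : ContDiffOn ℝ 3 (fderiv ℝ f) W := h.cf.fderiv_of_isOpen h.op (by norm_num)
lemma Sm.c2 (h : Sm f W) : ContDiffOn ℝ 2 (fderiv ℝ (fderiv ℝ f)) W :=
  h.c1.fderiv_of_isOpen h.op (by norm_num)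
lemma Sm.c3 (h : Sm f W) : ContDiffOn ℝ 1 (fderiv ℝ (fderiv ℝ (fderiv ℝ f))) W :=
  h.c2.fderiv_of_isOpen h.op (by norm_num)

lemma Sm.h1 (h : Sm f W) (hz : z ∈ W) : HasFDerivAt f (fderiv ℝ f z) z :=
  ((h.cf.contDiffAt (h.op.mem_nhds hz)).differentiableAt (by norm_num)).hasFDerivAt
lemma Sm.h2 (h : Sm f W) (hz : z ∈ W) : HasFDerivAt (fderiv ℝ f) (fderiv ℝ (fderiv ℝ f) z) z :=
  ((h.c1.contDiffAt (h.op.mem_nhds hz)).differentiableAt (by norm_num)).hasFDerivAt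
lemma Sm.h3 (h : Sm f W) (hz : z ∈ W) :
    HasFDerivAt (fderiv ℝ (fderiv ℝ f)) (fderiv ℝ (fderiv ℝ (fderiv ℝ f)) z) z :=
  ((h.c2.contDiffAt (h.op.mem_nhds hz)).differentiableAt (by norm_num)).hasFDerivAt
lemma Sm.h4 (h : Sm f W) (hz : z ∈ W) : HasFDerivAt (fderiv ℝ (fderiv ℝ (fderiv ℝ f)))
    (fderiv ℝ (fderiv ℝ (fderiv ℝ (fderiv ℝ f))) z) z :=
  ((h.c3.contDiffAt (h.op.mem_nhds hz)).differentiableAt (by norm_num)).hasFDerivAt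

lemma Sm.g2 (h : Sm f W) (hz : z ∈ W) (w : F) :
    HasFDerivAt (fun z' => d1 f z' w) ((fderiv ℝ (fderiv ℝ f) z).flip w) z := by
  refine ((h.h2 hz).clm_apply (hasFDerivAt_const w z)).congr_fderiv ?_
  ext x; simp
lemma Sm.g3 (h : Sm f W) (hz : z ∈ W) (w a : F) :
    HasFDerivAt (fun z' => d2 f z' w a)
      (((fderiv ℝ (fderiv ℝ (fderiv ℝ f)) z).flip w).flip a) z := by
  refine (((h.h3 hz).clm_apply (hasFDerivAt_const w z)).clm_apply
    (hasFDerivAt_const a z)).congr_fderiv ?_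
  ext x; simp
lemma Sm.g4 (h : Sm f W) (hz : z ∈ W) (w a b : F) :
    HasFDerivAt (fun z' => d3 f z' w a b)
      ((((fderiv ℝ (fderiv ℝ (fderiv ℝ (fderiv ℝ f))) z).flip w).flip a).flip b) z := by
  refine ((((h.h4 hz).clm_apply (hasFDerivAt_const w z)).clm_apply
    (hasFDerivAt_const a z)).clm_apply (hasFDerivAt_const b z)).congr_fderiv ?_
  ext x; simp

lemma Sm.s2 (h : Sm f W) (hz : z ∈ W) (v w : F) : d2 f z v w = d2 f z w v :=
  (h.cf.contDiffAt (h.op.mem_nhds hz)).isSymmSndFDerivAt (by norm_num) v w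
lemma Sm.s3a (h : Sm f W) (hz : z ∈ W) (v w a : F) : d3 f z v w a = d3 f z w v a :=
  congrArg (fun g => g a)
    ((h.c1.contDiffAt (h.op.mem_nhds hz)).isSymmSndFDerivAt (by norm_num) v w)
lemma Sm.s3b (h : Sm f W) (hz : z ∈ W) (v w a : F) : d3 f z v w a = d3 f z v a w := by
  have h3 : (fun z' => d2 f z' w a) =ᶠ[𝓝 z] (fun z' => d2 f z' a w) := by
    filter_upwards [h.op.mem_nhds hz] with z' hz' using h.s2 hz' w a
  exact congrArg (fun g => g v) (((h.g3 hz w a).congr_of_eventuallyEq h3.symm).unique (h.g3 hz a w))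
lemma Sm.s4a (h : Sm f W) (hz : z ∈ W) (v w a b : F) : d4 f z v w a b = d4 f z w v a b :=
  congrArg (fun g => g a b)
    ((h.c2.contDiffAt (h.op.mem_nhds hz)).isSymmSndFDerivAt (by norm_num) v w)
lemma Sm.s4b (h : Sm f W) (hz : z ∈ W) (v w a b : F) : d4 f z v w a b = d4 f z v a w b := by
  have h3 : (fun z' => d3 f z' w a b) =ᶠ[𝓝 z] (fun z' => d3 f z' a w b) := by
    filter_upwards [h.op.mem_nhds hz] with z' hz' using h.s3a hz' w a b
  exact congrArg (fun g => g v)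
    (((h.g4 hz w a b).congr_of_eventuallyEq h3.symm).unique (h.g4 hz a w b))
lemma Sm.s4c (h : Sm f W) (hz : z ∈ W) (v w a b : F) : d4 f z v w a b = d4 f z v w b a := by
  have h3 : (fun z' => d3 f z' w a b) =ᶠ[𝓝 z] (fun z' => d3 f z' w b a) := by
    filter_upwards [h.op.mem_nhds hz] with z' hz' using h.s3b hz' w a b
  exact congrArg (fun g => g v)
    (((h.g4 hz w a b).congr_of_eventuallyEq h3.symm).unique (h.g4 hz w b a))

/-- Uniform bounds on the derivatives. -/
lemma Sm.bounds (h : Sm f W) {S : Set F} (hS : IsCompact S) (hWS : W ⊆ S)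
    (hf : ContDiffOn ℝ 4 f S) : ∃ K : ℝ, 1 ≤ K ∧ ∀ z ∈ W, (∀ v, |d1 f z v| ≤ K * ‖v‖) ∧
    (∀ v w, |d2 f z v w| ≤ K * ‖v‖ * ‖w‖) ∧ (∀ v w a, |d3 f z v w a| ≤ K * ‖v‖ * ‖w‖ * ‖a‖) ∧
    (∀ v w a b, |d4 f z v w a b| ≤ K * ‖v‖ * ‖w‖ * ‖a‖ * ‖b‖) := by
  have h := fun k hk => iterated_bound hS h.op hWS (N := 4) hf (k := k) hk
  obtain ⟨K1, k1, h1⟩ := h 1 (by norm_num)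
  obtain ⟨K2, k2, h2⟩ := h 2 (by norm_num)
  obtain ⟨K3, k3, h3⟩ := h 3 (by norm_num)
  obtain ⟨K4, k4, h4⟩ := h 4 (by norm_num)
  refine ⟨1 + K1 + K2 + K3 + K4, by linarith, fun z hz => ⟨?_, ?_, ?_, ?_⟩⟩
  · intro v
    have := h1 z hz
    rw [← norm_iteratedFDeriv_fderiv, norm_iteratedFDeriv_zero] at this
    refine ((fderiv ℝ f z).le_opNorm v).trans ?_
    gcongr; linarith
  · intro v w
    have := h2 z hz
    rw [← norm_iteratedFDeriv_fderiv, ← norm_iteratedFDeriv_fderiv,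
      norm_iteratedFDeriv_zero] at this
    refine (ContinuousLinearMap.le_opNorm₂ (fderiv ℝ (fderiv ℝ f) z) v w).trans ?_
    gcongr; linarith
  · intro v w a
    have := h3 z hz
    rw [← norm_iteratedFDeriv_fderiv, ← norm_iteratedFDeriv_fderiv,
      ← norm_iteratedFDeriv_fderiv, norm_iteratedFDeriv_zero] at this
    refine (ContinuousLinearMap.le_opNorm₂ (fderiv ℝ (fderiv ℝ (fderiv ℝ f)) z v) w a).trans ?_
    gcongr
    refine (ContinuousLinearMap.le_opNorm (fderiv ℝ (fderiv ℝ (fderiv ℝ f)) z) v).trans ?_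
    gcongr; linarith
  · intro v w a b
    have := h4 z hz
    rw [← norm_iteratedFDeriv_fderiv, ← norm_iteratedFDeriv_fderiv,
      ← norm_iteratedFDeriv_fderiv, ← norm_iteratedFDeriv_fderiv,
      norm_iteratedFDeriv_zero] at this
    refine (ContinuousLinearMap.le_opNorm₂
      (fderiv ℝ (fderiv ℝ (fderiv ℝ (fderiv ℝ f))) z v w) a b).trans ?_
    gcongr
    refine (ContinuousLinearMap.le_opNorm₂
      (fderiv ℝ (fderiv ℝ (fderiv ℝ (fderiv ℝ f))) z) v w).trans ?_
    gcongr; linarith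

/-! chain rules along curves -/
variable {γ : ℝ → F} {γ' : F} {v w a : ℝ → F} {v' w' a' : F} {t : ℝ}

lemma Sm.k0 (h : Sm f W) (hz : γ t ∈ W) (hγ : HasDerivAt γ γ' t) :
    HasDerivAt (fun s => f (γ s)) (d1 f (γ t) γ') t := (h.h1 hz).comp_hasDerivAt t hγ
lemma Sm.k1 (h : Sm f W) (hz : γ t ∈ W) (hγ : HasDerivAt γ γ' t) (hv : HasDerivAt v v' t) :
    HasDerivAt (fun s => d1 f (γ s) (v s)) (d2 f (γ t) γ' (v t) + d1 f (γ t) v') t :=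
  ((h.h2 hz).comp_hasDerivAt t hγ).clm_apply hv
lemma Sm.k2 (h : Sm f W) (hz : γ t ∈ W) (hγ : HasDerivAt γ γ' t) (hv : HasDerivAt v v' t)
    (hw : HasDerivAt w w' t) :
    HasDerivAt (fun s => d2 f (γ s) (v s) (w s))
      (d3 f (γ t) γ' (v t) (w t) + d2 f (γ t) v' (w t) + d2 f (γ t) (v t) w') t :=
  (((h.h3 hz).comp_hasDerivAt t hγ).clm_apply hv).clm_apply hw
lemma Sm.k3 (h : Sm f W) (hz : γ t ∈ W) (hγ : HasDerivAt γ γ' t) (hv : HasDerivAt v v' t)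
    (hw : HasDerivAt w w' t) (ha : HasDerivAt a a' t) :
    HasDerivAt (fun s => d3 f (γ s) (v s) (w s) (a s))
      (d4 f (γ t) γ' (v t) (w t) (a t) + d3 f (γ t) v' (w t) (a t) + d3 f (γ t) (v t) w' (a t)
        + d3 f (γ t) (v t) (w t) a') t :=
  ((((h.h4 hz).comp_hasDerivAt t hγ).clm_apply hv).clm_apply hw).clm_apply ha

/-! composition with a linear map -/
variable {F' : Type*} [NormedAddCommGroup F'] [NormedSpace ℝ F']

lemma Sm.l1 (h : Sm f W) {W' : Set F'} (σ : F' →L[ℝ] F) {z : F'} (hz : z ∈ W')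
    (hW : MapsTo σ W' W) (v : F') : d1 (fun y => f (σ y)) z v = d1 f (σ z) (σ v) :=
  congrArg (fun g => g v) ((h.h1 (hW hz)).comp z σ.hasFDerivAt).fderiv

lemma Sm.l2 (h : Sm f W) {W' : Set F'} (σ : F' →L[ℝ] F) (h' : Sm (fun y => f (σ y)) W') {z : F'}
    (hz : z ∈ W') (hW : MapsTo σ W' W) (v w : F') :
    d2 (fun y => f (σ y)) z v w = d2 f (σ z) (σ v) (σ w) := by
  have h3 : (fun z' => d1 (fun y => f (σ y)) z' w) =ᶠ[𝓝 z] (fun z' => d1 f (σ z') (σ w)) := by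
    filter_upwards [h'.op.mem_nhds hz] with z' hz' using h.l1 σ hz' hW w
  have := ((h'.g2 hz w).congr_of_eventuallyEq h3.symm).unique
    ((h.g2 (hW hz) (σ w)).comp z σ.hasFDerivAt)
  exact congrArg (fun g => g v) this

lemma Sm.l3 (h : Sm f W) {W' : Set F'} (σ : F' →L[ℝ] F) (h' : Sm (fun y => f (σ y)) W') {z : F'}
    (hz : z ∈ W') (hW : MapsTo σ W' W) (v w a : F') :
    d3 (fun y => f (σ y)) z v w a = d3 f (σ z) (σ v) (σ w) (σ a) := by
  have h3 : (fun z' => d2 (fun y => f (σ y)) z' w a) =ᶠ[𝓝 z]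
      (fun z' => d2 f (σ z') (σ w) (σ a)) := by
    filter_upwards [h'.op.mem_nhds hz] with z' hz' using h.l2 σ h' hz' hW w a
  have := ((h'.g3 hz w a).congr_of_eventuallyEq h3.symm).unique
    ((h.g3 (hW hz) (σ w) (σ a)).comp z σ.hasFDerivAt)
  exact congrArg (fun g => g v) this

lemma Sm.l4 (h : Sm f W) {W' : Set F'} (σ : F' →L[ℝ] F) (h' : Sm (fun y => f (σ y)) W') {z : F'}
    (hz : z ∈ W') (hW : MapsTo σ W' W) (v w a b : F') :
    d4 (fun y => f (σ y)) z v w a b = d4 f (σ z) (σ v) (σ w) (σ a) (σ b) := by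
  have h3 : (fun z' => d3 (fun y => f (σ y)) z' w a b) =ᶠ[𝓝 z]
      (fun z' => d3 f (σ z') (σ w) (σ a) (σ b)) := by
    filter_upwards [h'.op.mem_nhds hz] with z' hz' using h.l3 σ h' hz' hW w a b
  have := ((h'.g4 hz w a b).congr_of_eventuallyEq h3.symm).unique
    ((h.g4 (hW hz) (σ w) (σ a) (σ b)).comp z σ.hasFDerivAt)
  exact congrArg (fun g => g v) this
end generic

section lin
set_option maxSynthPendingDepth 3
variable {F : Type*} [NormedAddCommGroup F] [NormedSpace ℝ F] (f : F → ℝ) (z : F)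
lemma d1_add (v v' : F) : d1 f z (v + v') = d1 f z v + d1 f z v' := by simp [d1]
lemma d1_smul (r : ℝ) (v : F) : d1 f z (r • v) = r * d1 f z v := by simp [d1]
lemma d2_add1 (v v' w : F) : d2 f z (v + v') w = d2 f z v w + d2 f z v' w := by simp [d2]
lemma d2_smul1 (r : ℝ) (v w : F) : d2 f z (r • v) w = r * d2 f z v w := by simp [d2]
lemma d2_add2 (w v v' : F) : d2 f z w (v + v') = d2 f z w v + d2 f z w v' := by simp [d2]
lemma d2_smul2 (r : ℝ) (w v : F) : d2 f z w (r • v) = r * d2 f z w v := by simp [d2]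
lemma d3_add1 (v v' w a : F) : d3 f z (v + v') w a = d3 f z v w a + d3 f z v' w a := by simp [d3]
lemma d3_add2 (v v' w a : F) : d3 f z w (v + v') a = d3 f z w v a + d3 f z w v' a := by simp [d3]
lemma d3_add3 (v v' w a : F) : d3 f z w a (v + v') = d3 f z w a v + d3 f z w a v' := by simp [d3]
lemma d3_smul1 (r : ℝ) (v w a : F) : d3 f z (r • v) w a = r * d3 f z v w a := by simp [d3]
lemma d3_smul2 (r : ℝ) (v w a : F) : d3 f z w (r • v) a = r * d3 f z w v a := by simp [d3]
lemma d3_smul3 (r : ℝ) (v w a : F) : d3 f z w a (r • v) = r * d3 f z w a v := by simp [d3]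
lemma d4_add1 (v v' w a b : F) :
    d4 f z (v + v') w a b = d4 f z v w a b + d4 f z v' w a b := by simp [d4]
lemma d4_add2 (v v' w a b : F) :
    d4 f z w (v + v') a b = d4 f z w v a b + d4 f z w v' a b := by simp [d4]
lemma d4_smul1 (r : ℝ) (v w a b : F) : d4 f z (r • v) w a b = r * d4 f z v w a b := by simp [d4]
lemma d4_smul2 (r : ℝ) (v w a b : F) : d4 f z w (r • v) a b = r * d4 f z w v a b := by simp [d4]
lemma d4_smul3 (r : ℝ) (v w a b : F) : d4 f z w a (r • v) b = r * d4 f z w a v b := by simp [d4]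
lemma d4_smul4 (r : ℝ) (v w a b : F) : d4 f z w a b (r • v) = r * d4 f z w a b v := by simp [d4]
end lin

/-- A cost with the standing hypotheses. -/
structure Cost (n : ℕ) where
  c : Euc n → Euc n → ℝ
  U : Set (Euc n)
  V : Set (Euc n)
  B0 : B0cond n c U V
  B1 : B1cond n c U V
  B2s : B2scond n c U V

namespace Cost
variable {n : ℕ} (C : Cost n)

/-- The uncurried cost. -/
def f : Euc n × Euc n → ℝ := Function.uncurry C.c
/-- The open product. -/
def W : Set (Euc n × Euc n) := C.U ×ˢ C.V

lemma hU : IsOpen C.U := C.B0.1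
lemma hV : IsOpen C.V := C.B0.2.2.1
lemma hUb : IsBounded C.U := C.B0.2.1
lemma hVb : IsBounded C.V := C.B0.2.2.2.1
lemma hc : ContDiffOn ℝ 4 C.f (closure C.U ×ˢ closure C.V) := C.B0.2.2.2.2
lemma hW : IsOpen C.W := C.hU.prod C.hV
lemma cU : IsCompact (closure C.U) := C.hUb.isCompact_closure
lemma cV : IsCompact (closure C.V) := C.hVb.isCompact_closure
lemma W_sub : C.W ⊆ closure C.U ×ˢ closure C.V := prod_mono subset_closure subset_closure
lemma cont_f : ContinuousOn C.f (closure C.U ×ˢ closure C.V) := C.hc.continuousOn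
lemma sm : Sm C.f C.W := ⟨C.hW, C.hc.mono C.W_sub⟩

/-- Exchange of variables. -/
def flip : Cost n where
  c := fun y x => C.c x y
  U := C.V
  V := C.U
  B0 := by
    obtain ⟨h1, h2, h3, h4, h5⟩ := C.B0
    refine ⟨h3, h4, h1, h2, ?_⟩
    exact ContDiffOn.comp (g := Function.uncurry C.c) (f := Prod.swap) h5
      ((contDiff_snd.prodMk contDiff_fst).contDiffOn) (fun z hz => ⟨hz.2, hz.1⟩)
  B1 := ⟨C.B1.2, C.B1.1⟩
  B2s := ⟨C.B2s.2, C.B2s.1⟩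

lemma flip_flip : C.flip.flip = C := rfl

/-- The A3w condition in infinitesimal, symmetric form. -/
def MTW : Prop := ∀ x ∈ C.U, ∀ y ∈ C.V, ∀ ξ η a b : Euc n,
  d2 C.f (x, y) (ξ, 0) (0, η) = 0 →
  (∀ ζ, d2 C.f (x, y) (a, 0) (0, ζ) = -d3 C.f (x, y) (ξ, 0) (ξ, 0) (0, ζ)) →
  (∀ ζ, d2 C.f (x, y) (ζ, 0) (0, b) = -d3 C.f (x, y) (ζ, 0) (0, η) (0, η)) →
  d4 C.f (x, y) (ξ, 0) (ξ, 0) (0, η) (0, η) ≤ d2 C.f (x, y) (a, 0) (0, b)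

variable {C}

/-- The swap as a continuous linear map. -/
def sw (n : ℕ) : Euc n × Euc n →L[ℝ] Euc n × Euc n :=
  (ContinuousLinearEquiv.prodComm ℝ (Euc n) (Euc n) : Euc n × Euc n →L[ℝ] Euc n × Euc n)

lemma MTW.flip (h : C.MTW) : C.flip.MTW := by
  intro y hy x hx η ξ b a h0 hb ha
  have hz : (y, x) ∈ C.flip.W := ⟨hy, hx⟩
  have hz' : (x, y) ∈ C.W := ⟨hx, hy⟩
  have e : sw n (y, x) = (x, y) := rfl
  have e1 : ∀ t : Euc n, sw n (t, 0) = (0, t) := fun _ => rfl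
  have e2 : ∀ t : Euc n, sw n (0, t) = (t, 0) := fun _ => rfl
  have hm : MapsTo (sw n) C.flip.W C.W := fun z hz => ⟨hz.2, hz.1⟩
  have hs : Sm (fun y => C.f (sw n y)) C.flip.W := C.flip.sm
  have ef : C.flip.f = fun y => C.f (sw n y) := rfl
  simp only [ef, C.sm.l2 (sw n) hs hz hm, C.sm.l3 (sw n) hs hz hm, C.sm.l4 (sw n) hs hz hm,
    e, e1, e2] at *
  have := h x hx y hy ξ η a b (by rw [C.sm.s2 hz', h0]) (fun ζ => by
    rw [C.sm.s2 hz', ha ζ, C.sm.s3a hz', C.sm.s3b hz']) (fun ζ => by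
    rw [C.sm.s2 hz', hb ζ, C.sm.s3b hz', C.sm.s3a hz'])
  rw [C.sm.s2 hz']
  rw [C.sm.s4b hz', C.sm.s4a hz', C.sm.s4c hz', C.sm.s4b hz']
  exact this

end Cost
end FKM

open Set MeasureTheory Metric Bornology
open scoped ENNReal NNReal Pointwise

namespace FKM
open scoped RealInnerProductSpace
open Filter Topology

namespace Cost
variable {n : ℕ} (C : Cost n)

/-- `p(x,y) = -D_x c(x,y)`. -/
noncomputable def p (x y : Euc n) : Euc n := -gradX n C.c x y

lemma p_formula {x y : Euc n} (hx : x ∈ C.U) (hy : y ∈ closure C.V)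
    {g : Euc n × Euc n →L[ℝ] ℝ}
    (hg : HasFDerivWithinAt C.f g (closure C.U ×ˢ closure C.V) (x, y)) :
    HasGradientAt (fun x' => C.c x' y) (-C.p x y) x ∧
    C.p x y = -(InnerProductSpace.toDual ℝ (Euc n)).symm (g.comp (.inl ℝ (Euc n) (Euc n))) := by
  have h1 : HasFDerivWithinAt (fun x' => C.f (x', y))
      (g.comp (.inl ℝ (Euc n) (Euc n))) C.U x := by
    refine hg.comp (f := fun x' => (x', y)) x ?_ (fun x' hx' => ⟨subset_closure hx', hy⟩)
    exact ((hasFDerivAt_id x).prodMk (hasFDerivAt_const y x)).hasFDerivWithinAt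
  have h2 := h1.hasFDerivAt (C.hU.mem_nhds hx)
  have h3 : HasGradientAt (fun x' => C.c x' y)
      ((InnerProductSpace.toDual ℝ (Euc n)).symm (g.comp (.inl ℝ (Euc n) (Euc n)))) x := by
    rw [hasGradientAt_iff_hasFDerivAt, LinearIsometryEquiv.apply_symm_apply]
    exact h2
  have h4 : gradX n C.c x y = _ := h3.gradient
  refine ⟨?_, by rw [p, h4]⟩
  rw [p, h4, neg_neg]
  exact h3

lemma hasGrad {x y : Euc n} (hx : x ∈ C.U) (hy : y ∈ closure C.V) :
    HasGradientAt (fun x' => C.c x' y) (-C.p x y) x :=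
  (C.p_formula hx hy ((C.hc.differentiableOn (by norm_num)) _
    ⟨subset_closure hx, hy⟩).hasFDerivWithinAt).1

lemma p_inner {x y : Euc n} (hx : x ∈ C.U) (hy : y ∈ C.V) (ξ : Euc n) :
    ⟪C.p x y, ξ⟫ = -d1 C.f (x, y) (ξ, 0) := by
  rw [(C.p_formula hx (subset_closure hy) (C.sm.h1 (z := (x, y)) ⟨hx, hy⟩).hasFDerivWithinAt).2,
    inner_neg_left, InnerProductSpace.toDual_symm_apply]
  rfl

lemma p_smooth : ContDiffOn ℝ 3 (fun z : Euc n × Euc n => C.p z.1 z.2) (C.U ×ˢ closure C.V) := by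
  rintro ⟨x, y⟩ ⟨hx, hy⟩
  have h0 := C.hc (x, y) ⟨subset_closure hx, hy⟩
  rw [show (4 : WithTop ℕ∞) = 3 + 1 by norm_num,
    contDiffWithinAt_succ_iff_hasFDerivWithinAt' (by norm_num)] at h0
  obtain ⟨u, hu, -, -, f', hf', hc'⟩ := h0
  rw [insert_eq_of_mem (show (x, y) ∈ closure C.U ×ˢ closure C.V from
    ⟨subset_closure hx, hy⟩)] at hu
  have hsub : C.U ×ˢ closure C.V ⊆ closure C.U ×ˢ closure C.V :=
    prod_mono subset_closure subset_rfl
  have h1 := hc'.mono hsub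
  have h2 : ContDiffWithinAt ℝ 3 (fun z => -(InnerProductSpace.toDual ℝ (Euc n)).symm
      ((f' z).comp (.inl ℝ (Euc n) (Euc n)))) (C.U ×ˢ closure C.V) (x, y) := by
    refine ContDiffWithinAt.neg ?_
    refine (LinearIsometryEquiv.contDiff _).comp_contDiffWithinAt ?_
    exact h1.clm_comp contDiffWithinAt_const
  refine h2.congr_of_eventuallyEq_of_mem ?_ ⟨hx, hy⟩
  filter_upwards [nhdsWithin_mono _ hsub hu, self_mem_nhdsWithin] with z hz hz'
  exact (C.p_formula hz'.1 hz'.2 (hf' z hz)).2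

lemma p_cont : ContinuousOn (fun z : Euc n × Euc n => C.p z.1 z.2) (C.U ×ˢ closure C.V) :=
  C.p_smooth.continuousOn

lemma px_cont {x : Euc n} (hx : x ∈ C.U) : ContinuousOn (C.p x) (closure C.V) :=
  C.p_cont.comp (f := fun y => (x, y)) (by fun_prop) fun y hy => ⟨hx, hy⟩

lemma px_smooth {x : Euc n} (hx : x ∈ C.U) : ContDiffOn ℝ 3 (C.p x) C.V :=
  C.p_smooth.comp (f := fun y => (x, y)) (by fun_prop) fun y hy => ⟨hx, subset_closure hy⟩

lemma px_inj {x : Euc n} (hx : x ∈ C.U) : InjOn (C.p x) (closure C.V) :=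
  (C.B1.2 x (subset_closure hx)).1

/-- `V_x`. -/
def Vx (x : Euc n) : Set (Euc n) := C.p x '' C.V

lemma Vx_convex {x : Euc n} (hx : x ∈ C.U) : Convex ℝ (C.Vx x) :=
  (C.B2s.2 x (subset_closure hx)).1

lemma img_closure {x : Euc n} (hx : x ∈ C.U) : C.p x '' closure C.V = closure (C.Vx x) := by
  refine Subset.antisymm (C.px_cont hx).image_closure ?_
  refine closure_minimal (image_mono subset_closure) ?_
  exact (C.cV.image_of_continuousOn (C.px_cont hx)).isClosed

lemma img_convex {x : Euc n} (hx : x ∈ C.U) : Convex ℝ (C.p x '' closure C.V) := by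
  rw [C.img_closure hx]; exact (C.Vx_convex hx).closure

/-- The `c`-exponential. -/
noncomputable def ups (x : Euc n) : Euc n → Euc n := Function.invFunOn (C.p x) (closure C.V)

lemma ups_p {x y : Euc n} (hx : x ∈ C.U) (hy : y ∈ closure C.V) : C.ups x (C.p x y) = y :=
  (C.px_inj hx).leftInvOn_invFunOn hy

lemma lip0 {x : Euc n} (hx : x ∈ C.U) : ∃ L : ℝ, 1 ≤ L ∧ ∀ y ∈ closure C.V, ∀ y' ∈ closure C.V,
    ‖y - y'‖ ≤ L * ‖C.p x y - C.p x y'‖ := by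
  have h := (C.B1.2 x (subset_closure hx)).2.2
  obtain ⟨K, hK⟩ := ContDiffOn.exists_lipschitzOnWith h (by norm_num) (C.img_convex hx)
    (C.cV.image_of_continuousOn (C.px_cont hx))
  refine ⟨max 1 K, le_max_left _ _, fun y hy y' hy' => ?_⟩
  have := hK.norm_sub_le (mem_image_of_mem _ hy) (mem_image_of_mem _ hy')
  have e1 : Function.invFunOn (fun y => -gradX n C.c x y) (closure C.V) (-gradX n C.c x y) = y :=
    C.ups_p hx hy
  have e2 : Function.invFunOn (fun y => -gradX n C.c x y) (closure C.V) (-gradX n C.c x y') = y' :=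
    C.ups_p hx hy'
  simp only [e1, e2] at this
  refine this.trans ?_
  have h2 : (K:ℝ) ≤ max 1 K := le_max_right _ _
  exact mul_le_mul_of_nonneg_right h2 (norm_nonneg _)

/-- The derivative of `p x`. -/
noncomputable def B (x y : Euc n) : Euc n →L[ℝ] Euc n := fderiv ℝ (C.p x) y

lemma hasB {x y : Euc n} (hx : x ∈ C.U) (hy : y ∈ C.V) : HasFDerivAt (C.p x) (C.B x y) y :=
  (((C.px_smooth hx).contDiffAt (C.hV.mem_nhds hy)).differentiableAt (by norm_num)).hasFDerivAt

lemma B_inner {x y : Euc n} (hx : x ∈ C.U) (hy : y ∈ C.V) (η ξ : Euc n) :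
    ⟪C.B x y η, ξ⟫ = -d2 C.f (x, y) (ξ, 0) (0, η) := by
  have h1 : HasDerivAt (fun t : ℝ => y + t • η) η 0 := by
    simpa using ((hasDerivAt_id (0:ℝ)).smul_const η).const_add y
  have hB : HasFDerivAt (C.p x) (C.B x y) (y + (0:ℝ) • η) := by simpa using C.hasB hx hy
  have h2 := (hB.comp_hasDerivAt (0:ℝ) h1).inner ℝ (hasDerivAt_const (0:ℝ) ξ)
  have h3 : HasDerivAt (fun t : ℝ => (x, y + t • η)) (0, η) 0 := (hasDerivAt_const _ _).prodMk h1
  have h4 := (C.sm.k1 (γ := fun t : ℝ => (x, y + t • η)) (t := 0) (by simpa using ⟨hx, hy⟩) h3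
    (hasDerivAt_const _ ((ξ, 0) : Euc n × Euc n))).neg
  have h5 : (fun t : ℝ => ⟪(C.p x ∘ fun t : ℝ => y + t • η) t, ξ⟫) =ᶠ[𝓝 0]
      (fun t => -d1 C.f (x, y + t • η) (ξ, 0)) := by
    have : ∀ᶠ t in 𝓝 (0:ℝ), y + t • η ∈ C.V := by
      refine h1.continuousAt.eventually_mem (C.hV.mem_nhds ?_)
      simpa using hy
    filter_upwards [this] with t ht using C.p_inner hx ht ξ
  have := (h4.congr_of_eventuallyEq h5).unique h2
  simp only [zero_smul, add_zero, inner_zero_right, zero_add] at this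
  rw [← this, C.sm.s2 ⟨hx, hy⟩]
  simp [d1]

lemma nd_of_lip {x y : Euc n} {L : ℝ} (hx : x ∈ C.U) (hy : y ∈ C.V)
    (h : ∀ y ∈ closure C.V, ∀ y' ∈ closure C.V, ‖y - y'‖ ≤ L * ‖C.p x y - C.p x y'‖) (η : Euc n) :
    ‖η‖ ≤ L * ‖C.B x y η‖ := by
  have h1 : HasDerivAt (fun t : ℝ => y + t • η) η 0 := by
    simpa using ((hasDerivAt_id (0:ℝ)).smul_const η).const_add y
  have hB : HasFDerivAt (C.p x) (C.B x y) (y + (0:ℝ) • η) := by simpa using C.hasB hx hy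
  have h2 := (hB.comp_hasDerivAt (0:ℝ) h1)
  rw [hasDerivAt_iff_tendsto_slope_zero] at h1 h2
  refine le_of_tendsto_of_tendsto h1.norm (h2.norm.const_mul L) ?_
  have : ∀ᶠ t in 𝓝 (0:ℝ), y + t • η ∈ C.V := by
    have : Continuous fun t : ℝ => y + t • η := by fun_prop
    refine this.continuousAt.eventually_mem (C.hV.mem_nhds ?_)
    simpa using hy
  filter_upwards [nhdsWithin_le_nhds this] with t ht
  have := h _ (subset_closure ht) _ (subset_closure hy)
  simp only [zero_add, zero_smul, add_zero, Function.comp, norm_smul]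
  calc _ ≤ ‖t⁻¹‖ * (L * ‖C.p x (y + t • η) - C.p x y‖) := by gcongr
    _ = _ := by ring

lemma inner_bound {E : Type*} [NormedAddCommGroup E] [InnerProductSpace ℝ E] {v : E} {K : ℝ}
    (hK : 0 ≤ K) (h : ∀ ξ, |⟪v, ξ⟫| ≤ K * ‖ξ‖) : ‖v‖ ≤ K := by
  have h1 := h v
  rw [real_inner_self_eq_norm_sq, abs_of_nonneg (by positivity)] at h1
  by_cases hv : ‖v‖ = 0
  · rw [hv]; exact hK
  · have : 0 < ‖v‖ := lt_of_le_of_ne (norm_nonneg _) (Ne.symm hv)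
    nlinarith

lemma bounds : ∃ K : ℝ, 1 ≤ K ∧ ∀ z ∈ C.W, (∀ v, |d1 C.f z v| ≤ K * ‖v‖) ∧
    (∀ v w, |d2 C.f z v w| ≤ K * ‖v‖ * ‖w‖) ∧
    (∀ v w a, |d3 C.f z v w a| ≤ K * ‖v‖ * ‖w‖ * ‖a‖) ∧
    (∀ v w a b, |d4 C.f z v w a b| ≤ K * ‖v‖ * ‖w‖ * ‖a‖ * ‖b‖) :=
  C.sm.bounds (C.cU.prod C.cV) C.W_sub C.hc

lemma norm_inl (ξ : Euc n) : ‖((ξ, 0) : Euc n × Euc n)‖ = ‖ξ‖ := by simp [Prod.norm_def]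
lemma norm_inr (ξ : Euc n) : ‖((0, ξ) : Euc n × Euc n)‖ = ‖ξ‖ := by simp [Prod.norm_def]

/-- Lipschitz dependence of `B` on `x`. -/
lemma B_lip {K : ℝ} (hK0 : 1 ≤ K)
    (hK : ∀ z ∈ C.W, ∀ v w a, |d3 C.f z v w a| ≤ K * ‖v‖ * ‖w‖ * ‖a‖)
    {T : Set (Euc n)} (hT : Convex ℝ T) (hTU : T ⊆ C.U) {x x' y : Euc n} (hx : x ∈ T) (hx' : x' ∈ T)
    (hy : y ∈ C.V) (η : Euc n) : ‖C.B x' y η - C.B x y η‖ ≤ K * ‖x' - x‖ * ‖η‖ := by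
  refine inner_bound (by positivity) fun ξ => ?_
  rw [inner_sub_left, C.B_inner (hTU hx) hy, C.B_inner (hTU hx') hy]
  have h := hT.norm_image_sub_le_of_norm_hasFDerivWithin_le
    (f := fun x => -d2 C.f (x, y) (ξ, 0) (0, η))
    (f' := fun x => -((((fderiv ℝ (fderiv ℝ (fderiv ℝ C.f)) (x, y)).flip (ξ, 0)).flip
      (0, η)).comp (.inl ℝ (Euc n) (Euc n)))) (C := K * ‖ξ‖ * ‖η‖) ?_ ?_ hx hx'
  · rw [Real.norm_eq_abs] at h
    refine h.trans (le_of_eq (by ring))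
  · intro x hx
    refine HasFDerivAt.hasFDerivWithinAt (HasFDerivAt.neg ?_)
    have e0 : HasFDerivAt (fun x : Euc n => (x, y)) (.inl ℝ (Euc n) (Euc n)) x :=
      (hasFDerivAt_id x).prodMk (hasFDerivAt_const y x)
    exact HasFDerivAt.comp (g := fun z => d2 C.f z (ξ, 0) (0, η)) (f := fun x => (x, y)) x
      (C.sm.g3 (z := (x, y)) ⟨hTU hx, hy⟩ (ξ, 0) (0, η)) e0
  · intro x hx
    rw [norm_neg]
    refine ContinuousLinearMap.opNorm_le_bound _ (by positivity) fun v => ?_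
    have := hK (x, y) ⟨hTU hx, hy⟩ (v, 0) (ξ, 0) (0, η)
    rw [norm_inl, norm_inl, norm_inr] at this
    refine (le_of_eq ?_).trans (this.trans (le_of_eq (by ring)))
    rfl

/-- Uniform non-degeneracy of `B` on compact subsets of `U`. -/
lemma nd {X' : Set (Euc n)} (hX : IsCompact X') (hXU : X' ⊆ C.U) : ∃ L : ℝ, 1 ≤ L ∧
    ∀ x ∈ X', ∀ y ∈ C.V, ∀ η, ‖η‖ ≤ L * ‖C.B x y η‖ := by
  obtain ⟨K, hK1, hK⟩ := C.bounds
  refine hX.induction_on (p := fun s => ∃ L : ℝ, 1 ≤ L ∧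
    ∀ x ∈ s, ∀ y ∈ C.V, ∀ η, ‖η‖ ≤ L * ‖C.B x y η‖) ⟨1, le_rfl, by simp⟩ ?_ ?_ ?_
  · rintro s t hst ⟨L, hL, h⟩
    exact ⟨L, hL, fun x hx => h x (hst hx)⟩
  · rintro s t ⟨L, hL, h⟩ ⟨L', hL', h'⟩
    refine ⟨max L L', le_max_of_le_left hL, ?_⟩
    rintro x (hx | hx) y hy η
    · exact (h x hx y hy η).trans (by gcongr; exact le_max_left _ _)
    · exact (h' x hx y hy η).trans (by gcongr; exact le_max_right _ _)
  · intro x hx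
    obtain ⟨L, hL, h⟩ := C.lip0 (hXU hx)
    obtain ⟨r, hr, hrU⟩ := Metric.isOpen_iff.1 C.hU x (hXU hx)
    set ρ := min r (1 / (2 * L * K)) with hρ
    have hρ0 : 0 < ρ := by positivity
    refine ⟨ball x ρ, mem_nhdsWithin_of_mem_nhds (ball_mem_nhds x hρ0), 2 * L, by linarith, ?_⟩
    intro x' hx' y hy η
    have h1 := C.nd_of_lip (hXU hx) hy h η
    have h2 := C.B_lip hK1 (fun z hz => (hK z hz).2.2.1) (convex_ball x r) hrU (mem_ball_self hr)
      (ball_subset_ball (min_le_left _ _) hx') hy η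
    have h3 : ‖x' - x‖ ≤ 1 / (2 * L * K) := by
      rw [mem_ball, dist_eq_norm] at hx'
      exact hx'.le.trans (min_le_right _ _)
    have h4 : ‖C.B x y η‖ ≤ ‖C.B x' y η‖ + ‖C.B x' y η - C.B x y η‖ := by
      rw [← norm_neg (C.B x' y η - C.B x y η)]
      exact (norm_add_le _ _).trans' (by simp)
    have h5 : L * (K * ‖x' - x‖ * ‖η‖) ≤ ‖η‖ / 2 := by
      calc _ ≤ L * (K * (1 / (2 * L * K)) * ‖η‖) := by gcongr
        _ = _ := by field_simp
    have h6 : L * ‖C.B x y η‖ ≤ L * (‖C.B x' y η‖ + K * ‖x' - x‖ * ‖η‖) := by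
      gcongr; linarith
    linarith

lemma B_inj {x y : Euc n} (hx : x ∈ C.U) (hy : y ∈ C.V) : Function.Injective (C.B x y) := by
  obtain ⟨L, hL, h⟩ := C.lip0 hx
  rw [injective_iff_map_eq_zero]
  intro η hη
  have := C.nd_of_lip hx hy h η
  rw [hη] at this
  simpa using this

/-- `B` as an equivalence. -/
noncomputable def Beq {x y : Euc n} (hx : x ∈ C.U) (hy : y ∈ C.V) : Euc n ≃L[ℝ] Euc n :=
  (LinearEquiv.ofInjectiveEndo (C.B x y : Euc n →ₗ[ℝ] Euc n) (C.B_inj hx hy)).toContinuousLinearEquiv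

lemma Beq_coe {x y : Euc n} (hx : x ∈ C.U) (hy : y ∈ C.V) :
    (C.Beq hx hy : Euc n →L[ℝ] Euc n) = C.B x y := by
  ext v; rfl

lemma ups_local {x y : Euc n} (hx : x ∈ C.U) (hy : y ∈ C.V) :
    C.Vx x ∈ 𝓝 (C.p x y) ∧ ContDiffAt ℝ 3 (C.ups x) (C.p x y) := by
  have h1 : ContDiffAt ℝ 3 (C.p x) y := (C.px_smooth hx).contDiffAt (C.hV.mem_nhds hy)
  have h2 : HasFDerivAt (C.p x) (C.Beq hx hy : Euc n →L[ℝ] Euc n) y := by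
    rw [C.Beq_coe]; exact C.hasB hx hy
  have h3 := h1.to_localInverse h2 (by norm_num)
  have h4 : HasStrictFDerivAt (C.p x) (C.Beq hx hy : Euc n →L[ℝ] Euc n) y :=
    h1.hasStrictFDerivAt' h2 (by norm_num)
  have h5 := h4.eventually_right_inverse
  have h6 : ∀ᶠ p in 𝓝 (C.p x y), h4.localInverse _ _ _ p ∈ C.V := by
    refine h4.localInverse_continuousAt.eventually_mem (C.hV.mem_nhds ?_)
    rw [h4.localInverse_apply_image]; exact hy
  constructor
  · filter_upwards [h5, h6] with p hp hp'
    exact ⟨_, hp', hp⟩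
  · refine h3.congr_of_eventuallyEq ?_
    filter_upwards [h5, h6] with p hp hp'
    have := C.ups_p hx (subset_closure hp')
    rw [hp] at this
    exact this

lemma Vx_open {x : Euc n} (hx : x ∈ C.U) : IsOpen (C.Vx x) := by
  rw [isOpen_iff_mem_nhds]
  rintro _ ⟨y, hy, rfl⟩
  exact (C.ups_local hx hy).1

lemma ups_mem {x p : Euc n} (hx : x ∈ C.U) (hp : p ∈ C.Vx x) :
    C.ups x p ∈ C.V ∧ C.p x (C.ups x p) = p := by
  obtain ⟨y, hy, rfl⟩ := hp
  rw [C.ups_p hx (subset_closure hy)]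
  exact ⟨hy, rfl⟩

lemma ups_smooth {x p : Euc n} (hx : x ∈ C.U) (hp : p ∈ C.Vx x) : ContDiffAt ℝ 3 (C.ups x) p := by
  obtain ⟨y, hy, rfl⟩ := hp
  exact (C.ups_local hx hy).2

lemma ups_deriv {x p : Euc n} (hx : x ∈ C.U) (hp : p ∈ C.Vx x) (w : Euc n) :
    C.B x (C.ups x p) (fderiv ℝ (C.ups x) p w) = w := by
  have e1 := ((C.ups_smooth hx hp).differentiableAt (by norm_num)).hasFDerivAt
  have e2 := HasFDerivAt.comp (g := C.p x) (f := C.ups x) p (C.hasB hx (C.ups_mem hx hp).1) e1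
  have e3 : (C.p x ∘ C.ups x) =ᶠ[𝓝 p] id := by
    filter_upwards [(C.Vx_open hx).mem_nhds hp] with p' hp' using (C.ups_mem hx hp').2
  have e4 := (e2.congr_of_eventuallyEq e3.symm).unique (hasFDerivAt_id p)
  exact DFunLike.congr_fun e4 w

lemma lip_V {x : Euc n} {L : ℝ} (hL : 0 ≤ L) (hx : x ∈ C.U)
    (h : ∀ y ∈ C.V, ∀ η, ‖η‖ ≤ L * ‖C.B x y η‖) :
    ∀ y ∈ C.V, ∀ y' ∈ C.V, ‖y - y'‖ ≤ L * ‖C.p x y - C.p x y'‖ := by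
  intro y hy y' hy'
  have := (C.Vx_convex hx).norm_image_sub_le_of_norm_hasFDerivWithin_le (f := C.ups x)
    (f' := fderiv ℝ (C.ups x)) (C := L) ?_ ?_ (mem_image_of_mem _ hy') (mem_image_of_mem _ hy)
  · rwa [C.ups_p hx (subset_closure hy), C.ups_p hx (subset_closure hy')] at this
  · intro p hp
    exact ((C.ups_smooth hx hp).differentiableAt (by norm_num)).hasFDerivAt.hasFDerivWithinAt
  · rintro p hp
    refine ContinuousLinearMap.opNorm_le_bound _ hL fun w => ?_
    have e5 := h _ (C.ups_mem hx hp).1 (fderiv ℝ (C.ups x) p w)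
    rwa [C.ups_deriv hx hp] at e5

/-- Uniform inverse Lipschitz bound from non-degeneracy. -/
lemma lip_of_nd {x : Euc n} {L : ℝ} (hL : 0 ≤ L) (hx : x ∈ C.U)
    (h : ∀ y ∈ C.V, ∀ η, ‖η‖ ≤ L * ‖C.B x y η‖) :
    ∀ y ∈ closure C.V, ∀ y' ∈ closure C.V, ‖y - y'‖ ≤ L * ‖C.p x y - C.p x y'‖ := by
  intro y hy y' hy'
  obtain ⟨a, ha, hat⟩ := mem_closure_iff_seq_limit.1 hy
  obtain ⟨b, hb, hbt⟩ := mem_closure_iff_seq_limit.1 hy'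
  have h1 : Tendsto (fun k => C.p x (a k)) atTop (𝓝 (C.p x y)) :=
    (C.px_cont hx y hy).tendsto.comp (tendsto_nhdsWithin_iff.2
      ⟨hat, Eventually.of_forall fun k => subset_closure (ha k)⟩)
  have h2 : Tendsto (fun k => C.p x (b k)) atTop (𝓝 (C.p x y')) :=
    (C.px_cont hx y' hy').tendsto.comp (tendsto_nhdsWithin_iff.2
      ⟨hbt, Eventually.of_forall fun k => subset_closure (hb k)⟩)
  exact le_of_tendsto_of_tendsto' (hat.sub hbt).norm ((h1.sub h2).norm.const_mul L)
    fun k => C.lip_V hL hx h _ (ha k) _ (hb k)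

/-- `c`-segments as smooth curves. -/
lemma curve {x y0 : Euc n} (hx : x ∈ C.U) (hy0 : y0 ∈ C.V) (w : Euc n) :
    ∃ y dy ddy : ℝ → Euc n, y 0 = y0 ∧ IsOpen {t : ℝ | C.p x y0 + t • w ∈ C.Vx x} ∧
      ∀ t : ℝ, C.p x y0 + t • w ∈ C.Vx x → y t ∈ C.V ∧ C.p x (y t) = C.p x y0 + t • w ∧
      HasDerivAt y (dy t) t ∧ HasDerivAt dy (ddy t) t ∧
      (∀ ζ, d2 C.f (x, y t) (ζ, 0) (0, dy t) = -⟪w, ζ⟫) ∧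
      (∀ ζ, d2 C.f (x, y t) (ζ, 0) (0, ddy t) = -d3 C.f (x, y t) (ζ, 0) (0, dy t) (0, dy t)) := by
  set T : Set ℝ := {t : ℝ | C.p x y0 + t • w ∈ C.Vx x} with hT
  have hTo : IsOpen T := (C.Vx_open hx).preimage (by fun_prop)
  set y : ℝ → Euc n := fun t => C.ups x (C.p x y0 + t • w) with hy
  have hys : ∀ t ∈ T, ContDiffAt ℝ 3 y t := fun t ht => by
    have := C.ups_smooth hx ht
    exact this.comp t (by fun_prop)
  have hyc : ContDiffOn ℝ 3 y T := fun t ht => (hys t ht).contDiffWithinAt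
  have hdy : ContDiffOn ℝ 2 (deriv y) T := hyc.deriv_of_isOpen hTo (by norm_num)
  have h1 : ∀ t ∈ T, HasDerivAt y (deriv y t) t := fun t ht =>
    ((hys t ht).differentiableAt (by norm_num)).hasDerivAt
  have h2 : ∀ t ∈ T, HasDerivAt (deriv y) (deriv (deriv y) t) t := fun t ht =>
    ((hdy.contDiffAt (hTo.mem_nhds ht)).differentiableAt (by norm_num)).hasDerivAt
  have h0 : ∀ t ∈ T, y t ∈ C.V ∧ C.p x (y t) = C.p x y0 + t • w := fun t ht => C.ups_mem hx ht
  have hr1 : ∀ ζ, ∀ t ∈ T, d2 C.f (x, y t) (0, deriv y t) (ζ, 0) = -⟪w, ζ⟫ := by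
    intro ζ t ht
    have e1 := C.sm.k1 (γ := fun t => (x, y t)) (t := t) ⟨hx, (h0 t ht).1⟩
      ((hasDerivAt_const t x).prodMk (h1 t ht)) (hasDerivAt_const t ((ζ, 0) : Euc n × Euc n))
    have e2 : HasDerivAt (fun t : ℝ => -⟪C.p x y0 + t • w, ζ⟫) (-⟪w, ζ⟫) t := by
      have := (((hasDerivAt_id t).smul_const w).const_add (C.p x y0)).inner ℝ
        (hasDerivAt_const t ζ)
      have h' := HasDerivAt.fun_neg this
      simpa using h'
    have e3 : (fun t => d1 C.f (x, y t) (ζ, 0)) =ᶠ[𝓝 t] (fun t : ℝ => -⟪C.p x y0 + t • w, ζ⟫) := by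
      filter_upwards [hTo.mem_nhds ht] with s hs
      rw [← (h0 s hs).2, C.p_inner hx (h0 s hs).1, neg_neg]
    have := e1.unique (e2.congr_of_eventuallyEq e3)
    simpa [d1] using this
  have hr2 : ∀ ζ, ∀ t ∈ T, d2 C.f (x, y t) (0, deriv (deriv y) t) (ζ, 0) =
      -d3 C.f (x, y t) (0, deriv y t) (0, deriv y t) (ζ, 0) := by
    intro ζ t ht
    have e1 := C.sm.k2 (γ := fun t => (x, y t)) (t := t) ⟨hx, (h0 t ht).1⟩
      ((hasDerivAt_const t x).prodMk (h1 t ht))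
      ((hasDerivAt_const t (0 : Euc n)).prodMk (h2 t ht))
      (hasDerivAt_const t ((ζ, 0) : Euc n × Euc n))
    have e2 := hasDerivAt_const t (-⟪w, ζ⟫)
    have e3 : (fun t => d2 C.f (x, y t) (0, deriv y t) (ζ, 0)) =ᶠ[𝓝 t] (fun t : ℝ => -⟪w, ζ⟫) := by
      filter_upwards [hTo.mem_nhds ht] with s hs using hr1 ζ s hs
    have := e1.unique (e2.congr_of_eventuallyEq e3)
    have e4 : d2 C.f (x, y t) (0, deriv y t) 0 = 0 := by simp [d2]
    rw [e4] at this
    linarith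
  refine ⟨y, deriv y, deriv (deriv y), ?_, hTo, fun t ht => ⟨(h0 t ht).1, (h0 t ht).2, h1 t ht,
    h2 t ht, fun ζ => ?_, fun ζ => ?_⟩⟩
  · simp only [hy, zero_smul, add_zero]; exact C.ups_p hx (subset_closure hy0)
  · rw [C.sm.s2 ⟨hx, (h0 t ht).1⟩]; exact hr1 ζ t ht
  · have hz : (x, y t) ∈ C.W := ⟨hx, (h0 t ht).1⟩
    rw [C.sm.s2 hz, C.sm.s3a hz, C.sm.s3b hz]; exact hr2 ζ t ht

end Cost
end FKM

open Set MeasureTheory Metric Bornology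
open scoped ENNReal NNReal Pointwise

set_option linter.unusedVariables false
namespace FKM
open scoped RealInnerProductSpace
open Filter Topology

namespace Cost
variable {n : ℕ} (C : Cost n)

lemma fd1 {x y : Euc n} (hx : x ∈ C.U) (hy : y ∈ C.V) (v : Euc n × Euc n) :
    d1 C.flip.f (y, x) v = d1 C.f (x, y) (v.2, v.1) :=
  C.sm.l1 (W' := C.flip.W) (sw n) (z := (y, x)) ⟨hy, hx⟩ (fun z hz => ⟨hz.2, hz.1⟩) v

lemma fd2 {x y : Euc n} (hx : x ∈ C.U) (hy : y ∈ C.V) (v w : Euc n × Euc n) :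
    d2 C.flip.f (y, x) v w = d2 C.f (x, y) (v.2, v.1) (w.2, w.1) :=
  C.sm.l2 (W' := C.flip.W) (sw n) C.flip.sm (z := (y, x)) ⟨hy, hx⟩ (fun z hz => ⟨hz.2, hz.1⟩) v w

lemma fd3 {x y : Euc n} (hx : x ∈ C.U) (hy : y ∈ C.V) (v w a : Euc n × Euc n) :
    d3 C.flip.f (y, x) v w a = d3 C.f (x, y) (v.2, v.1) (w.2, w.1) (a.2, a.1) :=
  C.sm.l3 (W' := C.flip.W) (sw n) C.flip.sm (z := (y, x)) ⟨hy, hx⟩ (fun z hz => ⟨hz.2, hz.1⟩) v w a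

lemma eq_of_d2 {x y : Euc n} (hx : x ∈ C.U) (hy : y ∈ C.V) {η η' : Euc n}
    (h : ∀ ζ, d2 C.f (x, y) (ζ, 0) (0, η) = d2 C.f (x, y) (ζ, 0) (0, η')) : η = η' := by
  refine C.B_inj hx hy (ext_inner_right ℝ fun ζ => ?_)
  rw [C.B_inner hx hy, C.B_inner hx hy, h]

/-- `c`-segment with prescribed initial velocity, normalised to be defined on `[-1,1]`. -/
lemma curve' {x y0 : Euc n} (hx : x ∈ C.U) (hy0 : y0 ∈ C.V) (η b : Euc n)
    (hb : ∀ ζ, d2 C.f (x, y0) (ζ, 0) (0, b) = -d3 C.f (x, y0) (ζ, 0) (0, η) (0, η)) :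
    ∃ r0 : ℝ, 0 < r0 ∧ ∀ r : ℝ, 0 < r → r ≤ r0 → ∃ y dy ddy : ℝ → Euc n, y 0 = y0 ∧
      dy 0 = r • η ∧ ddy 0 = r ^ 2 • b ∧ (∃ g : Euc n, ∀ t ∈ Icc (-1:ℝ) 1, y t ∈ C.V ∧
        C.p x (y t) = C.p x y0 + t • g) ∧
      ∀ᶠ t in 𝓝 (0:ℝ), y t ∈ C.V ∧ HasDerivAt y (dy t) t ∧ HasDerivAt dy (ddy t) t := by
  obtain ⟨ρ, hρ, hball⟩ := Metric.isOpen_iff.1 (C.Vx_open hx) _ (mem_image_of_mem (C.p x) hy0)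
  refine ⟨ρ / (2 * (‖C.B x y0 η‖ + 1)), by positivity, fun r hr hr0 => ?_⟩
  obtain ⟨y, dy, ddy, h0, hTo, h⟩ := C.curve hx hy0 (r • C.B x y0 η)
  have hmem : ∀ t ∈ Icc (-1:ℝ) 1, C.p x y0 + t • r • C.B x y0 η ∈ C.Vx x := by
    intro t ht
    apply hball
    rw [mem_ball, dist_eq_norm, add_sub_cancel_left, norm_smul, norm_smul, Real.norm_eq_abs,
      Real.norm_eq_abs, abs_of_pos hr]
    have h1 : |t| ≤ 1 := abs_le.2 ht
    have h2 : r * (2 * (‖C.B x y0 η‖ + 1)) ≤ ρ := (le_div_iff₀ (by positivity)).1 hr0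
    have h3 : 0 ≤ r * ‖C.B x y0 η‖ := by positivity
    nlinarith
  have h00 := h 0 (hmem 0 (by simp))
  have e1 : dy 0 = r • η := by
    refine C.eq_of_d2 hx hy0 fun ζ => ?_
    have := h00.2.2.2.2.1 ζ
    rw [h0] at this
    rw [this, inner_smul_left, C.B_inner hx hy0, show ((0:Euc n), r • η) = r • ((0:Euc n), η) by simp,
      d2_smul2]
    simp
  refine ⟨y, dy, ddy, h0, e1, ?_, ⟨_, fun t ht => ⟨(h t (hmem t ht)).1, (h t (hmem t ht)).2.1⟩⟩, ?_⟩
  · refine C.eq_of_d2 hx hy0 fun ζ => ?_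
    have := h00.2.2.2.2.2 ζ
    rw [h0, e1, show ((0:Euc n), r • η) = r • ((0:Euc n), η) by simp, d3_smul2, d3_smul3] at this
    rw [this, show ((0:Euc n), r ^ 2 • b) = r ^ 2 • ((0:Euc n), b) by simp, d2_smul2, hb]
    ring
  · filter_upwards [hTo.mem_nhds (hmem 0 (by simp))] with t ht
    exact ⟨(h t ht).1, (h t ht).2.2.1, (h t ht).2.2.2.1⟩

lemma cross2 {x y dx dy : ℝ → Euc n} (hx : ∀ᶠ s in 𝓝 (0:ℝ), x s ∈ C.U) (hx0 : x 0 ∈ C.U)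
    (hy0 : y 0 ∈ C.V) (hdx : HasDerivAt x (dx 0) 0) (hdy : HasDerivAt y (dy 0) 0) :
    crossDiff2 n C.c x y = d2 C.f (x 0, y 0) (dx 0, 0) (0, dy 0) := by
  have h1 : (fun s => deriv (fun t => C.c (x s) (y t)) 0) =ᶠ[𝓝 0]
      fun s => d1 C.f (x s, y 0) (0, dy 0) := by
    filter_upwards [hx] with s hs
    exact (C.sm.k0 (γ := fun t => (x s, y t)) (t := 0) ⟨hs, hy0⟩
      ((hasDerivAt_const _ _).prodMk hdy)).deriv
  rw [crossDiff2, h1.deriv_eq]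
  have := (C.sm.k1 (γ := fun s => (x s, y 0)) (t := 0) ⟨hx0, hy0⟩
      (hdx.prodMk (hasDerivAt_const _ _)) (hasDerivAt_const _ ((0, dy 0) : Euc n × Euc n))).deriv
  rw [this]
  simp [d1]

lemma cross4 {x y dx dy ddx ddy : ℝ → Euc n}
    (hx : ∀ᶠ s in 𝓝 (0:ℝ), x s ∈ C.U ∧ HasDerivAt x (dx s) s ∧ HasDerivAt dx (ddx s) s)
    (hy : ∀ᶠ s in 𝓝 (0:ℝ), y s ∈ C.V ∧ HasDerivAt y (dy s) s ∧ HasDerivAt dy (ddy s) s) :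
    crossDiff4 n C.c x y = d4 C.f (x 0, y 0) (dx 0, 0) (dx 0, 0) (0, dy 0) (0, dy 0)
      + d3 C.f (x 0, y 0) (ddx 0, 0) (0, dy 0) (0, dy 0)
      + d3 C.f (x 0, y 0) (dx 0, 0) (dx 0, 0) (0, ddy 0)
      + d2 C.f (x 0, y 0) (ddx 0, 0) (0, ddy 0) := by
  have hy0 := hy.self_of_nhds
  have hx0 := hx.self_of_nhds
  have h1 : ∀ᶠ s in 𝓝 (0:ℝ), deriv (deriv (fun t => C.c (x s) (y t))) 0 =
      d2 C.f (x s, y 0) (0, dy 0) (0, dy 0) + d1 C.f (x s, y 0) (0, ddy 0) := by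
    filter_upwards [hx] with s hs
    have h2 : deriv (fun t => C.c (x s) (y t)) =ᶠ[𝓝 0] fun t => d1 C.f (x s, y t) (0, dy t) := by
      filter_upwards [hy] with t ht
      exact (C.sm.k0 (γ := fun t => (x s, y t)) (t := t) ⟨hs.1, ht.1⟩
        ((hasDerivAt_const _ _).prodMk ht.2.1)).deriv
    rw [h2.deriv_eq]
    exact (C.sm.k1 (γ := fun t => (x s, y t)) (t := 0) ⟨hs.1, hy0.1⟩
      ((hasDerivAt_const _ _).prodMk hy0.2.1) ((hasDerivAt_const _ _).prodMk hy0.2.2)).deriv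
  have h3 : deriv (fun s => deriv (deriv (fun t => C.c (x s) (y t))) 0) =ᶠ[𝓝 0]
      fun s => d3 C.f (x s, y 0) (dx s, 0) (0, dy 0) (0, dy 0) +
        d2 C.f (x s, y 0) (dx s, 0) (0, ddy 0) := by
    filter_upwards [h1.eventually_nhds, hx] with s hs hxs
    rw [EventuallyEq.deriv_eq hs]
    have e1 := C.sm.k2 (γ := fun s => (x s, y 0)) (t := s) ⟨hxs.1, hy0.1⟩
      (hxs.2.1.prodMk (hasDerivAt_const _ _)) (hasDerivAt_const _ ((0, dy 0) : Euc n × Euc n))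
      (hasDerivAt_const _ ((0, dy 0) : Euc n × Euc n))
    have e2 := C.sm.k1 (γ := fun s => (x s, y 0)) (t := s) ⟨hxs.1, hy0.1⟩
      (hxs.2.1.prodMk (hasDerivAt_const _ _)) (hasDerivAt_const _ ((0, ddy 0) : Euc n × Euc n))
    rw [(e1.fun_add e2).deriv]
    simp [d1, d2]
  rw [crossDiff4, h3.deriv_eq]
  have e1 := C.sm.k3 (γ := fun s => (x s, y 0)) (t := 0) ⟨hx0.1, hy0.1⟩
    (hx0.2.1.prodMk (hasDerivAt_const _ _)) (hx0.2.2.prodMk (hasDerivAt_const _ (0 : Euc n)))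
    (hasDerivAt_const _ ((0, dy 0) : Euc n × Euc n)) (hasDerivAt_const _ ((0, dy 0) : Euc n × Euc n))
  have e2 := C.sm.k2 (γ := fun s => (x s, y 0)) (t := 0) ⟨hx0.1, hy0.1⟩
    (hx0.2.1.prodMk (hasDerivAt_const _ _)) (hx0.2.2.prodMk (hasDerivAt_const _ (0 : Euc n)))
    (hasDerivAt_const _ ((0, ddy 0) : Euc n × Euc n))
  rw [(e1.fun_add e2).deriv]
  have z3 : ∀ v w : Euc n × Euc n, d3 C.f (x 0, y 0) v w 0 = 0 := fun v w => by simp [d3]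
  have z3' : ∀ v w : Euc n × Euc n, d3 C.f (x 0, y 0) v 0 w = 0 := fun v w => by simp [d3]
  have z2 : ∀ v : Euc n × Euc n, d2 C.f (x 0, y 0) v 0 = 0 := fun v => by simp [d2]
  rw [z3, z3', z2]
  ring

theorem MTW_of_B3 (h : B3cond n C.c C.U C.V) : C.MTW := by
  intro x hx y hy ξ η a b h0 ha hb
  have hz : (x, y) ∈ C.W := ⟨hx, hy⟩
  obtain ⟨r1, hr1, H1⟩ := C.curve' hx hy η b hb
  have ha' : ∀ ζ, d2 C.flip.f (y, x) (ζ, 0) (0, a) = -d3 C.flip.f (y, x) (ζ, 0) (0, ξ) (0, ξ) := by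
    intro ζ
    rw [C.fd2 hx hy, C.fd3 hx hy, C.sm.s2 hz, C.sm.s3a hz, C.sm.s3b hz]
    exact ha ζ
  obtain ⟨r2, hr2, H2⟩ := C.flip.curve' hy hx ξ a ha'
  set r := min r1 r2 with hr
  have hr0 : 0 < r := lt_min hr1 hr2
  obtain ⟨Y, dY, ddY, hY0, hdY, hddY, ⟨g, hg⟩, hYe⟩ := H1 r hr0 (min_le_left _ _)
  obtain ⟨X, dX, ddX, hX0, hdX, hddX, ⟨k, hk⟩, hXe⟩ := H2 r hr0 (min_le_right _ _)
  have hseg : IsAffineSeg n (fun t => (gradY n C.c (X t) (Y 0), gradX n C.c (X 0) (Y t))) := by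
    refine ⟨(-C.flip.p y x, -C.p x y), (-k, -g), fun t ht => ?_⟩
    have e1 := (hg t ht).2
    have e2 := (hk t ht).2
    rw [hX0, hY0]
    refine Prod.ext ?_ ?_
    · have : gradY n C.c (X t) y = -C.flip.p y (X t) := (neg_neg _).symm
      change gradY n C.c (X t) y = -C.flip.p y x + t • -k
      rw [this, e2, neg_add, smul_neg]
    · have : gradX n C.c x (Y t) = -C.p x (Y t) := (neg_neg _).symm
      change gradX n C.c x (Y t) = -C.p x y + t • -g
      rw [this, e1, neg_add, smul_neg]
  have hXe' : ∀ᶠ s in 𝓝 (0:ℝ), X s ∈ C.U ∧ HasDerivAt X (dX s) s ∧ HasDerivAt dX (ddX s) s := hXe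
  have k0 := hXe'.self_of_nhds
  have k1 := hYe.self_of_nhds
  have k2 := C.cross2 (hXe'.mono fun s hs => hs.1) k0.1 k1.1 k0.2.1 k1.2.1
  have k4 := C.cross4 hXe' hYe
  have z1 : ∀ (r : ℝ) (v : Euc n), ((r • v, 0) : Euc n × Euc n) = r • (v, 0) := fun r v => by simp
  have z2 : ∀ (r : ℝ) (v : Euc n), ((0, r • v) : Euc n × Euc n) = r • (0, v) := fun r v => by simp
  rw [hdX, hdY, hX0, hY0, z1, z2, d2_smul1, d2_smul2, h0] at k2
  have := h X Y (fun t ht => subset_closure (hk t ht).1) (fun t ht => subset_closure (hg t ht).1)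
    hseg (by rw [k2]; ring)
  rw [k4, hX0, hY0, hdX, hdY, hddX, hddY] at this
  simp only [z1, z2, d2_smul1, d2_smul2, d3_smul1, d3_smul2, d3_smul3, d4_smul1, d4_smul2,
    d4_smul3, d4_smul4] at this
  have q1 := ha b
  have q2 := hb a
  have : r ^ 4 * (d4 C.f (x, y) (ξ, 0) (ξ, 0) (0, η) (0, η) - d2 C.f (x, y) (a, 0) (0, b)) ≤ 0 := by
    rw [show d3 C.f (x, y) (ξ, 0) (ξ, 0) (0, b) = -d2 C.f (x, y) (a, 0) (0, b) by linarith,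
      show d3 C.f (x, y) (a, 0) (0, η) (0, η) = -d2 C.f (x, y) (a, 0) (0, b) by linarith] at this
    refine le_trans (le_of_eq ?_) this
    ring
  have hp : 0 < r ^ 4 := by positivity
  nlinarith [nonpos_of_mul_nonpos_right this hp]

end Cost
end FKM

open Set MeasureTheory Metric Bornology
open scoped ENNReal NNReal Pointwise

set_option linter.unusedVariables false
namespace FKM
open scoped RealInnerProductSpace
open Filter Topology

lemma second_order {ψ ψ' ψ'' : ℝ → ℝ} {m : ℝ} (hm : 0 ≤ m)
    (h1 : ∀ t ∈ Icc (0:ℝ) 1, HasDerivAt ψ (ψ' t) t)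
    (h2 : ∀ t ∈ Icc (0:ℝ) 1, HasDerivAt ψ' (ψ'' t) t) (h0 : ψ 0 = 0) (h0' : ψ' 0 = 0)
    (h : ∀ t ∈ Icc (0:ℝ) 1, -m ≤ ψ'' t) : -m ≤ ψ 1 := by
  obtain ⟨c, hc, e1⟩ := exists_hasDerivAt_eq_slope ψ ψ' zero_lt_one
    (fun s hs => (h1 s hs).continuousAt.continuousWithinAt)
    (fun s hs => h1 s (Ioo_subset_Icc_self hs))
  obtain ⟨d, hd, e2⟩ := exists_hasDerivAt_eq_slope ψ' ψ'' hc.1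
    (fun s hs => (h2 s ⟨hs.1, hs.2.trans hc.2.le⟩).continuousAt.continuousWithinAt)
    (fun s hs => h2 s ⟨hs.1.le, hs.2.le.trans hc.2.le⟩)
  have h3 := h d ⟨hd.1.le, hd.2.le.trans hc.2.le⟩
  have e3 : ψ' c = ψ'' d * c := by
    rw [e2, h0', sub_zero, sub_zero]; have := hc.1.ne'; field_simp
  have e4 : ψ 1 = ψ' c := by rw [e1, h0]; simp
  rw [e4, e3]
  nlinarith [hc.1, hc.2]

lemma ode {g g' : ℝ → ℝ} {K : ℝ} (hK : 0 < K) {a b : ℝ} (hab : a ≤ b)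
    (h1 : ∀ t ∈ Icc a b, HasDerivAt g (g' t) t) (h : ∀ t ∈ Icc a b, -K * |g t| ≤ g' t)
    (h0 : 0 < g a) : Real.exp (-(2 * K * (b - a))) * g a ≤ g b := by
  have := image_le_of_deriv_right_lt_deriv_boundary' (f := fun t => -g t) (f' := fun t => -g' t)
    (a := a) (b := b) (B := fun t => -(Real.exp (-(2 * K * (t - a))) * g a))
    (B' := fun t => -(Real.exp (-(2 * K * (t - a))) * (-(2 * K)) * g a))
    (fun t ht => (h1 t ht).continuousAt.continuousWithinAt.neg)
    (fun t ht => (h1 t ⟨ht.1, ht.2.le⟩).fun_neg.hasDerivWithinAt) (by simp) (by fun_prop)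
    (fun t ht => ?_) (fun t ht he => ?_) (right_mem_Icc.2 hab)
  · simpa using this
  · refine HasDerivAt.hasDerivWithinAt ?_
    refine HasDerivAt.fun_neg (HasDerivAt.mul_const (HasDerivAt.exp ?_) _)
    have := (((hasDerivAt_id t).sub_const a).const_mul (2 * K)).fun_neg
    simpa using this
  · have h2 := h t ⟨ht.1, ht.2.le⟩
    have h3 : g t = Real.exp (-(2 * K * (t - a))) * g a := neg_inj.1 he
    have h4 : 0 < g t := by rw [h3]; positivity
    rw [abs_of_pos h4] at h2
    have : -(Real.exp (-(2 * K * (t - a))) * (-(2 * K)) * g a) = 2 * K * g t := by rw [h3]; ring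
    rw [this]
    nlinarith

namespace Cost
variable {n : ℕ} (C : Cost n)

lemma exists_acc {x y : Euc n} (hx : x ∈ C.U) (hy : y ∈ C.V) (l : Euc n →L[ℝ] ℝ) :
    ∃ a, ∀ ζ, d2 C.f (x, y) (a, 0) (0, ζ) = l ζ := by
  have h1 : Function.Surjective (C.flip.B y x) := (C.flip.Beq hy hx).surjective
  obtain ⟨a, ha⟩ := h1 (-(InnerProductSpace.toDual ℝ (Euc n)).symm l)
  refine ⟨a, fun ζ => ?_⟩
  have := C.flip.B_inner hy hx a ζ
  rw [ha, inner_neg_left, InnerProductSpace.toDual_symm_apply, C.fd2 hx hy] at this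
  rw [C.sm.s2 ⟨hx, hy⟩]
  simp only at this
  linarith

/-- quantitative cross-curvature inequality. -/
lemma T_bound {K L : ℝ} (hK1 : 1 ≤ K) (hL1 : 1 ≤ L) (hM : C.MTW) {x y : Euc n} (hx : x ∈ C.U)
    (hy : y ∈ C.V)
    (hK3 : ∀ v w a, |d3 C.f (x, y) v w a| ≤ K * ‖v‖ * ‖w‖ * ‖a‖)
    (hK4 : ∀ v w a b, |d4 C.f (x, y) v w a b| ≤ K * ‖v‖ * ‖w‖ * ‖a‖ * ‖b‖)
    (hL : ∀ η, ‖η‖ ≤ L * ‖C.B x y η‖) {P η b : Euc n}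
    (hη : ∀ ζ, d2 C.f (x, y) (ζ, 0) (0, η) = -⟪P, ζ⟫)
    (hb : ∀ ζ, d2 C.f (x, y) (ζ, 0) (0, b) = -d3 C.f (x, y) (ζ, 0) (0, η) (0, η)) (ξ : Euc n) :
    d4 C.f (x, y) (0, η) (0, η) (ξ, 0) (ξ, 0) + d3 C.f (x, y) (0, b) (ξ, 0) (ξ, 0) ≤
      4 * K ^ 2 * L ^ 3 * ‖P‖ * ‖ξ‖ * |⟪P, ξ⟫| := by
  have hz : (x, y) ∈ C.W := ⟨hx, hy⟩
  have hBη : C.B x y η = P := ext_inner_right ℝ fun ζ => by rw [C.B_inner hx hy, hη, neg_neg]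
  have nη : ‖η‖ ≤ L * ‖P‖ := by rw [← hBη]; exact hL η
  have nb : ‖b‖ ≤ L * (K * ‖η‖ * ‖η‖) := by
    refine (hL b).trans ?_
    gcongr
    refine inner_bound (by positivity) fun ζ => ?_
    rw [C.B_inner hx hy, hb, neg_neg]
    refine (hK3 _ _ _).trans (le_of_eq ?_)
    rw [norm_inl, norm_inr]; ring
  set T : Euc n → Euc n → ℝ := fun v w => d4 C.f (x, y) (0, η) (0, η) (v, 0) (w, 0) +
    d3 C.f (x, y) (0, b) (v, 0) (w, 0) with hT
  have Tb : ∀ v w, |T v w| ≤ 2 * K ^ 2 * L ^ 3 * ‖P‖ ^ 2 * ‖v‖ * ‖w‖ := by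
    intro v w
    have e1 := hK4 (0, η) (0, η) (v, 0) (w, 0)
    have e2 := hK3 (0, b) (v, 0) (w, 0)
    simp only [norm_inl, norm_inr] at e1 e2
    have n2 : ‖η‖ * ‖η‖ ≤ L ^ 2 * ‖P‖ ^ 2 := by
      calc _ ≤ (L * ‖P‖) * (L * ‖P‖) := by gcongr
        _ = _ := by ring
    have nb' : ‖b‖ ≤ K * L ^ 3 * ‖P‖ ^ 2 := by
      calc _ ≤ L * (K * (‖η‖ * ‖η‖)) := by rw [← mul_assoc K]; exact nb
        _ ≤ L * (K * (L ^ 2 * ‖P‖ ^ 2)) := by gcongr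
        _ = _ := by ring
    have hKK : K ≤ K ^ 2 := by nlinarith
    have hLL : L ^ 2 ≤ L ^ 3 := pow_le_pow_right₀ hL1 (by norm_num)
    calc |T v w| ≤ K * ‖η‖ * ‖η‖ * ‖v‖ * ‖w‖ + K * ‖b‖ * ‖v‖ * ‖w‖ :=
          (abs_add_le _ _).trans (add_le_add e1 e2)
      _ = K * (‖η‖ * ‖η‖) * ‖v‖ * ‖w‖ + K * ‖b‖ * ‖v‖ * ‖w‖ := by ring
      _ ≤ K ^ 2 * (L ^ 3 * ‖P‖ ^ 2) * ‖v‖ * ‖w‖ + K * (K * L ^ 3 * ‖P‖ ^ 2) * ‖v‖ * ‖w‖ := by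
          have n3 : ‖η‖ * ‖η‖ ≤ L ^ 3 * ‖P‖ ^ 2 := n2.trans (by gcongr)
          have n4 : K * (‖η‖ * ‖η‖) ≤ K ^ 2 * (L ^ 3 * ‖P‖ ^ 2) :=
            mul_le_mul hKK n3 (by positivity) (by positivity)
          gcongr
      _ = _ := by ring
  have Tadd1 : ∀ v v' w, T (v + v') w = T v w + T v' w := by
    intro v v' w
    have : ((v + v', 0) : Euc n × Euc n) = (v, 0) + (v', 0) := by simp
    simp only [hT, this, d3_add2]
    have : d4 C.f (x, y) (0, η) (0, η) ((v, 0) + (v', 0)) (w, 0) =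
      d4 C.f (x, y) (0, η) (0, η) (v, 0) (w, 0) + d4 C.f (x, y) (0, η) (0, η) (v', 0) (w, 0) := by
      simp only [d4, map_add, _root_.add_apply]
    rw [this]; ring
  have Tadd2 : ∀ v v' w, T w (v + v') = T w v + T w v' := by
    intro v v' w
    have : ((v + v', 0) : Euc n × Euc n) = (v, 0) + (v', 0) := by simp
    simp only [hT, this, d3_add3]
    have : d4 C.f (x, y) (0, η) (0, η) (w, 0) ((v, 0) + (v', 0)) =
      d4 C.f (x, y) (0, η) (0, η) (w, 0) (v, 0) + d4 C.f (x, y) (0, η) (0, η) (w, 0) (v', 0) := by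
      simp only [d4, map_add]
    rw [this]; ring
  have Tperp : ∀ ξ0, ⟪P, ξ0⟫ = 0 → T ξ0 ξ0 ≤ 0 := by
    intro ξ0 h0
    obtain ⟨a, ha⟩ := C.exists_acc hx hy
      (-((fderiv ℝ (fderiv ℝ (fderiv ℝ C.f)) (x, y) (ξ0, 0) (ξ0, 0)).comp
        (.inr ℝ (Euc n) (Euc n))))
    have h1 := hM x hx y hy ξ0 η a b (by rw [hη, h0, neg_zero]) (fun ζ => ha ζ) hb
    have h2 : d2 C.f (x, y) (a, 0) (0, b) = -d3 C.f (x, y) (ξ0, 0) (ξ0, 0) (0, b) := ha b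
    have h3 : d3 C.f (x, y) (0, b) (ξ0, 0) (ξ0, 0) = d3 C.f (x, y) (ξ0, 0) (ξ0, 0) (0, b) := by
      rw [C.sm.s3a hz, C.sm.s3b hz]
    have h4 : d4 C.f (x, y) (0, η) (0, η) (ξ0, 0) (ξ0, 0) =
        d4 C.f (x, y) (ξ0, 0) (ξ0, 0) (0, η) (0, η) := by
      rw [C.sm.s4b hz, C.sm.s4a hz, C.sm.s4c hz, C.sm.s4b hz]
    simp only [hT, h3, h4]
    linarith
  change T ξ ξ ≤ _
  by_cases hP : P = 0
  · have := Tb ξ ξ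
    rw [hP] at this ⊢
    simp only [norm_zero] at this ⊢
    have h2 := le_abs_self (T ξ ξ)
    nlinarith
  have hPn : 0 < ‖P‖ := norm_pos_iff.2 hP
  set lam := ⟪P, ξ⟫ / ‖P‖ ^ 2 with hlam
  set ξ0 := ξ - lam • P with hξ0
  have hperp : ⟪P, ξ0⟫ = 0 := by
    rw [hξ0, inner_sub_right, inner_smul_right, real_inner_self_eq_norm_sq, hlam]
    field_simp; simp
  have hξ : ξ = ξ0 + lam • P := by rw [hξ0]; simp
  have nξ0 : ‖ξ0‖ ≤ ‖ξ‖ := by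
    have : ‖ξ‖ ^ 2 = ‖ξ0‖ ^ 2 + ‖lam • P‖ ^ 2 := by
      conv_lhs => rw [hξ]
      rw [norm_add_sq_real, inner_smul_right, real_inner_comm, hperp]
      ring
    nlinarith [norm_nonneg ξ, norm_nonneg ξ0, sq_nonneg ‖lam • P‖]
  have e1 : T ξ ξ = T ξ0 ξ0 + T ξ0 (lam • P) + T (lam • P) ξ := by
    calc T ξ ξ = T (ξ0 + lam • P) ξ := by rw [← hξ]
      _ = T ξ0 ξ + T (lam • P) ξ := Tadd1 _ _ _
      _ = T ξ0 (ξ0 + lam • P) + T (lam • P) ξ := by rw [← hξ]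
      _ = _ := by rw [Tadd2]
  have e2 := Tperp ξ0 hperp
  have e3 := (le_abs_self _).trans (Tb ξ0 (lam • P))
  have e4 := (le_abs_self _).trans (Tb (lam • P) ξ)
  have nl : ‖lam • P‖ = |⟪P, ξ⟫| / ‖P‖ := by
    rw [norm_smul, hlam, norm_div, Real.norm_eq_abs, norm_pow, norm_norm]
    field_simp
  rw [nl] at e3 e4
  have e5 : 2 * K ^ 2 * L ^ 3 * ‖P‖ ^ 2 * ‖ξ0‖ * (|⟪P, ξ⟫| / ‖P‖) ≤
      2 * K ^ 2 * L ^ 3 * ‖P‖ ^ 2 * ‖ξ‖ * (|⟪P, ξ⟫| / ‖P‖) := by gcongr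
  have e6 : 2 * K ^ 2 * L ^ 3 * ‖P‖ ^ 2 * ‖ξ‖ * (|⟪P, ξ⟫| / ‖P‖) =
    2 * K ^ 2 * L ^ 3 * ‖P‖ * ‖ξ‖ * |⟪P, ξ⟫| := by field_simp
  have e7 : 2 * K ^ 2 * L ^ 3 * ‖P‖ ^ 2 * (|⟪P, ξ⟫| / ‖P‖) * ‖ξ‖ =
    2 * K ^ 2 * L ^ 3 * ‖P‖ * ‖ξ‖ * |⟪P, ξ⟫| := by field_simp
  linarith

/-- pointwise second derivative inequality. -/
lemma pw {K L : ℝ} (hK1 : 1 ≤ K) (hL1 : 1 ≤ L) (hM : C.MTW) {x : Euc n} (hx : x ∈ C.U)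
    (hK3 : ∀ y ∈ C.V, ∀ v w a, |d3 C.f (x, y) v w a| ≤ K * ‖v‖ * ‖w‖ * ‖a‖)
    (hK4 : ∀ y ∈ C.V, ∀ v w a b, |d4 C.f (x, y) v w a b| ≤ K * ‖v‖ * ‖w‖ * ‖a‖ * ‖b‖)
    (hL : ∀ y ∈ C.V, ∀ η, ‖η‖ ≤ L * ‖C.B x y η‖) {yb y ξ a : Euc n} (hyb : yb ∈ C.V) (hy : y ∈ C.V)
    (ha : ∀ ζ, d2 C.f (x, yb) (a, 0) (0, ζ) = -d3 C.f (x, yb) (ξ, 0) (ξ, 0) (0, ζ)) :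
    -(4 * K ^ 2 * L ^ 3 * ‖C.p x y - C.p x yb‖ * ‖ξ‖ * |⟪C.p x y - C.p x yb, ξ⟫|) ≤
      -d2 C.f (x, y) (ξ, 0) (ξ, 0) + d2 C.f (x, yb) (ξ, 0) (ξ, 0) + ⟪C.p x y - C.p x yb, a⟫ := by
  set P := C.p x y - C.p x yb with hP
  obtain ⟨Y, dY, ddY, h0, hTo, h⟩ := C.curve hx hyb P
  have hmem : ∀ t ∈ Icc (0:ℝ) 1, C.p x yb + t • P ∈ C.Vx x := fun t ht =>
    (C.Vx_convex hx).add_smul_sub_mem (mem_image_of_mem _ hyb) (mem_image_of_mem _ hy) ht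
  have hY1 : Y 1 = y := by
    obtain ⟨h1, h2, -⟩ := h 1 (hmem 1 (by simp))
    refine C.px_inj hx (subset_closure h1) (subset_closure hy) ?_
    rw [h2, hP]; simp
  have h00 := h 0 (hmem 0 (by simp))
  have := second_order (ψ := fun t => -d2 C.f (x, Y t) (ξ, 0) (ξ, 0) +
      d2 C.f (x, yb) (ξ, 0) (ξ, 0) + t * ⟪P, a⟫)
    (ψ' := fun t => -d3 C.f (x, Y t) (0, dY t) (ξ, 0) (ξ, 0) + ⟪P, a⟫)
    (ψ'' := fun t => -(d4 C.f (x, Y t) (0, dY t) (0, dY t) (ξ, 0) (ξ, 0) +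
      d3 C.f (x, Y t) (0, ddY t) (ξ, 0) (ξ, 0)))
    (m := 4 * K ^ 2 * L ^ 3 * ‖P‖ * ‖ξ‖ * |⟪P, ξ⟫|) (by positivity) ?_ ?_ ?_ ?_ ?_
  · simpa [hY1] using this
  · intro t ht
    obtain ⟨k1, k2, k3, k4, k5, k6⟩ := h t (hmem t ht)
    have e1 := C.sm.k2 (γ := fun t => (x, Y t)) (t := t) ⟨hx, k1⟩
      ((hasDerivAt_const _ _).prodMk k3) (hasDerivAt_const t ((ξ, 0) : Euc n × Euc n))
      (hasDerivAt_const t ((ξ, 0) : Euc n × Euc n))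
    have e2 := ((e1.fun_neg).add_const (d2 C.f (x, yb) (ξ, 0) (ξ, 0))).fun_add
      ((hasDerivAt_id t).mul_const ⟪P, a⟫)
    refine e2.congr_deriv ?_
    simp [d2]
  · intro t ht
    obtain ⟨k1, k2, k3, k4, k5, k6⟩ := h t (hmem t ht)
    have e1 := C.sm.k3 (γ := fun t => (x, Y t)) (t := t) ⟨hx, k1⟩
      ((hasDerivAt_const _ _).prodMk k3) ((hasDerivAt_const _ (0 : Euc n)).prodMk k4)
      (hasDerivAt_const t ((ξ, 0) : Euc n × Euc n)) (hasDerivAt_const t ((ξ, 0) : Euc n × Euc n))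
    refine ((e1.fun_neg).add_const ⟪P, a⟫).congr_deriv ?_
    simp [d3]
  · simp [h0]
  · have e1 := ha (dY 0)
    have e2 := h00.2.2.2.2.1 a
    have hz : (x, yb) ∈ C.W := ⟨hx, hyb⟩
    rw [h0] at e2
    simp only [h0]
    rw [C.sm.s3a hz, C.sm.s3b hz]
    linarith
  · intro t ht
    obtain ⟨k1, k2, k3, k4, k5, k6⟩ := h t (hmem t ht)
    exact neg_le_neg (C.T_bound hK1 hL1 hM hx k1 (hK3 _ k1) (hK4 _ k1) (hL _ k1) k5 k6 ξ)

end Cost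
end FKM

open Set MeasureTheory Metric Bornology
open scoped ENNReal NNReal Pointwise

set_option linter.unusedVariables false
namespace FKM
open scoped RealInnerProductSpace
open Filter Topology

namespace Cost
variable {n : ℕ} (C : Cost n)

/-- inverse of the cost exponential coordinates. -/
noncomputable def chi (yb : Euc n) : Euc n → Euc n := C.flip.ups yb
/-- domain of the cost exponential coordinates. -/
def Ub (yb : Euc n) : Set (Euc n) := C.flip.Vx yb
/-- modified cost. -/
noncomputable def bb (yb q y : Euc n) : ℝ := -C.c (C.chi yb q) y + C.c (C.chi yb q) yb
/-- gradient of the modified cost. -/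
noncomputable def PP (yb q y : Euc n) : Euc n :=
  ContinuousLinearMap.adjoint (fderiv ℝ (C.chi yb) q) (C.p (C.chi yb q) y - C.p (C.chi yb q) yb)

variable {C}
lemma Ub_open {yb : Euc n} (hyb : yb ∈ C.V) : IsOpen (C.Ub yb) := C.flip.Vx_open hyb
lemma Ub_convex {yb : Euc n} (hyb : yb ∈ C.V) : Convex ℝ (C.Ub yb) := C.flip.Vx_convex hyb
lemma chi_mem {yb q : Euc n} (hyb : yb ∈ C.V) (hq : q ∈ C.Ub yb) : C.chi yb q ∈ C.U :=
  (C.flip.ups_mem hyb hq).1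
lemma p_chi {yb q : Euc n} (hyb : yb ∈ C.V) (hq : q ∈ C.Ub yb) : C.flip.p yb (C.chi yb q) = q :=
  (C.flip.ups_mem hyb hq).2
lemma chi_p {yb x : Euc n} (hyb : yb ∈ C.V) (hx : x ∈ closure C.U) :
    C.chi yb (C.flip.p yb x) = x := C.flip.ups_p hyb hx
lemma chi_smooth {yb : Euc n} (hyb : yb ∈ C.V) : ContDiffOn ℝ 3 (C.chi yb) (C.Ub yb) :=
  fun q hq => (C.flip.ups_smooth hyb hq).contDiffWithinAt
lemma chi_cont {yb : Euc n} (hyb : yb ∈ C.V) : ContinuousOn (C.chi yb) (C.Ub yb) :=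
  (C.chi_smooth hyb).continuousOn
lemma chi_deriv {yb q : Euc n} (hyb : yb ∈ C.V) (hq : q ∈ C.Ub yb) :
    HasFDerivAt (C.chi yb) (fderiv ℝ (C.chi yb) q) q :=
  ((C.flip.ups_smooth hyb hq).differentiableAt (by norm_num)).hasFDerivAt
lemma dchi_cont {yb : Euc n} (hyb : yb ∈ C.V) : ContinuousOn (fderiv ℝ (C.chi yb)) (C.Ub yb) :=
  (C.chi_smooth hyb).continuousOn_fderiv_of_isOpen (Ub_open hyb) (by norm_num)
lemma B_dchi {yb q : Euc n} (hyb : yb ∈ C.V) (hq : q ∈ C.Ub yb) (w : Euc n) :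
    C.flip.B yb (C.chi yb q) (fderiv ℝ (C.chi yb) q w) = w := C.flip.ups_deriv hyb hq w
lemma PP_inner (yb q y w : Euc n) : ⟪C.PP yb q y, w⟫ =
    ⟪C.p (C.chi yb q) y - C.p (C.chi yb q) yb, fderiv ℝ (C.chi yb) q w⟫ := by
  rw [PP, ContinuousLinearMap.adjoint_inner_left]

lemma bb_grad {yb q y : Euc n} (hyb : yb ∈ C.V) (hq : q ∈ C.Ub yb) (hy : y ∈ closure C.V) :
    HasGradientAt (fun q => C.bb yb q y) (C.PP yb q y) q := by
  have h1 := (C.hasGrad (chi_mem hyb hq) hy).hasFDerivAt.comp q (chi_deriv hyb hq)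
  have h2 := (C.hasGrad (chi_mem hyb hq) (subset_closure hyb)).hasFDerivAt.comp q (chi_deriv hyb hq)
  rw [hasGradientAt_iff_hasFDerivAt]
  refine ((h1.fun_neg).fun_add h2).congr_fderiv ?_
  ext w
  simp [PP_inner, inner_sub_left]
  ring

lemma bb_cont {yb : Euc n} (hyb : yb ∈ C.V) :
    ContinuousOn (Function.uncurry (C.bb yb)) (C.Ub yb ×ˢ closure C.V) := by
  have h1 : ContinuousOn (fun z : Euc n × Euc n => C.c (C.chi yb z.1) z.2) (C.Ub yb ×ˢ closure C.V) :=
    C.cont_f.comp (f := fun z : Euc n × Euc n => (C.chi yb z.1, z.2))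
      (((chi_cont hyb).comp continuousOn_fst fun z hz => hz.1).prodMk continuousOn_snd)
      fun z hz => ⟨subset_closure (chi_mem hyb hz.1), hz.2⟩
  have h2 : ContinuousOn (fun z : Euc n × Euc n => C.c (C.chi yb z.1) yb) (C.Ub yb ×ˢ closure C.V) :=
    C.cont_f.comp (f := fun z : Euc n × Euc n => (C.chi yb z.1, yb))
      (((chi_cont hyb).comp continuousOn_fst fun z hz => hz.1).prodMk continuousOn_const)
      fun z hz => ⟨subset_closure (chi_mem hyb hz.1), subset_closure hyb⟩
  exact h1.neg.add h2

lemma PP_cont {yb : Euc n} (hyb : yb ∈ C.V) :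
    ContinuousOn (Function.uncurry (C.PP yb)) (C.Ub yb ×ˢ closure C.V) := by
  have h1 : ContinuousOn (fun z : Euc n × Euc n => C.p (C.chi yb z.1) z.2) (C.Ub yb ×ˢ closure C.V) :=
    C.p_cont.comp (f := fun z : Euc n × Euc n => (C.chi yb z.1, z.2))
      (((chi_cont hyb).comp continuousOn_fst fun z hz => hz.1).prodMk continuousOn_snd)
      fun z hz => ⟨chi_mem hyb hz.1, hz.2⟩
  have h2 : ContinuousOn (fun z : Euc n × Euc n => C.p (C.chi yb z.1) yb) (C.Ub yb ×ˢ closure C.V) :=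
    C.p_cont.comp (f := fun z : Euc n × Euc n => (C.chi yb z.1, yb))
      (((chi_cont hyb).comp continuousOn_fst fun z hz => hz.1).prodMk continuousOn_const)
      fun z hz => ⟨chi_mem hyb hz.1, subset_closure hyb⟩
  have h3 : ContinuousOn (fun z : Euc n × Euc n =>
      ContinuousLinearMap.adjoint (fderiv ℝ (C.chi yb) z.1)) (C.Ub yb ×ˢ closure C.V) :=
    (ContinuousLinearMap.adjoint (𝕜 := ℝ) (E := Euc n) (F := Euc n)).continuous.comp_continuousOn
      ((dchi_cont hyb).comp continuousOn_fst fun z hz => hz.1)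
  exact h3.clm_apply (h1.sub h2)

/-- derivative along a line and its differential inequality. -/
lemma star_line {K L L' : ℝ} (hK1 : 1 ≤ K) (hL1 : 1 ≤ L) (hL1' : 1 ≤ L') (hM : C.MTW)
    (hK : ∀ z ∈ C.W, (∀ v, |d1 C.f z v| ≤ K * ‖v‖) ∧
      (∀ v w, |d2 C.f z v w| ≤ K * ‖v‖ * ‖w‖) ∧
      (∀ v w a, |d3 C.f z v w a| ≤ K * ‖v‖ * ‖w‖ * ‖a‖) ∧
      (∀ v w a b, |d4 C.f z v w a b| ≤ K * ‖v‖ * ‖w‖ * ‖a‖ * ‖b‖))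
    {yb y q w : Euc n} (hyb : yb ∈ C.V) (hy : y ∈ C.V) {s : ℝ} (hq : q ∈ C.Ub yb)
    (hs : q + s • w ∈ C.Ub yb)
    (hL : ∀ y ∈ C.V, ∀ η, ‖η‖ ≤ L * ‖C.B (C.chi yb (q + s • w)) y η‖)
    (hL' : ∀ ξ, ‖ξ‖ ≤ L' * ‖C.flip.B yb (C.chi yb (q + s • w)) ξ‖) :
    ∃ g', HasDerivAt (fun s : ℝ => ⟪C.PP yb (q + s • w) y, w⟫) g' s ∧
      -(8 * K ^ 3 * L ^ 3 * L' * ‖w‖) * |⟪C.PP yb (q + s • w) y, w⟫| ≤ g' := by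
  obtain ⟨X, dX, ddX, h0, hTo, h⟩ := C.flip.curve hyb (chi_mem hyb hq) w
  have ec : C.flip.p yb (C.chi yb q) = q := p_chi hyb hq
  rw [ec] at hTo h
  set T : Set ℝ := {t : ℝ | q + t • w ∈ C.flip.Vx yb} with hT
  have hX : ∀ t ∈ T, X t = C.chi yb (q + t • w) := by
    intro t ht
    have := (h t ht).2.1
    rw [← this]
    exact (chi_p hyb (subset_closure (h t ht).1)).symm
  have hdX : ∀ t ∈ T, dX t = fderiv ℝ (C.chi yb) (q + t • w) w := by
    intro t ht
    have e1 : HasDerivAt (fun t : ℝ => q + t • w) w t := by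
      simpa using ((hasDerivAt_id t).smul_const w).const_add q
    have e2 := (chi_deriv hyb ht).comp_hasDerivAt t e1
    refine (h t ht).2.2.1.unique (e2.congr_of_eventuallyEq ?_)
    filter_upwards [hTo.mem_nhds ht] with r hr using hX r hr
  have hsT : s ∈ T := hs
  obtain ⟨k1, k2, k3, k4, k5, k6⟩ := h s hs
  have k1' : X s ∈ C.U := k1
  have hg : (fun s : ℝ => ⟪C.PP yb (q + s • w) y, w⟫) =ᶠ[𝓝 s]
      fun s => -d1 C.f (X s, y) (dX s, 0) + d1 C.f (X s, yb) (dX s, 0) := by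
    filter_upwards [hTo.mem_nhds hsT] with t ht
    have h1 : X t ∈ C.U := (h t ht).1
    rw [PP_inner, ← hX t ht, ← hdX t ht, inner_sub_left, C.p_inner h1 hy, C.p_inner h1 hyb]
    ring
  have e1 := C.sm.k1 (γ := fun s => (X s, y)) (t := s) ⟨k1, hy⟩ (k3.prodMk (hasDerivAt_const _ _))
    (k4.prodMk (hasDerivAt_const _ (0 : Euc n)))
  have e2 := C.sm.k1 (γ := fun s => (X s, yb)) (t := s) ⟨k1, hyb⟩
    (k3.prodMk (hasDerivAt_const _ _)) (k4.prodMk (hasDerivAt_const _ (0 : Euc n)))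
  refine ⟨_, (e1.fun_neg.fun_add e2).congr_of_eventuallyEq hg, ?_⟩
  have ha : ∀ ζ, d2 C.f (X s, yb) (ddX s, 0) (0, ζ) =
      -d3 C.f (X s, yb) (dX s, 0) (dX s, 0) (0, ζ) := by
    intro ζ
    have hz : (X s, yb) ∈ C.W := ⟨k1, hyb⟩
    have := k6 ζ
    rw [C.fd2 k1' hyb, C.fd3 k1' hyb, C.sm.s2 hz, C.sm.s3a hz, C.sm.s3b hz] at this
    exact this
  have hp := C.pw hK1 hL1 hM k1' (fun y hy => (hK (X s, y) ⟨k1, hy⟩).2.2.1)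
    (fun y hy => (hK (X s, y) ⟨k1, hy⟩).2.2.2) (fun y hy η => by rw [hX s hs]; exact hL y hy η)
    hyb hy ha
  have hP2 : ‖C.p (X s) y - C.p (X s) yb‖ ≤ 2 * K := by
    have hb : ∀ y ∈ C.V, ‖C.p (X s) y‖ ≤ K := fun y hy => by
      refine inner_bound (by positivity) fun ζ => ?_
      rw [C.p_inner k1' hy, abs_neg, ← norm_inl]
      exact (hK (X s, y) ⟨k1', hy⟩).1 (ζ, 0)
    have := norm_sub_le (C.p (X s) y) (C.p (X s) yb)
    linarith [hb y hy, hb yb hyb]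
  have hd : ‖dX s‖ ≤ L' * ‖w‖ := by
    rw [hdX s hs]
    have := hL' (fderiv ℝ (C.chi yb) (q + s • w) w)
    rwa [B_dchi hyb hs] at this
  have e3 : ⟪C.PP yb (q + s • w) y, w⟫ = ⟪C.p (X s) y - C.p (X s) yb, dX s⟫ := by
    rw [PP_inner, ← hX s hs, ← hdX s hs]
  rw [e3]
  have e4 : ⟪C.p (X s) y - C.p (X s) yb, ddX s⟫ =
      -d1 C.f (X s, y) (ddX s, 0) + d1 C.f (X s, yb) (ddX s, 0) := by
    rw [inner_sub_left, C.p_inner k1' hy, C.p_inner k1' hyb]; ring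
  have e5 : 4 * K ^ 2 * L ^ 3 * ‖C.p (X s) y - C.p (X s) yb‖ * ‖dX s‖ *
      |⟪C.p (X s) y - C.p (X s) yb, dX s⟫| ≤ 4 * K ^ 2 * L ^ 3 * (2 * K) * (L' * ‖w‖) *
      |⟪C.p (X s) y - C.p (X s) yb, dX s⟫| := by gcongr
  rw [e4] at hp
  refine le_trans ?_ (hp.trans (le_of_eq (by ring)))
  rw [neg_mul]
  refine neg_le_neg (e5.trans (le_of_eq (by ring)))

lemma bb_line {yb y q w : Euc n} (hyb : yb ∈ C.V) (hy : y ∈ closure C.V) {s : ℝ}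
    (hs : q + s • w ∈ C.Ub yb) :
    HasDerivAt (fun s : ℝ => C.bb yb (q + s • w) y) ⟪C.PP yb (q + s • w) y, w⟫ s := by
  have h1 := (bb_grad hyb hs hy).hasFDerivAt
  have h2 : HasDerivAt (fun s : ℝ => q + s • w) w s := by
    simpa using ((hasDerivAt_id s).smul_const w).const_add q
  have h3 := h1.comp_hasDerivAt s h2
  rw [InnerProductSpace.toDual_apply_apply] at h3
  exact h3

lemma ode1 {E0 : ℝ} (hE : 0 ≤ E0) {g : ℝ → ℝ}
    (h : ∀ r ∈ Icc (0:ℝ) 1, ∃ g', HasDerivAt g g' r ∧ -E0 * |g r| ≤ g') {s t : ℝ} (h0s : 0 ≤ s)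
    (hst : s ≤ t) (ht1 : t ≤ 1) (h0 : 0 < g s) : Real.exp (-(2 * E0)) * g s ≤ g t := by
  choose! g' hg' hg'' using h
  have hsub : ∀ r ∈ Icc s t, r ∈ Icc (0:ℝ) 1 := fun r hr => ⟨h0s.trans hr.1, hr.2.trans ht1⟩
  rcases hE.eq_or_lt with rfl | hE
  · have h1 : MonotoneOn g (Icc s t) := by
      refine monotoneOn_of_deriv_nonneg (convex_Icc _ _)
        (fun r hr => (hg' r (hsub r hr)).continuousAt.continuousWithinAt)
        (fun r hr => (hg' r (hsub r (interior_subset hr))).differentiableAt.differentiableWithinAt)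
        (fun r hr => ?_)
      rw [(hg' r (hsub r (interior_subset hr))).deriv]
      have := hg'' r (hsub r (interior_subset hr))
      simpa using this
    simpa using h1 (left_mem_Icc.2 hst) (right_mem_Icc.2 hst) hst
  have := ode (g := g) (g' := g') (K := E0) hE hst
      (fun r hr => hg' r (hsub r hr)) (fun r hr => hg'' r (hsub r hr)) h0
  refine le_trans ?_ this
  refine mul_le_mul_of_nonneg_right (Real.exp_le_exp.2 (neg_le_neg ?_)) h0.le
  have h1 : t - s ≤ 1 := by linarith
  calc 2 * E0 * (t - s) ≤ 2 * E0 * 1 := by gcongr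
    _ = _ := by ring

/-- STAR inequality, interior. -/
lemma star0 {K L L' : ℝ} (hK1 : 1 ≤ K) (hL1 : 1 ≤ L) (hL1' : 1 ≤ L') (hM : C.MTW)
    (hK : ∀ z ∈ C.W, (∀ v, |d1 C.f z v| ≤ K * ‖v‖) ∧
      (∀ v w, |d2 C.f z v w| ≤ K * ‖v‖ * ‖w‖) ∧
      (∀ v w a, |d3 C.f z v w a| ≤ K * ‖v‖ * ‖w‖ * ‖a‖) ∧
      (∀ v w a b, |d4 C.f z v w a b| ≤ K * ‖v‖ * ‖w‖ * ‖a‖ * ‖b‖))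
    {yb q w : Euc n} (hyb : yb ∈ C.V) (hq : q ∈ C.Ub yb)
    (hs : ∀ s ∈ Icc (0:ℝ) 1, q + s • w ∈ C.Ub yb)
    (hL : ∀ s ∈ Icc (0:ℝ) 1, ∀ y ∈ C.V, ∀ η, ‖η‖ ≤ L * ‖C.B (C.chi yb (q + s • w)) y η‖)
    (hL' : ∀ s ∈ Icc (0:ℝ) 1, ∀ ξ, ‖ξ‖ ≤ L' * ‖C.flip.B yb (C.chi yb (q + s • w)) ξ‖)
    {s t : ℝ} (h0s : 0 ≤ s) (hst : s ≤ t) (ht1 : t ≤ 1) {y : Euc n} (hy : y ∈ C.V)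
    (h0 : 0 < ⟪C.PP yb (q + s • w) y, w⟫) :
    Real.exp (-(16 * K ^ 3 * L ^ 3 * L' * ‖w‖)) * ⟪C.PP yb (q + s • w) y, w⟫ ≤
      ⟪C.PP yb (q + t • w) y, w⟫ := by
  have h1 := ode1 (E0 := 8 * K ^ 3 * L ^ 3 * L' * ‖w‖) (by positivity)
    (g := fun s : ℝ => ⟪C.PP yb (q + s • w) y, w⟫)
    (fun r hr => star_line hK1 hL1 hL1' hM hK hyb hy hq (hs r hr) (hL r hr) (hL' r hr)) h0s hst ht1 h0
  rw [show (16 * K ^ 3 * L ^ 3 * L' * ‖w‖) = 2 * (8 * K ^ 3 * L ^ 3 * L' * ‖w‖) by ring]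
  exact h1

lemma tend_le {E0 : ℝ} {a b : ℕ → ℝ} {A B : ℝ} (ha : Tendsto a atTop (𝓝 A))
    (hb : Tendsto b atTop (𝓝 B)) (hA : 0 < A) (h : ∀ k, 0 < a k → E0 * a k ≤ b k) :
    E0 * A ≤ B := by
  refine le_of_tendsto_of_tendsto (ha.const_mul _) hb ?_
  filter_upwards [ha.eventually (lt_mem_nhds hA)] with k hk using h k hk

lemma unc_tend {E : Type*} [NormedAddCommGroup E] [InnerProductSpace ℝ E]
    {A B : Set E} {P : E → E → E} (h : ContinuousOn (Function.uncurry P) (A ×ˢ B)) {q y w : E}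
    (hq : q ∈ A) (hy : y ∈ B) {a : ℕ → E} (ha : ∀ k, a k ∈ B) (hat : Tendsto a atTop (𝓝 y)) :
    Tendsto (fun k => ⟪P q (a k), w⟫) atTop (𝓝 ⟪P q y, w⟫) := by
  have h1 := (h (q, y) ⟨hq, hy⟩).tendsto
  have h2 : Tendsto (fun k => (q, a k)) atTop (𝓝[A ×ˢ B] (q, y)) :=
    tendsto_nhdsWithin_iff.2 ⟨tendsto_const_nhds.prodMk_nhds hat,
      Eventually.of_forall fun k => ⟨hq, ha k⟩⟩
  have h3 : Tendsto (fun k => P q (a k)) atTop (𝓝 (P q y)) := h1.comp h2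
  exact h3.inner tendsto_const_nhds

lemma PP_tend {yb q w y : Euc n} (hyb : yb ∈ C.V) (hq : q ∈ C.Ub yb) {a : ℕ → Euc n}
    (hy : y ∈ closure C.V) (ha : ∀ k, a k ∈ closure C.V) (hat : Tendsto a atTop (𝓝 y)) :
    Tendsto (fun k => ⟪C.PP yb q (a k), w⟫) atTop (𝓝 ⟪C.PP yb q y, w⟫) :=
  unc_tend (PP_cont hyb) hq hy ha hat

/-- STAR inequality. -/
lemma star {K L L' : ℝ} (hK1 : 1 ≤ K) (hL1 : 1 ≤ L) (hL1' : 1 ≤ L') (hM : C.MTW)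
    (hK : ∀ z ∈ C.W, (∀ v, |d1 C.f z v| ≤ K * ‖v‖) ∧
      (∀ v w, |d2 C.f z v w| ≤ K * ‖v‖ * ‖w‖) ∧
      (∀ v w a, |d3 C.f z v w a| ≤ K * ‖v‖ * ‖w‖ * ‖a‖) ∧
      (∀ v w a b, |d4 C.f z v w a b| ≤ K * ‖v‖ * ‖w‖ * ‖a‖ * ‖b‖))
    {yb q w : Euc n} (hyb : yb ∈ C.V) (hq : q ∈ C.Ub yb)
    (hs : ∀ s ∈ Icc (0:ℝ) 1, q + s • w ∈ C.Ub yb)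
    (hL : ∀ s ∈ Icc (0:ℝ) 1, ∀ y ∈ C.V, ∀ η, ‖η‖ ≤ L * ‖C.B (C.chi yb (q + s • w)) y η‖)
    (hL' : ∀ s ∈ Icc (0:ℝ) 1, ∀ ξ, ‖ξ‖ ≤ L' * ‖C.flip.B yb (C.chi yb (q + s • w)) ξ‖)
    {s t : ℝ} (h0s : 0 ≤ s) (hst : s ≤ t) (ht1 : t ≤ 1) {y : Euc n} (hy : y ∈ closure C.V)
    (h0 : 0 < ⟪C.PP yb (q + s • w) y, w⟫) :
    Real.exp (-(16 * K ^ 3 * L ^ 3 * L' * ‖w‖)) * ⟪C.PP yb (q + s • w) y, w⟫ ≤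
      ⟪C.PP yb (q + t • w) y, w⟫ := by
  obtain ⟨a, ha, hat⟩ := mem_closure_iff_seq_limit.1 hy
  have l1 := PP_tend (w := w) hyb (hs s ⟨h0s, hst.trans ht1⟩) hy (fun k => subset_closure (ha k)) hat
  have l2 := PP_tend (w := w) hyb (hs t ⟨h0s.trans hst, ht1⟩) hy (fun k => subset_closure (ha k)) hat
  exact tend_le l1 l2 h0 fun k hk => star0 hK1 hL1 hL1' hM hK hyb hq hs hL hL' h0s hst ht1 (ha k) hk

/-- Loeper's maximum principle in the interior. -/
lemma dasm0 (hM : C.MTW) {yb q q' y : Euc n} (hyb : yb ∈ C.V) (hq : q ∈ C.Ub yb)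
    (hq' : q' ∈ C.Ub yb) (hy : y ∈ closure C.V) {t : ℝ} (ht : t ∈ Icc (0:ℝ) 1) :
    C.bb yb (q + t • (q' - q)) y ≤ max (C.bb yb q y) (C.bb yb q' y) := by
  obtain ⟨K, hK1, hK⟩ := C.bounds
  have hs : ∀ s ∈ Icc (0:ℝ) 1, q + s • (q' - q) ∈ C.Ub yb := fun s hs =>
    (Ub_convex hyb).add_smul_sub_mem hq hq' hs
  have hcp : IsCompact ((fun s : ℝ => C.chi yb (q + s • (q' - q))) '' Icc (0:ℝ) 1) := by
    refine isCompact_Icc.image_of_continuousOn ?_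
    exact (chi_cont hyb).comp (by fun_prop) hs
  obtain ⟨L, hL1, hL⟩ := C.nd hcp (by rintro _ ⟨s, hs', rfl⟩; exact chi_mem hyb (hs s hs'))
  obtain ⟨L', hL1', hL'⟩ := C.flip.lip0 hyb
  have hst := fun {s t : ℝ} => star (s := s) (t := t) hK1 hL1 hL1' hM hK hyb hq hs
    (fun s hs' => hL _ (mem_image_of_mem _ hs'))
    (fun s hs' ξ => C.flip.nd_of_lip hyb (chi_mem hyb (hs s hs')) hL' ξ)
  by_contra hcon
  rw [not_le, max_lt_iff] at hcon
  set φ : ℝ → ℝ := fun s => C.bb yb (q + s • (q' - q)) y with hφ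
  have hd : ∀ s ∈ Icc (0:ℝ) 1, HasDerivAt φ ⟪C.PP yb (q + s • (q' - q)) y, q' - q⟫ s :=
    fun s hs' => bb_line hyb hy (hs s hs')
  have h0 : φ 0 = C.bb yb q y := by simp [hφ]
  have h1 : φ 1 = C.bb yb q' y := by simp [hφ]
  have hlt0 : φ 0 < φ t := by rw [h0]; exact hcon.1
  have hlt1 : φ 1 < φ t := by rw [h1]; exact hcon.2
  have ht0 : 0 < t := lt_of_le_of_ne ht.1 (by rintro rfl; exact lt_irrefl _ hlt0)
  have ht1 : t < 1 := lt_of_le_of_ne ht.2 (by rintro rfl; exact lt_irrefl _ hlt1)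
  obtain ⟨s, hs', e1⟩ := exists_hasDerivAt_eq_slope φ _ ht0
    (fun s hs' => (hd s ⟨hs'.1, hs'.2.trans ht.2⟩).continuousAt.continuousWithinAt)
    (fun s hs' => hd s ⟨hs'.1.le, hs'.2.le.trans ht.2⟩)
  obtain ⟨r, hr', e2⟩ := exists_hasDerivAt_eq_slope φ _ ht1
    (fun s hs' => (hd s ⟨ht.1.trans hs'.1, hs'.2⟩).continuousAt.continuousWithinAt)
    (fun s hs' => hd s ⟨ht.1.trans hs'.1.le, hs'.2.le⟩)
  have p1 : 0 < ⟪C.PP yb (q + s • (q' - q)) y, q' - q⟫ := by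
    rw [e1]; exact div_pos (by linarith) (by linarith)
  have p2 : ⟪C.PP yb (q + r • (q' - q)) y, q' - q⟫ < 0 := by
    rw [e2]; exact div_neg_of_neg_of_pos (by linarith) (by linarith)
  have p3 := hst hs'.1.le (hs'.2.trans hr'.1).le hr'.2.le hy p1
  have p4 := mul_pos (Real.exp_pos (-(16 * K ^ 3 * L ^ 3 * L' * ‖q' - q‖))) p1
  linarith

/-- Loeper's maximum principle up to the boundary. -/
lemma dasm (hM : C.MTW) {yb x0 x1 : Euc n} (hyb : yb ∈ C.V) (hx0 : x0 ∈ closure C.U)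
    (hx1 : x1 ∈ closure C.U) {t : ℝ} (ht : t ∈ Icc (0:ℝ) 1) :
    ∃ z ∈ closure C.U, C.flip.p yb z = (1 - t) • C.flip.p yb x0 + t • C.flip.p yb x1 ∧
      ∀ y ∈ closure C.V, -C.c z y + C.c z yb ≤
        max (-C.c x0 y + C.c x0 yb) (-C.c x1 y + C.c x1 yb) := by
  obtain ⟨z, hz, hzp⟩ : (1 - t) • C.flip.p yb x0 + t • C.flip.p yb x1 ∈
      C.flip.p yb '' closure C.U :=
    C.flip.img_convex hyb (mem_image_of_mem _ hx0) (mem_image_of_mem _ hx1)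
      (by linarith [ht.2]) ht.1 (by ring)
  refine ⟨z, hz, hzp, fun y hy => ?_⟩
  obtain ⟨a, ha, hat⟩ := mem_closure_iff_seq_limit.1 hx0
  obtain ⟨b, hb, hbt⟩ := mem_closure_iff_seq_limit.1 hx1
  have hpc : ∀ {d : ℕ → Euc n} {x : Euc n}, x ∈ closure C.U → (∀ k, d k ∈ closure C.U) →
      Tendsto d atTop (𝓝 x) → Tendsto (fun k => C.flip.p yb (d k)) atTop (𝓝 (C.flip.p yb x)) :=
    fun hx hd hdt => (C.flip.px_cont hyb _ hx).tendsto.comp (tendsto_nhdsWithin_iff.2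
      ⟨hdt, Eventually.of_forall hd⟩)
  have hcc : ∀ {d : ℕ → Euc n} {x : Euc n}, x ∈ closure C.U → (∀ k, d k ∈ closure C.U) →
      Tendsto d atTop (𝓝 x) → Tendsto (fun k => -C.c (d k) y + C.c (d k) yb) atTop
        (𝓝 (-C.c x y + C.c x yb)) := by
    intro d x hx hd hdt
    have : ∀ y ∈ closure C.V, Tendsto (fun k => C.c (d k) y) atTop (𝓝 (C.c x y)) := fun y hy =>
      (C.cont_f (x, y) ⟨hx, hy⟩).tendsto.comp (tendsto_nhdsWithin_iff.2
        ⟨hdt.prodMk_nhds tendsto_const_nhds, Eventually.of_forall fun k => ⟨hd k, hy⟩⟩)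
    exact (this y hy).neg.add (this yb (subset_closure hyb))
  have ha' := fun k => subset_closure (s := C.U) (ha k)
  have hb' := fun k => subset_closure (s := C.U) (hb k)
  set qk : ℕ → Euc n := fun k => C.flip.p yb (a k) + t • (C.flip.p yb (b k) - C.flip.p yb (a k))
    with hqk
  have hqU : ∀ k, qk k ∈ C.Ub yb := fun k => (Ub_convex hyb).add_smul_sub_mem
    (mem_image_of_mem _ (ha k)) (mem_image_of_mem _ (hb k)) ht
  set zk : ℕ → Euc n := fun k => C.chi yb (qk k) with hzk
  obtain ⟨L', hL1', hL'⟩ := C.flip.lip0 hyb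
  have hzt : Tendsto zk atTop (𝓝 z) := by
    rw [tendsto_iff_norm_sub_tendsto_zero]
    have h1 : Tendsto qk atTop (𝓝 (C.flip.p yb z)) := by
      have := (hpc hx0 ha' hat).add (((hpc hx1 hb' hbt).sub (hpc hx0 ha' hat)).const_smul t)
      convert this using 2
      rw [hzp]; module
    have h2 : Tendsto (fun k => L' * ‖qk k - C.flip.p yb z‖) atTop (𝓝 0) := by
      have := (h1.sub_const (C.flip.p yb z)).norm.const_mul L'
      simpa using this
    refine squeeze_zero (fun _ => norm_nonneg _) (fun k => ?_) h2
    have := hL' (zk k) (subset_closure (chi_mem hyb (hqU k))) z hz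
    rwa [hzk, p_chi hyb (hqU k)] at this
  refine le_of_tendsto_of_tendsto' (hcc hz (fun k => subset_closure (chi_mem hyb (hqU k))) hzt)
    ((hcc hx0 ha' hat).max (hcc hx1 hb' hbt)) fun k => ?_
  have := dasm0 hM hyb (mem_image_of_mem _ (ha k)) (mem_image_of_mem _ (hb k)) hy ht
  have e1 : C.chi yb (C.flip.p yb (a k)) = a k := chi_p hyb (ha' k)
  have e2 : C.chi yb (C.flip.p yb (b k)) = b k := chi_p hyb (hb' k)
  rw [bb, bb, bb, e1, e2] at this
  exact this

end Cost
end FKM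

open Set MeasureTheory Metric Bornology
open scoped ENNReal NNReal Pointwise

set_option linter.unusedVariables false
set_option linter.unusedSectionVars false
namespace FKM
open Filter Topology
open scoped BoundedContinuousFunction

section dual
variable {X Y : Type*} [MetricSpace X] [CompactSpace X] [Nonempty X]
  [MetricSpace Y] [CompactSpace Y] [Nonempty Y]

/-- c-transform. -/
noncomputable def ct (c : X → Y → ℝ) (v : Y → ℝ) (x : X) : ℝ :=
  sSup ((fun y => -c x y - v y) '' univ)

lemma ct_spec {c : X → Y → ℝ} (hc : Continuous (Function.uncurry c)) {v : Y → ℝ}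
    (hv : Continuous v) (x : X) :
    (∃ y, ct c v x = -c x y - v y) ∧ ∀ y, -c x y - v y ≤ ct c v x := by
  have h1 : Continuous (fun y => -c x y - v y) := by
    have : Continuous fun y => c x y := hc.comp (Continuous.prodMk_right x)
    fun_prop
  obtain ⟨y, -, hy, hy'⟩ := isCompact_univ.exists_sSup_image_eq_and_ge (univ_nonempty (α := Y))
    h1.continuousOn
  refine ⟨⟨y, hy⟩, fun z => ?_⟩
  rw [ct, hy]
  exact hy' z (mem_univ _)

lemma ct_cont {c : X → Y → ℝ} (hc : Continuous (Function.uncurry c)) {v : Y → ℝ}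
    (hv : Continuous v) : Continuous (ct c v) := by
  refine isCompact_univ.continuous_sSup (f := fun x y => -c x y - v y) ?_
  have : Continuous (fun z : X × Y => c z.1 z.2) := hc
  exact this.neg.sub (hv.comp continuous_snd)

lemma ct_mod {c : X → Y → ℝ} (hc : Continuous (Function.uncurry c)) {v : Y → ℝ}
    (hv : Continuous v) {x x' : X} {ε : ℝ} (h : ∀ y, |c x y - c x' y| ≤ ε) :
    |ct c v x - ct c v x'| ≤ ε := by
  obtain ⟨⟨y, hy⟩, hx⟩ := ct_spec hc hv x
  obtain ⟨⟨y', hy'⟩, hx'⟩ := ct_spec hc hv x'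
  have h1 := abs_le.1 (h y)
  have h2 := abs_le.1 (h y')
  have h3 := hx y'
  have h4 := hx' y
  rw [abs_le]
  constructor <;> linarith

lemma ct_le {c : X → Y → ℝ} (hc : Continuous (Function.uncurry c)) {v w : Y → ℝ}
    (hv : Continuous v) (hw : Continuous w) {ε : ℝ} (h : ∀ y, v y ≤ w y + ε) (x : X) :
    ct c w x ≤ ct c v x + ε := by
  obtain ⟨⟨y, hy⟩, hx⟩ := ct_spec hc hw x
  have h1 := (ct_spec hc hv x).2 y
  linarith [h y]

lemma flip_cont {c : X → Y → ℝ} (hc : Continuous (Function.uncurry c)) :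
    Continuous (Function.uncurry (Function.swap c)) := hc.comp continuous_swap

lemma exists_min [MeasurableSpace X] [BorelSpace X] [MeasurableSpace Y] [BorelSpace Y]
    {c : X → Y → ℝ} (hc : Continuous (Function.uncurry c)) (μ : Measure X) (ν : Measure Y)
    [IsProbabilityMeasure μ] [IsProbabilityMeasure ν] :
    ∃ u : X → ℝ, ∃ v : Y → ℝ, Continuous u ∧ Continuous v ∧ u = ct c v ∧
      v = ct (Function.swap c) u ∧ ∀ w : Y → ℝ, Continuous w →
      ∫ x, u x ∂μ + ∫ y, v y ∂ν ≤ ∫ x, ct c w x ∂μ + ∫ y, w y ∂ν := by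
  have hc' := flip_cont hc
  obtain ⟨y0⟩ := ‹Nonempty Y›
  have iμ : ∀ {f : X → ℝ}, Continuous f → Integrable f μ := fun hf =>
    hf.integrable_of_hasCompactSupport (HasCompactSupport.of_compactSpace _)
  have iν : ∀ {f : Y → ℝ}, Continuous f → Integrable f ν := fun hf =>
    hf.integrable_of_hasCompactSupport (HasCompactSupport.of_compactSpace _)
  set J : (Y → ℝ) → ℝ := fun w => ∫ x, ct c w x ∂μ + ∫ y, w y ∂ν with hJ
  have hmono : ∀ v w : Y → ℝ, Continuous v → Continuous w → ∀ ε, (∀ y, |v y - w y| ≤ ε) →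
      J v ≤ J w + 2 * ε := by
    intro v w hv hw ε h
    have h1 : ∫ x, ct c v x ∂μ ≤ ∫ x, (ct c w x + ε) ∂μ :=
      integral_mono (iμ (ct_cont hc hv)) ((iμ (ct_cont hc hw)).add (integrable_const _))
        fun x => ct_le hc hw hv (fun y => by have := abs_le.1 (h y); linarith) x
    have h2 : ∫ y, v y ∂ν ≤ ∫ y, (w y + ε) ∂ν :=
      integral_mono (iν hv) ((iν hw).add (integrable_const _))
        fun y => by have := abs_le.1 (h y); show v y ≤ w y + ε; linarith
    rw [integral_add (iμ (ct_cont hc hw)) (integrable_const _)] at h1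
    rw [integral_add (iν hw) (integrable_const _)] at h2
    simp at h1 h2
    simp only [hJ]
    linarith
  set A : Set (Y →ᵇ ℝ) := {w | w y0 = 0 ∧ ∀ ε y y', (∀ x, |c x y - c x y'| ≤ ε) →
    |w y - w y'| ≤ ε} with hA
  obtain ⟨K, hK⟩ : ∃ K : ℝ, ∀ x y, |c x y| ≤ K := by
    obtain ⟨K, hK⟩ := (isCompact_univ (X := X × Y)).exists_bound_of_continuousOn hc.continuousOn
    exact ⟨K, fun x y => by simpa using hK (x, y) (mem_univ _)⟩
  have hAc : IsCompact A := by
    refine BoundedContinuousFunction.arzela_ascoli₂ (Icc (-(2*K)) (2*K)) isCompact_Icc A ?_ ?_ ?_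
    · have e : A = {w : Y →ᵇ ℝ | w y0 = 0} ∩ ⋂ (ε) (y) (y') (_ : ∀ x, |c x y - c x y'| ≤ ε),
          {w : Y →ᵇ ℝ | |w y - w y'| ≤ ε} := by
        ext w; simp [hA]
      rw [e]
      have hev : ∀ y, Continuous fun w : Y →ᵇ ℝ => w y :=
        fun y => continuous_eval_const (F := Y →ᵇ ℝ) y
      refine (isClosed_eq (hev y0) continuous_const).inter ?_
      refine isClosed_iInter fun ε => isClosed_iInter fun y => isClosed_iInter fun y' =>
        isClosed_iInter fun _ => isClosed_le ((hev y).sub (hev y')).abs continuous_const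
    · intro w y hw
      have := hw.2 (2 * K) y y0 fun x => by
        have h1 := abs_sub (c x y) (c x y0)
        linarith [hK x y, hK x y0]
      rw [hw.1, sub_zero] at this
      exact abs_le.1 this
    · intro y
      rw [Metric.equicontinuousAt_iff]
      intro ε hε
      have huc : UniformContinuous (Function.uncurry c) :=
        CompactSpace.uniformContinuous_of_continuous hc
      obtain ⟨δ, hδ, h⟩ := Metric.uniformContinuous_iff.1 huc (ε / 2) (by positivity)
      refine ⟨δ, hδ, fun y' hy' w => ?_⟩
      have := w.2.2 (ε/2) y y' fun x => by
        have := @h (x, y) (x, y') (by rw [Prod.dist_eq]; simpa [dist_comm] using hy')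
        rw [Real.dist_eq] at this
        exact this.le
      rw [Real.dist_eq]
      exact this.trans_lt (by linarith)
  have hA0 : (0 : Y →ᵇ ℝ) ∈ A := by
    refine ⟨rfl, fun ε y y' h => ?_⟩
    obtain ⟨x⟩ := ‹Nonempty X›
    simpa using (abs_nonneg _).trans (h x)
  have hJc : Continuous fun w : Y →ᵇ ℝ => J w := by
    rw [Metric.continuous_iff]
    intro w ε hε
    refine ⟨ε / 3, by positivity, fun w' hw' => ?_⟩
    have hb : ∀ y, |w' y - w y| ≤ ε / 3 := fun y =>
      (BoundedContinuousFunction.dist_coe_le_dist y).trans hw'.le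
    have h1 := hmono w' w w'.continuous w.continuous _ hb
    have h2 := hmono w w' w.continuous w'.continuous _ fun y => by rw [abs_sub_comm]; exact hb y
    rw [Real.dist_eq, abs_lt]
    constructor <;> linarith
  obtain ⟨v0, hv0A, hv0⟩ := hAc.exists_isMinOn ⟨0, hA0⟩ hJc.continuousOn
  have hcc : ∀ w : Y → ℝ, Continuous w → ct c (ct (Function.swap c) (ct c w)) = ct c w ∧
      J (ct (Function.swap c) (ct c w)) ≤ J w := by
    intro w hw
    have hu := ct_cont hc hw
    have hle : ∀ y, ct (Function.swap c) (ct c w) y ≤ w y := fun y => by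
      obtain ⟨⟨x, hx⟩, -⟩ := ct_spec hc' hu y
      have := (ct_spec hc hw x).2 y
      simp only [Function.swap] at hx
      linarith
    have e : ct c (ct (Function.swap c) (ct c w)) = ct c w := by
      ext x
      refine le_antisymm ?_ ?_
      · obtain ⟨⟨y, hy⟩, -⟩ := ct_spec hc (ct_cont hc' hu) x
        have := (ct_spec hc' hu y).2 x
        simp only [Function.swap] at this
        linarith
      · have := ct_le hc (ct_cont hc' hu) hw (ε := 0) (fun y => by simpa using hle y) x
        simpa using this
    refine ⟨e, ?_⟩
    simp only [hJ, e]
    have := integral_mono (iν (ct_cont hc' hu)) (iν hw) hle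
    linarith
  have hmin : ∀ w : Y → ℝ, Continuous w → J v0 ≤ J w := by
    intro w hw
    set w2 := ct (Function.swap c) (ct c w) with hw2
    have hw2c : Continuous w2 := ct_cont hc' (ct_cont hc hw)
    set w3 : Y → ℝ := fun y => w2 y - w2 y0 with hw3
    have hw3c : Continuous w3 := by fun_prop
    have hw3A : BoundedContinuousFunction.mkOfCompact ⟨w3, hw3c⟩ ∈ A := by
      refine ⟨by simp [hw3], fun ε y y' h => ?_⟩
      have := ct_mod hc' (ct_cont hc hw) (x := y) (x' := y') (ε := ε) h
      simpa [hw3] using this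
    have h1 : J v0 ≤ J w3 := hv0 hw3A
    have h2 : J w3 = J w2 := by
      have e : ∀ x, ct c w3 x = ct c w2 x + w2 y0 := by
        intro x
        have a1 := ct_le hc hw3c hw2c (ε := - w2 y0) (fun y => by simp only [hw3]; linarith) x
        have a2 := ct_le hc hw2c hw3c (ε := w2 y0) (fun y => by simp only [hw3]; linarith) x
        linarith
      simp only [hJ]
      simp_rw [e, hw3]
      rw [integral_add (iμ (ct_cont hc hw2c)) (integrable_const _),
        integral_sub (iν hw2c) (integrable_const _)]
      simp
    rw [h2] at h1
    exact h1.trans (hcc w hw).2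
  have hu := ct_cont hc v0.continuous
  refine ⟨ct c v0, ct (Function.swap c) (ct c v0), hu, ct_cont hc' hu, (hcc _ v0.continuous).1.symm,
    rfl, fun w hw => ?_⟩
  have h1 := (hcc _ v0.continuous).2
  have h2 := hmin w hw
  simp only [hJ, (hcc _ v0.continuous).1] at h1 h2
  linarith

/-- derivative of the c-transform. -/
lemma ct_lim {c : X → Y → ℝ} (hc : Continuous (Function.uncurry c)) {v h : Y → ℝ}
    (hv : Continuous v) (hh : Continuous h) {H : ℝ} (hH : ∀ y, |h y| ≤ H) (x : X) :
    (∀ t : ℝ, 0 < t → |(ct c (fun y => v y + t * h y) x - ct c v x) / t| ≤ H) ∧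
    ∀ y, (∀ y', ct c v x + v y' + c x y' = 0 ↔ y' = y) → Tendsto (fun k : ℕ =>
      (ct c (fun y => v y + (1 / ((k : ℝ) + 1)) * h y) x - ct c v x) / (1 / ((k : ℝ) + 1))) atTop
        (𝓝 (-h y)) := by
  have hvt : ∀ t : ℝ, Continuous fun y => v y + t * h y := fun t => by fun_prop
  constructor
  · intro t ht
    have h1 := ct_le hc hv (hvt t) (ε := t * H) (fun y => by
      have := abs_le.1 (hH y); nlinarith) x
    have h2 := ct_le hc (hvt t) hv (ε := t * H) (fun y => by
      have := abs_le.1 (hH y); nlinarith) x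
    rw [abs_le, le_div_iff₀ ht, div_le_iff₀ ht]
    constructor <;> linarith
  · intro y hy
    have e0 : ct c v x + v y + c x y = 0 := (hy y).2 rfl
    have hlow : ∀ t : ℝ, 0 < t → -h y ≤ (ct c (fun y => v y + t * h y) x - ct c v x) / t := by
      intro t ht
      have := (ct_spec hc (hvt t) x).2 y
      rw [le_div_iff₀ ht]; linarith
    rw [Metric.tendsto_atTop]
    intro ε hε
    obtain ⟨δ, hδ, hF⟩ : ∃ δ > 0, ∀ y', h y' ≤ h y - ε / 2 → δ ≤ ct c v x + v y' + c x y' := by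
      have hFc : IsCompact {y' | h y' ≤ h y - ε / 2} := (isClosed_le hh continuous_const).isCompact
      have hcx : Continuous fun y => c x y := hc.comp (Continuous.prodMk_right x)
      rcases ({y' | h y' ≤ h y - ε / 2} : Set Y).eq_empty_or_nonempty with he | hne
      · exact ⟨1, one_pos, fun y' hy' => absurd (show y' ∈ {y' | h y' ≤ h y - ε / 2} from hy')
          (by rw [he]; simp)⟩
      · obtain ⟨z, hz, hz'⟩ := hFc.exists_isMinOn hne
          (f := fun y' => ct c v x + v y' + c x y') (by fun_prop)
        refine ⟨ct c v x + v z + c x z, ?_, fun y' hy' => hz' hy'⟩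
        have h1 := (ct_spec hc hv x).2 z
        refine lt_of_le_of_ne (by linarith) fun h2 => ?_
        have := (hy z).1 h2.symm
        subst this
        have : h z ≤ h z - ε / 2 := hz
        linarith
    have hH0 : 0 ≤ H := (abs_nonneg _).trans (hH y)
    obtain ⟨N, hN⟩ := exists_nat_gt (2 * H / δ)
    refine ⟨N, fun k hk => ?_⟩
    set t : ℝ := 1 / ((k : ℝ) + 1) with ht
    have ht0 : 0 < t := by positivity
    have htH : 2 * t * H < δ := by
      rw [ht]
      have : (N : ℝ) ≤ k := by exact_mod_cast hk
      rw [div_lt_iff₀ hδ] at hN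
      have h3 : 2 * H < ((k : ℝ) + 1) * δ := by nlinarith
      have h4 : (0:ℝ) < (k : ℝ) + 1 := by positivity
      rw [show 2 * (1 / ((k:ℝ) + 1)) * H = 2 * H / (k + 1) by ring, div_lt_iff₀ h4]
      linarith
    obtain ⟨⟨z, hz⟩, -⟩ := ct_spec hc (hvt t) x
    have h1 := (ct_spec hc hv x).2 z
    have h2 : h y - ε / 2 < h z := by
      by_contra hcon
      have := hF z (not_lt.1 hcon)
      have h3 := hlow t ht0
      rw [le_div_iff₀ ht0] at h3
      have h4 := abs_le.1 (hH z)
      have h5 := abs_le.1 (hH y)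
      nlinarith
    have h3 : (ct c (fun y => v y + t * h y) x - ct c v x) / t ≤ -h z := by
      rw [div_le_iff₀ ht0]; linarith
    have h4 := hlow t ht0
    rw [Real.dist_eq, abs_lt]
    constructor <;> linarith

lemma push [MeasurableSpace X] [BorelSpace X] [MeasurableSpace Y] [BorelSpace Y]
    {c : X → Y → ℝ} (hc : Continuous (Function.uncurry c)) (μ : Measure X) (ν : Measure Y)
    [IsProbabilityMeasure μ] [IsProbabilityMeasure ν] {u : X → ℝ} {v : Y → ℝ} (hu : Continuous u)
    (hv : Continuous v) (huv : u = ct c v) (hmin : ∀ w : Y → ℝ, Continuous w →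
      ∫ x, u x ∂μ + ∫ y, v y ∂ν ≤ ∫ x, ct c w x ∂μ + ∫ y, w y ∂ν)
    {g : X → Y} (hg : Measurable g)
    (hgu : ∀ᵐ x ∂μ, ∀ y', u x + v y' + c x y' = 0 ↔ y' = g x) : μ.map g = ν := by
  have iμ : ∀ {f : X → ℝ}, Continuous f → Integrable f μ := fun hf =>
    hf.integrable_of_hasCompactSupport (HasCompactSupport.of_compactSpace _)
  have iν : ∀ {f : Y → ℝ}, Continuous f → Integrable f ν := fun hf =>
    hf.integrable_of_hasCompactSupport (HasCompactSupport.of_compactSpace _)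
  have key : ∀ h : Y → ℝ, Continuous h → ∫ x, h (g x) ∂μ ≤ ∫ y, h y ∂ν := by
    intro h hh
    obtain ⟨H, hH⟩ : ∃ H : ℝ, ∀ y, |h y| ≤ H := by
      obtain ⟨K, hK⟩ := (isCompact_univ (X := Y)).exists_bound_of_continuousOn hh.continuousOn
      exact ⟨K, fun y => by simpa using hK y (mem_univ _)⟩
    have hvt : ∀ t : ℝ, Continuous fun y => v y + t * h y := fun t => by fun_prop
    have hlim : Tendsto (fun k : ℕ => ∫ x,
        (ct c (fun y => v y + (1 / ((k : ℝ) + 1)) * h y) x - ct c v x) / (1 / ((k : ℝ) + 1)) ∂μ)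
        atTop (𝓝 (∫ x, -h (g x) ∂μ)) := by
      refine tendsto_integral_of_dominated_convergence (fun _ => H) (fun k => ?_)
        (integrable_const _) (fun k => ?_) ?_
      · exact (((ct_cont hc (hvt _)).sub (ct_cont hc hv)).div_const _).aestronglyMeasurable
      · exact Eventually.of_forall fun x => (ct_lim hc hv hh hH x).1 _ (by positivity)
      · filter_upwards [hgu] with x hx
        refine (ct_lim hc hv hh hH x).2 _ ?_
        rw [← huv]; exact hx
    rw [integral_neg] at hlim
    have : -∫ y, h y ∂ν ≤ -∫ x, h (g x) ∂μ := by
      refine ge_of_tendsto' hlim fun k => ?_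
      set t : ℝ := 1 / ((k : ℝ) + 1) with ht
      have ht0 : 0 < t := by positivity
      rw [integral_div, integral_sub (iμ (ct_cont hc (hvt _))) (iμ (ct_cont hc hv)),
        le_div_iff₀ ht0]
      have h1 := hmin _ (hvt t)
      rw [integral_add (iν hv) (iν (by fun_prop)), integral_const_mul, huv] at h1
      linarith
    linarith
  have : IsProbabilityMeasure (μ.map g) := Measure.isProbabilityMeasure_map hg.aemeasurable
  refine ext_of_forall_integral_eq_of_IsFiniteMeasure fun f => ?_
  rw [integral_map hg.aemeasurable f.continuous.aestronglyMeasurable]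
  refine le_antisymm (key f f.continuous) ?_
  have := key (fun y => -f y) (by fun_prop)
  rw [integral_neg, integral_neg] at this
  linarith

/-- measurable selection of the unique contact point. -/
lemma sel [MeasurableSpace X] [BorelSpace X] [MeasurableSpace Y] [BorelSpace Y]
    {Φ : X → Y → ℝ} (hΦ : Continuous (Function.uncurry Φ)) (hex : ∀ x, ∃ y, Φ x y = 0) :
    ∃ g : X → Y, Measurable g ∧ (∀ x, Φ x (g x) = 0 ∨ ∃ y y', y ≠ y' ∧ Φ x y = 0 ∧ Φ x y' = 0) ∧
      MeasurableSet {x | ∃ y y', y ≠ y' ∧ Φ x y = 0 ∧ Φ x y' = 0} := by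
  set D : Set X := {x | ∃ y y', y ≠ y' ∧ Φ x y = 0 ∧ Φ x y' = 0} with hD
  have hcl : ∀ F : Set Y, IsClosed F → IsClosed {x | ∃ y ∈ F, Φ x y = 0} := by
    intro F hF
    have h1 : IsCompact ({z : X × Y | z.2 ∈ F} ∩ {z | Function.uncurry Φ z = 0}) :=
      ((hF.preimage continuous_snd).inter (isClosed_eq hΦ continuous_const)).isCompact
    have := (h1.image continuous_fst).isClosed
    convert this using 1
    ext x; simp
  have hDm : MeasurableSet D := by
    have e : D = ⋃ k : ℕ, {x | ∃ z : Y × Y, 1 / ((k : ℝ) + 1) ≤ dist z.1 z.2 ∧ Φ x z.1 = 0 ∧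
        Φ x z.2 = 0} := by
      ext x
      simp only [hD, mem_ofPred_eq, mem_iUnion]
      constructor
      · rintro ⟨y, y', hne, h1, h2⟩
        obtain ⟨k, hk⟩ := exists_nat_one_div_lt (dist_pos.2 hne)
        exact ⟨k, (y, y'), hk.le, h1, h2⟩
      · rintro ⟨k, z, hz, h1, h2⟩
        refine ⟨z.1, z.2, ?_, h1, h2⟩
        intro hh
        rw [hh, dist_self] at hz
        have : (0:ℝ) < 1 / ((k : ℝ) + 1) := by positivity
        linarith
    rw [e]
    refine MeasurableSet.iUnion fun k => IsClosed.measurableSet ?_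
    have hΦ' : Continuous fun z : X × Y => Φ z.1 z.2 := hΦ
    have h1 : IsCompact {z : X × (Y × Y) | 1 / ((k : ℝ) + 1) ≤ dist z.2.1 z.2.2 ∧ Φ z.1 z.2.1 = 0 ∧
        Φ z.1 z.2.2 = 0} := by
      refine IsClosed.isCompact ?_
      refine (isClosed_le (f := fun _ => 1 / ((k : ℝ) + 1)) (g := fun z : X × (Y × Y) => dist z.2.1 z.2.2) continuous_const (by fun_prop)).inter
        ((isClosed_eq ?_ continuous_const).inter (isClosed_eq ?_ continuous_const))
      · exact hΦ'.comp (continuous_fst.prodMk (continuous_fst.comp continuous_snd))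
      · exact hΦ'.comp (continuous_fst.prodMk (continuous_snd.comp continuous_snd))
    have := (h1.image continuous_fst).isClosed
    convert this using 1
    ext x; simp
  obtain ⟨y0⟩ := ‹Nonempty Y›
  classical
  choose s hs using hex
  refine ⟨fun x => if x ∈ D then y0 else s x, ?_, fun x => ?_, hDm⟩
  · refine measurable_of_isClosed fun F hF => ?_
    have e : (fun x => if x ∈ D then y0 else s x) ⁻¹' F =
        (D ∩ {x | y0 ∈ F}) ∪ (Dᶜ ∩ {x | ∃ y ∈ F, Φ x y = 0}) := by
      ext x
      by_cases hx : x ∈ D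
      · simp [hx]
      · simp only [mem_preimage, hx, if_false, mem_union, mem_inter_iff, false_and, mem_compl_iff,
          not_false_eq_true, true_and, false_or, mem_ofPred_eq]
        constructor
        · intro h; exact ⟨s x, h, hs x⟩
        · rintro ⟨y, hy, h0⟩
          have : y = s x := by
            by_contra hne
            exact hx ⟨y, s x, hne, h0, hs x⟩
          rwa [← this]
    rw [e]
    refine (hDm.inter ?_).union (hDm.compl.inter (hcl F hF).measurableSet)
    exact MeasurableSet.const _
  · by_cases hx : x ∈ D
    · right; exact hx
    · left; simp only [hx, if_false]; exact hs x

/-- mass balance for the contact set. -/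
lemma balance [MeasurableSpace X] [BorelSpace X] [MeasurableSpace Y] [BorelSpace Y]
    {Φ : X → Y → ℝ} (hΦ : Continuous (Function.uncurry Φ)) (μ : Measure X) (ν : Measure Y)
    {g : X → Y} (hg : Measurable g) (hmap : μ.map g = ν) (hg0 : ∀ᵐ x ∂μ, ∀ y, Φ x y = 0 ↔ y = g x)
    (hν : ∀ᵐ y ∂ν, ∀ x x', Φ x y = 0 → Φ x' y = 0 → x = x') {A : Set X} (hA : IsClosed A) :
    ν {y | ∃ x ∈ A, Φ x y = 0} = μ A ∧ ∀ B : Set Y, IsClosed B → μ {x | ∃ y ∈ B, Φ x y = 0} = ν B := by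
  have hcl : IsClosed {y | ∃ x ∈ A, Φ x y = 0} := by
    have h1 : IsCompact ({z : X × Y | z.1 ∈ A} ∩ {z | Function.uncurry Φ z = 0}) :=
      ((hA.preimage continuous_fst).inter (isClosed_eq hΦ continuous_const)).isCompact
    have := (h1.image continuous_snd).isClosed
    convert this using 1
    ext x; simp
  rw [← hmap] at hν
  have hν' := ae_of_ae_map hg.aemeasurable hν
  constructor
  · rw [← hmap, Measure.map_apply hg hcl.measurableSet]
    refine measure_congr ?_
    filter_upwards [hg0, hν'] with x h1 h2
    refine propext ⟨?_, ?_⟩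
    · rintro ⟨a, ha, h3⟩
      have := h2 a x h3 ((h1 _).2 rfl)
      rwa [this] at ha
    · intro hx
      exact ⟨x, hx, (h1 _).2 rfl⟩
  · intro B hB
    rw [← hmap, Measure.map_apply hg hB.measurableSet]
    refine measure_congr ?_
    filter_upwards [hg0] with x h1
    refine propext ⟨?_, ?_⟩
    · rintro ⟨y, hy, h0⟩
      rw [(h1 y).1 h0] at hy; exact hy
    · intro h; exact ⟨g x, h, (h1 _).2 rfl⟩

end dual
end FKM

open Set MeasureTheory Metric Bornology
open scoped ENNReal NNReal Pointwise

set_option linter.unusedVariables false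
set_option linter.unusedSectionVars false
namespace FKM
open scoped RealInnerProductSpace
open Filter Topology

/-- A pair of conjugate potentials. -/
structure Pot {n : ℕ} (C : Cost n) where
  u : Euc n → ℝ
  v : Euc n → ℝ
  hu : ContinuousOn u (closure C.U)
  hv : ContinuousOn v (closure C.V)
  nn : ∀ x ∈ closure C.U, ∀ y ∈ closure C.V, 0 ≤ u x + v y + C.c x y
  ex1 : ∀ x ∈ closure C.U, ∃ y ∈ closure C.V, u x + v y + C.c x y = 0
  ex2 : ∀ y ∈ closure C.V, ∃ x ∈ closure C.U, u x + v y + C.c x y = 0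

namespace Pot
variable {n : ℕ} {C : Cost n} (P : Pot C)

/-- contact relation. -/
def Gm (x y : Euc n) : Prop := x ∈ closure C.U ∧ y ∈ closure C.V ∧ P.u x + P.v y + C.c x y = 0

/-- exchange the roles of the variables. -/
def flip : Pot C.flip where
  u := P.v
  v := P.u
  hu := P.hv
  hv := P.hu
  nn := fun y hy x hx => by have := P.nn x hx y hy; simpa [Cost.flip, add_comm] using this
  ex1 := fun y hy => by
    obtain ⟨x, hx, h⟩ := P.ex2 y hy
    exact ⟨x, hx, by simpa [Cost.flip, add_comm] using h⟩
  ex2 := fun x hx => by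
    obtain ⟨y, hy, h⟩ := P.ex1 x hx
    exact ⟨y, hy, by simpa [Cost.flip, add_comm] using h⟩

lemma flip_Gm {x y : Euc n} : P.flip.Gm y x ↔ P.Gm x y := by
  simp only [Gm, flip, Cost.flip]
  constructor
  · rintro ⟨h1, h2, h3⟩; exact ⟨h2, h1, by linarith⟩
  · rintro ⟨h1, h2, h3⟩; exact ⟨h2, h1, by linarith⟩

end Pot

lemma Cost.p_bound {n : ℕ} (C : Cost n) : ∃ K : ℝ, 1 ≤ K ∧ ∀ x ∈ C.U, ∀ y ∈ closure C.V,
    ‖C.p x y‖ ≤ K := by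
  obtain ⟨K, hK1, hK⟩ := C.bounds
  refine ⟨K, hK1, fun x hx y hy => ?_⟩
  obtain ⟨a, ha, hat⟩ := mem_closure_iff_seq_limit.1 hy
  have h1 : Tendsto (fun k => C.p x (a k)) atTop (𝓝 (C.p x y)) :=
    (C.px_cont hx y hy).tendsto.comp (tendsto_nhdsWithin_iff.2
      ⟨hat, Eventually.of_forall fun k => subset_closure (ha k)⟩)
  refine le_of_tendsto' h1.norm fun k => ?_
  refine Cost.inner_bound (by linarith) fun ξ => ?_
  rw [C.p_inner hx (ha k), abs_neg, ← Cost.norm_inl]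
  exact (hK (x, a k) ⟨hx, ha k⟩).1 (ξ, 0)

lemma Cost.c_lip {n : ℕ} (C : Cost n) {K : ℝ} (hK : ∀ x ∈ C.U, ∀ y ∈ closure C.V, ‖C.p x y‖ ≤ K)
    {S : Set (Euc n)} (hS : Convex ℝ S) (hSU : S ⊆ C.U) {x x' y : Euc n} (hx : x ∈ S) (hx' : x' ∈ S)
    (hy : y ∈ closure C.V) : |C.c x' y - C.c x y| ≤ K * ‖x' - x‖ := by
  refine Convex.norm_image_sub_le_of_norm_hasFDerivWithin_le (f := fun x => C.c x y)
    (fun z hz => (C.hasGrad (hSU hz) hy).hasFDerivAt.hasFDerivWithinAt) (fun z hz => ?_) hS hx hx'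
  rw [LinearIsometryEquiv.norm_map, norm_neg]
  exact hK z (hSU hz) y hy

namespace Pot
variable {n : ℕ} {C : Cost n} (P : Pot C)

lemma u_lip {K : ℝ} (hK : ∀ x ∈ C.U, ∀ y ∈ closure C.V, ‖C.p x y‖ ≤ K)
    {S : Set (Euc n)} (hS : Convex ℝ S) (hSU : S ⊆ C.U) {x x' : Euc n} (hx : x ∈ S) (hx' : x' ∈ S) :
    |P.u x' - P.u x| ≤ K * ‖x' - x‖ := by
  have key : ∀ x x', x ∈ S → x' ∈ S → P.u x' - P.u x ≤ K * ‖x' - x‖ := by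
    intro x x' hx hx'
    obtain ⟨y, hy, h0⟩ := P.ex1 x' (subset_closure (hSU hx'))
    have h1 := P.nn x (subset_closure (hSU hx)) y hy
    have h2 := abs_le.1 (C.c_lip hK hS hSU hx hx' hy)
    linarith
  rw [abs_le]
  have h1 := key x x' hx hx'
  have h2 := key x' x hx' hx
  rw [norm_sub_rev] at h2
  constructor <;> linarith

lemma u_diff : ∀ᵐ x ∂(volume.restrict C.U), DifferentiableAt ℝ P.u x := by
  obtain ⟨K, hK1, hK⟩ := C.p_bound
  rw [ae_restrict_iff' C.hU.measurableSet, ae_iff]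
  refine measure_null_of_locally_null _ fun x hx => ?_
  have hxU : x ∈ C.U := by
    by_contra h
    exact hx fun h' => absurd h' h
  obtain ⟨r, hr, hb⟩ := Metric.isOpen_iff.1 C.hU x hxU
  refine ⟨{z | ¬ (z ∈ C.U → DifferentiableAt ℝ P.u z)} ∩ ball x r,
    inter_mem_nhdsWithin _ (ball_mem_nhds _ hr), ?_⟩
  have hl : LipschitzOnWith K.toNNReal P.u (ball x r) := by
    refine LipschitzOnWith.of_dist_le_mul fun a ha b hb' => ?_
    rw [Real.dist_eq, dist_eq_norm, Real.coe_toNNReal _ (by linarith)]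
    exact P.u_lip hK (convex_ball x r) hb hb' ha
  have h1 := hl.ae_differentiableWithinAt_of_mem (μ := volume)
  rw [ae_iff] at h1
  refine measure_mono_null (fun z hz => ?_) h1
  rintro h2
  exact hz.1 fun _ => (h2 hz.2).differentiableAt (isOpen_ball.mem_nhds hz.2)

lemma grad_eq {x y : Euc n} (hx : x ∈ C.U) (hd : DifferentiableAt ℝ P.u x) (h : P.Gm x y) :
    C.p x y = gradient P.u x := by
  have h1 := hd.hasGradientAt.hasFDerivAt
  have h2 := (C.hasGrad hx h.2.1).hasFDerivAt
  have hmin : IsLocalMin (fun z => P.u z + C.c z y) x := by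
    filter_upwards [C.hU.mem_nhds hx] with z hz
    have := P.nn z (subset_closure hz) y h.2.1
    have := h.2.2
    linarith
  have h3 := hmin.hasFDerivAt_eq_zero (h1.fun_add h2)
  rw [← map_add] at h3
  have h4 := (LinearIsometryEquiv.map_eq_zero_iff _).1 h3
  rw [← sub_eq_zero, ← neg_eq_zero, ← h4]
  abel

lemma uniq {x y y' : Euc n} (hx : x ∈ C.U) (hd : DifferentiableAt ℝ P.u x) (h : P.Gm x y)
    (h' : P.Gm x y') : y = y' :=
  C.px_inj hx h.2.1 h'.2.1 ((P.grad_eq hx hd h).trans (P.grad_eq hx hd h').symm)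

end Pot

lemma meas_ext {E : Type*} [TopologicalSpace E] [MeasurableSpace E] [OpensMeasurableSpace E]
    {S : Set E} (hS : IsClosed S) {φ : E → ℝ} (hφ : ContinuousOn φ S) :
    Measurable (S.indicator φ) := by
  classical
  rw [← piecewise_eq_indicator]
  exact hφ.measurable_piecewise continuousOn_const hS.measurableSet

lemma opt_aux {E : Type*} [TopologicalSpace E] [MeasurableSpace E] [BorelSpace E]
    [SecondCountableTopology E] [T2Space E]
    {X Y : Set E} (hX : IsCompact X) (hY : IsCompact Y) {c : E → E → ℝ}
    (hc : ContinuousOn (Function.uncurry c) (X ×ˢ Y)) {v : E → ℝ} (hv : ContinuousOn v Y)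
    {μ ν : Measure E} [IsProbabilityMeasure μ] [IsProbabilityMeasure ν] (hμ : ∀ᵐ x ∂μ, x ∈ X)
    (hν : ∀ᵐ y ∂ν, y ∈ Y) {H : E → E} (hH : Measurable H) (hmap : μ.map H = ν) :
    (∀ᵐ x ∂μ, H x ∈ Y) ∧ Integrable (fun x => c x (H x)) μ ∧ Integrable (fun x => v (H x)) μ ∧
      ∫ x, v (H x) ∂μ = ∫ y, v y ∂ν := by
  have h1 : ∀ᵐ x ∂μ, H x ∈ Y := by
    rw [← hmap] at hν
    exact ae_of_ae_map hH.aemeasurable hν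
  have m1 := meas_ext (hX.prod hY).isClosed hc
  have m2 := meas_ext hY.isClosed hv
  obtain ⟨K, hK⟩ := (hX.prod hY).exists_bound_of_continuousOn hc
  obtain ⟨K', hK'⟩ := hY.exists_bound_of_continuousOn hv
  have e2 : v =ᵐ[ν] Y.indicator v := by
    filter_upwards [hν] with y hy using (indicator_of_mem hy v).symm
  have m2' : AEStronglyMeasurable v ν := m2.aestronglyMeasurable.congr e2.symm
  refine ⟨h1, ?_, ?_, ?_⟩
  · refine Integrable.mono' (integrable_const K) ?_ ?_
    · refine ((m1.comp (measurable_id.prodMk hH)).aestronglyMeasurable (μ := μ)).congr ?_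
      filter_upwards [hμ, h1] with x h2 h3
      exact indicator_of_mem (s := X ×ˢ Y) ⟨h2, h3⟩ _
    · filter_upwards [hμ, h1] with x h2 h3
      exact hK (x, H x) ⟨h2, h3⟩
  · refine Integrable.mono' (integrable_const K') ?_ ?_
    · refine ((m2.comp hH).aestronglyMeasurable (μ := μ)).congr ?_
      filter_upwards [h1] with x h3
      exact indicator_of_mem h3 _
    · filter_upwards [h1] with x h3
      exact hK' _ h3
  · rw [← hmap] at m2' ⊢
    rw [integral_map hH.aemeasurable m2']

lemma dens_ae {n : ℕ} {A : Set (Euc n)} (hA : MeasurableSet A) (f : Euc n → ℝ) {p : Euc n → Prop}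
    (h : ∀ᵐ x ∂(volume.restrict A), p x) : ∀ᵐ x ∂(densMeasure n A f), p x :=
  (withDensity_absolutelyContinuous _ _) h

theorem exists_pot {n : ℕ} (C : Cost n) (fp fm : Euc n → ℝ)
    (i1 : IsProbabilityMeasure (densMeasure n C.U fp))
    (i2 : IsProbabilityMeasure (densMeasure n C.V fm)) :
    ∃ P : Pot C, ∃ G : Euc n → Euc n, Measurable G ∧ MapsTo G (closure C.U) (closure C.V) ∧
      Measure.map G (densMeasure n C.U fp) = densMeasure n C.V fm ∧
      (∀ H : Euc n → Euc n, Measurable H →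
        Measure.map H (densMeasure n C.U fp) = densMeasure n C.V fm →
        ∫ x, C.c x (G x) ∂(densMeasure n C.U fp) ≤ ∫ x, C.c x (H x) ∂(densMeasure n C.U fp)) ∧
      (∀ x ∈ closure C.U, P.Gm x (G x) ∨ ∃ y y', y ≠ y' ∧ P.Gm x y ∧ P.Gm x y') ∧
      (∀ A ⊆ closure C.U, IsCompact A →
        densMeasure n C.V fm {y | ∃ x ∈ A, P.Gm x y} = densMeasure n C.U fp A) ∧
      (∀ A ⊆ closure C.V, IsCompact A →
        densMeasure n C.U fp {x | ∃ y ∈ A, P.Gm x y} = densMeasure n C.V fm A) := by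
  set μ := densMeasure n C.U fp with hμdef
  set ν := densMeasure n C.V fm with hνdef
  set X := closure C.U with hXdef
  set Y := closure C.V with hYdef
  have cX : IsCompact X := C.cU
  have cY : IsCompact Y := C.cV
  have hμU : ∀ᵐ x ∂μ, x ∈ C.U := dens_ae C.hU.measurableSet fp (ae_restrict_mem C.hU.measurableSet)
  have hνV : ∀ᵐ x ∂ν, x ∈ C.V := dens_ae C.hV.measurableSet fm (ae_restrict_mem C.hV.measurableSet)
  have hμX : ∀ᵐ x ∂μ, x ∈ X := hμU.mono fun x hx => subset_closure hx
  have hνY : ∀ᵐ x ∂ν, x ∈ Y := hνV.mono fun x hx => subset_closure hx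
  have neX : X.Nonempty := hμX.exists
  have neY : Y.Nonempty := hνY.exists
  have : CompactSpace X := isCompact_iff_compactSpace.1 cX
  have : CompactSpace Y := isCompact_iff_compactSpace.1 cY
  have : Nonempty X := neX.to_subtype
  have : Nonempty Y := neY.to_subtype
  have mX : MeasurableSet X := isClosed_closure.measurableSet
  have mY : MeasurableSet Y := isClosed_closure.measurableSet
  set μX : Measure X := μ.comap Subtype.val with hμXd
  set νY : Measure Y := ν.comap Subtype.val with hνYd
  have eμ : μX.map Subtype.val = μ := by
    rw [hμXd, map_comap_subtype_coe mX, Measure.restrict_eq_self_of_ae_mem hμX]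
  have eν : νY.map Subtype.val = ν := by
    rw [hνYd, map_comap_subtype_coe mY, Measure.restrict_eq_self_of_ae_mem hνY]
  have : IsProbabilityMeasure μX := by
    constructor
    have := measure_univ (μ := μ)
    rwa [← eμ, Measure.map_apply measurable_subtype_coe MeasurableSet.univ, preimage_univ] at this
  have : IsProbabilityMeasure νY := by
    constructor
    have := measure_univ (μ := ν)
    rwa [← eν, Measure.map_apply measurable_subtype_coe MeasurableSet.univ, preimage_univ] at this
  set c' : X → Y → ℝ := fun x y => C.c x y with hc'
  have hcc : Continuous (Function.uncurry c') := by
    have := C.cont_f.comp_continuous (f := fun z : X × Y => ((z.1 : Euc n), (z.2 : Euc n)))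
      (by fun_prop) (fun z => ⟨z.1.2, z.2.2⟩)
    exact this
  obtain ⟨u, v, hu, hv, huv, hvu, hmin⟩ := exists_min hcc μX νY
  classical
  set P : Pot C :=
    { u := fun x => if h : x ∈ X then u ⟨x, h⟩ else 0
      v := fun y => if h : y ∈ Y then v ⟨y, h⟩ else 0
      hu := by
        rw [continuousOn_iff_continuous_domRestrict]
        refine hu.congr fun x => ?_
        have := x.2
        simp
      hv := by
        rw [continuousOn_iff_continuous_domRestrict]
        refine hv.congr fun x => ?_
        have := x.2
        simp
      nn := by
        intro x hx y hy
        rw [dif_pos hx, dif_pos hy]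
        have := (ct_spec hcc hv ⟨x, hx⟩).2 ⟨y, hy⟩
        rw [← huv] at this
        simp only [hc'] at this
        linarith
      ex1 := by
        intro x hx
        obtain ⟨⟨y, hy⟩, -⟩ := ct_spec hcc hv ⟨x, hx⟩
        refine ⟨y, y.2, ?_⟩
        rw [dif_pos hx, dif_pos y.2, huv, hy]
        simp only [hc']
        ring
      ex2 := by
        intro y hy
        obtain ⟨⟨x, hx⟩, -⟩ := ct_spec (flip_cont hcc) hu ⟨y, hy⟩
        refine ⟨x, x.2, ?_⟩
        rw [dif_pos hy, dif_pos x.2, hvu, hx]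
        simp only [hc', Function.swap]
        ring } with hP
  have hGm : ∀ (x : X) (y : Y), P.Gm x y ↔ u x + v y + c' x y = 0 := by
    intro x y
    have hx := x.2
    have hy := y.2
    simp only [Pot.Gm, hP]
    rw [dif_pos hx, dif_pos hy]
    exact ⟨fun h => h.2.2, fun h => ⟨hx, hy, h⟩⟩
  have hΦ : Continuous (Function.uncurry fun x y => u x + v y + c' x y) :=
    ((hu.comp continuous_fst).add (hv.comp continuous_snd)).add hcc
  have hun1 : ∀ᵐ x ∂μ, ∀ y y', P.Gm x y → P.Gm x y' → y = y' := by
    filter_upwards [dens_ae C.hU.measurableSet fp P.u_diff, hμU] with x h1 h2 y y' h3 h4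
    exact P.uniq h2 h1 h3 h4
  have hun2 : ∀ᵐ y ∂ν, ∀ x x', P.Gm x y → P.Gm x' y → x = x' := by
    filter_upwards [dens_ae C.hV.measurableSet fm P.flip.u_diff, hνV] with y h1 h2 x x' h3 h4
    exact P.flip.uniq h2 h1 (P.flip_Gm.2 h3) (P.flip_Gm.2 h4)
  obtain ⟨g, hg, hg0, -⟩ := sel hΦ (fun x => by
    obtain ⟨⟨y, hy⟩, -⟩ := ct_spec hcc hv x
    refine ⟨y, ?_⟩
    rw [huv, hy]
    simp only [hc']
    ring)
  have hgu : ∀ᵐ x ∂μX, ∀ y', u x + v y' + c' x y' = 0 ↔ y' = g x := by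
    rw [← eμ] at hun1
    filter_upwards [ae_of_ae_map measurable_subtype_coe.aemeasurable hun1] with x hx y'
    have hgx : u x + v (g x) + c' x (g x) = 0 := by
      rcases hg0 x with h | ⟨y, y', hne, h1, h2⟩
      · exact h
      · exact absurd (Subtype.ext (hx y y' ((hGm _ _).2 h1) ((hGm _ _).2 h2))) hne
    constructor
    · intro h
      exact Subtype.ext (hx y' (g x) ((hGm _ _).2 h) ((hGm _ _).2 hgx))
    · rintro rfl; exact hgx
  have hmap := push hcc μX νY hu hv huv hmin hg hgu
  obtain ⟨y0, hy0⟩ := neY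
  set G : Euc n → Euc n := fun x => if h : x ∈ X then ((g ⟨x, h⟩ : Y) : Euc n) else y0 with hG
  have hGm' : Measurable G :=
    Measurable.dite (s := X) (f := fun x : X => ((g x : Y) : Euc n)) (g := fun _ => y0)
      (measurable_subtype_coe.comp hg) measurable_const mX
  have hGg : ∀ x : X, G x = g x := fun x => by simp only [hG]; rw [dif_pos x.2]
  have hGmap : μ.map G = ν := by
    rw [← eμ, Measure.map_map hGm' measurable_subtype_coe, ← eν, ← hmap,
      Measure.map_map measurable_subtype_coe hg]
    congr 1
    ext1 x
    exact hGg x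
  have hGae : ∀ᵐ x ∂μ, P.Gm x (G x) := by
    have hms : ∀ᵐ x : X ∂μX, P.Gm x (G x) := by
      filter_upwards [hgu] with x hx
      rw [hGg, hGm]
      exact (hx _).2 rfl
    rw [← eμ]
    exact ((MeasurableEmbedding.subtype_coe mX).ae_map_iff).2 hms
  have hbal := fun {A : Set X} => balance (A := A) hΦ μX νY hg hmap hgu (by
    rw [← eν] at hun2
    filter_upwards [ae_of_ae_map measurable_subtype_coe.aemeasurable hun2] with y hy x x' h1 h2
    exact Subtype.ext (hy x x' ((hGm _ _).2 h1) ((hGm _ _).2 h2)))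
  have aμ : ∀ S : Set (Euc n), μ S = μX ((Subtype.val : X → Euc n) ⁻¹' S) := fun S => by
    rw [← (MeasurableEmbedding.subtype_coe mX).map_apply μX S, eμ]
  have aν : ∀ S : Set (Euc n), ν S = νY ((Subtype.val : Y → Euc n) ⁻¹' S) := fun S => by
    rw [← (MeasurableEmbedding.subtype_coe mY).map_apply νY S, eν]
  refine ⟨P, G, hGm', ?_, hGmap, ?_, ?_, ?_, ?_⟩
  · intro x hx
    rw [hGg ⟨x, hx⟩]
    exact (g ⟨x, hx⟩).2
  · intro H hH hHmap
    obtain ⟨a1, a2, a3, a4⟩ := opt_aux cX cY C.cont_f P.hv hμX hνY hH hHmap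
    obtain ⟨b1, b2, b3, b4⟩ := opt_aux cX cY C.cont_f P.hv hμX hνY hGm' hGmap
    obtain ⟨-, -, d3, d4⟩ := opt_aux cX cX (c := fun _ _ => 0) (v := P.u) continuousOn_const
      P.hu hμX hμX (H := id) measurable_id (Measure.map_id)
    have d3' : Integrable P.u μ := d3
    have d5 : Integrable (fun x => -P.u x) μ := d3'.neg
    have e1 : ∫ x, C.c x (G x) ∂μ = ∫ x, (-P.u x - P.v (G x)) ∂μ := by
      refine integral_congr_ae ?_
      filter_upwards [hGae] with x hx
      have := hx.2.2
      linarith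
    have e2 : ∫ x, (-P.u x - P.v (H x)) ∂μ ≤ ∫ x, C.c x (H x) ∂μ := by
      refine integral_mono_ae (d5.sub a3) a2 ?_
      filter_upwards [hμX, a1] with x h1 h2
      have := P.nn x h1 _ h2
      show -P.u x - P.v (H x) ≤ C.c x (H x)
      linarith
    have e3 : ∫ x, (-P.u x - P.v (G x)) ∂μ = ∫ x, (-P.u x - P.v (H x)) ∂μ := by
      rw [integral_sub d5 b3, integral_sub d5 a3, a4, b4]
    rw [e1, e3]
    exact e2
  · intro x hx
    rcases hg0 ⟨x, hx⟩ with h | ⟨y, y', hne, h1, h2⟩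
    · left
      have := (hGm ⟨x, hx⟩ (g ⟨x, hx⟩)).2 h
      rwa [← hGg] at this
    · right
      exact ⟨y, y', fun h => hne (Subtype.ext h), (hGm ⟨x, hx⟩ y).2 h1, (hGm ⟨x, hx⟩ y').2 h2⟩
  · intro A hA hAc
    rw [aμ, aν, ← (hbal (hAc.isClosed.preimage continuous_subtype_val)).1]
    congr 1
    ext y
    constructor
    · rintro ⟨x, hx, h⟩
      exact ⟨⟨x, hA hx⟩, hx, (hGm ⟨x, hA hx⟩ y).1 h⟩
    · rintro ⟨x, hx, h⟩
      exact ⟨x, hx, (hGm x y).2 h⟩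
  · intro A hA hAc
    rw [aμ, aν, ← (hbal isClosed_empty).2 _ (hAc.isClosed.preimage continuous_subtype_val)]
    congr 1
    ext x
    constructor
    · rintro ⟨y, hy, h⟩
      exact ⟨⟨y, hA hy⟩, hy, (hGm x ⟨y, hA hy⟩).1 h⟩
    · rintro ⟨y, hy, h⟩
      exact ⟨y, hy, (hGm x y).2 h⟩

end FKM

open Set MeasureTheory Metric Bornology
open scoped ENNReal NNReal Pointwise

set_option linter.unusedVariables false
set_option linter.unusedSectionVars false
namespace FKM
open scoped RealInnerProductSpace
open Filter Topology

lemma vol_lip {n : ℕ} {f : Euc n → Euc n} {S : Set (Euc n)} {L : ℝ} (hL : 0 ≤ L)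
    (h : ∀ y ∈ S, ∀ y' ∈ S, ‖f y - f y'‖ ≤ L * ‖y - y'‖) :
    volume (f '' S) ≤ ENNReal.ofReal (L ^ n) * volume S := by
  have hl : LipschitzOnWith L.toNNReal f S := by
    refine LipschitzOnWith.of_dist_le_mul fun y hy y' hy' => ?_
    rw [dist_eq_norm, dist_eq_norm, Real.coe_toNNReal L hL]; exact h y hy y' hy'
  have h1 := hl.hausdorffMeasure_image_le (d := (n : ℝ)) (by positivity)
  have h2 : (volume : Measure (Euc n)) = Measure.addHaarScalarFactor (volume : Measure (Euc n))
      μH[(n:ℝ)] • μH[(n:ℝ)] :=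
    Measure.isAddLeftInvariant_eq_smul _ _
  rw [h2]
  simp only [Measure.smul_apply, ENNReal.smul_def, smul_eq_mul]
  calc _ ≤ _ := mul_le_mul_right h1 _
    _ = _ := by
      rw [ENNReal.rpow_natCast, ENNReal.ofReal_pow hL]
      change _ * (ENNReal.ofReal L ^ n * _) = _
      ring

lemma vol_colip {n : ℕ} {f : Euc n → Euc n} {S : Set (Euc n)} {L : ℝ} (hL : 0 ≤ L)
    (h : ∀ y ∈ S, ∀ y' ∈ S, ‖y - y'‖ ≤ L * ‖f y - f y'‖) :
    volume S ≤ ENNReal.ofReal (L ^ n) * volume (f '' S) := by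
  have hi : InjOn f S := fun y hy y' hy' e => by
    have := h y hy y' hy'
    rw [e, sub_self, norm_zero, mul_zero] at this
    exact sub_eq_zero.1 (norm_le_zero_iff.1 this)
  have h1 : Function.invFunOn f S '' (f '' S) = S := hi.invFunOn_image subset_rfl
  have := vol_lip (f := Function.invFunOn f S) (S := f '' S) hL (by
    rintro _ ⟨y, hy, rfl⟩ _ ⟨y', hy', rfl⟩
    rw [hi.leftInvOn_invFunOn hy, hi.leftInvOn_invFunOn hy']; exact h y hy y' hy')
  rwa [h1] at this

lemma Cost.bdry_null {n : ℕ} (C : Cost n) (hU : C.U.Nonempty) :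
    volume (closure C.V \ C.V) = 0 := by
  obtain ⟨x, hx⟩ := hU
  obtain ⟨L, hL1, hL⟩ := C.lip0 hx
  have h1 := vol_colip (f := C.p x) (S := closure C.V \ C.V) (by linarith : 0 ≤ L)
    fun y hy y' hy' => hL y hy.1 y' hy'.1
  have h2 : C.p x '' (closure C.V \ C.V) ⊆ frontier (C.Vx x) := by
    rintro _ ⟨y, hy, rfl⟩
    rw [(C.Vx_open hx).frontier_eq, ← C.img_closure hx]
    refine ⟨⟨y, hy.1, rfl⟩, ?_⟩
    rintro ⟨y', hy', e⟩
    have := C.px_inj hx (subset_closure hy') hy.1 e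
    exact hy.2 (this ▸ hy')
  have h3 : volume (C.p x '' (closure C.V \ C.V)) = 0 :=
    measure_mono_null h2 ((C.Vx_convex hx).addHaar_frontier volume)
  rw [h3, mul_zero] at h1
  exact le_antisymm h1 bot_le

lemma dens_le {n : ℕ} {A S : Set (Euc n)} (hA : MeasurableSet A) (hS : MeasurableSet S)
    {f : Euc n → ℝ} {K : ℝ} (h : ∀ x ∈ S ∩ A, f x ≤ K) :
    densMeasure n A f S ≤ ENNReal.ofReal K * volume S := by
  rw [densMeasure, withDensity_apply _ hS, Measure.restrict_restrict hS]
  calc _ ≤ ∫⁻ x in S ∩ A, ENNReal.ofReal K :=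
        setLIntegral_mono' (hS.inter hA) fun x hx => ENNReal.ofReal_le_ofReal (h x hx)
    _ = ENNReal.ofReal K * volume (S ∩ A) := setLIntegral_const _ _
    _ ≤ _ := by gcongr; exact inter_subset_left

lemma dens_ge {n : ℕ} {A S : Set (Euc n)} (hA : MeasurableSet A) (hS : MeasurableSet S)
    (hSA : S ⊆ closure A) (h0 : volume (closure A \ A) = 0)
    {f : Euc n → ℝ} {K : ℝ} (h : ∀ x ∈ S ∩ A, K ≤ f x) :
    ENNReal.ofReal K * volume S ≤ densMeasure n A f S := by
  rw [densMeasure, withDensity_apply _ hS, Measure.restrict_restrict hS]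
  calc _ ≤ ENNReal.ofReal K * (volume (S ∩ A) + volume (closure A \ A)) := by
        gcongr
        refine le_trans (measure_mono ?_) (measure_union_le _ _)
        intro x hx
        by_cases hxA : x ∈ A
        · exact Or.inl ⟨hx, hxA⟩
        · exact Or.inr ⟨hSA hx, hxA⟩
    _ = ∫⁻ x in S ∩ A, ENNReal.ofReal K := by rw [h0, add_zero, setLIntegral_const]
    _ ≤ _ := setLIntegral_mono' (hS.inter hA) fun x hx => ENNReal.ofReal_le_ofReal (h x hx)

lemma dens_pos {n : ℕ} {A : Set (Euc n)} (hA : MeasurableSet A) {f : Euc n → ℝ}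
    (i : IsProbabilityMeasure (densMeasure n A f)) : ∃ x ∈ A, 0 < f x := by
  by_contra hc
  push Not at hc
  have h := dens_le (S := univ) hA MeasurableSet.univ (f := f) (K := 0) fun x hx => hc x hx.2
  rw [measure_univ, ENNReal.ofReal_zero, zero_mul] at h
  simp at h

namespace Pot
variable {n : ℕ} {C : Cost n} (P : Pot C)

/-- image of a set under the contact relation. -/
def Gam (A : Set (Euc n)) : Set (Euc n) := {y | ∃ x ∈ A, P.Gm x y}

/-- lower bound on the Monge-Ampere measure. -/
def MAlo (lam : ℝ) (N : Set (Euc n)) : Prop :=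
  ∀ A ⊆ N, IsCompact A → ENNReal.ofReal lam * volume A ≤ volume (P.Gam A)

/-- upper bound on the Monge-Ampere measure. -/
def MAup (lam : ℝ) (N : Set (Euc n)) : Prop :=
  ∀ A ⊆ N, IsCompact A → volume (P.Gam A) ≤ ENNReal.ofReal lam * volume A

lemma Gam_sub (A : Set (Euc n)) : P.Gam A ⊆ closure C.V := fun y ⟨x, _, h⟩ => h.2.1

lemma Gm_compact : IsCompact {z : Euc n × Euc n | P.Gm z.1 z.2} := by
  have hX : IsCompact (closure C.U ×ˢ closure C.V) := C.cU.prod C.cV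
  have hcont : ContinuousOn (fun z : Euc n × Euc n => P.u z.1 + P.v z.2 + C.f z)
      (closure C.U ×ˢ closure C.V) :=
    ((P.hu.comp continuous_fst.continuousOn fun z hz => hz.1).add
      (P.hv.comp continuous_snd.continuousOn fun z hz => hz.2)).add C.cont_f
  have h := hcont.preimage_isClosed_of_isClosed hX.isClosed (isClosed_singleton (x := (0:ℝ)))
  have h2 : {z : Euc n × Euc n | P.Gm z.1 z.2} = (closure C.U ×ˢ closure C.V) ∩
      (fun z : Euc n × Euc n => P.u z.1 + P.v z.2 + C.f z) ⁻¹' {0} := by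
    ext z
    exact ⟨fun ⟨a, b, c⟩ => ⟨⟨a, b⟩, c⟩, fun ⟨⟨a, b⟩, c⟩ => ⟨a, b, c⟩⟩
  rw [h2]; exact hX.of_isClosed_subset h inter_subset_left

lemma Gam_compact {A : Set (Euc n)} (hA : IsCompact A) : IsCompact (P.Gam A) := by
  have h : IsCompact ({z : Euc n × Euc n | P.Gm z.1 z.2} ∩ Prod.fst ⁻¹' A) :=
    P.Gm_compact.inter_right (hA.isClosed.preimage continuous_fst)
  have h2 : P.Gam A = Prod.snd '' ({z : Euc n × Euc n | P.Gm z.1 z.2} ∩ Prod.fst ⁻¹' A) := by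
    ext y; constructor
    · rintro ⟨x, hx, h⟩; exact ⟨(x, y), ⟨h, hx⟩, rfl⟩
    · rintro ⟨⟨x, y'⟩, ⟨h, hx⟩, rfl⟩; exact ⟨x, hx, h⟩
  rw [h2]; exact h.image continuous_snd

end Pot

lemma cancel_mul {a b : ℝ} (ha : 0 < a) {s t : ℝ≥0∞}
    (h : ENNReal.ofReal a * s ≤ ENNReal.ofReal b * t) : ENNReal.ofReal (b / a) * t ≥ s := by
  rw [div_eq_inv_mul, ENNReal.ofReal_mul (by positivity), ENNReal.ofReal_inv_of_pos ha, mul_assoc]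
  have h0 : ENNReal.ofReal a ≠ 0 := by simpa using ha
  calc s = (ENNReal.ofReal a)⁻¹ * (ENNReal.ofReal a * s) := by
        rw [← mul_assoc, ENNReal.inv_mul_cancel h0 ENNReal.ofReal_ne_top, one_mul]
    _ ≤ _ := by gcongr

lemma cancel_mul' {a b : ℝ} (ha : 0 < a) (hb : 0 < b) {s t : ℝ≥0∞}
    (h : ENNReal.ofReal a * s ≤ ENNReal.ofReal b * t) : ENNReal.ofReal (a / b) * s ≤ t := by
  rw [div_eq_inv_mul, ENNReal.ofReal_mul (by positivity), ENNReal.ofReal_inv_of_pos hb, mul_assoc]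
  have h0 : ENNReal.ofReal b ≠ 0 := by simpa using hb
  calc _ ≤ (ENNReal.ofReal b)⁻¹ * (ENNReal.ofReal b * t) := by gcongr
    _ = t := by
        rw [← mul_assoc, ENNReal.inv_mul_cancel h0 ENNReal.ofReal_ne_top, one_mul]

theorem MA_bounds {n : ℕ} {C : Cost n} (P : Pot C) {fp fm : Euc n → ℝ} {U' : Set (Euc n)} {M : ℝ}
    (hU' : U' ⊆ C.U) (hne : U'.Nonempty)
    (i1 : IsProbabilityMeasure (densMeasure n C.U fp))
    (i2 : IsProbabilityMeasure (densMeasure n C.V fm))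
    (h0 : ∀ x, 0 ≤ fp x) (h0' : ∀ x, 0 ≤ fm x)
    (h1 : ∃ K : ℝ, ∀ x ∈ C.U, ∀ y ∈ C.V, fp x ≤ K * fm y)
    (h2 : ∃ K : ℝ, ∀ x ∈ U', ∀ y ∈ C.V, fm y ≤ K * fp x)
    (h3 : ∀ x ∈ U', ∀ y ∈ C.V, |Real.log (fp x / fm y)| ≤ M)
    (hp1 : ∀ A ⊆ closure C.U, IsCompact A →
        densMeasure n C.V fm {y | ∃ x ∈ A, P.Gm x y} = densMeasure n C.U fp A)
    (hp2 : ∀ A ⊆ closure C.V, IsCompact A →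
        densMeasure n C.U fp {x | ∃ y ∈ A, P.Gm x y} = densMeasure n C.V fm A) :
    (∃ lam : ℝ, 0 < lam ∧ P.flip.MAlo lam C.V) ∧ (∃ Lam : ℝ, 0 < Lam ∧ P.MAup Lam (closure C.U)) ∧
    P.MAlo (Real.exp (-(3 * M))) U' ∧
    ∀ N ⊆ closure C.V, P.flip.Gam N ⊆ U' →
      P.flip.MAlo (Real.exp (-(3 * M))) N ∧ P.flip.MAup (Real.exp (3 * M)) N := by
  obtain ⟨x0, hx0, hf0⟩ := dens_pos C.hU.measurableSet i1
  obtain ⟨y0, hy0, hg0⟩ := dens_pos C.hV.measurableSet i2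
  obtain ⟨K, hK⟩ := h1
  obtain ⟨K', hK'⟩ := h2
  have nV : volume (closure C.V \ C.V) = 0 := C.bdry_null ⟨x0, hx0⟩
  have nU : volume (closure C.U \ C.U) = 0 := C.flip.bdry_null ⟨y0, hy0⟩
  have hKpos : 0 < K := by
    by_contra hc
    have := hK x0 hx0 y0 hy0
    nlinarith [mul_nonneg (neg_nonneg.2 (not_lt.1 hc)) hg0.le]
  set m := fp x0 / K with hm
  have hmpos : 0 < m := by positivity
  have hmle : ∀ y ∈ C.V, m ≤ fm y := fun y hy => by
    rw [hm, div_le_iff₀' hKpos]; exact hK x0 hx0 y hy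
  set Kp := K * fm y0 with hKp
  have hKppos : 0 < Kp := by positivity
  have hfmpos : ∀ y ∈ C.V, 0 < fm y := fun y hy => hmpos.trans_le (hmle y hy)
  have hfppos : ∀ x ∈ U', 0 < fp x := fun x hx => by
    have h := hK' x hx y0 hy0
    rcases (h0 x).lt_or_eq with h' | h'
    · exact h'
    · rw [← h', mul_zero] at h; linarith
  have hup : ∀ x ∈ U', ∀ y ∈ C.V, fp x ≤ Real.exp M * fm y := fun x hx y hy => by
    have h := (abs_le.1 (h3 x hx y hy)).2
    rw [Real.log_le_iff_le_exp (div_pos (hfppos x hx) (hfmpos y hy)),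
      div_le_iff₀ (hfmpos y hy)] at h
    exact h
  have hlo : ∀ x ∈ U', ∀ y ∈ C.V, Real.exp (-M) * fm y ≤ fp x := fun x hx y hy => by
    have h := (abs_le.1 (h3 x hx y hy)).1
    rw [Real.le_log_iff_exp_le (div_pos (hfppos x hx) (hfmpos y hy)),
      le_div_iff₀ (hfmpos y hy)] at h
    exact h
  obtain ⟨x1, hx1⟩ := hne
  have e1 : Real.exp M * Real.exp (-M) = 1 := by rw [← Real.exp_add]; simp
  set k := fm y0 with hk
  have mV : ∀ y ∈ C.V, fm y ≤ Real.exp (2 * M) * k := fun y hy => by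
    have a := hlo x1 hx1 y hy
    have b := hup x1 hx1 y0 hy0
    have c := mul_le_mul_of_nonneg_left (a.trans b) (Real.exp_pos M).le
    rw [← mul_assoc, e1, one_mul, ← mul_assoc, ← Real.exp_add] at c
    rwa [two_mul]
  have mV' : ∀ y ∈ C.V, Real.exp (-(2 * M)) * k ≤ fm y := fun y hy => by
    have a := hlo x1 hx1 y0 hy0
    have b := hup x1 hx1 y hy
    have c := mul_le_mul_of_nonneg_left (a.trans b) (Real.exp_pos (-M)).le
    rw [← mul_assoc (Real.exp (-M)) (Real.exp M), mul_comm (Real.exp (-M)) (Real.exp M), e1, one_mul,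
      ← mul_assoc, ← Real.exp_add] at c
    rwa [two_mul, neg_add]
  have q1 : Real.exp (-M) * k / (Real.exp (2 * M) * k) = Real.exp (-(3 * M)) := by
    rw [mul_div_mul_right _ _ hg0.ne', ← Real.exp_sub]; congr 1; ring
  have q2 : Real.exp (-(2 * M)) * k / (Real.exp M * k) = Real.exp (-(3 * M)) := by
    rw [mul_div_mul_right _ _ hg0.ne', ← Real.exp_sub]; congr 1; ring
  have q3 : Real.exp (2 * M) * k / (Real.exp (-M) * k) = Real.exp (3 * M) := by
    rw [mul_div_mul_right _ _ hg0.ne', ← Real.exp_sub]; congr 1; ring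
  have fG : ∀ B, P.flip.Gam B = {x | ∃ y ∈ B, P.Gm x y} := fun B => by
    ext x; simp only [Pot.Gam, mem_ofPred_eq, P.flip_Gm]
  refine ⟨⟨m / Kp, by positivity, fun B hB cB => ?_⟩, ⟨Kp / m, by positivity, fun A hA cA => ?_⟩,
    fun A hA cA => ?_, fun N hN hNU => ⟨fun B hB cB => ?_, fun B hB cB => ?_⟩⟩
  · refine cancel_mul' hmpos hKppos ?_
    have hB' := hB.trans (subset_closure (s := C.V))
    refine (dens_ge C.hV.measurableSet cB.measurableSet hB' nV fun y hy => hmle y hy.2).trans ?_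
    rw [← hp2 B hB' cB, ← fG]
    exact dens_le C.hU.measurableSet (P.flip.Gam_compact cB).measurableSet
      fun x hx => hK x hx.2 y0 hy0
  · refine cancel_mul hmpos ?_
    refine (dens_ge C.hV.measurableSet (P.Gam_compact cA).measurableSet (P.Gam_sub A) nV
      fun y hy => hmle y hy.2).trans ?_
    rw [Pot.Gam, hp1 A hA cA]
    exact dens_le C.hU.measurableSet cA.measurableSet fun x hx => hK x hx.2 y0 hy0
  · rw [← q1]
    refine cancel_mul' (by positivity) (by positivity) ?_
    have hA' := (hA.trans hU').trans (subset_closure (s := C.U))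
    refine (dens_ge C.hU.measurableSet cA.measurableSet hA' nU
      fun x hx => hlo x (hA hx.1) y0 hy0).trans ?_
    rw [← hp1 A hA' cA]
    exact dens_le C.hV.measurableSet (P.Gam_compact cA).measurableSet fun y hy => mV y hy.2
  · rw [← q2]
    refine cancel_mul' (by positivity) (by positivity) ?_
    refine (dens_ge C.hV.measurableSet cB.measurableSet (hB.trans hN) nV
      fun y hy => mV' y hy.2).trans ?_
    rw [← hp2 B (hB.trans hN) cB, ← fG]
    refine dens_le C.hU.measurableSet (P.flip.Gam_compact cB).measurableSet
      fun x hx => hup x (hNU ?_) y0 hy0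
    obtain ⟨y, hy, hh⟩ := hx.1; exact ⟨y, hB hy, hh⟩
  · rw [← q3]
    refine cancel_mul (by positivity) ?_
    refine (dens_ge C.hU.measurableSet (P.flip.Gam_compact cB).measurableSet (P.flip.Gam_sub B) nU
      fun x hx => hlo x (hNU ?_) y0 hy0).trans ?_
    · obtain ⟨y, hy, hh⟩ := hx.1; exact ⟨y, hB hy, hh⟩
    rw [fG, hp2 B (hB.trans hN) cB]
    exact dens_le C.hV.measurableSet cB.measurableSet fun y hy => mV y hy.2

end FKM

open Set MeasureTheory Metric Bornology
open scoped ENNReal NNReal Pointwise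

set_option linter.unusedVariables false
set_option linter.unusedSectionVars false
namespace FKM
open scoped RealInnerProductSpace
open Filter Topology

namespace Cost
variable {n : ℕ} {C : Cost n}

lemma dchi_B {yb q : Euc n} (hyb : yb ∈ C.V) (hq : q ∈ C.Ub yb) (ξ : Euc n) :
    fderiv ℝ (C.chi yb) q (C.flip.B yb (C.chi yb q) ξ) = ξ :=
  C.flip.B_inj hyb (C.chi_mem hyb hq) (C.B_dchi hyb hq _)

lemma PP_sub (yb q y y' w : Euc n) : ⟪C.PP yb q y - C.PP yb q y', w⟫ =
    ⟪C.p (C.chi yb q) y - C.p (C.chi yb q) y', fderiv ℝ (C.chi yb) q w⟫ := by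
  rw [inner_sub_left, C.PP_inner, C.PP_inner, ← inner_sub_left]
  congr 1; abel

lemma p_sub_inner {yb q : Euc n} (hyb : yb ∈ C.V) (hq : q ∈ C.Ub yb) (y y' ξ : Euc n) :
    ⟪C.p (C.chi yb q) y - C.p (C.chi yb q) y', ξ⟫ =
      ⟪C.PP yb q y - C.PP yb q y', C.flip.B yb (C.chi yb q) ξ⟫ := by
  rw [C.PP_sub, C.dchi_B hyb hq]

lemma B_flip {x y : Euc n} (hx : x ∈ C.U) (hy : y ∈ C.V) (η ξ : Euc n) :
    ⟪C.flip.B y x ξ, η⟫ = ⟪C.B x y η, ξ⟫ := by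
  rw [C.B_inner hx hy, C.flip.B_inner hy hx]
  have h := C.sm.l2 (sw n) C.flip.sm (z := (y, x)) ⟨hy, hx⟩ (fun z hz => ⟨hz.2, hz.1⟩) (η, 0) (0, ξ)
  have h' : d2 C.flip.f (y, x) (η, 0) (0, ξ) = d2 C.f (x, y) (0, η) (ξ, 0) := h
  rw [h', C.sm.s2 ⟨hx, hy⟩]

lemma norm_B {K : ℝ} (hK1 : 1 ≤ K)
    (hK : ∀ z ∈ C.W, ∀ v w, |d2 C.f z v w| ≤ K * ‖v‖ * ‖w‖) {x y : Euc n} (hx : x ∈ C.U)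
    (hy : y ∈ C.V) (η : Euc n) : ‖C.B x y η‖ ≤ K * ‖η‖ := by
  refine inner_bound (by positivity) fun ξ => ?_
  rw [C.B_inner hx hy, abs_neg]
  have := hK (x, y) ⟨hx, hy⟩ (ξ, 0) (0, η)
  rw [norm_inl, norm_inr] at this
  linarith

lemma norm_Bf {K : ℝ} (hK1 : 1 ≤ K)
    (hK : ∀ z ∈ C.W, ∀ v w, |d2 C.f z v w| ≤ K * ‖v‖ * ‖w‖) {x y : Euc n} (hx : x ∈ C.U)
    (hy : y ∈ C.V) (ξ : Euc n) : ‖C.flip.B y x ξ‖ ≤ K * ‖ξ‖ := by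
  refine inner_bound (by positivity) fun η => ?_
  rw [C.B_flip hx hy]
  calc _ ≤ ‖C.B x y η‖ * ‖ξ‖ := abs_real_inner_le_norm _ _
    _ ≤ (K * ‖η‖) * ‖ξ‖ := by gcongr; exact C.norm_B hK1 hK hx hy η
    _ = _ := by ring

/-- Lipschitz dependence of the mixed derivative on the second variable. -/
lemma B_lip2 {K : ℝ} (hK1 : 1 ≤ K)
    (hK : ∀ z ∈ C.W, ∀ v w a, |d3 C.f z v w a| ≤ K * ‖v‖ * ‖w‖ * ‖a‖)
    {T : Set (Euc n)} (hT : Convex ℝ T) (hTV : T ⊆ C.V) {x y y' : Euc n} (hx : x ∈ C.U)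
    (hy : y ∈ T) (hy' : y' ∈ T) (η : Euc n) :
    ‖C.B x y' η - C.B x y η‖ ≤ K * ‖y' - y‖ * ‖η‖ := by
  refine inner_bound (by positivity) fun ξ => ?_
  have hd : ∀ ζ ∈ T, HasFDerivWithinAt (fun ζ => ⟪C.B x ζ η, ξ⟫)
      (-((((fderiv ℝ (fderiv ℝ (fderiv ℝ C.f)) (x, ζ)).flip (ξ, 0)).flip (0, η)).comp
        (.inr ℝ (Euc n) (Euc n)))) T ζ := fun ζ hζ => by
    have h1 := (C.sm.g3 (z := (x, ζ)) ⟨hx, hTV hζ⟩ (ξ, 0) (0, η)).comp ζ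
      (hasFDerivAt_prodMk_right x ζ)
    refine h1.neg.hasFDerivWithinAt.congr (fun ζ' hζ' => ?_) ?_
    · rw [C.B_inner hx (hTV hζ')]; rfl
    · rw [C.B_inner hx (hTV hζ)]; rfl
  have h := hT.norm_image_sub_le_of_norm_hasFDerivWithin_le (C := K * ‖η‖ * ‖ξ‖) hd
    (fun ζ hζ => ContinuousLinearMap.opNorm_le_bound _ (by positivity) fun a => by
      have := hK (x, ζ) ⟨hx, hTV hζ⟩ (0, a) (ξ, 0) (0, η)
      rw [norm_inl, norm_inr, norm_inr] at this
      simp only [ContinuousLinearMap.neg_apply, norm_neg, Real.norm_eq_abs]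
      refine le_trans ?_ (this.trans (le_of_eq (by ring)))
      exact le_of_eq rfl) hy hy'
  rw [Real.norm_eq_abs, ← inner_sub_left] at h
  exact h.trans (le_of_eq (by ring))

/-- constants controlling a cost near given points. -/
structure Cst (C : Cost n) (K L : ℝ) (X' Y' : Set (Euc n)) : Prop where
  K1 : 1 ≤ K
  L1 : 1 ≤ L
  hK : ∀ z ∈ C.W, (∀ v, |d1 C.f z v| ≤ K * ‖v‖) ∧
      (∀ v w, |d2 C.f z v w| ≤ K * ‖v‖ * ‖w‖) ∧
      (∀ v w a, |d3 C.f z v w a| ≤ K * ‖v‖ * ‖w‖ * ‖a‖) ∧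
      (∀ v w a b, |d4 C.f z v w a b| ≤ K * ‖v‖ * ‖w‖ * ‖a‖ * ‖b‖)
  hp : ∀ x ∈ C.U, ∀ y ∈ closure C.V, ‖C.p x y‖ ≤ K
  hq : ∀ y ∈ C.V, ∀ x ∈ closure C.U, ‖C.flip.p y x‖ ≤ K
  XU : X' ⊆ C.U
  YV : Y' ⊆ C.V
  hL : ∀ x ∈ X', ∀ y ∈ C.V, ∀ η, ‖η‖ ≤ L * ‖C.B x y η‖
  hL' : ∀ y ∈ Y', ∀ x ∈ C.U, ∀ ξ, ‖ξ‖ ≤ L * ‖C.flip.B y x ξ‖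

lemma exists_cst (C : Cost n) {X' Y' : Set (Euc n)} (hX : IsCompact X') (hY : IsCompact Y')
    (XU : X' ⊆ C.U) (YV : Y' ⊆ C.V) : ∃ K L, Cst C K L X' Y' := by
  obtain ⟨K, hK1, hK⟩ := C.bounds
  obtain ⟨K1, hK11, hKp⟩ := C.p_bound
  obtain ⟨K2, hK21, hKq⟩ := C.flip.p_bound
  obtain ⟨L, hL1, hL⟩ := C.nd hX XU
  obtain ⟨L', hL1', hL'⟩ := C.flip.nd hY YV
  refine ⟨K + K1 + K2, L + L', by linarith, by linarith, fun z hz => ?_, ?_, ?_, XU, YV, ?_, ?_⟩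
  · obtain ⟨a1, a2, a3, a4⟩ := hK z hz
    have hKK : K ≤ K + K1 + K2 := by linarith
    refine ⟨fun v => (a1 v).trans ?_, fun v w => (a2 v w).trans ?_, fun v w a => (a3 v w a).trans ?_,
      fun v w a b => (a4 v w a b).trans ?_⟩ <;> gcongr
  · exact fun x hx y hy => (hKp x hx y hy).trans (by linarith)
  · exact fun x hx y hy => (hKq x hx y hy).trans (by linarith)
  · exact fun x hx y hy η => (hL x hx y hy η).trans (by gcongr; linarith)
  · exact fun x hx y hy η => (hL' x hx y hy η).trans (by gcongr; linarith)

namespace Cst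
variable {K L : ℝ} {X' Y' : Set (Euc n)} (h : Cst C K L X' Y')

lemma norm_dchi (h : Cst C K L X' Y') {yb q : Euc n} (hyb : yb ∈ Y') (hq : q ∈ C.Ub yb) (w : Euc n) :
    ‖fderiv ℝ (C.chi yb) q w‖ ≤ L * ‖w‖ := by
  have := h.hL' yb hyb _ (C.chi_mem (h.YV hyb) hq) (fderiv ℝ (C.chi yb) q w)
  rwa [C.B_dchi (h.YV hyb) hq] at this

lemma PP_lower (h : Cst C K L X' Y') {yb q : Euc n} (hyb : yb ∈ Y') (hq : q ∈ C.Ub yb)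
    (hx : C.chi yb q ∈ X') {z z' : Euc n} (hz : z ∈ closure C.V) (hz' : z' ∈ closure C.V) :
    ‖z - z'‖ ≤ L * K * ‖C.PP yb q z - C.PP yb q z'‖ := by
  have h0 : 0 ≤ L := by linarith [h.L1]
  have h0' : 0 ≤ K := by linarith [h.K1]
  have h1 := C.lip_of_nd h0 (h.XU hx) (h.hL _ hx) z hz z' hz'
  have h2 : ‖C.p (C.chi yb q) z - C.p (C.chi yb q) z'‖ ≤ K * ‖C.PP yb q z - C.PP yb q z'‖ := by
    refine inner_bound (by positivity) fun ξ => ?_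
    rw [C.p_sub_inner (h.YV hyb) hq]
    calc _ ≤ ‖C.PP yb q z - C.PP yb q z'‖ * ‖C.flip.B yb (C.chi yb q) ξ‖ :=
          abs_real_inner_le_norm _ _
      _ ≤ ‖C.PP yb q z - C.PP yb q z'‖ * (K * ‖ξ‖) := by
          gcongr; exact C.norm_Bf h.K1 (fun z hz => (h.hK z hz).2.1) (h.XU hx) (h.YV hyb) ξ
      _ = _ := by ring
  calc _ ≤ _ := h1
    _ ≤ L * (K * ‖C.PP yb q z - C.PP yb q z'‖) := by gcongr
    _ = _ := by ring

lemma PP_upper (h : Cst C K L X' Y') {yb q : Euc n} (hyb : yb ∈ Y') (hq : q ∈ C.Ub yb)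
    {z z' : Euc n} (hz : z ∈ closure C.V) (hz' : z' ∈ closure C.V) :
    ‖C.PP yb q z - C.PP yb q z'‖ ≤ 2 * K * L := by
  have h0 : 0 ≤ L := by linarith [h.L1]
  have h0' : 0 ≤ K := by linarith [h.K1]
  refine inner_bound (by positivity) fun w => ?_
  rw [C.PP_sub]
  have hx := C.chi_mem (h.YV hyb) hq
  calc _ ≤ ‖C.p (C.chi yb q) z - C.p (C.chi yb q) z'‖ * ‖fderiv ℝ (C.chi yb) q w‖ :=
        abs_real_inner_le_norm _ _
    _ ≤ (K + K) * (L * ‖w‖) := by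
        gcongr
        · exact (norm_sub_le _ _).trans (add_le_add (h.hp _ hx _ hz) (h.hp _ hx _ hz'))
        · exact h.norm_dchi hyb hq w
    _ = _ := by ring

lemma near_id (h : Cst C K L X' Y') {yb q : Euc n} (hyb : yb ∈ Y') (hq : q ∈ C.Ub yb)
    {r : ℝ} (hr : ball yb r ⊆ C.V) {z z' : Euc n} (hz : z ∈ ball yb r) (hz' : z' ∈ ball yb r) :
    ‖C.PP yb q z - C.PP yb q z' - (z - z')‖ ≤ L * K * r * ‖z - z'‖ := by
  have h0 : 0 ≤ L := by linarith [h.L1]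
  have h0' : 0 ≤ K := by linarith [h.K1]
  have hr0 : 0 < r := pos_of_mem_ball hz
  have hx := C.chi_mem (h.YV hyb) hq
  have hV := h.YV hyb
  have h1 : ‖C.p (C.chi yb q) z - C.p (C.chi yb q) z' - C.B (C.chi yb q) yb (z - z')‖
      ≤ K * r * ‖z - z'‖ := by
    refine (convex_ball yb r).norm_image_sub_le_of_norm_hasFDerivWithin_le'
      (f' := fun ζ => C.B (C.chi yb q) ζ)
      (fun ζ hζ => (C.hasB hx (hr hζ)).hasFDerivWithinAt) (fun ζ hζ => ?_) hz' hz
    refine ContinuousLinearMap.opNorm_le_bound _ (by positivity) fun η => ?_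
    refine (C.B_lip2 h.K1 (fun z hz => (h.hK z hz).2.2.1) (convex_ball yb r) hr hx
      (mem_ball_self hr0) hζ η).trans ?_
    gcongr
    rw [← dist_eq_norm]; exact (mem_ball.1 hζ).le
  refine inner_bound (by positivity) fun w => ?_
  have h2 : ⟪C.PP yb q z - C.PP yb q z' - (z - z'), w⟫ =
      ⟪C.p (C.chi yb q) z - C.p (C.chi yb q) z' - C.B (C.chi yb q) yb (z - z'),
        fderiv ℝ (C.chi yb) q w⟫ := by
    rw [inner_sub_left, C.PP_sub, inner_sub_left (C.p (C.chi yb q) z - C.p (C.chi yb q) z'),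
      ← C.B_flip hx hV, C.B_dchi hV hq, real_inner_comm w]
  rw [h2]
  calc _ ≤ _ := abs_real_inner_le_norm _ _
    _ ≤ (K * r * ‖z - z'‖) * (L * ‖w‖) := by
        gcongr; exact h.norm_dchi hyb hq w
    _ = _ := by ring

lemma star' (h : Cst C K L X' Y') (hM : C.MTW) {yb : Euc n} (hyb : yb ∈ Y') {O : Set (Euc n)}
    (hOc : Convex ℝ O) (hOU : O ⊆ C.Ub yb) (hOX : ∀ q ∈ O, C.chi yb q ∈ X') {m D : ℝ}
    (hD : ∀ q ∈ O, ∀ q' ∈ O, ‖q' - q‖ ≤ D) (hm : m ≤ Real.exp (-(16 * K ^ 3 * L ^ 3 * L * D))) :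
    ∀ q ∈ O, ∀ q' ∈ O, ∀ y ∈ closure C.V, 0 < ⟪C.PP yb q y, q' - q⟫ →
    m * ⟪C.PP yb q y, q' - q⟫ ≤ ⟪C.PP yb q' y, q' - q⟫ := by
  intro q hq q' hq' y hy h0
  have hseg : ∀ s ∈ Icc (0:ℝ) 1, q + s • (q' - q) ∈ O := fun s hs =>
    hOc.add_smul_sub_mem hq hq' hs
  have hs := C.star h.K1 h.L1 h.L1 hM h.hK (w := q' - q) (s := 0) (t := 1) (y := y)
    (h.YV hyb) (hOU hq)
    (fun s hs => hOU (hseg s hs)) (fun s hs => h.hL _ (hOX _ (hseg s hs)))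
    (fun s hs => h.hL' yb hyb _ (C.chi_mem (h.YV hyb) (hOU (hseg s hs)))) le_rfl zero_le_one le_rfl hy
    (by simpa using h0)
  simp only [zero_smul, add_zero, one_smul, add_sub_cancel] at hs
  refine le_trans (mul_le_mul_of_nonneg_right (hm.trans ?_) h0.le) hs
  have h0 : 0 ≤ L := by linarith [h.L1]
  have h0' : 0 ≤ K := by linarith [h.K1]
  gcongr
  exact hD q hq q' hq'

end Cst

lemma cseg_full (hM : C.MTW) {x y0 y1 : Euc n} (hx : x ∈ C.U) (hy0 : y0 ∈ closure C.V)
    (hy1 : y1 ∈ closure C.V) {t : ℝ} (ht : t ∈ Icc (0:ℝ) 1) :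
    ∃ z ∈ closure C.V, C.p x z = (1 - t) • C.p x y0 + t • C.p x y1 ∧
      ∀ x' ∈ closure C.U, -C.c x' z + C.c x z ≤
        max (-C.c x' y0 + C.c x y0) (-C.c x' y1 + C.c x y1) :=
  C.flip.dasm hM.flip hx hy0 hy1 ht

lemma PP_seg {yb q z y0 y1 : Euc n} {t : ℝ}
    (h : C.p (C.chi yb q) z = (1 - t) • C.p (C.chi yb q) y0 + t • C.p (C.chi yb q) y1) :
    C.PP yb q z = (1 - t) • C.PP yb q y0 + t • C.PP yb q y1 := by
  simp only [PP]
  rw [← map_smul, ← map_smul, ← map_add]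
  congr 1
  rw [h]; module

end Cost

namespace Pot
variable {n : ℕ} {C : Cost n} (P : Pot C)

/-- the normalized potential in original coordinates. -/
def F (yb x : Euc n) : ℝ := P.u x + C.c x yb + P.v yb

lemma seg_Gm (hM : C.MTW) {x y0 y1 : Euc n} (hx : x ∈ C.U) (h0 : P.Gm x y0) (h1 : P.Gm x y1)
    {z : Euc n} (hz : z ∈ closure C.V)
    (h : ∀ x' ∈ closure C.U, -C.c x' z + C.c x z ≤
        max (-C.c x' y0 + C.c x y0) (-C.c x' y1 + C.c x y1)) : P.Gm x z := by
  refine ⟨subset_closure hx, hz, ?_⟩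
  obtain ⟨x', hx', e⟩ := P.ex2 z hz
  have a0 := P.nn x' hx' y0 h0.2.1
  have a1 := P.nn x' hx' y1 h1.2.1
  have b0 := h0.2.2
  have b1 := h1.2.2
  have := P.nn x (subset_closure hx) z hz
  rcases le_max_iff.1 (h x' hx') with hh | hh <;> linarith

/-- The concrete system attached to a base point. -/
noncomputable def mkSys (hM : C.MTW) (yb : Euc n) (hyb : yb ∈ C.V) (O : Set (Euc n)) (hO : IsOpen O)
    (hOc : Convex ℝ O) (hOU : O ⊆ C.Ub yb) (m : ℝ) (hm0 : 0 < m) (hm1 : m ≤ 1)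
    (hst : ∀ q ∈ O, ∀ q' ∈ O, ∀ y ∈ closure C.V, 0 < ⟪C.PP yb q y, q' - q⟫ →
      m * ⟪C.PP yb q y, q' - q⟫ ≤ ⟪C.PP yb q' y, q' - q⟫) : Sys n where
  O := O
  Y := closure C.V
  yb := yb
  b := C.bb yb
  P := C.PP yb
  u := fun q => P.F yb (C.chi yb q)
  a := fun y => P.v y - P.v yb
  m0 := m
  hO := hO
  hOc := hOc
  hY := C.cV
  hyb := subset_closure hyb
  hb0 := fun q hq => by simp [Cost.bb]
  hg := fun q hq y hy => C.bb_grad hyb (hOU hq) hy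
  hPc := (C.PP_cont hyb).mono (prod_mono hOU subset_rfl)
  hbc := (C.bb_cont hyb).mono (prod_mono hOU subset_rfl)
  hac := P.hv.sub continuousOn_const
  ha0 := by simp
  hu := by
    have h1 : ContinuousOn (C.chi yb) O := (C.chi_cont hyb).mono hOU
    have h2 : MapsTo (C.chi yb) O (closure C.U) := fun q hq =>
      subset_closure (C.chi_mem hyb (hOU hq))
    have h3 : ContinuousOn (fun x => C.c x yb) (closure C.U) :=
      C.cont_f.comp (f := fun x => (x, yb)) (by fun_prop) fun x hx => ⟨hx, subset_closure hyb⟩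
    exact ((P.hu.comp h1 h2).add (h3.comp h1 h2)).add continuousOn_const
  hle := fun q hq y hy => by
    have := P.nn _ (subset_closure (C.chi_mem hyb (hOU hq))) y hy
    simp only [Cost.bb, F]; linarith
  hex := fun q hq => by
    obtain ⟨y, hy, h⟩ := P.ex1 _ (subset_closure (C.chi_mem hyb (hOU hq)))
    exact ⟨y, hy, by simp only [Cost.bb, F]; linarith⟩
  hm0 := hm0
  hm1 := hm1
  star := hst
  inj := fun q hq y hy y' hy' e => by
    refine C.px_inj (C.chi_mem hyb (hOU hq)) hy hy' ?_
    rw [← sub_eq_zero]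
    refine ext_inner_right ℝ fun ξ => ?_
    rw [C.p_sub_inner hyb (hOU hq), e, sub_self, inner_zero_left, inner_zero_left]
  gconv := fun q hq => by
    have hx := C.chi_mem hyb (hOU hq)
    rw [convex_iff_add_mem]
    rintro _ ⟨y0, ⟨hy0, e0⟩, rfl⟩ _ ⟨y1, ⟨hy1, e1⟩, rfl⟩ a b ha hb hab
    have h0 : P.Gm (C.chi yb q) y0 :=
      ⟨subset_closure hx, hy0, by simp only [Cost.bb, F] at e0; linarith⟩
    have h1 : P.Gm (C.chi yb q) y1 :=
      ⟨subset_closure hx, hy1, by simp only [Cost.bb, F] at e1; linarith⟩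
    obtain ⟨z, hz, e, hh⟩ := C.cseg_full hM hx hy0 hy1 (t := b) ⟨hb, by linarith⟩
    have hG := P.seg_Gm hM hx h0 h1 hz hh
    have ha' : a = 1 - b := by linarith
    refine ⟨z, ⟨hz, ?_⟩, ?_⟩
    · have := hG.2.2
      simp only [Cost.bb, F]; linarith
    · rw [ha']; exact C.PP_seg e
  cseg := fun q hq y0 hy0 y1 hy1 t ht => by
    have hx := C.chi_mem hyb (hOU hq)
    obtain ⟨z, hz, e, hh⟩ := C.cseg_full hM hx hy0 hy1 ht
    refine ⟨z, hz, C.PP_seg e, fun q' hq' => ?_⟩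
    have := hh _ (subset_closure (C.chi_mem hyb (hOU hq')))
    simp only [Cost.bb]
    rcases le_max_iff.1 this with h | h
    · exact le_max_of_le_left (by linarith)
    · exact le_max_of_le_right (by linarith)

end Pot

end FKM

open Set MeasureTheory Metric Bornology
open scoped ENNReal NNReal Pointwise

set_option linter.unusedVariables false
set_option linter.unusedSectionVars false
namespace FKM
open scoped RealInnerProductSpace
open Filter Topology

namespace Pot
variable {n : ℕ} {C : Cost n} (P : Pot C)

lemma F_cont : ContinuousOn (fun z : Euc n × Euc n => P.F z.2 z.1) (closure C.U ×ˢ closure C.V) :=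
  ((P.hu.comp continuous_fst.continuousOn fun z hz => hz.1).add C.cont_f).add
    (P.hv.comp continuous_snd.continuousOn fun z hz => hz.2)

lemma F_contx {y : Euc n} (hy : y ∈ closure C.V) : ContinuousOn (P.F y) (closure C.U) :=
  P.F_cont.comp (f := fun x => (x, y)) (by fun_prop) fun x hx => ⟨hx, hy⟩

lemma F_nonneg {x y : Euc n} (hx : x ∈ closure C.U) (hy : y ∈ closure C.V) : 0 ≤ P.F y x := by
  have := P.nn x hx y hy
  simp only [F]; linarith

lemma Gm_iff {x y : Euc n} (hx : x ∈ closure C.U) (hy : y ∈ closure C.V) :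
    P.Gm x y ↔ P.F y x ≤ 0 := by
  have := P.nn x hx y hy
  simp only [F, Gm]
  exact ⟨fun h => by linarith [h.2.2], fun h => ⟨hx, hy, by linarith⟩⟩

lemma sub_small {y0 : Euc n} (hy0 : y0 ∈ closure C.V) {N : Set (Euc n)} (hN : IsOpen N)
    (h : ∀ x, P.Gm x y0 → x ∈ N) : ∃ h0 : ℝ, 0 < h0 ∧ ∃ r : ℝ, 0 < r ∧ ∀ yb ∈ closure C.V,
      ‖yb - y0‖ < r → ∀ x ∈ closure C.U, P.F yb x ≤ h0 → x ∈ N := by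
  have cS : IsCompact (closure C.U \ N) := C.cU.diff hN
  have hpos : ∃ h0 : ℝ, 0 < h0 ∧ ∀ x ∈ closure C.U \ N, 2 * h0 < P.F y0 x := by
    rcases (closure C.U \ N).eq_empty_or_nonempty with he | hne
    · exact ⟨1, one_pos, by simp [he]⟩
    · obtain ⟨x1, hx1, hmin⟩ := cS.exists_isMinOn hne ((P.F_contx hy0).mono sdiff_subset)
      have hp : 0 < P.F y0 x1 := by
        by_contra hc
        exact hx1.2 (h x1 ((P.Gm_iff hx1.1 hy0).2 (not_lt.1 hc)))
      refine ⟨P.F y0 x1 / 4, by positivity, fun x hx => ?_⟩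
      have : P.F y0 x1 ≤ P.F y0 x := hmin hx
      linarith
  obtain ⟨h0, hh0, hS⟩ := hpos
  have hu := (C.cU.prod C.cV).uniformContinuousOn_of_continuous P.F_cont
  rw [Metric.uniformContinuousOn_iff] at hu
  obtain ⟨r, hr, hr'⟩ := hu h0 hh0
  refine ⟨h0, hh0, r, hr, fun yb hyb hd x hx hF => ?_⟩
  by_contra hc
  have h1 := hr' (x, yb) ⟨hx, hyb⟩ (x, y0) ⟨hx, hy0⟩ (by
    rw [Prod.dist_eq, dist_self, dist_eq_norm]; exact max_lt hr hd)
  rw [Real.dist_eq] at h1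
  have h2 := hS x ⟨hx, hc⟩
  have h3 := (abs_lt.1 h1).1
  simp only at h3
  linarith

lemma Gm_small {y0 : Euc n} (hy0 : y0 ∈ closure C.V) {N : Set (Euc n)} (hN : IsOpen N)
    (h : ∀ x, P.Gm x y0 → x ∈ N) : ∃ r : ℝ, 0 < r ∧ ∀ y,
      ‖y - y0‖ < r → ∀ x, P.Gm x y → x ∈ N := by
  obtain ⟨h0, hh0, r, hr, hh⟩ := P.sub_small hy0 hN h
  exact ⟨r, hr, fun y hd x hG => hh y hG.2.1 hd x hG.1
    (((P.Gm_iff hG.1 hG.2.1).1 hG).trans hh0.le)⟩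

/-- data for a concrete system. -/
structure Dat (P : Pot C) (K L : ℝ) (X' Y' : Set (Euc n)) (yb : Euc n) (O : Set (Euc n)) (m : ℝ) :
    Prop where
  cst : Cost.Cst C K L X' Y'
  hM : C.MTW
  hyb : yb ∈ Y'
  hO : IsOpen O
  hOc : Convex ℝ O
  hOU : O ⊆ C.Ub yb
  hOX : ∀ q ∈ O, C.chi yb q ∈ X'
  hm0 : 0 < m
  hm1 : m ≤ 1
  hst : ∀ q ∈ O, ∀ q' ∈ O, ∀ y ∈ closure C.V, 0 < ⟪C.PP yb q y, q' - q⟫ →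
      m * ⟪C.PP yb q y, q' - q⟫ ≤ ⟪C.PP yb q' y, q' - q⟫

variable {P}
namespace Dat
variable {K L : ℝ} {X' Y' : Set (Euc n)} {yb : Euc n} {O : Set (Euc n)} {m : ℝ}

/-- the system. -/
noncomputable def S (D : Dat P K L X' Y' yb O m) : Sys n :=
  P.mkSys D.hM yb (D.cst.YV D.hyb) O D.hO D.hOc D.hOU m D.hm0 D.hm1 D.hst

lemma mem_Q (D : Dat P K L X' Y' yb O m) {h : ℝ} {q : Euc n} :
    q ∈ D.S.Q h ↔ q ∈ O ∧ P.F yb (C.chi yb q) ≤ h := Iff.rfl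

lemma S_u (D : Dat P K L X' Y' yb O m) (q : Euc n) : D.S.u q = P.F yb (C.chi yb q) := rfl

lemma mem_G (D : Dat P K L X' Y' yb O m) {q y : Euc n} (hq : q ∈ O) :
    y ∈ D.S.G q ↔ P.Gm (C.chi yb q) y := by
  have hx := C.chi_mem (D.cst.YV D.hyb) (D.hOU hq)
  change (y ∈ closure C.V ∧ P.F yb (C.chi yb q) = C.bb yb q y - (P.v y - P.v yb)) ↔ _
  simp only [Gm, F, Cost.bb]
  exact ⟨fun h => ⟨subset_closure hx, h.1, by linarith [h.2]⟩, fun h => ⟨h.2.1, by linarith [h.2.2]⟩⟩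

lemma GI_eq (D : Dat P K L X' Y' yb O m) {A : Set (Euc n)} (hA : A ⊆ O) :
    D.S.GI A = P.Gam (C.chi yb '' A) := by
  ext y
  constructor
  · rintro ⟨q, hq, h⟩
    exact ⟨_, ⟨q, hq, rfl⟩, (D.mem_G (hA hq)).1 h⟩
  · rintro ⟨_, ⟨q, hq, rfl⟩, h⟩
    exact ⟨q, hq, (D.mem_G (hA hq)).2 h⟩

/-- sublevel sets are compactly inside the chart -/
def In (D : Dat P K L X' Y' yb O m) (h : ℝ) : Prop :=
  ∀ x ∈ closure C.U, P.F yb x ≤ h → C.flip.p yb x ∈ O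

lemma Q_eq (D : Dat P K L X' Y' yb O m) {h : ℝ} (hI : D.In h) :
    D.S.Q h = C.flip.p yb '' {x ∈ closure C.U | P.F yb x ≤ h} := by
  have hV := D.cst.YV D.hyb
  ext q
  rw [D.mem_Q]
  constructor
  · rintro ⟨hq, hF⟩
    exact ⟨C.chi yb q, ⟨subset_closure (C.chi_mem hV (D.hOU hq)), hF⟩, C.p_chi hV (D.hOU hq)⟩
  · rintro ⟨x, ⟨hx, hF⟩, rfl⟩
    exact ⟨hI x hx hF, by rwa [C.chi_p hV hx]⟩

lemma Q_compact (D : Dat P K L X' Y' yb O m) {h : ℝ} (hI : D.In h) : IsCompact (D.S.Q h) := by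
  have hV := D.cst.YV D.hyb
  rw [D.Q_eq hI]
  refine IsCompact.image_of_continuousOn ?_ ((C.flip.px_cont hV).mono fun x hx => hx.1)
  exact C.cU.of_isClosed_subset ((P.F_contx (subset_closure hV)).preimage_isClosed_of_isClosed
    C.cU.isClosed isClosed_Iic) inter_subset_left

lemma mono_In (D : Dat P K L X' Y' yb O m) {h h' : ℝ} (hI : D.In h) (hh : h' ≤ h) : D.In h' :=
  fun x hx hF => hI x hx (hF.trans hh)

/-- Verification of section hypotheses. -/
lemma secHyp (D : Dat P K L X' Y' yb O m) {h ε r0 κ J : ℝ} (hh : 0 < h) (hI : D.In h) (hε : 0 < ε)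
    (hε1 : ε ≤ 1) (hr0 : 0 < r0) (hr : ball yb r0 ⊆ C.V) (hrε : L * K * r0 ≤ ε / 4)
    (hκ : ∀ q ∈ D.S.Q h, ∀ y ∈ D.S.G q, κ * ‖D.S.P q y‖ ≤ r0 / (4 * (L * K)))
    (hJ2 : 2 ^ n ≤ J)
    (hvU : ∀ q ∈ D.S.Q h, ∀ T ⊆ D.S.GI (D.S.Q h),
      volume T ≤ ENNReal.ofReal J * volume (D.S.P q '' T)) :
    SecHyp D.S ε h (r0 / (4 * (L * K))) κ J := by
  have hV := D.cst.YV D.hyb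
  have hLK : 1 ≤ L * K := by nlinarith [D.cst.K1, D.cst.L1]
  have hyc : yb ∈ closure C.V := subset_closure hV
  have hPyb : ∀ q, C.PP yb q yb = 0 := fun q => by simp [Cost.PP]
  have hclose : ∀ q ∈ O, ∀ z ∈ closure C.V, ‖C.PP yb q z‖ ≤ 2 * (r0 / (4 * (L * K))) →
      z ∈ ball yb r0 := fun q hq z hz hle => by
    have h1 := D.cst.PP_lower D.hyb (D.hOU hq) (D.hOX q hq) hz hyc
    rw [hPyb, sub_zero] at h1
    rw [mem_ball, dist_eq_norm]
    have h2 : L * K * ‖C.PP yb q z‖ ≤ L * K * (2 * (r0 / (4 * (L * K)))) := by gcongr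
    have h3 : L * K * (2 * (r0 / (4 * (L * K)))) = r0 / 2 := by
      have hL0 : L ≠ 0 := (lt_of_lt_of_le one_pos D.cst.L1).ne'
      have hK0 : K ≠ 0 := (lt_of_lt_of_le one_pos D.cst.K1).ne'
      field_simp; norm_num
    linarith
  have hni : ∀ q ∈ O, ∀ z ∈ ball yb r0, ∀ z' ∈ ball yb r0,
      ‖C.PP yb q z - C.PP yb q z' - (z - z')‖ ≤ ε / 4 * ‖z - z'‖ := fun q hq z hz z' hz' =>
    (D.cst.near_id D.hyb (D.hOU hq) hr hz hz').trans (by gcongr)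
  refine ⟨hh, D.Q_compact hI, ?_, hκ, ?_, hvU⟩
  · intro q hq q' hq' z hz hle
    change ‖C.PP yb q z‖ ≤ _ at hle
    change ‖C.PP yb q' z - C.PP yb q z‖ ≤ ε * ‖C.PP yb q z‖
    have hzb := hclose q hq.1 z hz (hle.trans (by
      have : 0 ≤ r0 / (4 * (L * K)) := by positivity
      linarith))
    have a1 := hni q hq.1 z hzb yb (mem_ball_self hr0)
    have a2 := hni q' hq'.1 z hzb yb (mem_ball_self hr0)
    rw [hPyb, sub_zero] at a1 a2
    have e : C.PP yb q' z - C.PP yb q z =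
        (C.PP yb q' z - (z - yb)) - (C.PP yb q z - (z - yb)) := by abel
    have b1 : ‖C.PP yb q' z - C.PP yb q z‖ ≤ ε / 4 * ‖z - yb‖ + ε / 4 * ‖z - yb‖ := by
      rw [e]; exact (norm_sub_le _ _).trans (add_le_add a2 a1)
    have b2 : ‖z - yb‖ ≤ ‖C.PP yb q z‖ + ε / 4 * ‖z - yb‖ := by
      calc _ = ‖C.PP yb q z - (C.PP yb q z - (z - yb))‖ := by congr 1; abel
        _ ≤ _ := (norm_sub_le _ _).trans (by gcongr)
    have b3 : ‖z - yb‖ ≤ 2 * ‖C.PP yb q z‖ := by nlinarith [norm_nonneg (z - yb)]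
    nlinarith [norm_nonneg (z - yb)]
  · intro q hq T hT hTb
    refine (vol_lip (L := 2) zero_le_two fun z hz z' hz' => ?_).trans
      (mul_le_mul_left (ENNReal.ofReal_le_ofReal hJ2) _)
    have h1 := hni q hq.1 z (hclose q hq.1 z (hT hz) (hTb z hz)) z'
      (hclose q hq.1 z' (hT hz') (hTb z' hz'))
    change ‖C.PP yb q z - C.PP yb q z'‖ ≤ _
    calc ‖C.PP yb q z - C.PP yb q z'‖ = ‖(C.PP yb q z - C.PP yb q z' - (z - z')) + (z - z')‖ := by
          congr 1; abel
      _ ≤ ε / 4 * ‖z - z'‖ + ‖z - z'‖ := (norm_add_le _ _).trans (by gcongr)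
      _ ≤ _ := by nlinarith [norm_nonneg (z - z')]

/-- global version of the constants. -/
lemma secHypI (D : Dat P K L X' Y' yb O m) {h ε r0 : ℝ} (hh : 0 < h) (hI : D.In h) (hε : 0 < ε)
    (hε1 : ε ≤ 1) (hr0 : 0 < r0) (hr : ball yb r0 ⊆ C.V) (hrε : L * K * r0 ≤ ε / 4) :
    SecHyp D.S ε h (r0 / (4 * (L * K))) (r0 / (4 * (L * K)) / (2 * K * L)) ((2 + L * K) ^ n) := by
  have hV := D.cst.YV D.hyb
  have hLK : 1 ≤ L * K := by nlinarith [D.cst.K1, D.cst.L1]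
  have hK1 := D.cst.K1
  have hL1 := D.cst.L1
  refine D.secHyp hh hI hε hε1 hr0 hr hrε ?_ (by gcongr; linarith) ?_
  · intro q hq y hy
    have h1 := D.cst.PP_upper D.hyb (D.hOU hq.1) hy.1 (subset_closure hV)
    have e : C.PP yb q yb = 0 := by simp [Cost.PP]
    rw [e, sub_zero] at h1
    change _ * ‖C.PP yb q y‖ ≤ _
    rw [div_mul_eq_mul_div, div_le_iff₀ (by positivity)]
    gcongr
  · intro q hq T hT
    refine (vol_colip (L := L * K) (by positivity) fun z hz z' hz' => ?_).trans
      (mul_le_mul_left (ENNReal.ofReal_le_ofReal (by gcongr; linarith)) _)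
    obtain ⟨_, _, h1⟩ := hT hz
    obtain ⟨_, _, h2⟩ := hT hz'
    exact D.cst.PP_lower D.hyb (D.hOU hq.1) (D.hOX q hq.1) h1.1 h2.1

/-- local version of the constants. -/
lemma secHypQ (D : Dat P K L X' Y' yb O m) {h ε r0 : ℝ} (hh : 0 < h) (hI : D.In h) (hε : 0 < ε)
    (hε1 : ε ≤ 1) (hr0 : 0 < r0) (hr : ball yb r0 ⊆ C.V) (hrε : L * K * r0 ≤ ε / 4)
    (hG : ∀ q ∈ D.S.Q h, ∀ y, P.Gm (C.chi yb q) y → ‖y - yb‖ ≤ r0 / (8 * (L * K))) :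
    SecHyp D.S ε h (r0 / (4 * (L * K))) 1 (2 ^ n) := by
  have hV := D.cst.YV D.hyb
  have hLK : 1 ≤ L * K := by nlinarith [D.cst.K1, D.cst.L1]
  have hlt : r0 / (8 * (L * K)) < r0 := by
    rw [div_lt_iff₀ (by positivity)]; nlinarith
  have hni : ∀ q ∈ O, ∀ z ∈ ball yb r0, ∀ z' ∈ ball yb r0,
      ‖C.PP yb q z - C.PP yb q z' - (z - z')‖ ≤ ε / 4 * ‖z - z'‖ := fun q hq z hz z' hz' =>
    (D.cst.near_id D.hyb (D.hOU hq) hr hz hz').trans (by gcongr)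
  have hb : ∀ q ∈ D.S.Q h, ∀ y ∈ D.S.G q, y ∈ ball yb r0 := fun q hq y hy => by
    rw [mem_ball, dist_eq_norm]
    exact (hG q hq y ((D.mem_G hq.1).1 hy)).trans_lt hlt
  refine D.secHyp hh hI hε hε1 hr0 hr hrε ?_ le_rfl ?_
  · intro q hq y hy
    have h1 := hni q hq.1 y (hb q hq y hy) yb (mem_ball_self hr0)
    have e : C.PP yb q yb = 0 := by simp [Cost.PP]
    rw [e, sub_zero] at h1
    have h2 := hG q hq y ((D.mem_G hq.1).1 hy)
    change 1 * ‖C.PP yb q y‖ ≤ _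
    have h3 : ‖C.PP yb q y‖ ≤ ε / 4 * ‖y - yb‖ + ‖y - yb‖ := by
      calc ‖C.PP yb q y‖ = ‖(C.PP yb q y - (y - yb)) + (y - yb)‖ := by congr 1; abel
        _ ≤ _ := (norm_add_le _ _).trans (by gcongr)
    have h4 : r0 / (4 * (L * K)) = 2 * (r0 / (8 * (L * K))) := by
      have hL0 : L ≠ 0 := (lt_of_lt_of_le one_pos D.cst.L1).ne'
      have hK0 : K ≠ 0 := (lt_of_lt_of_le one_pos D.cst.K1).ne'
      field_simp; norm_num
    nlinarith [norm_nonneg (y - yb)]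
  · intro q hq T hT
    refine vol_colip (L := 2) zero_le_two fun z hz z' hz' => ?_
    obtain ⟨q1, hq1, h1⟩ := hT hz
    obtain ⟨q2, hq2, h2⟩ := hT hz'
    have h3 := hni q hq.1 z (hb q1 hq1 z h1) z' (hb q2 hq2 z' h2)
    change _ ≤ 2 * ‖C.PP yb q z - C.PP yb q z'‖
    have h4 : ‖z - z'‖ ≤ ‖C.PP yb q z - C.PP yb q z'‖ + ε / 4 * ‖z - z'‖ := by
      calc _ = ‖(C.PP yb q z - C.PP yb q z') - (C.PP yb q z - C.PP yb q z' - (z - z'))‖ := by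
            congr 1; abel
        _ ≤ _ := (norm_sub_le _ _).trans (by gcongr)
    nlinarith [norm_nonneg (z - z')]

lemma chi_lip (D : Dat P K L X' Y' yb O m) : ∀ q ∈ O, ∀ q' ∈ O,
    ‖C.chi yb q - C.chi yb q'‖ ≤ L * ‖q - q'‖ := fun q hq q' hq' => by
  have hL1 := D.cst.L1
  refine D.hOc.norm_image_sub_le_of_norm_hasFDerivWithin_le (f := C.chi yb)
    (fun ζ hζ => (C.chi_deriv (D.cst.YV D.hyb) (D.hOU hζ)).hasFDerivWithinAt)
    (fun ζ hζ => ContinuousLinearMap.opNorm_le_bound _ (by positivity)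
      fun w => D.cst.norm_dchi D.hyb (D.hOU hζ) w) hq' hq

end Dat
end Pot

/-- Lipschitz bound for the coordinate map. -/
lemma Cost.Cst.q_lip {n : ℕ} {C : Cost n} {K L : ℝ} {X' Y' : Set (Euc n)} (h : C.Cst K L X' Y')
    {y : Euc n} (hy : y ∈ C.V) {T : Set (Euc n)} (hT : Convex ℝ T) (hTU : T ⊆ C.U) :
    ∀ x ∈ T, ∀ x' ∈ T, ‖C.flip.p y x - C.flip.p y x'‖ ≤ K * ‖x - x'‖ := fun x hx x' hx' => by
  have hK1 := h.K1
  refine hT.norm_image_sub_le_of_norm_hasFDerivWithin_le (f := C.flip.p y)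
    (fun ζ hζ => (C.flip.hasB hy (hTU hζ)).hasFDerivWithinAt)
    (fun ζ hζ => ContinuousLinearMap.opNorm_le_bound _ (by positivity)
      fun w => C.norm_Bf hK1 (fun z hz => (h.hK z hz).2.1) (hTU hζ) hy w) hx' hx

end FKM

open Set MeasureTheory Metric Bornology
open scoped ENNReal NNReal Pointwise

set_option linter.unusedVariables false
set_option linter.unusedSectionVars false
namespace FKM
open scoped RealInnerProductSpace
open Filter Topology

namespace Sys
variable {n : ℕ} {S : Sys n}

lemma Q_mono {h h' : ℝ} (hh : h ≤ h') : S.Q h ⊆ S.Q h' := fun q hq => ⟨hq.1, hq.2.trans hh⟩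

lemma Q_compact_of_le {h h0 : ℝ} (hQ : IsCompact (S.Q h0)) (hh : h ≤ h0) : IsCompact (S.Q h) := by
  have h1 : S.Q h = S.Q h0 ∩ S.u ⁻¹' Iic h := by
    ext q
    exact ⟨fun hq => ⟨Q_mono hh hq, hq.2⟩, fun hq => ⟨hq.1.1, hq.2⟩⟩
  rw [h1]
  refine hQ.of_isClosed_subset ?_ inter_subset_left
  exact (S.hu.mono fun q hq => hq.1).preimage_isClosed_of_isClosed hQ.isClosed isClosed_Iic

/-- The doubling property -/
def Dbl (S : Sys n) (q0 : Euc n) (ρ h0 : ℝ) : Prop :=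
  ∀ h, 0 < h → h ≤ h0 → ∀ qs ∈ S.Q h, S.u qs = h → h / 2 < S.u (qs - ρ • (qs - q0))

lemma Dbl.step {q0 : Euc n} {ρ h0 h : ℝ} (hD : S.Dbl q0 ρ h0) (hρ : 0 < ρ) (hρ1 : ρ < 1)
    (hq0 : q0 ∈ S.O) (hu0 : S.u q0 = 0) (hQ : IsCompact (S.Q h0)) (hh : 0 < h) (hh0 : h ≤ h0)
    {q : Euc n} (hq : q ∈ S.O) (hqh : S.u q ≤ h / 2) : q0 + (1 - ρ)⁻¹ • (q - q0) ∈ S.Q h := by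
  have h1ρ : 0 < 1 - ρ := by linarith
  set σ := (1 - ρ)⁻¹ with hσ
  have hσ1 : 1 ≤ σ := (one_le_inv₀ h1ρ).2 (by linarith)
  set g : ℝ → Euc n := fun t => q0 + t • (q - q0) with hg
  have hgc : Continuous g := by fun_prop
  have hQc := Q_compact_of_le hQ hh0
  have hT : IsCompact (Icc 1 σ ∩ g ⁻¹' S.Q h) :=
    isCompact_Icc.inter_right (hQc.isClosed.preimage hgc)
  have h1T : (1:ℝ) ∈ Icc 1 σ ∩ g ⁻¹' S.Q h := by
    refine ⟨⟨le_rfl, hσ1⟩, ?_⟩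
    change g 1 ∈ S.Q h
    have : g 1 = q := by simp [hg]
    rw [this]; exact ⟨hq, by linarith⟩
  obtain ⟨t, ht, hmax⟩ := hT.exists_isMaxOn ⟨1, h1T⟩ continuousOn_id
  have htQ : g t ∈ S.Q h := ht.2
  rcases eq_or_lt_of_le ht.1.2 with he | hlt
  · rw [he] at htQ; exact htQ
  exfalso
  have huh : S.u (g t) = h := by
    by_contra hne
    have hlt' := lt_of_le_of_ne htQ.2 hne
    have hnb := interior_of_lt htQ.1 hlt'
    have h2 := (hgc.continuousAt (x := t)).eventually hnb
    have h3 : ∀ᶠ s in 𝓝[>] t, g s ∈ S.Q h ∧ s ≤ σ ∧ t < s := by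
      filter_upwards [h2.filter_mono nhdsWithin_le_nhds, Ioo_mem_nhdsGT hlt] with s hs hs'
      exact ⟨hs, hs'.2.le, hs'.1⟩
    obtain ⟨s, hs1, hs2, hs3⟩ := h3.exists
    have := hmax (⟨⟨ht.1.1.trans hs3.le, hs2⟩, hs1⟩ : s ∈ Icc 1 σ ∩ g ⁻¹' S.Q h)
    simp only [id, mem_ofPred_eq] at this
    linarith
  have h4 := hD h hh hh0 _ htQ huh
  have e : g t - ρ • (g t - q0) = q0 + ((1 - ρ) * t) • (q - q0) := by
    simp only [hg]; module
  rw [e] at h4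
  have hle : (1 - ρ) * t ≤ 1 := by
    have : (1 - ρ) * t ≤ (1 - ρ) * σ := by gcongr
    rwa [hσ, mul_inv_cancel₀ h1ρ.ne'] at this
  have h5 := (Q_convex (S := S) (h / 2)).add_smul_sub_mem (x := q0) (y := q)
    ⟨hq0, by rw [hu0]; positivity⟩ ⟨hq, hqh⟩ (t := (1 - ρ) * t)
    ⟨mul_nonneg h1ρ.le (zero_le_one.trans ht.1.1), hle⟩
  linarith [h5.2]

lemma Dbl.iter {q0 : Euc n} {ρ h0 : ℝ} (hD : S.Dbl q0 ρ h0) (hρ : 0 < ρ) (hρ1 : ρ < 1)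
    (hq0 : q0 ∈ S.O) (hu0 : S.u q0 = 0) (hQ : IsCompact (S.Q h0)) (hh0 : 0 < h0) (k : ℕ) :
    ∀ q ∈ S.O, S.u q ≤ h0 / 2 ^ k → q0 + ((1 - ρ)⁻¹) ^ k • (q - q0) ∈ S.Q h0 := by
  induction k with
  | zero => 
    intro q hq h
    rw [pow_zero, one_smul, add_sub_cancel]
    exact ⟨hq, by simpa using h⟩
  | succ k ih =>
    intro q hq h
    have h1 := hD.step hρ hρ1 hq0 hu0 hQ (h := h0 / 2 ^ k) (by positivity)
      (div_le_self hh0.le (one_le_pow₀ one_le_two)) hq (by rw [div_div, ← pow_succ]; exact h)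
    have h2 := ih _ h1.1 h1.2
    have e : q0 + ((1 - ρ)⁻¹) ^ k • (q0 + (1 - ρ)⁻¹ • (q - q0) - q0) =
        q0 + ((1 - ρ)⁻¹) ^ (k + 1) • (q - q0) := by rw [pow_succ]; module
    rwa [e] at h2

lemma Dbl.growth {q0 : Euc n} {ρ h0 D β : ℝ} (hD : S.Dbl q0 ρ h0) (hρ : 0 < ρ) (hρ1 : ρ < 1)
    (hq0 : q0 ∈ S.O) (hu0 : S.u q0 = 0) (hQ : IsCompact (S.Q h0)) (hh0 : 0 < h0)
    (hDb : ∀ q ∈ S.Q h0, ‖q - q0‖ ≤ D) (hβ : 0 < β) (hβρ : 1 - ρ ≤ (1 / 2 : ℝ) ^ β) :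
    ∀ q ∈ S.Q h0, ‖q - q0‖ ≤ D * (2 * S.u q / h0) ^ β := by
  intro q hq
  have h1ρ : 0 < 1 - ρ := by linarith
  have hD0 : 0 ≤ D := (norm_nonneg _).trans (hDb q hq)
  have key : ∀ k : ℕ, S.u q ≤ h0 / 2 ^ k → ‖q - q0‖ ≤ D * (1 - ρ) ^ k := fun k hk => by
    have h1 := hDb _ (hD.iter hρ hρ1 hq0 hu0 hQ hh0 k q hq.1 hk)
    rw [add_sub_cancel_left, norm_smul, Real.norm_of_nonneg (by positivity), inv_pow,
      inv_mul_le_iff₀ (by positivity)] at h1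
    linarith
  have hun := S.u_nonneg hq.1
  rcases hun.eq_or_lt with h0' | hpos
  · have h2 : Tendsto (fun k : ℕ => D * (1 - ρ) ^ k) atTop (𝓝 (D * 0)) :=
      (tendsto_pow_atTop_nhds_zero_of_lt_one h1ρ.le (by linarith)).const_mul D
    have h3 : ‖q - q0‖ ≤ D * 0 := ge_of_tendsto' h2 fun k => key k (by rw [← h0']; positivity)
    rw [← h0']
    rw [mul_zero] at h3
    exact h3.trans (by positivity)
  · obtain ⟨k, hk1, hk2⟩ := exists_nat_pow_near (x := h0 / S.u q) (y := 2)
      ((one_le_div hpos).2 hq.2) one_lt_two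
    have h1 := key k (by
      rw [le_div_iff₀ hpos] at hk1
      rw [le_div_iff₀ (by positivity)]; linarith)
    refine h1.trans (mul_le_mul_of_nonneg_left ?_ hD0)
    calc (1 - ρ) ^ k ≤ ((1 / 2 : ℝ) ^ β) ^ k := by gcongr
      _ = ((1 / 2 : ℝ) ^ k) ^ β := by
        rw [← Real.rpow_natCast, ← Real.rpow_mul (by norm_num), mul_comm, Real.rpow_mul (by norm_num),
          Real.rpow_natCast]
      _ ≤ _ := by
        refine Real.rpow_le_rpow (by positivity) ?_ hβ.le
        rw [div_lt_iff₀ hpos, pow_succ] at hk2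
        rw [one_div, inv_pow, inv_le_iff_one_le_mul₀ (by positivity), div_mul_eq_mul_div,
          one_le_div hh0]
        linarith

end Sys

namespace Pot
variable {n : ℕ} {C : Cost n} {P : Pot C}
namespace Dat
variable {K L : ℝ} {X' Y' : Set (Euc n)} {yb : Euc n} {O : Set (Euc n)} {m : ℝ}

lemma lower_MA (D : Dat P K L X' Y' yb O m) {lam j : ℝ} (hl : 0 < lam) (hj : 0 < j) {N : Set (Euc n)}
    (hN : P.MAlo lam N) {A : Set (Euc n)} (hA : IsCompact A) (hAO : A ⊆ O)
    (hAN : C.chi yb '' A ⊆ N)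
    (hv : volume A ≤ ENNReal.ofReal j * volume (C.chi yb '' A)) :
    ENNReal.ofReal (lam / j) * volume A ≤ volume (D.S.GI A) := by
  rw [D.GI_eq hAO]
  have hc : IsCompact (C.chi yb '' A) := hA.image_of_continuousOn
    ((C.chi_cont (D.cst.YV D.hyb)).mono (hAO.trans D.hOU))
  refine le_trans ?_ (hN _ hAN hc)
  calc ENNReal.ofReal (lam / j) * volume A
      ≤ ENNReal.ofReal (lam / j) * (ENNReal.ofReal j * volume (C.chi yb '' A)) := by gcongr
    _ = _ := by
      rw [← mul_assoc, ← ENNReal.ofReal_mul (by positivity), div_mul_cancel₀ _ hj.ne']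

lemma upper_MA (D : Dat P K L X' Y' yb O m) {Lam j : ℝ} (hl : 0 < Lam) {N : Set (Euc n)}
    (hN : P.MAup Lam N) {A : Set (Euc n)} (hA : IsCompact A) (hAO : A ⊆ O)
    (hAN : C.chi yb '' A ⊆ N)
    (hv : volume (C.chi yb '' A) ≤ ENNReal.ofReal j * volume A) :
    volume (D.S.GI A) ≤ ENNReal.ofReal (Lam * j) * volume A := by
  rw [D.GI_eq hAO]
  have hc : IsCompact (C.chi yb '' A) := hA.image_of_continuousOn
    ((C.chi_cont (D.cst.YV D.hyb)).mono (hAO.trans D.hOU))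
  refine (hN _ hAN hc).trans ?_
  rw [ENNReal.ofReal_mul hl.le, mul_assoc]
  gcongr

lemma q_image (D : Dat P K L X' Y' yb O m) {A : Set (Euc n)} (hAO : A ⊆ O) :
    C.flip.p yb '' (C.chi yb '' A) = A := by
  rw [image_image]
  have h1 : ∀ q ∈ A, C.flip.p yb (C.chi yb q) = q := fun q hq =>
    C.p_chi (D.cst.YV D.hyb) (D.hOU (hAO hq))
  exact (image_congr h1).trans (image_id' A)

end Dat

/-- Part I, second half. -/
lemma partI_aux {ε : ℝ} (hε : 0 < ε) (hε1 : ε ≤ 1)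
    (hmain : ∀ m κ J θ C : ℝ, 0 < m → 0 < κ → κ ≤ 1 → 0 < J → 0 < θ → θ ≤ 1 → 0 < C →
    ∃ ρ : ℝ, 0 < ρ ∧ ρ < 1 ∧ ∀ (S : Sys n) (h t1 lam Lam : ℝ), S.m0 = m →
      SecHyp S ε h t1 κ J → 0 < lam → Lam ≤ C * lam →
      ∀ q0 ∈ S.Q h, S.u q0 < h →
      (∀ A : Set (Euc n), IsCompact A → A ⊆ (fun q => q0 + θ • (q - q0)) '' S.Q h →
        ENNReal.ofReal lam * volume A ≤ volume (S.GI A)) →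
      volume (S.GI (S.Q h)) ≤ ENNReal.ofReal Lam * volume (S.Q h) →
      ∀ qs ∈ S.Q h, S.u qs = h → h / 2 < S.u (qs - ρ • (qs - q0)))
    {K L : ℝ} {X' Y' : Set (Euc n)} {yb : Euc n} {O : Set (Euc n)} {m : ℝ}
    (D : Dat P K L X' Y' yb O m) {x0 : Euc n} (h0 : P.Gm x0 yb) {lam Lam r h1 Db : ℝ} (hlam : 0 < lam)
    (hLam : 0 < Lam) (hr : 0 < r) (hlo : P.MAlo lam (ball x0 r)) (hrU : ball x0 r ⊆ C.U)
    {N : Set (Euc n)} (hup : P.MAup Lam N) (hh1 : 0 < h1)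
    (hIn : D.In h1) (hInN : ∀ x ∈ closure C.U, P.F yb x ≤ h1 → x ∈ N)
    (hDb0 : 0 < Db) (hDb : ∀ q ∈ O, ∀ q' ∈ O, ‖q' - q‖ ≤ Db) :
    ∀ x, P.Gm x yb → x = x0 := by
  have hV := D.cst.YV D.hyb
  have hK1 := D.cst.K1
  have hL1 := D.cst.L1
  obtain ⟨r1, hr1, hr1V⟩ := Metric.isOpen_iff.1 C.hV yb hV
  obtain ⟨r0, hr0, hr0r, hr0ε⟩ : ∃ r0 : ℝ, 0 < r0 ∧ r0 ≤ r1 ∧ L * K * r0 ≤ ε / 4 := by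
    refine ⟨min r1 (ε / 4 / (L * K)), by positivity, min_le_left _ _, ?_⟩
    calc L * K * min r1 (ε / 4 / (L * K)) ≤ L * K * (ε / 4 / (L * K)) := by
          gcongr; exact min_le_right _ _
      _ = _ := by field_simp
  have hr0V : ball yb r0 ⊆ C.V := (ball_subset_ball hr0r).trans hr1V
  have hLK : 1 ≤ L * K := by nlinarith
  have hκ1 : r0 / (4 * (L * K)) / (2 * K * L) ≤ 1 := by
    have : r0 ≤ 1 := by nlinarith
    rw [div_le_one (by positivity), div_le_iff₀ (by positivity)]
    nlinarith
  set θ : ℝ := min 1 (r / (2 * (L * Db))) with hθ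
  have hθ0 : 0 < θ := by positivity
  have hθr : L * (θ * Db) < r := by
    have : θ ≤ r / (2 * (L * Db)) := min_le_right _ _
    rw [le_div_iff₀ (by positivity)] at this
    nlinarith
  obtain ⟨ρ, hρ0, hρ1, hρ⟩ := hmain m (r0 / (4 * (L * K)) / (2 * K * L)) ((2 + L * K) ^ n) θ
    (Lam * L ^ n / (lam / K ^ n)) D.hm0 (by positivity) hκ1 (by positivity) hθ0 (min_le_left _ _)
    (by positivity)
  have hq0 : C.flip.p yb x0 ∈ O := hIn x0 h0.1 (((P.Gm_iff h0.1 h0.2.1).1 h0).trans hh1.le)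
  set q0 := C.flip.p yb x0 with hq0d
  have hu0 : D.S.u q0 = 0 := by
    rw [D.S_u, hq0d, C.chi_p hV h0.1]
    exact le_antisymm ((P.Gm_iff h0.1 h0.2.1).1 h0) (P.F_nonneg h0.1 h0.2.1)
  have hx0c : C.chi yb q0 = x0 := C.chi_p hV h0.1
  have hdbl : D.S.Dbl q0 ρ h1 := by
    intro h hh hhle
    have hI := D.mono_In hIn hhle
    have hQO : D.S.Q h ⊆ O := fun q hq => hq.1
    refine hρ D.S h _ (lam / K ^ n) (Lam * L ^ n) rfl (D.secHypI hh hI hε hε1 hr0 hr0V hr0ε)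
      (by positivity) (by rw [div_mul_cancel₀ _ (by positivity)]) q0 ⟨hq0, by rw [hu0]; exact hh.le⟩ (by rw [hu0]; exact hh)
      ?_ ?_
    · intro A hA hAs
      have hAO : A ⊆ O := by
        intro z hz
        obtain ⟨q, hq, rfl⟩ := hAs hz
        exact D.hOc.add_smul_sub_mem hq0 hq.1 ⟨hθ0.le, min_le_left _ _⟩
      have hAb : C.chi yb '' A ⊆ ball x0 r := by
        rintro _ ⟨q', hq', rfl⟩
        have hq'O := hAO hq'
        obtain ⟨q, hq, rfl⟩ := hAs hq'
        rw [mem_ball, dist_eq_norm, ← hx0c]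
        refine (D.chi_lip _ hq'O _ hq0).trans_lt ?_
        simp only [add_sub_cancel_left, norm_smul, Real.norm_of_nonneg hθ0.le]
        refine lt_of_le_of_lt ?_ hθr
        gcongr
        exact hDb _ hq0 _ hq.1
      refine D.lower_MA hlam (by positivity) hlo hA hAO hAb ?_
      have := vol_lip (f := C.flip.p yb) (S := C.chi yb '' A) (L := K) (by positivity)
        fun x hx x' hx' => D.cst.q_lip hV (convex_ball x0 r) hrU x (hAb hx) x' (hAb hx')
      rwa [D.q_image hAO] at this
    · refine D.upper_MA hLam hup (D.Q_compact hI) hQO ?_ ?_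
      · rintro _ ⟨q, hq, rfl⟩
        exact hInN _ (subset_closure (C.chi_mem hV (D.hOU hq.1))) (hq.2.trans hhle)
      · exact vol_lip (by positivity) fun q hq q' hq' => D.chi_lip q (hQO hq) q' (hQO hq')
  intro x hx
  have hxF := (P.Gm_iff hx.1 hx.2.1).1 hx
  have hxO := hIn x hx.1 (hxF.trans hh1.le)
  have hcx := C.chi_p hV hx.1
  obtain ⟨β, hβ, hβρ⟩ : ∃ β : ℝ, 0 < β ∧ 1 - ρ ≤ (1 / 2 : ℝ) ^ β := by
    have ht : Tendsto (fun β : ℝ => (1 / 2 : ℝ) ^ β) (𝓝[>] 0) (𝓝 1) := by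
      have : ContinuousAt (fun β : ℝ => (1 / 2 : ℝ) ^ β) 0 :=
        (Real.continuous_const_rpow (by norm_num)).continuousAt
      have h2 := this.tendsto
      simp only [Real.rpow_zero] at h2
      exact h2.mono_left nhdsWithin_le_nhds
    have h3 := (ht.eventually (lt_mem_nhds (show 1 - ρ < 1 by linarith))).and self_mem_nhdsWithin
    obtain ⟨β, h4, h5⟩ := h3.exists
    exact ⟨β, h5, h4.le⟩
  have hux : D.S.u (C.flip.p yb x) = 0 := by
    rw [D.S_u, hcx]
    exact le_antisymm hxF (P.F_nonneg hx.1 hx.2.1)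
  have := hdbl.growth hρ0 hρ1 hq0 hu0 (D.Q_compact hIn) hh1 (fun q hq => hDb _ hq0 _ hq.1) hβ hβρ
    (C.flip.p yb x) ⟨hxO, by rw [hux]; exact hh1.le⟩
  rw [hux, mul_zero, zero_div, Real.zero_rpow hβ.ne', mul_zero] at this
  have h2 := sub_eq_zero.1 (norm_le_zero_iff.1 this)
  rw [← hcx, h2, hx0c]

lemma fiber_convex (P : Pot C) (hM : C.MTW) {yb : Euc n} (hyb : yb ∈ C.V) :
    Convex ℝ (C.flip.p yb '' {x | P.Gm x yb}) := by
  rw [convex_iff_add_mem]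
  rintro _ ⟨x0, h0, rfl⟩ _ ⟨x1, h1, rfl⟩ a b ha hb hab
  obtain ⟨z, hz, e, h⟩ := C.flip.cseg_full hM.flip hyb h0.1 h1.1 (t := b) ⟨hb, by linarith⟩
  have ea : a = 1 - b := by linarith
  refine ⟨z, P.flip_Gm.1 (P.flip.seg_Gm hM.flip hyb (P.flip_Gm.2 h0) (P.flip_Gm.2 h1) hz h), ?_⟩
  rw [e, ea]

theorem partI (hn : 0 < n) (P : Pot C) (hM : C.MTW) {yb x0 : Euc n} (hyb : yb ∈ C.V)
    (hU : ∀ x, P.Gm x yb → x ∈ C.U) (h0 : P.Gm x0 yb) {lam Lam r : ℝ} (hlam : 0 < lam)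
    (hLam : 0 < Lam) (hr : 0 < r) (hlo : P.MAlo lam (ball x0 r))
    {N : Set (Euc n)} (hN : IsOpen N) (hNs : ∀ x, P.Gm x yb → x ∈ N) (hup : P.MAup Lam N) :
    ∀ x, P.Gm x yb → x = x0 := by
  obtain ⟨ε, hε, hε1, hmain⟩ := main6 n hn
  have hyc : yb ∈ closure C.V := subset_closure hyb
  have hK0 : {x | P.Gm x yb} = P.flip.Gam {yb} := by
    ext x; exact ⟨fun h => ⟨yb, rfl, (P.flip_Gm).2 h⟩, fun ⟨y, hy, h⟩ => by
      rw [mem_singleton_iff.1 hy] at h; exact (P.flip_Gm).1 h⟩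
  have cK : IsCompact {x | P.Gm x yb} := by
    rw [hK0]; exact P.flip.Gam_compact isCompact_singleton
  set H := convexHull ℝ (C.flip.p yb '' {x | P.Gm x yb}) with hH
  have cq : IsCompact (C.flip.p yb '' {x | P.Gm x yb}) :=
    cK.image_of_continuousOn ((C.flip.px_cont hyb).mono fun x hx => hx.1)
  have cH : IsCompact H := by rw [hH, (P.fiber_convex hM hyb).convexHull_eq]; exact cq
  have hHU : H ⊆ C.Ub yb := convexHull_min (by
    rintro _ ⟨x, hx, rfl⟩; exact ⟨x, hU x hx, rfl⟩) (C.Ub_convex hyb)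
  obtain ⟨δ, hδ, hδU⟩ := cH.exists_cthickening_subset_open (C.Ub_open hyb) hHU
  have cT : IsCompact (cthickening δ H) := cH.cthickening
  set O := thickening δ H with hOd
  have hOT : O ⊆ cthickening δ H := thickening_subset_cthickening δ H
  have cX : IsCompact (C.chi yb '' cthickening δ H) :=
    cT.image_of_continuousOn ((C.chi_cont hyb).mono hδU)
  obtain ⟨K, L, hc⟩ := C.exists_cst cX (isCompact_singleton (x := yb))
    (by rintro _ ⟨q, hq, rfl⟩; exact C.chi_mem hyb (hδU hq)) (by simpa using hyb)
  obtain ⟨Db, hDb0, hDb⟩ : ∃ Db : ℝ, 0 < Db ∧ ∀ q ∈ O, ∀ q' ∈ O, ‖q' - q‖ ≤ Db := by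
    refine ⟨diam (cthickening δ H) + 1, by positivity, fun q hq q' hq' => ?_⟩
    rw [← dist_eq_norm]
    linarith [dist_le_diam_of_mem cT.isBounded (hOT hq') (hOT hq)]
  have hOc : Convex ℝ O := (convex_convexHull ℝ _).thickening δ
  have hOX : ∀ q ∈ O, C.chi yb q ∈ C.chi yb '' cthickening δ H := fun q hq => ⟨q, hOT hq, rfl⟩
  have hK1 := hc.K1
  have hL1 := hc.L1
  have D : Dat P K L (C.chi yb '' cthickening δ H) {yb} yb O
      (Real.exp (-(16 * K ^ 3 * L ^ 3 * L * Db))) :=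
    ⟨hc, hM, rfl, isOpen_thickening, hOc, hOT.trans hδU, hOX, Real.exp_pos _,
      Real.exp_le_one_iff.2 (by have : 0 ≤ 16 * K ^ 3 * L ^ 3 * L * Db := by positivity
                                linarith),
      hc.star' hM rfl hOc (hOT.trans hδU) hOX hDb le_rfl⟩
  have hx0U := hU x0 h0
  obtain ⟨r1, hr1, hr1U⟩ := Metric.isOpen_iff.1 C.hU x0 hx0U
  have hNo : IsOpen (N ∩ (C.U ∩ C.flip.p yb ⁻¹' O)) :=
    hN.inter (((C.flip.px_cont hyb).mono subset_closure).isOpen_inter_preimage C.hU isOpen_thickening)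
  obtain ⟨h1, hh1, r2, hr2, hsub⟩ := P.sub_small hyc hNo fun x hx => ⟨hNs x hx, hU x hx,
    self_subset_thickening hδ H (subset_convexHull ℝ _ ⟨x, hx, rfl⟩)⟩
  have hsub' := hsub yb hyc (by simpa using hr2)
  exact partI_aux hε hε1 hmain D h0 hlam hLam (r := min r r1) (lt_min hr hr1)
    (fun A hA hA' => hlo A (hA.trans (ball_subset_ball (min_le_left _ _))) hA')
    ((ball_subset_ball (min_le_right _ _)).trans hr1U) hup hh1
    (fun x hx hF => (hsub' x hx hF).2.2) (fun x hx hF => (hsub' x hx hF).1) hDb0 hDb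

end Pot
end FKM

open Set MeasureTheory Metric Bornology
open scoped ENNReal NNReal Pointwise

set_option linter.unusedVariables false
set_option linter.unusedSectionVars false
namespace FKM
open scoped RealInnerProductSpace
open Filter Topology

namespace Cost
variable {n : ℕ} (C : Cost n)

lemma approx {x0 y0 : Euc n} (hx0 : x0 ∈ C.U) (hy0 : y0 ∈ C.V) {δ : ℝ≥0} (hδ : 0 < δ) :
    ∃ r : ℝ, 0 < r ∧ ball x0 r ⊆ C.U ∧ ball y0 r ⊆ C.V ∧ ∀ x ∈ ball x0 r,
      ApproximatesLinearOn (C.p x) (C.B x0 y0) (ball y0 r) δ := by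
  obtain ⟨K, hK1, hK⟩ := C.bounds
  obtain ⟨r1, hr1, h1⟩ := Metric.isOpen_iff.1 C.hU x0 hx0
  obtain ⟨r2, hr2, h2⟩ := Metric.isOpen_iff.1 C.hV y0 hy0
  have hδ' : (0:ℝ) < δ := hδ
  set r := min (min r1 r2) (δ / (2 * K)) with hr
  have hr0 : 0 < r := by positivity
  have hU : ball x0 r ⊆ C.U := (ball_subset_ball ((min_le_left _ _).trans (min_le_left _ _))).trans h1
  have hV : ball y0 r ⊆ C.V := (ball_subset_ball ((min_le_left _ _).trans (min_le_right _ _))).trans h2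
  have hrδ : 2 * K * r ≤ δ := by
    have : r ≤ δ / (2 * K) := min_le_right _ _
    rw [le_div_iff₀ (by positivity)] at this
    linarith
  refine ⟨r, hr0, hU, hV, fun x hx => ?_⟩
  have hb : ∀ ζ ∈ ball y0 r, ‖C.B x ζ - C.B x0 y0‖ ≤ δ := fun ζ hζ => by
    refine ContinuousLinearMap.opNorm_le_bound _ hδ'.le fun η => ?_
    have a1 := C.B_lip2 hK1 (fun z hz => (hK z hz).2.2.1) (convex_ball y0 r) hV (hU hx)
      (mem_ball_self hr0) hζ η
    have a2 := C.B_lip hK1 (fun z hz => (hK z hz).2.2.1) (convex_ball x0 r) hU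
      (mem_ball_self hr0) hx hy0 η
    have hζ' : ‖ζ - y0‖ ≤ r := by rw [← dist_eq_norm]; exact (mem_ball.1 hζ).le
    have hx' : ‖x - x0‖ ≤ r := by rw [← dist_eq_norm]; exact (mem_ball.1 hx).le
    have e : (C.B x ζ - C.B x0 y0) η = (C.B x ζ η - C.B x y0 η) + (C.B x y0 η - C.B x0 y0 η) := by
      simp
    rw [e]
    calc _ ≤ K * r * ‖η‖ + K * r * ‖η‖ := (norm_add_le _ _).trans (add_le_add
            (a1.trans (by gcongr)) (a2.trans (by gcongr)))
      _ = 2 * K * r * ‖η‖ := by ring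
      _ ≤ _ := by gcongr
  intro y hy y' hy'
  have := (convex_ball y0 r).norm_image_sub_le_of_norm_hasFDerivWithin_le
    (f := fun ζ => C.p x ζ - C.B x0 y0 ζ) (f' := fun ζ => C.B x ζ - C.B x0 y0) (C := δ)
    (fun ζ hζ => ((C.hasB (hU hx) (hV hζ)).sub (C.B x0 y0).hasFDerivAt).hasFDerivWithinAt) hb hy' hy
  refine le_trans (le_of_eq ?_) this
  congr 1
  simp only [map_sub]; abel

lemma approx_surj {x0 y0 : Euc n} (hx0 : x0 ∈ C.U) (hy0 : y0 ∈ C.V) :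
    ∃ k r0 : ℝ, 0 < k ∧ 0 < r0 ∧ ball y0 r0 ⊆ C.V ∧ ∀ x ∈ ball x0 r0, ∀ r : ℝ, 0 ≤ r → r < r0 →
      closedBall (C.p x y0) (k * r) ⊆ C.p x '' closedBall y0 r := by
  let e := C.Beq hx0 hy0
  let R : ContinuousLinearMap.NonlinearRightInverse (e : Euc n →L[ℝ] Euc n) :=
    ⟨e.symm, ‖(e.symm : Euc n →L[ℝ] Euc n)‖₊ + 1, fun y => by
      refine ((e.symm : Euc n →L[ℝ] Euc n).le_opNorm y).trans ?_
      gcongr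
      simp, fun y => e.apply_symm_apply y⟩
  have hR : 0 < R.nnnorm := by
    change 0 < ‖(e.symm : Euc n →L[ℝ] Euc n)‖₊ + 1
    positivity
  obtain ⟨r, hr, hU, hV, ha⟩ := C.approx hx0 hy0 (δ := R.nnnorm⁻¹ / 2) (by positivity)
  refine ⟨(R.nnnorm : ℝ)⁻¹ / 2, r, by positivity, hr, hV, fun x hx t ht0 ht => ?_⟩
  have h1 := ha x hx
  rw [← C.Beq_coe hx0 hy0] at h1
  have h2 := h1.surjOn_closedBall_of_nonlinearRightInverse R ht0 (closedBall_subset_ball ht)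
  have e2 : ((R.nnnorm : ℝ)⁻¹ - ((R.nnnorm⁻¹ / 2 : ℝ≥0) : ℝ)) = (R.nnnorm : ℝ)⁻¹ / 2 := by
    push_cast; ring
  rw [e2] at h2
  exact h2

lemma vol_ratio {x0 y0 : Euc n} (hx0 : x0 ∈ C.U) (hy0 : y0 ∈ C.V) :
    ∃ d r : ℝ, 0 < d ∧ 0 < r ∧ ∀ x ∈ ball x0 r, ∀ A ⊆ ball y0 r,
      volume (C.p x '' A) ≤ ENNReal.ofReal (2 * d) * volume A ∧
      volume A ≤ ENNReal.ofReal (2 / d) * volume (C.p x '' A) := by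
  set T := C.B x0 y0 with hT
  have hdet : T.det ≠ 0 := by
    rw [hT, ← C.Beq_coe hx0 hy0]
    exact (LinearEquiv.isUnit_det' (C.Beq hx0 hy0).toLinearEquiv).ne_zero
  set d := |T.det| with hd
  have hd0 : 0 < d := abs_pos.2 hdet
  have e1 := addHaar_image_le_mul_of_det_lt (volume : Measure (Euc n)) T (m := Real.toNNReal (2 * d))
    ((ENNReal.ofReal_lt_ofReal_iff (by positivity)).2 (by linarith))
  have e2 := mul_le_addHaar_image_of_lt_det (volume : Measure (Euc n)) T (m := Real.toNNReal (d / 2))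
    ((ENNReal.ofReal_lt_ofReal_iff (by positivity)).2 (by linarith))
  obtain ⟨δ, ⟨h1, h2⟩, hδ⟩ := ((e1.and e2).and self_mem_nhdsWithin).exists
  obtain ⟨r, hr, hU, hV, ha⟩ := C.approx hx0 hy0 hδ
  refine ⟨d, r, hd0, hr, fun x hx A hA => ⟨h1 A _ ((ha x hx).mono_set hA), ?_⟩⟩
  have h3 := h2 A _ ((ha x hx).mono_set hA)
  calc volume A = ENNReal.ofReal (2 / d) * (ENNReal.ofReal (d / 2) * volume A) := by
        rw [← mul_assoc, ← ENNReal.ofReal_mul (by positivity)]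
        have : 2 / d * (d / 2) = 1 := by field_simp
        rw [this, ENNReal.ofReal_one, one_mul]
    _ ≤ _ := by gcongr; exact h3

end Cost

lemma real_aux {t e β D : ℝ} (ht : 0 ≤ t) (he : 0 ≤ e) (hβ : 0 < β) (hβ1 : β < 1) (hD : 0 ≤ D)
    (h : t ≤ D * (e * t) ^ β) : t ≤ D ^ (1 / (1 - β)) * e ^ (β / (1 - β)) := by
  rcases ht.eq_or_lt with h0 | h0
  · rw [← h0]; positivity
  have hb : 0 < 1 - β := by linarith
  have h1 : t ^ (1 - β) ≤ D * e ^ β := by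
    rw [Real.rpow_sub h0, Real.rpow_one, div_le_iff₀ (by positivity), mul_assoc,
      ← Real.mul_rpow he ht]
    exact h
  calc t = (t ^ (1 - β)) ^ (1 / (1 - β)) := by
        rw [← Real.rpow_mul ht, mul_one_div_cancel hb.ne', Real.rpow_one]
    _ ≤ (D * e ^ β) ^ (1 / (1 - β)) := Real.rpow_le_rpow (by positivity) h1 (by positivity)
    _ = _ := by
      rw [Real.mul_rpow hD (by positivity), ← Real.rpow_mul he, mul_one_div]

lemma exists_beta {ρ : ℝ} (hρ : 0 < ρ) : ∃ β : ℝ, 0 < β ∧ β ≤ 1 / 2 ∧ 1 - ρ ≤ (1 / 2 : ℝ) ^ β := by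
  have ht : Tendsto (fun β : ℝ => (1 / 2 : ℝ) ^ β) (𝓝[>] 0) (𝓝 1) := by
    have : ContinuousAt (fun β : ℝ => (1 / 2 : ℝ) ^ β) 0 :=
      (Real.continuous_const_rpow (by norm_num)).continuousAt
    have h2 := this.tendsto
    simp only [Real.rpow_zero] at h2
    exact h2.mono_left nhdsWithin_le_nhds
  have h3 := (ht.eventually (lt_mem_nhds (show 1 - ρ < 1 by linarith))).and
    (Ioo_mem_nhdsGT (show (0:ℝ) < 1 / 2 by norm_num))
  obtain ⟨β, h4, h5⟩ := h3.exists
  exact ⟨β, h5.1, h5.2.le, h4.le⟩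

namespace Pot
variable {n : ℕ} {C : Cost n} {P : Pot C}

/-- quantitative estimate at a fixed base point. -/
lemma Dat.holder {K L : ℝ} {X' Y' : Set (Euc n)} {yb : Euc n} {O : Set (Euc n)} {m : ℝ}
    (D : Dat P K L X' Y' yb O m) {r0 ρ β h1 Db : ℝ} (hr0V : ball yb r0 ⊆ C.V)
    (hr01 : L * K * r0 ≤ 1)
    (hρ0 : 0 < ρ) (hρ1 : ρ < 1) (hβ : 0 < β) (hβ1 : β < 1) (hβρ : 1 - ρ ≤ (1 / 2 : ℝ) ^ β)
    (hh1 : 0 < h1) (hIn : D.In h1) (hDb : ∀ q ∈ O, ∀ q' ∈ O, ‖q' - q‖ ≤ Db) (hDb0 : 0 ≤ Db)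
    {xb : Euc n} (hxb : P.Gm xb yb) (hd : D.S.Dbl (C.flip.p yb xb) ρ h1)
    {x1 y1 : Euc n} (hx1 : P.Gm x1 y1) (hF : P.F yb x1 ≤ h1) (hy1 : y1 ∈ ball yb r0) :
    ‖x1 - xb‖ ≤ L * ((Db * (4 / h1) ^ β) ^ (1 / (1 - β)) * ‖y1 - yb‖ ^ (β / (1 - β))) := by
  have hV := D.cst.YV D.hyb
  have hL1 := D.cst.L1
  have hq0 : C.flip.p yb xb ∈ O :=
    hIn xb hxb.1 (((P.Gm_iff hxb.1 hxb.2.1).1 hxb).trans hh1.le)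
  have hq1 : C.flip.p yb x1 ∈ O := hIn x1 hx1.1 hF
  have hc0 := C.chi_p hV hxb.1
  have hc1 := C.chi_p hV hx1.1
  set q0 := C.flip.p yb xb
  set q1 := C.flip.p yb x1
  have hu0 : D.S.u q0 = 0 := by
    rw [D.S_u, hc0]
    exact le_antisymm ((P.Gm_iff hxb.1 hxb.2.1).1 hxb) (P.F_nonneg hxb.1 hxb.2.1)
  have hq1Q : q1 ∈ D.S.Q h1 := D.mem_Q.2 ⟨hq1, by rw [hc1]; exact hF⟩
  have hg := hd.growth hρ0 hρ1 hq0 hu0 (D.Q_compact hIn) hh1 (fun q hq => hDb _ hq0 _ hq.1) hβ hβρ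
    q1 hq1Q
  have hr0 : 0 < r0 := pos_of_mem_ball hy1
  -- upper bound on u q1
  have hG : y1 ∈ D.S.G q1 := (D.mem_G hq1).2 (by rw [hc1]; exact hx1)
  have hle := D.S.hle q0 hq0 y1 hG.1
  obtain ⟨s, hs, hmv⟩ := Sys.mvt (S := D.S) hq0 hq1 hG.1
  have hqs : q0 + s • (q1 - q0) ∈ O := Sys.seg_mem (S := D.S) hq0 hq1 hs.1.le hs.2.le
  have hni := D.cst.near_id D.hyb (D.hOU hqs) hr0V hy1 (mem_ball_self hr0)
  have e0 : C.PP yb (q0 + s • (q1 - q0)) yb = 0 := by simp [Cost.PP]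
  rw [e0, sub_zero] at hni
  have hPn : ‖C.PP yb (q0 + s • (q1 - q0)) y1‖ ≤ 2 * ‖y1 - yb‖ := by
    calc _ = ‖(C.PP yb (q0 + s • (q1 - q0)) y1 - (y1 - yb)) + (y1 - yb)‖ := by congr 1; abel
      _ ≤ L * K * r0 * ‖y1 - yb‖ + ‖y1 - yb‖ := (norm_add_le _ _).trans (by gcongr)
      _ ≤ _ := by nlinarith [norm_nonneg (y1 - yb)]
  have hu1 : D.S.u q1 ≤ 2 * ‖y1 - yb‖ * ‖q1 - q0‖ := by
    have h2 : D.S.u q1 ≤ D.S.b q1 y1 - D.S.b q0 y1 := by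
      rw [hu0] at hle
      linarith [hG.2]
    rw [hmv] at h2
    refine h2.trans ((real_inner_le_norm _ _).trans ?_)
    gcongr
    exact hPn
  have hun := D.S.u_nonneg hq1
  have hg2 : ‖q1 - q0‖ ≤ (Db * (4 / h1) ^ β) * (‖y1 - yb‖ * ‖q1 - q0‖) ^ β := by
    refine hg.trans ?_
    rw [mul_assoc, ← Real.mul_rpow (by positivity) (by positivity)]
    refine mul_le_mul_of_nonneg_left (Real.rpow_le_rpow (by positivity) ?_ hβ.le) hDb0
    rw [div_mul_eq_mul_div]
    exact div_le_div_of_nonneg_right (by linarith) hh1.le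
  have h3 := real_aux (norm_nonneg _) (norm_nonneg _) hβ hβ1 (by positivity) hg2
  rw [← hc1, ← hc0]
  refine (D.chi_lip _ hq1 _ hq0).trans ?_
  gcongr

end Pot
end FKM

open Set MeasureTheory Metric Bornology
open scoped ENNReal NNReal Pointwise

set_option linter.unusedVariables false
set_option linter.unusedSectionVars false
namespace FKM
open scoped RealInnerProductSpace
open Filter Topology

namespace Pot
variable {n : ℕ}

/-- Uniform choice of charts near a point. -/
lemma chart {C : Cost n} {x0 y0 : Euc n} (hM : C.MTW) (hx0 : x0 ∈ C.U) (hy0 : y0 ∈ C.V) :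
    ∃ K L rX rY ro s : ℝ, 0 < rX ∧ 0 < rY ∧ 0 < ro ∧ 0 < s ∧ 1 ≤ K ∧ 1 ≤ L ∧
      ball y0 (2 * rY) ⊆ C.V ∧ ball x0 s ⊆ C.U ∧
      ∀ P : Pot C, ∀ yb ∈ ball y0 s, ‖yb - y0‖ < rY ∧
        Dat P K L (closedBall x0 rX) (closedBall y0 rY) yb (ball (C.flip.p yb x0) ro) (1 / 2) ∧
        ∀ x ∈ ball x0 s, C.flip.p yb x ∈ ball (C.flip.p yb x0) ro := by
  obtain ⟨r1, hr1, h1⟩ := Metric.isOpen_iff.1 C.hU x0 hx0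
  obtain ⟨r2, hr2, h2⟩ := Metric.isOpen_iff.1 C.hV y0 hy0
  set rX := r1 / 2 with hrX
  have hrX0 : 0 < rX := by positivity
  set rY := r2 / 2 with hrY
  have hrY0 : 0 < rY := by positivity
  have hX : closedBall x0 rX ⊆ C.U := (closedBall_subset_ball (by linarith)).trans h1
  have hY : closedBall y0 rY ⊆ C.V := (closedBall_subset_ball (by linarith)).trans h2
  obtain ⟨K, L, hc⟩ := C.exists_cst (isCompact_closedBall x0 rX) (isCompact_closedBall y0 rY) hX hY
  have hK1 := hc.K1
  have hL1 := hc.L1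
  obtain ⟨k, r0, hk, hr0, -, hs⟩ := C.flip.approx_surj (x0 := y0) (y0 := x0) hy0 hx0
  set rA := min rX (r0 / 2) with hrA
  have hrA0 : 0 < rA := by positivity
  set E := 16 * K ^ 3 * L ^ 3 * L with hE
  have hE0 : 0 < E := by positivity
  set ro := min (k * rA) (Real.log 2 / (2 * E)) with hro
  have hl2 : 0 < Real.log 2 := Real.log_pos one_lt_two
  have hro0 : 0 < ro := by positivity
  have hroE : E * (2 * ro) ≤ Real.log 2 := by
    have : ro ≤ Real.log 2 / (2 * E) := min_le_right _ _
    rw [le_div_iff₀ (by positivity)] at this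
    linarith
  set s := min (min rY r0) (min (ro / K) rX) with hsd
  have hs0 : 0 < s := by positivity
  have hsX : ball x0 s ⊆ C.U := (ball_subset_closedBall.trans
    (closedBall_subset_closedBall ((min_le_right _ _).trans (min_le_right _ _)))).trans hX
  refine ⟨K, L, rX, rY, ro, s, hrX0, hrY0, hro0, hs0, hK1, hL1, ?_, hsX, ?_⟩
  · rw [hrY]; convert h2 using 2; ring
  intro P yb hyb
  have hyb' : ‖yb - y0‖ < rY := by
    rw [← dist_eq_norm]
    exact lt_of_lt_of_le (mem_ball.1 hyb) ((min_le_left _ _).trans (min_le_left _ _))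
  have hybY : yb ∈ closedBall y0 rY := by
    rw [mem_closedBall, dist_eq_norm]; exact hyb'.le
  have hybV := hY hybY
  have hsub : ball (C.flip.p yb x0) ro ⊆ C.flip.p yb '' closedBall x0 rA := by
    refine (ball_subset_closedBall.trans (closedBall_subset_closedBall (min_le_left _ _))).trans
      (hs yb (ball_subset_ball ((min_le_left _ _).trans (min_le_right _ _)) hyb) rA hrA0.le ?_)
    exact (min_le_right _ _).trans_lt (by linarith)
  have hAX : closedBall x0 rA ⊆ closedBall x0 rX := closedBall_subset_closedBall (min_le_left _ _)
  have hOU : ball (C.flip.p yb x0) ro ⊆ C.Ub yb := fun q hq => by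
    obtain ⟨x, hx, rfl⟩ := hsub hq
    exact ⟨x, hX (hAX hx), rfl⟩
  have hOX : ∀ q ∈ ball (C.flip.p yb x0) ro, C.chi yb q ∈ closedBall x0 rX := fun q hq => by
    obtain ⟨x, hx, rfl⟩ := hsub hq
    rw [C.chi_p hybV (subset_closure (hX (hAX hx)))]
    exact hAX hx
  have hm : (1 / 2 : ℝ) ≤ Real.exp (-(16 * K ^ 3 * L ^ 3 * L * (2 * ro))) := by
    rw [← hE]
    calc (1 / 2 : ℝ) = Real.exp (-(Real.log 2)) := by
          rw [Real.exp_neg, Real.exp_log two_pos]; norm_num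
      _ ≤ _ := Real.exp_le_exp.2 (by linarith)
  refine ⟨hyb', ⟨hc, hM, hybY, isOpen_ball, convex_ball _ _, hOU, hOX, by norm_num, by norm_num,
    hc.star' hM hybY (convex_ball _ _) hOU hOX (D := 2 * ro) (fun q hq q' hq' => ?_) hm⟩, ?_⟩
  · rw [← dist_eq_norm]
    have h3 := dist_triangle_right q' q (C.flip.p yb x0)
    have := mem_ball.1 hq
    have := mem_ball.1 hq'
    linarith
  · intro x hx
    have h3 := hc.q_lip hybV (convex_ball x0 s) hsX x hx x0 (mem_ball_self hs0)
    rw [mem_ball, dist_eq_norm]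
    refine h3.trans_lt ?_
    have h4 : ‖x - x0‖ < ro / K := by
      rw [← dist_eq_norm]
      exact lt_of_lt_of_le (mem_ball.1 hx) ((min_le_right _ _).trans (min_le_left _ _))
    rw [lt_div_iff₀ (by positivity)] at h4
    linarith

theorem partQ (hn : 0 < n) {R : ℝ} (hR : 0 < R) : ∃ α : ℝ, 0 < α ∧ α ≤ 1 ∧
    ∀ (C : Cost n) (P : Pot C) (hM : C.MTW) (x0 y0 : Euc n) (hx0 : x0 ∈ C.U) (hy0 : y0 ∈ C.V)
    (h0 : P.Gm x0 y0) (hx : ∀ x, P.Gm x y0 → x = x0) (hy : ∀ y, P.Gm x0 y → y = y0)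
    (lam Lam : ℝ) (hlam : 0 < lam) (hLam : 0 < Lam) (hRl : Lam ≤ R * lam) (N : Set (Euc n))
    (hN : IsOpen N) (hxN : x0 ∈ N) (hlo : P.MAlo lam N) (hup : P.MAup Lam N),
    ∃ r H : ℝ, 0 < r ∧ 0 ≤ H ∧ ∀ yb ∈ ball y0 r, ∀ y1 ∈ ball y0 r, ∀ xb x1, P.Gm xb yb → P.Gm x1 y1 →
      ‖x1 - xb‖ ≤ H * ‖y1 - yb‖ ^ α := by
  obtain ⟨ε, hε, hε1, hmain⟩ := main6 n hn
  obtain ⟨ρ, hρ0, hρ1, hρ⟩ := hmain (1 / 2) 1 (2 ^ n) 1 (4 * R) (by norm_num) one_pos le_rfl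
    (by positivity) one_pos le_rfl (by positivity)
  obtain ⟨β, hβ, hβ2, hβρ⟩ := exists_beta hρ0
  have hβ1 : 0 < 1 - β := by linarith
  refine ⟨β / (1 - β), by positivity, by rw [div_le_one hβ1]; linarith, ?_⟩
  intro C P hM x0 y0 hx0 hy0 h0 hx hy lam Lam hlam hLam hRl N hN hxN hlo hup
  obtain ⟨K, L, rX, rY, ro, s, hrX, hrY, hro, hs, hK1, hL1, hYV, hsU, hchart⟩ := chart hM hx0 hy0
  obtain ⟨d, rd, hd, hrd, hvol⟩ := C.flip.vol_ratio (x0 := y0) (y0 := x0) hy0 hx0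
  have hLK : 1 ≤ L * K := by nlinarith
  set r0 := min rY (ε / 4 / (L * K)) with hr0d
  have hr0 : 0 < r0 := by positivity
  have hr0ε : L * K * r0 ≤ ε / 4 := by
    calc L * K * r0 ≤ L * K * (ε / 4 / (L * K)) := by gcongr; exact min_le_right _ _
      _ = _ := by field_simp
  set g := r0 / (16 * (L * K)) with hg
  have hg0 : 0 < g := by positivity
  have hgr : g ≤ r0 / 4 := by
    rw [hg]; apply div_le_div_of_nonneg_left <;> first | positivity | linarith
  have hg8 : r0 / (8 * (L * K)) = g + g := by
    have h1 : L ≠ 0 := by positivity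
    have h2 : K ≠ 0 := by positivity
    rw [hg]; field_simp; norm_num
  obtain ⟨r3, hr3, hGs⟩ := P.flip.Gm_small (y0 := x0) (subset_closure hx0) (N := ball y0 g)
    isOpen_ball fun y hyG => by
      rw [hy y (P.flip_Gm.1 hyG)]; exact mem_ball_self hg0
  set N1 := N ∩ ball x0 (min (min s rd) r3) with hN1
  have hN1o : IsOpen N1 := hN.inter isOpen_ball
  obtain ⟨h1, hh1, r4, hr4, hsub⟩ := P.sub_small (subset_closure hy0) hN1o fun x hxG => by
    rw [hx x hxG]; exact ⟨hxN, mem_ball_self (by positivity)⟩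
  have hu := (C.cU.prod C.cV).uniformContinuousOn_of_continuous P.F_cont
  rw [Metric.uniformContinuousOn_iff] at hu
  obtain ⟨r5, hr5, hu5⟩ := hu h1 hh1
  set r := min (min (min s rd) (min g r4)) (r5 / 2) with hr
  have hr0' : 0 < r := by positivity
  refine ⟨r, L * ((2 * ro) * (4 / h1) ^ β) ^ (1 / (1 - β)), hr0', by positivity, ?_⟩
  intro yb hyb y1 hy1 xb x1 hGb hG1
  rw [mul_assoc]
  have hrs : r ≤ s := (min_le_left _ _).trans ((min_le_left _ _).trans (min_le_left _ _))
  have hrrd : r ≤ rd := (min_le_left _ _).trans ((min_le_left _ _).trans (min_le_right _ _))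
  have hrg : r ≤ g := (min_le_left _ _).trans ((min_le_right _ _).trans (min_le_left _ _))
  have hrr4 : r ≤ r4 := (min_le_left _ _).trans ((min_le_right _ _).trans (min_le_right _ _))
  have hrr5 : r ≤ r5 / 2 := min_le_right _ _
  have hyb' : ‖yb - y0‖ < r := by rw [← dist_eq_norm]; exact hyb
  have hy1' : ‖y1 - y0‖ < r := by rw [← dist_eq_norm]; exact hy1
  have hyb1 : ‖y1 - yb‖ < 2 * r := by
    have : y1 - yb = (y1 - y0) - (yb - y0) := by abel
    rw [this]; linarith [norm_sub_le (y1 - y0) (yb - y0)]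
  obtain ⟨hyY, D, hDO⟩ := hchart P yb (ball_subset_ball hrs hyb)
  have hV := D.cst.YV D.hyb
  have hr0V : ball yb r0 ⊆ C.V := by
    refine (ball_subset_ball' ?_).trans hYV
    rw [dist_eq_norm]
    linarith [min_le_left rY (ε / 4 / (L * K))]
  have hsub' := hsub yb (subset_closure hV) (hyb'.trans_le hrr4)
  have hIn : D.In h1 := fun x hxU hF =>
    hDO x (ball_subset_ball ((min_le_left _ _).trans (min_le_left _ _)) (hsub' x hxU hF).2)
  have hF1 : P.F yb x1 ≤ h1 := by
    have h2 := hu5 (x1, yb) ⟨hG1.1, subset_closure hV⟩ (x1, y1) ⟨hG1.1, hG1.2.1⟩ (by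
      rw [Prod.dist_eq, dist_self, dist_comm, dist_eq_norm]; exact max_lt hr5 (by linarith))
    rw [Real.dist_eq] at h2
    have h3 := (abs_lt.1 h2).2
    simp only at h3
    linarith [(P.Gm_iff hG1.1 hG1.2.1).1 hG1]
  have hu0 : D.S.u (C.flip.p yb xb) = 0 := by
    rw [D.S_u, C.chi_p hV hGb.1]
    exact le_antisymm ((P.Gm_iff hGb.1 hGb.2.1).1 hGb) (P.F_nonneg hGb.1 hGb.2.1)
  have hq0 : C.flip.p yb xb ∈ ball (C.flip.p yb x0) ro :=
    hIn xb hGb.1 (((P.Gm_iff hGb.1 hGb.2.1).1 hGb).trans hh1.le)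
  have hdbl : D.S.Dbl (C.flip.p yb xb) ρ h1 := by
    intro h hh hhle
    have hI := D.mono_In hIn hhle
    have hQO : D.S.Q h ⊆ ball (C.flip.p yb x0) ro := fun q hq => hq.1
    have hQN : ∀ q ∈ D.S.Q h, C.chi yb q ∈ N1 := fun q hq =>
      hsub' _ (subset_closure (C.chi_mem hV (D.hOU hq.1))) (hq.2.trans hhle)
    have hQN' : ∀ A ⊆ D.S.Q h, C.chi yb '' A ⊆ N := by
      rintro A hA _ ⟨q, hq, rfl⟩
      exact (hQN q (hA hq)).1
    have hQd : ∀ A ⊆ D.S.Q h, C.chi yb '' A ⊆ ball x0 rd := by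
      rintro A hA _ ⟨q, hq, rfl⟩
      exact ball_subset_ball ((min_le_left _ _).trans (min_le_right _ _)) (hQN q (hA hq)).2
    have hv : ∀ A ⊆ D.S.Q h, volume A ≤ ENNReal.ofReal (2 * d) * volume (C.chi yb '' A) ∧
        volume (C.chi yb '' A) ≤ ENNReal.ofReal (2 / d) * volume A := fun A hA => by
      have h3 := hvol yb (ball_subset_ball hrrd hyb) _ (hQd A hA)
      rwa [D.q_image (hA.trans hQO)] at h3
    refine hρ D.S h _ (lam / (2 * d)) (Lam * (2 / d)) rfl
      (D.secHypQ hh hI hε hε1 hr0 hr0V hr0ε ?_)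
      (by positivity) ?_ _ ⟨hq0, by rw [hu0]; exact hh.le⟩ (by rw [hu0]; exact hh) ?_ ?_
    · intro q hq y hGy
      have h3 := (hQN q hq).2
      have h4 := hGs (C.chi yb q) (by
        rw [← dist_eq_norm]; exact lt_of_lt_of_le (mem_ball.1 h3) (min_le_right _ _)) y
        (P.flip_Gm.2 hGy)
      rw [mem_ball, dist_eq_norm] at h4
      have : y - yb = (y - y0) - (yb - y0) := by abel
      rw [this, hg8]
      linarith [norm_sub_le (y - y0) (yb - y0)]
    · calc Lam * (2 / d) ≤ R * lam * (2 / d) := by gcongr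
        _ = 4 * R * (lam / (2 * d)) := by field_simp; ring
    · intro A hA hAs
      have hAQ : A ⊆ D.S.Q h := fun z hz => by
        obtain ⟨q, hq, rfl⟩ := hAs hz
        simpa using hq
      exact D.lower_MA hlam (by positivity) hlo hA (hAQ.trans hQO) (hQN' A hAQ) (hv A hAQ).1
    · exact D.upper_MA hLam hup (D.Q_compact hI) hQO (hQN' _ subset_rfl) (hv _ subset_rfl).2
  refine D.holder hr0V (by linarith) hρ0 hρ1 hβ (by linarith) hβρ hh1 hIn (Db := 2 * ro)
    (fun q hq q' hq' => ?_) (by positivity) hGb hdbl hG1 hF1 ?_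
  · rw [← dist_eq_norm]
    have h3 := dist_triangle_right q' q (C.flip.p yb x0)
    have := mem_ball.1 hq
    have := mem_ball.1 hq'
    linarith
  · rw [mem_ball, dist_eq_norm]
    linarith

end Pot
end FKM

open Set MeasureTheory Metric Bornology
open scoped ENNReal NNReal Pointwise
set_option linter.unusedVariables false
set_option linter.unusedSectionVars false
namespace FKM
open scoped RealInnerProductSpace
open Filter Topology

namespace Cost
variable {n : ℕ} (C : Cost n)

/-- second order remainder in the first variable. -/
lemma qq_pt {K L : ℝ} (hK1 : 1 ≤ K) (hL1 : 1 ≤ L) {x x0 y : Euc n} {T : Set (Euc n)}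
    (hT : Convex ℝ T) (hTU : T ⊆ C.U) (hx0 : x0 ∈ T) (hx : x ∈ T) (hy : y ∈ C.V)
    (hK3 : ∀ z ∈ C.W, ∀ v w a, |d3 C.f z v w a| ≤ K * ‖v‖ * ‖w‖ * ‖a‖)
    (hK4 : ∀ z ∈ C.W, ∀ v w a b, |d4 C.f z v w a b| ≤ K * ‖v‖ * ‖w‖ * ‖a‖ * ‖b‖)
    (hL : ∀ η, ‖η‖ ≤ L * ‖C.B x0 y η‖) {P η b : Euc n}
    (hη : ∀ ζ, d2 C.f (x0, y) (ζ, 0) (0, η) = -⟪P, ζ⟫)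
    (hb : ∀ ζ, d2 C.f (x0, y) (ζ, 0) (0, b) = -d3 C.f (x0, y) (ζ, 0) (0, η) (0, η)) :
    -(2 * K ^ 2 * L ^ 3 * ‖x - x0‖ ^ 2 * ‖P‖ ^ 2) ≤
      d2 C.f (x, y) (0, η) (0, η) + d1 C.f (x, y) (0, b) -
      (d2 C.f (x0, y) (0, η) (0, η) + d1 C.f (x0, y) (0, b)) := by
  have hx0U := hTU hx0
  have hBη : C.B x0 y η = P := ext_inner_right ℝ fun ζ => by rw [C.B_inner hx0U hy, hη, neg_neg]
  have nη : ‖η‖ ≤ L * ‖P‖ := by rw [← hBη]; exact hL η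
  have nb : ‖b‖ ≤ L * (K * ‖η‖ * ‖η‖) := by
    refine (hL b).trans ?_
    gcongr
    refine inner_bound (by positivity) fun ζ => ?_
    rw [C.B_inner hx0U hy, hb, neg_neg]
    refine (hK3 _ ⟨hx0U, hy⟩ _ _ _).trans (le_of_eq ?_)
    rw [norm_inl, norm_inr]; ring
  have n2 : ‖η‖ * ‖η‖ ≤ L ^ 2 * ‖P‖ ^ 2 := by
    calc _ ≤ (L * ‖P‖) * (L * ‖P‖) := by gcongr
      _ = _ := by ring
  have nb' : ‖b‖ ≤ K * L ^ 3 * ‖P‖ ^ 2 := by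
    calc _ ≤ L * (K * (‖η‖ * ‖η‖)) := by rw [← mul_assoc K]; exact nb
      _ ≤ L * (K * (L ^ 2 * ‖P‖ ^ 2)) := by gcongr
      _ = _ := by ring
  have hKK : K ≤ K ^ 2 := by nlinarith
  have hLL : L ^ 2 ≤ L ^ 3 := pow_le_pow_right₀ hL1 (by norm_num)
  set ξ := x - x0 with hξ
  have hmem : ∀ s ∈ Icc (0:ℝ) 1, x0 + s • ξ ∈ C.U := fun s hs =>
    hTU (hT.add_smul_sub_mem hx0 hx hs)
  have hγ : ∀ s : ℝ, HasDerivAt (fun s : ℝ => ((x0 + s • ξ, y) : Euc n × Euc n)) (ξ, 0) s := fun s => by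
    have := ((hasDerivAt_id s).smul_const ξ).const_add x0
    simp only [one_smul] at this
    exact this.prodMk (hasDerivAt_const _ _)
  have hc1 : ∀ s : ℝ, ∀ v : Euc n × Euc n, HasDerivAt (fun s : ℝ => v) 0 s := fun s v => hasDerivAt_const s v
  have := second_order (ψ := fun s => d2 C.f (x0 + s • ξ, y) (0, η) (0, η) + d1 C.f (x0 + s • ξ, y) (0, b) -
      (d2 C.f (x0, y) (0, η) (0, η) + d1 C.f (x0, y) (0, b)))
    (ψ' := fun s => d3 C.f (x0 + s • ξ, y) (ξ, 0) (0, η) (0, η) + d2 C.f (x0 + s • ξ, y) (ξ, 0) (0, b))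
    (ψ'' := fun s => d4 C.f (x0 + s • ξ, y) (ξ, 0) (ξ, 0) (0, η) (0, η) +
      d3 C.f (x0 + s • ξ, y) (ξ, 0) (ξ, 0) (0, b))
    (m := 2 * K ^ 2 * L ^ 3 * ‖ξ‖ ^ 2 * ‖P‖ ^ 2) (by positivity) ?_ ?_ ?_ ?_ ?_
  · simpa [hξ] using this
  · intro s hs
    have e1 := C.sm.k2 (t := s) ⟨hmem s hs, hy⟩ (hγ s) (hc1 s (0, η)) (hc1 s (0, η))
    have e2 := C.sm.k1 (t := s) ⟨hmem s hs, hy⟩ (hγ s) (hc1 s (0, b))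
    refine ((e1.fun_add e2).sub_const _).congr_deriv ?_
    simp [d2, d1]
  · intro s hs
    have e1 := C.sm.k3 (t := s) ⟨hmem s hs, hy⟩ (hγ s) (hc1 s (ξ, 0)) (hc1 s (0, η)) (hc1 s (0, η))
    have e2 := C.sm.k2 (t := s) ⟨hmem s hs, hy⟩ (hγ s) (hc1 s (ξ, 0)) (hc1 s (0, b))
    refine (e1.fun_add e2).congr_deriv ?_
    simp [d2, d3]
  · simp
  · have := hb ξ
    simp only [zero_smul, add_zero]
    linarith
  · intro s hs
    have e1 := hK4 (x0 + s • ξ, y) ⟨hmem s hs, hy⟩ (ξ, 0) (ξ, 0) (0, η) (0, η)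
    have e2 := hK3 (x0 + s • ξ, y) ⟨hmem s hs, hy⟩ (ξ, 0) (ξ, 0) (0, b)
    simp only [norm_inl, norm_inr] at e1 e2
    have n3 : ‖η‖ * ‖η‖ ≤ L ^ 3 * ‖P‖ ^ 2 := n2.trans (by gcongr)
    have n4 : K * ‖ξ‖ * ‖ξ‖ * ‖η‖ * ‖η‖ ≤ K ^ 2 * L ^ 3 * ‖ξ‖ ^ 2 * ‖P‖ ^ 2 := by
      calc _ = K * (‖ξ‖ ^ 2 * (‖η‖ * ‖η‖)) := by ring
        _ ≤ K ^ 2 * (‖ξ‖ ^ 2 * (L ^ 3 * ‖P‖ ^ 2)) := by gcongr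
        _ = _ := by ring
    have n5 : K * ‖ξ‖ * ‖ξ‖ * ‖b‖ ≤ K ^ 2 * L ^ 3 * ‖ξ‖ ^ 2 * ‖P‖ ^ 2 := by
      calc _ = K * (‖ξ‖ ^ 2 * ‖b‖) := by ring
        _ ≤ K * (‖ξ‖ ^ 2 * (K * L ^ 3 * ‖P‖ ^ 2)) := by gcongr
        _ = _ := by ring
    have := neg_abs_le (d4 C.f (x0 + s • ξ, y) (ξ, 0) (ξ, 0) (0, η) (0, η))
    have := neg_abs_le (d3 C.f (x0 + s • ξ, y) (ξ, 0) (ξ, 0) (0, b))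
    linarith

lemma QQ0 {K L : ℝ} (hK1 : 1 ≤ K) (hL1 : 1 ≤ L) {x x0 y' y ζ : Euc n} {T : Set (Euc n)}
    (hT : Convex ℝ T) (hTU : T ⊆ C.U) (hx0 : x0 ∈ T) (hx : x ∈ T) (hy' : y' ∈ C.V) (hy : y ∈ C.V)
    (hK3 : ∀ z ∈ C.W, ∀ v w a, |d3 C.f z v w a| ≤ K * ‖v‖ * ‖w‖ * ‖a‖)
    (hK4 : ∀ z ∈ C.W, ∀ v w a b, |d4 C.f z v w a b| ≤ K * ‖v‖ * ‖w‖ * ‖a‖ * ‖b‖)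
    (hL : ∀ y ∈ C.V, ∀ η, ‖η‖ ≤ L * ‖C.B x0 y η‖)
    (hζ : C.flip.p y' x - C.flip.p y' x0 = C.flip.B y' x0 ζ) :
    -C.c x y + C.c x0 y + C.c x y' - C.c x0 y' ≤ ⟪C.p x0 y - C.p x0 y', ζ⟫ +
      2 * K ^ 2 * L ^ 3 * ‖x - x0‖ ^ 2 * ‖C.p x0 y - C.p x0 y'‖ ^ 2 := by
  have hx0U := hTU hx0
  have hxU := hTU hx
  set P := C.p x0 y - C.p x0 y' with hP
  obtain ⟨Y, dY, ddY, h0, hTo, h⟩ := C.curve hx0U hy' P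
  have hmem : ∀ t ∈ Icc (0:ℝ) 1, C.p x0 y' + t • P ∈ C.Vx x0 := fun t ht =>
    (C.Vx_convex hx0U).add_smul_sub_mem (mem_image_of_mem _ hy') (mem_image_of_mem _ hy) ht
  have hY1 : Y 1 = y := by
    obtain ⟨h1, h2, -⟩ := h 1 (hmem 1 (by simp))
    refine C.px_inj hx0U (subset_closure h1) (subset_closure hy) ?_
    rw [h2, hP]; simp
  have h00 := h 0 (hmem 0 (by simp))
  have hBη : C.B x0 y' (dY 0) = P := ext_inner_right ℝ fun ζ => by
    have := h00.2.2.2.2.1 ζ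
    rw [h0] at this
    rw [C.B_inner hx0U hy', this, neg_neg]
  have hd0 : d1 C.f (x, y') (0, dY 0) - d1 C.f (x0, y') (0, dY 0) = -⟪P, ζ⟫ := by
    have e1 := C.flip.p_inner hy' hxU (dY 0)
    have e2 := C.flip.p_inner hy' hx0U (dY 0)
    rw [C.fd1 hxU hy'] at e1
    rw [C.fd1 hx0U hy'] at e2
    have e3 := C.B_flip hx0U hy' (dY 0) ζ
    rw [← hζ, inner_sub_left, hBη] at e3
    simp only at e1 e2
    linarith
  have := second_order (ψ := fun t => C.f (x, Y t) - C.f (x0, Y t) - (C.f (x, y') - C.f (x0, y')) + t * ⟪P, ζ⟫)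
    (ψ' := fun t => d1 C.f (x, Y t) (0, dY t) - d1 C.f (x0, Y t) (0, dY t) + ⟪P, ζ⟫)
    (ψ'' := fun t => d2 C.f (x, Y t) (0, dY t) (0, dY t) + d1 C.f (x, Y t) (0, ddY t) -
      (d2 C.f (x0, Y t) (0, dY t) (0, dY t) + d1 C.f (x0, Y t) (0, ddY t)))
    (m := 2 * K ^ 2 * L ^ 3 * ‖x - x0‖ ^ 2 * ‖P‖ ^ 2) (by positivity) ?_ ?_ ?_ ?_ ?_
  · simp only [hY1, one_mul] at this
    change _ ≤ C.c x y - C.c x0 y - (C.c x y' - C.c x0 y') + _ at this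
    linarith
  · intro t ht
    obtain ⟨k1, k2, k3, k4, k5, k6⟩ := h t (hmem t ht)
    have e1 := C.sm.k0 (γ := fun t => (x, Y t)) (t := t) ⟨hxU, k1⟩ ((hasDerivAt_const _ _).prodMk k3)
    have e2 := C.sm.k0 (γ := fun t => (x0, Y t)) (t := t) ⟨hx0U, k1⟩ ((hasDerivAt_const _ _).prodMk k3)
    have e3 := ((e1.fun_sub e2).sub_const (C.f (x, y') - C.f (x0, y'))).fun_add
      ((hasDerivAt_id t).mul_const ⟪P, ζ⟫)
    refine e3.congr_deriv ?_
    simp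
  · intro t ht
    obtain ⟨k1, k2, k3, k4, k5, k6⟩ := h t (hmem t ht)
    have e1 := C.sm.k1 (γ := fun t => (x, Y t)) (t := t) ⟨hxU, k1⟩ ((hasDerivAt_const _ _).prodMk k3)
      ((hasDerivAt_const _ (0 : Euc n)).prodMk k4)
    have e2 := C.sm.k1 (γ := fun t => (x0, Y t)) (t := t) ⟨hx0U, k1⟩ ((hasDerivAt_const _ _).prodMk k3)
      ((hasDerivAt_const _ (0 : Euc n)).prodMk k4)
    exact (e1.fun_sub e2).add_const ⟪P, ζ⟫
  · simp [h0]
  · simp only [h0]; linarith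
  · intro t ht
    obtain ⟨k1, k2, k3, k4, k5, k6⟩ := h t (hmem t ht)
    exact C.qq_pt hK1 hL1 hT hTU hx0 hx k1 hK3 hK4 (hL _ k1) k5 k6

/-- quantitative upper bound for the cross difference of the cost. -/
lemma QQ {K L : ℝ} (hK1 : 1 ≤ K) (hL1 : 1 ≤ L) {x x0 y' y ζ : Euc n} {T : Set (Euc n)}
    (hT : Convex ℝ T) (hTU : T ⊆ C.U) (hx0 : x0 ∈ T) (hx : x ∈ T) (hy' : y' ∈ C.V)
    (hy : y ∈ closure C.V)
    (hK3 : ∀ z ∈ C.W, ∀ v w a, |d3 C.f z v w a| ≤ K * ‖v‖ * ‖w‖ * ‖a‖)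
    (hK4 : ∀ z ∈ C.W, ∀ v w a b, |d4 C.f z v w a b| ≤ K * ‖v‖ * ‖w‖ * ‖a‖ * ‖b‖)
    (hL : ∀ y ∈ C.V, ∀ η, ‖η‖ ≤ L * ‖C.B x0 y η‖)
    (hζ : C.flip.p y' x - C.flip.p y' x0 = C.flip.B y' x0 ζ) :
    -C.c x y + C.c x0 y + C.c x y' - C.c x0 y' ≤ ⟪C.p x0 y - C.p x0 y', ζ⟫ +
      2 * K ^ 2 * L ^ 3 * ‖x - x0‖ ^ 2 * ‖C.p x0 y - C.p x0 y'‖ ^ 2 := by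
  have hcx : ∀ x ∈ C.U, ContinuousOn (fun y => C.c x y) (closure C.V) := fun x hx =>
    C.cont_f.comp (f := fun y => (x, y)) (by fun_prop) fun y hy => ⟨subset_closure hx, hy⟩
  have h1 := hcx x (hTU hx)
  have h2 := hcx x0 (hTU hx0)
  have h3 := C.px_cont (hTU hx0)
  refine le_on_closure (s := C.V) (f := fun y => -C.c x y + C.c x0 y + C.c x y' - C.c x0 y')
    (fun y hy => C.QQ0 hK1 hL1 hT hTU hx0 hx hy' hy hK3 hK4 hL hζ) ?_ ?_ hy
  · fun_prop
  · fun_prop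

end Cost
end FKM

open Set MeasureTheory Metric Bornology
open scoped ENNReal NNReal Pointwise
set_option linter.unusedVariables false
set_option linter.unusedSectionVars false
namespace FKM
open scoped RealInnerProductSpace
open Filter Topology

/-- stretching by `θ` in the direction `ν`. -/
noncomputable def strch {n : ℕ} (ν : Euc n) (θ : ℝ) : Euc n →ₗ[ℝ] Euc n :=
  LinearMap.transvection (innerSL ℝ ν : Euc n →ₗ[ℝ] ℝ) ((θ - 1) • ν)

lemma strch_apply {n : ℕ} (ν : Euc n) (θ : ℝ) (z : Euc n) :
    strch ν θ z = z + ⟪ν, z⟫ • ((θ - 1) • ν) := rfl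

lemma vol_strch {n : ℕ} {ν : Euc n} (hν : ‖ν‖ = 1) {θ : ℝ} (hθ : 0 ≤ θ) (S : Set (Euc n)) :
    volume (strch ν θ '' S) = ENNReal.ofReal θ * volume S := by
  rw [Measure.addHaar_image_linearMap]
  congr 2
  rw [strch, LinearMap.transvection.det]
  have : (innerSL ℝ ν : Euc n →ₗ[ℝ] ℝ) ((θ - 1) • ν) = θ - 1 := by
    change ⟪ν, (θ - 1) • ν⟫ = _
    rw [inner_smul_right, real_inner_self_eq_norm_sq, hν]; ring
  rw [this, show 1 + (θ - 1) = θ by ring, abs_of_nonneg hθ]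

lemma slab_up {n : ℕ} {ν : Euc n} (hν : ‖ν‖ = 1) {θ a : ℝ} (hθ : 0 < θ) :
    volume {P : Euc n | ‖P‖ ≤ a * θ ∧ |⟪ν, P⟫| ≤ a * θ ^ 2} ≤
      ENNReal.ofReal θ * volume (closedBall (0 : Euc n) (2 * a * θ)) := by
  rw [← vol_strch hν hθ.le]
  refine measure_mono fun P hP => ?_
  have hνν : ⟪ν, ν⟫ = 1 := by rw [real_inner_self_eq_norm_sq, hν]; norm_num
  refine ⟨P + (⟪ν, P⟫ * (θ⁻¹ - 1)) • ν, ?_, ?_⟩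
  · rw [mem_closedBall_zero_iff]
    have e : P + (⟪ν, P⟫ * (θ⁻¹ - 1)) • ν = (P - ⟪ν, P⟫ • ν) + (⟪ν, P⟫ * θ⁻¹) • ν := by
      rw [mul_sub, sub_smul, mul_one]; abel
    have n1 : ‖P - ⟪ν, P⟫ • ν‖ ≤ ‖P‖ := by
      have h : ‖P - ⟪ν, P⟫ • ν‖ ^ 2 ≤ ‖P‖ ^ 2 := by
        rw [norm_sub_sq_real, inner_smul_right, real_inner_comm, norm_smul, hν, Real.norm_eq_abs, mul_one,
          sq_abs]
        nlinarith [sq_nonneg ⟪ν, P⟫]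
      exact abs_le_of_sq_le_sq' h (norm_nonneg _) |>.2
    have n2 : ‖(⟪ν, P⟫ * θ⁻¹) • ν‖ ≤ a * θ := by
      rw [norm_smul, hν, mul_one, norm_mul, norm_inv, Real.norm_eq_abs, Real.norm_eq_abs, abs_of_pos hθ]
      calc _ ≤ a * θ ^ 2 * θ⁻¹ := by gcongr; exact hP.2
        _ = _ := by field_simp
    rw [e]
    calc _ ≤ a * θ + a * θ := (norm_add_le _ _).trans (add_le_add (n1.trans hP.1) n2)
      _ = _ := by ring
  · rw [strch_apply, inner_add_right, inner_smul_right, hνν, smul_smul, add_assoc, ← add_smul]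
    have : ⟪ν, P⟫ * (θ⁻¹ - 1) + (⟪ν, P⟫ + ⟪ν, P⟫ * (θ⁻¹ - 1) * 1) * (θ - 1) = 0 := by
      field_simp; ring
    rw [this]; simp

/-- thin cylinder in the direction `ν`. -/
def cyl {n : ℕ} (ν : Euc n) (θ s : ℝ) : Set (Euc n) :=
  {z | |⟪ν, z⟫ - 3 * s / 4| ≤ s / 4 ∧ ‖z - ⟪ν, z⟫ • ν‖ ≤ θ * s / 4}

lemma cyl_low {n : ℕ} {ν : Euc n} (hν : ‖ν‖ = 1) {θ s : ℝ} (hθ : 0 < θ) :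
    volume (closedBall (0 : Euc n) (θ * s / 4)) ≤ ENNReal.ofReal θ * volume (cyl ν θ s) := by
  have hνν : ⟪ν, ν⟫ = 1 := by rw [real_inner_self_eq_norm_sq, hν]; norm_num
  have h1 : volume (cyl ν θ s) = volume ((fun z => (-(3 * s / 4)) • ν + z) '' cyl ν θ s) := by
    rw [image_add_left, measure_preimage_add]
  rw [h1, ← vol_strch hν hθ.le]
  refine measure_mono fun w hw => ?_
  rw [mem_closedBall_zero_iff] at hw
  refine ⟨w + (⟪ν, w⟫ * (θ⁻¹ - 1)) • ν, ⟨(3 * s / 4) • ν + (w + (⟪ν, w⟫ * (θ⁻¹ - 1)) • ν), ?_, ?_⟩, ?_⟩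
  · have e : ⟪ν, (3 * s / 4) • ν + (w + (⟪ν, w⟫ * (θ⁻¹ - 1)) • ν)⟫ = 3 * s / 4 + ⟪ν, w⟫ * θ⁻¹ := by
      simp only [inner_add_right, inner_smul_right, hνν]; ring
    have hi : |⟪ν, w⟫| ≤ ‖w‖ := by
      have := abs_real_inner_le_norm ν w
      rwa [hν, one_mul] at this
    constructor
    · rw [e]
      have : 3 * s / 4 + ⟪ν, w⟫ * θ⁻¹ - 3 * s / 4 = ⟪ν, w⟫ * θ⁻¹ := by ring
      rw [this, abs_mul, abs_inv, abs_of_pos hθ]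
      calc _ ≤ θ * s / 4 * θ⁻¹ := by gcongr; exact hi.trans hw
        _ = _ := by field_simp
    · rw [e]
      have : (3 * s / 4) • ν + (w + (⟪ν, w⟫ * (θ⁻¹ - 1)) • ν) - (3 * s / 4 + ⟪ν, w⟫ * θ⁻¹) • ν =
          w - ⟪ν, w⟫ • ν := by
        module
      rw [this]
      refine le_trans ?_ hw
      have h : ‖w - ⟪ν, w⟫ • ν‖ ^ 2 ≤ ‖w‖ ^ 2 := by
        rw [norm_sub_sq_real, inner_smul_right, real_inner_comm, norm_smul, hν, Real.norm_eq_abs, mul_one,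
          sq_abs]
        nlinarith [sq_nonneg ⟪ν, w⟫]
      exact abs_le_of_sq_le_sq' h (norm_nonneg _) |>.2
  · simp only; module
  · rw [strch_apply, inner_add_right, inner_smul_right, hνν, smul_smul, add_assoc, ← add_smul]
    have : ⟪ν, w⟫ * (θ⁻¹ - 1) + (⟪ν, w⟫ + ⟪ν, w⟫ * (θ⁻¹ - 1) * 1) * (θ - 1) = 0 := by
      field_simp; ring
    rw [this]; simp

lemma cyl_bd {n : ℕ} {ν : Euc n} (hν : ‖ν‖ = 1) {θ s : ℝ} (hθ1 : θ ≤ 1) (hs : 0 ≤ s)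
    {z : Euc n} (hz : z ∈ cyl ν θ s) : ‖z‖ ≤ 2 * s := by
  have e : z = (z - ⟪ν, z⟫ • ν) + ⟪ν, z⟫ • ν := by simp
  have h1 := abs_le.1 hz.1
  have h2 : |⟪ν, z⟫| ≤ s := abs_le.2 ⟨by linarith, by linarith⟩
  rw [e]
  refine (norm_add_le _ _).trans ?_
  rw [norm_smul ⟪ν, z⟫ ν, hν, mul_one, Real.norm_eq_abs]
  have := hz.2
  nlinarith

lemma cyl_compact {n : ℕ} {ν : Euc n} (hν : ‖ν‖ = 1) {θ s : ℝ} (hθ1 : θ ≤ 1) (hs : 0 ≤ s) :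
    IsCompact (cyl ν θ s) := by
  refine (isCompact_closedBall (0 : Euc n) (2 * s)).of_isClosed_subset ?_
    fun z hz => mem_closedBall_zero_iff.2 (cyl_bd hν hθ1 hs hz)
  have h1 : IsClosed {z : Euc n | |⟪ν, z⟫ - 3 * s / 4| ≤ s / 4} := isClosed_le (by fun_prop) (by fun_prop)
  have h2 : IsClosed {z : Euc n | ‖z - ⟪ν, z⟫ • ν‖ ≤ θ * s / 4} := isClosed_le (by fun_prop) (by fun_prop)
  exact h1.inter h2

/-- the linear algebra of the boundary estimate. -/
lemma bdry_alg {n : ℕ} {ν P P' ζ : Euc n} (hν : ‖ν‖ = 1) {K R s θ δ M : ℝ} (hK : 1 ≤ K) (hR : 0 < R) (hs : 0 < s)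
    (hθ : 0 < θ) (hθ1 : θ ≤ 1) (hδ : 0 < δ) (hM : 0 ≤ M)
    (hMs : M * s ≤ 1 / (8 * R)) (hδs : δ * (2 * s + 4 * K * M * s ^ 2 + 2) ≤ s * θ ^ 2)
    (hP : ‖P‖ ≤ 2 * K) (hP' : ‖P'‖ ≤ 2 * K) (hPP : ‖P' - P‖ ≤ δ)
    (hsc : ‖P‖ ^ 2 + 2 * R * ⟪ν, P⟫ ≤ 0) (hζ : ζ ∈ cyl ν θ s)
    (h : 0 ≤ ⟪P', ζ⟫ + M * s ^ 2 * ‖P'‖ ^ 2 + 2 * δ) :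
    ‖P‖ ≤ (2 * R + 8) * θ ∧ |⟪ν, P⟫| ≤ (2 * R + 8) * θ ^ 2 := by
  have h1 := abs_le.1 hζ.1
  set A := -⟪ν, P⟫ with hA
  have hA0 : ‖P‖ ^ 2 ≤ 2 * R * A := by linarith
  have hA00 : 0 ≤ A := by
    by_contra hc
    push Not at hc
    nlinarith [sq_nonneg ‖P‖]
  have i1 : ⟪P', ζ⟫ ≤ ⟪P, ζ⟫ + δ * (2 * s) := by
    have : ⟪P', ζ⟫ = ⟪P, ζ⟫ + ⟪P' - P, ζ⟫ := by rw [inner_sub_left]; ring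
    rw [this]
    have := (real_inner_le_norm (P' - P) ζ).trans
      (mul_le_mul hPP (cyl_bd hν hθ1 hs.le hζ) (norm_nonneg _) hδ.le)
    linarith
  have i2 : ⟪P, ζ⟫ ≤ -(A * (s / 2)) + ‖P‖ * (θ * s / 4) := by
    have e : ⟪P, ζ⟫ = ⟪P, ζ - ⟪ν, ζ⟫ • ν⟫ + ⟪ν, ζ⟫ * ⟪ν, P⟫ := by
      rw [inner_sub_right, inner_smul_right, real_inner_comm P ν]; ring
    rw [e]
    have := (real_inner_le_norm P (ζ - ⟪ν, ζ⟫ • ν)).trans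
      (mul_le_mul_of_nonneg_left hζ.2 (norm_nonneg _))
    have hn : ⟪ν, P⟫ = -A := by simp [hA]
    rw [hn]
    nlinarith
  have i3 : ‖P'‖ ^ 2 ≤ ‖P‖ ^ 2 + δ * (4 * K) := by
    have : ‖P'‖ ≤ ‖P‖ + δ := by
      have := norm_le_norm_add_norm_sub' P' P
      linarith
    nlinarith [norm_nonneg P, norm_nonneg P']
  have i4 : M * s ^ 2 * ‖P'‖ ^ 2 ≤ M * s ^ 2 * (‖P‖ ^ 2 + δ * (4 * K)) := by gcongr
  have i5 : M * s * ‖P‖ ^ 2 ≤ A / 4 := by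
    calc _ ≤ 1 / (8 * R) * (2 * R * A) := by gcongr
      _ = _ := by field_simp; ring
  have i6 : 0 ≤ s * (-(A / 4) + ‖P‖ * θ / 4 + θ ^ 2) := by nlinarith
  have i7 : A ≤ θ * ‖P‖ + 4 * θ ^ 2 := by
    have := nonneg_of_mul_nonneg_right i6 hs
    linarith
  have i8 : ‖P‖ ≤ (2 * R + 4) * θ := by
    by_contra hc
    push Not at hc
    have : ‖P‖ ^ 2 ≤ 2 * R * (θ * ‖P‖ + 4 * θ ^ 2) := hA0.trans (by gcongr)
    nlinarith [mul_pos hR hθ, norm_nonneg P]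
  refine ⟨i8.trans (by gcongr; norm_num), ?_⟩
  rw [← abs_neg, ← hA, abs_of_nonneg hA00]
  nlinarith

namespace Cost
variable {n : ℕ} (C : Cost n)

lemma adj_nd {x y : Euc n} {L : ℝ} (hL0 : 0 ≤ L) (hx : x ∈ C.U) (hy : y ∈ C.V)
    (hL : ∀ η, ‖η‖ ≤ L * ‖C.B x y η‖) (ζ : Euc n) : ‖ζ‖ ≤ L * ‖C.flip.B y x ζ‖ := by
  obtain ⟨η, hη⟩ := (C.Beq hx hy).surjective ζ
  have hη' : C.B x y η = ζ := hη
  have h1 := C.B_flip hx hy η ζ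
  rw [hη', real_inner_self_eq_norm_sq] at h1
  have h2 := hL η
  rw [hη'] at h2
  have h3 := real_inner_le_norm (C.flip.B y x ζ) η
  by_cases h0 : ‖ζ‖ = 0
  · rw [h0]; positivity
  · have : 0 < ‖ζ‖ := lt_of_le_of_ne (norm_nonneg _) (Ne.symm h0)
    have h4 : ‖C.flip.B y x ζ‖ * ‖η‖ ≤ ‖C.flip.B y x ζ‖ * (L * ‖ζ‖) := by gcongr
    nlinarith

lemma unif_surj {K L ρ0 s : ℝ} {x0 y' : Euc n} (h : Cst C K L {x0} ∅) (hρ : 0 < ρ0)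
    (hρU : ball x0 ρ0 ⊆ C.U) (hρK : 2 * K * L * ρ0 ≤ 1) (hy' : y' ∈ C.V) (hs : 0 ≤ s)
    (hsρ : 4 * K * L * s < ρ0) {Z : Set (Euc n)} (hZ : IsCompact Z) (hZs : ∀ z ∈ Z, ‖z‖ ≤ 2 * s) :
    ∃ E, IsCompact E ∧ E ⊆ closedBall x0 (4 * K * L * s) ∧
      (∀ x ∈ E, ∃ ζ ∈ Z, C.flip.p y' x - C.flip.p y' x0 = C.flip.B y' x0 ζ) ∧
      volume Z ≤ ENNReal.ofReal ((L * K) ^ n) * volume E := by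
  have hK1 := h.K1
  have hL1 := h.L1
  have hx0 : x0 ∈ C.U := hρU (mem_ball_self hρ)
  have hadj := C.adj_nd (by linarith) hx0 hy' (h.hL x0 rfl y' hy')
  set q := C.flip.p y' with hq
  let e := C.flip.Beq hy' hx0
  have he : (e : Euc n →L[ℝ] Euc n) = C.flip.B y' x0 := C.flip.Beq_coe hy' hx0
  have he' : ∀ z, e z = C.flip.B y' x0 z := fun z => rfl
  have hsub : closedBall x0 (4 * K * L * s) ⊆ ball x0 ρ0 := closedBall_subset_ball hsρ
  have hlip : ∀ x ∈ ball x0 ρ0, ∀ x' ∈ ball x0 ρ0, ‖q x - q x'‖ ≤ K * ‖x - x'‖ := fun x hx x' hx' =>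
    (convex_ball x0 ρ0).norm_image_sub_le_of_norm_hasFDerivWithin_le (f := q)
      (f' := fun ζ => C.flip.B y' ζ) (C := K)
      (fun ζ hζ => (C.flip.hasB hy' (hρU hζ)).hasFDerivWithinAt)
      (fun ζ hζ => ContinuousLinearMap.opNorm_le_bound _ (by linarith) fun a =>
        C.norm_Bf hK1 (fun z hz => (h.hK z hz).2.1) (hρU hζ) hy' a) hx' hx
  have hflip3 : ∀ z ∈ C.flip.W, ∀ v w a, |d3 C.flip.f z v w a| ≤ K * ‖v‖ * ‖w‖ * ‖a‖ := by
    rintro ⟨y, x⟩ ⟨hy, hx⟩ v w a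
    rw [C.fd3 hx hy]
    refine ((h.hK (x, y) ⟨hx, hy⟩).2.2.1 _ _ _).trans (le_of_eq ?_)
    simp only [Prod.norm_def, max_comm]
  have hKr : K * ρ0 ≤ (2 * L)⁻¹ := by
    rw [le_inv_comm₀ (by positivity) (by positivity)]
    rw [le_inv_comm₀ (by positivity) (by positivity), ← one_div, le_div_iff₀ (by positivity)]
    nlinarith
  set δ : ℝ≥0 := ⟨(2 * L)⁻¹, by positivity⟩ with hδ
  have hδc : (δ : ℝ) = (2 * L)⁻¹ := rfl
  have happ : ApproximatesLinearOn q (e : Euc n →L[ℝ] Euc n) (ball x0 ρ0) δ := by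
    rw [he]
    intro x hx x' hx'
    have := (convex_ball x0 ρ0).norm_image_sub_le_of_norm_hasFDerivWithin_le
      (f := fun ζ => q ζ - C.flip.B y' x0 ζ) (f' := fun ζ => C.flip.B y' ζ - C.flip.B y' x0) (C := δ)
      (fun ζ hζ => ((C.flip.hasB hy' (hρU hζ)).sub (C.flip.B y' x0).hasFDerivAt).hasFDerivWithinAt)
      (fun ζ hζ => ContinuousLinearMap.opNorm_le_bound _ (by positivity) fun a => by
        have a1 := C.flip.B_lip2 hK1 hflip3 (convex_ball x0 ρ0) hρU hy' (mem_ball_self hρ) hζ a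
        have hζ' : ‖ζ - x0‖ ≤ ρ0 := by rw [← dist_eq_norm]; exact (mem_ball.1 hζ).le
        rw [_root_.sub_apply]
        refine a1.trans ?_
        rw [hδc]
        gcongr
        exact le_trans (by gcongr) hKr) hx' hx
    refine le_trans (le_of_eq ?_) this
    congr 1
    simp only [map_sub]; abel
  let Rr : ContinuousLinearMap.NonlinearRightInverse (e : Euc n →L[ℝ] Euc n) :=
    ⟨e.symm, ⟨L, by linarith⟩, fun z => by
      have := hadj (e.symm z)
      rwa [← he', e.apply_symm_apply] at this, fun z => e.apply_symm_apply z⟩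
  have hsurj := happ.surjOn_closedBall_of_nonlinearRightInverse Rr
    (by positivity : (0:ℝ) ≤ 4 * K * L * s) hsub
  have hrad : ((Rr.nnnorm : ℝ)⁻¹ - δ) * (4 * K * L * s) = 2 * K * s := by
    change (L⁻¹ - (2 * L)⁻¹) * (4 * K * L * s) = _
    have : L ≠ 0 := by positivity
    field_simp; ring
  rw [hrad] at hsurj
  have hcont : ContinuousOn q (closedBall x0 (4 * K * L * s)) := happ.continuousOn.mono hsub
  refine ⟨closedBall x0 (4 * K * L * s) ∩ (fun x => q x - q x0) ⁻¹' (C.flip.B y' x0 '' Z), ?_,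
    inter_subset_left, ?_, ?_⟩
  · refine (isCompact_closedBall x0 _).of_isClosed_subset ?_ inter_subset_left
    exact (hcont.sub continuousOn_const).preimage_isClosed_of_isClosed isClosed_closedBall
      (hZ.image (C.flip.B y' x0).continuous).isClosed
  · rintro x ⟨-, ζ, hζ, hx⟩
    exact ⟨ζ, hζ, hx.symm⟩
  · set E := closedBall x0 (4 * K * L * s) ∩ (fun x => q x - q x0) ⁻¹' (C.flip.B y' x0 '' Z) with hE
    have h1 : Z ⊆ (fun x => e.symm (q x - q x0)) '' E := fun ζ hζ => by
      have hb : q x0 + C.flip.B y' x0 ζ ∈ closedBall (q x0) (2 * K * s) := by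
        rw [mem_closedBall, dist_eq_norm, add_sub_cancel_left]
        have := C.norm_Bf hK1 (fun z hz => (h.hK z hz).2.1) hx0 hy' ζ
        have := hZs ζ hζ
        nlinarith
      obtain ⟨x, hx, hxe⟩ := hsurj hb
      have hxe' : q x - q x0 = C.flip.B y' x0 ζ := by rw [hxe]; simp
      refine ⟨x, ⟨hx, ζ, hζ, hxe'.symm⟩, ?_⟩
      simp only
      rw [hxe', ← he', e.symm_apply_apply]
    refine (measure_mono h1).trans (vol_lip (by positivity) fun x hx x' hx' => ?_)
    rw [← map_sub, sub_sub_sub_cancel_right]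
    have := hadj (e.symm (q x - q x'))
    rw [← he', e.apply_symm_apply] at this
    refine this.trans ?_
    rw [mul_assoc]
    gcongr
    exact hlip x (hsub hx.1) x' (hsub hx'.1)

end Cost
end FKM

open Set MeasureTheory Metric Bornology
open scoped ENNReal NNReal Pointwise
set_option linter.unusedVariables false
set_option linter.unusedSectionVars false
namespace FKM
open scoped RealInnerProductSpace
open Filter Topology

namespace Cost
variable {n : ℕ} (C : Cost n)

/-- enclosing ball at a boundary point. -/
lemma strong {x0 y0 : Euc n} (hx0 : x0 ∈ C.U) (hy0 : y0 ∈ closure C.V) (hn : y0 ∉ C.V) :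
    ∃ R : ℝ, 0 < R ∧ ∃ ν : Euc n, ‖ν‖ = 1 ∧ ∀ y ∈ closure C.V,
      ‖C.p x0 y - C.p x0 y0‖ ^ 2 + 2 * R * ⟪ν, C.p x0 y - C.p x0 y0⟫ ≤ 0 := by
  obtain ⟨-, R, hR, h⟩ := C.B2s.2 x0 (subset_closure hx0)
  have hf : C.p x0 y0 ∈ frontier (C.Vx x0) := by
    rw [frontier, (C.Vx_open hx0).interior_eq]
    refine ⟨?_, ?_⟩
    · rw [← C.img_closure hx0]; exact mem_image_of_mem _ hy0
    · rintro ⟨y, hy, e⟩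
      exact hn (C.px_inj hx0 (subset_closure hy) hy0 e ▸ hy)
  obtain ⟨z, hz, hsub⟩ := h _ hf
  have hsub' : closure (C.Vx x0) ⊆ closedBall z R := closure_minimal hsub isClosed_closedBall
  refine ⟨R, hR, R⁻¹ • (C.p x0 y0 - z), ?_, fun y hy => ?_⟩
  · rw [norm_smul, ← dist_eq_norm, hz, norm_inv, Real.norm_eq_abs, abs_of_pos hR]
    exact inv_mul_cancel₀ hR.ne'
  · have h1 : C.p x0 y ∈ closedBall z R := hsub' (by
      rw [← C.img_closure hx0]; exact mem_image_of_mem _ hy)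
    rw [mem_closedBall, dist_eq_norm] at h1
    have h2 : ‖C.p x0 y - z‖ ^ 2 ≤ R ^ 2 := by gcongr
    have e : C.p x0 y - z = (C.p x0 y - C.p x0 y0) + (C.p x0 y0 - z) := by abel
    rw [e, norm_add_sq_real, ← dist_eq_norm (C.p x0 y0) z, hz] at h2
    rw [inner_smul_left, real_inner_comm]
    simp only [conj_trivial]
    have : 2 * R * (R⁻¹ * ⟪C.p x0 y - C.p x0 y0, C.p x0 y0 - z⟫) =
      2 * ⟪C.p x0 y - C.p x0 y0, C.p x0 y0 - z⟫ := by field_simp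
    linarith

/-- approximate a boundary point from inside. -/
lemma approx_bdry {x0 y0 : Euc n} (hx0 : x0 ∈ C.U) (hy0 : y0 ∈ closure C.V) {δ : ℝ} (hδ : 0 < δ) :
    ∃ y' ∈ C.V, ‖C.p x0 y' - C.p x0 y0‖ ≤ δ ∧ ∀ x ∈ closure C.U, |C.c x y' - C.c x y0| ≤ δ := by
  have hu := (C.cU.prod C.cV).uniformContinuousOn_of_continuous C.cont_f
  rw [Metric.uniformContinuousOn_iff] at hu
  obtain ⟨d1, hd1, h1⟩ := hu δ hδ
  obtain ⟨d2, hd2, h2⟩ := Metric.continuousWithinAt_iff.1 (C.px_cont hx0 y0 hy0) δ hδ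
  obtain ⟨y', hy', hd⟩ := Metric.mem_closure_iff.1 hy0 (min d1 d2) (by positivity)
  rw [dist_comm] at hd
  refine ⟨y', hy', ?_, fun x hx => ?_⟩
  · rw [← dist_eq_norm]
    exact (h2 (subset_closure hy') (hd.trans_le (min_le_right _ _))).le
  · have := h1 (x, y') ⟨hx, subset_closure hy'⟩ (x, y0) ⟨hx, hy0⟩ (by
      rw [Prod.dist_eq]; simp [hd.trans_le (min_le_left _ _)])
    rw [Real.dist_eq] at this
    exact this.le

end Cost

namespace Pot
variable {n : ℕ} {C : Cost n} (P : Pot C)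

lemma mono_c {x0 y0 x y : Euc n} (h0 : P.Gm x0 y0) (h : P.Gm x y) :
    0 ≤ -C.c x y + C.c x0 y + C.c x y0 - C.c x0 y0 := by
  have h1 := P.nn x0 h0.1 y h.2.1
  have h2 := P.nn x h.1 y0 h0.2.1
  have h3 := h.2.2
  have h4 := h0.2.2
  linarith

lemma vol_fin {lam A2 θ s a : ℝ} (hlam : 0 < lam) (hA : 0 < A2) (hθ : 0 < θ) (hs : 0 < s) (ha : 0 < a)
    (h : ENNReal.ofReal lam * volume (closedBall (0 : Euc n) (θ * s / 4)) ≤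
      ENNReal.ofReal (θ * A2) * (ENNReal.ofReal θ * volume (closedBall (0 : Euc n) (2 * a * θ)))) :
    lam * (s / 4) ^ n ≤ A2 * (2 * a) ^ n * θ ^ 2 := by
  rw [Measure.addHaar_closedBall _ _ (by positivity), Measure.addHaar_closedBall _ _ (by positivity),
    finrank_euclideanSpace_fin, ← mul_assoc, ← mul_assoc, ← mul_assoc, ← ENNReal.ofReal_mul (by positivity),
    ← ENNReal.ofReal_mul (by positivity), ← ENNReal.ofReal_mul (by positivity)] at h
  have h2 := (ENNReal.mul_le_mul_iff_left (measure_ball_pos volume (0 : Euc n) one_pos).ne'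
    measure_ball_lt_top.ne).1 h
  rw [ENNReal.ofReal_le_ofReal_iff (by positivity)] at h2
  have e1 : lam * (θ * s / 4) ^ n = θ ^ n * (lam * (s / 4) ^ n) := by
    rw [mul_div_assoc, mul_pow]; ring
  have e2 : θ * A2 * θ * (2 * a * θ) ^ n = θ ^ n * (A2 * (2 * a) ^ n * θ ^ 2) := by
    rw [mul_pow]; ring
  rw [e1, e2] at h2
  exact le_of_mul_le_mul_left h2 (by positivity)

/-- contact points of interior points are interior. -/
theorem partB {x0 : Euc n} (hx0 : x0 ∈ C.U) {lam r : ℝ} (hlam : 0 < lam) (hr : 0 < r)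
    (hlo : P.MAlo lam (ball x0 r)) : ∀ y, P.Gm x0 y → y ∈ C.V := by
  intro y0 h0
  by_contra hy0
  obtain ⟨R, hR, ν, hν, hsc⟩ := C.strong hx0 h0.2.1 hy0
  obtain ⟨K, L, h⟩ := C.exists_cst (X' := {x0}) (Y' := ∅) isCompact_singleton isCompact_empty
    (singleton_subset_iff.2 hx0) (empty_subset _)
  have hK1 := h.K1
  have hL1 := h.L1
  have hK3 : ∀ z ∈ C.W, ∀ v w a, |d3 C.f z v w a| ≤ K * ‖v‖ * ‖w‖ * ‖a‖ := fun z hz => (h.hK z hz).2.2.1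
  have hK4 : ∀ z ∈ C.W, ∀ v w a b, |d4 C.f z v w a b| ≤ K * ‖v‖ * ‖w‖ * ‖a‖ * ‖b‖ :=
    fun z hz => (h.hK z hz).2.2.2
  have hL := h.hL x0 rfl
  obtain ⟨r1, hr1, hrU⟩ := Metric.isOpen_iff.1 C.hU x0 hx0
  set ρ0 := min (min r r1) (1 / (2 * K * L)) with hρ0
  have hρ : 0 < ρ0 := by positivity
  have hρr : ρ0 ≤ r := (min_le_left _ _).trans (min_le_left _ _)
  have hρU : ball x0 ρ0 ⊆ C.U := (ball_subset_ball ((min_le_left _ _).trans (min_le_right _ _))).trans hrU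
  have hρK : 2 * K * L * ρ0 ≤ 1 := by
    have : ρ0 ≤ 1 / (2 * K * L) := min_le_right _ _
    rw [le_div_iff₀ (by positivity)] at this
    linarith
  set M := 2 * K ^ 2 * L ^ 3 * (4 * K * L) ^ 2 with hMdef
  have hM : 0 < M := by positivity
  set s := min (ρ0 / (8 * K * L)) (1 / (8 * R * M)) with hs
  have hs0 : 0 < s := by positivity
  have hsρ : 4 * K * L * s < ρ0 := by
    have : s ≤ ρ0 / (8 * K * L) := min_le_left _ _
    rw [le_div_iff₀ (by positivity)] at this
    linarith
  have hMs : M * s ≤ 1 / (8 * R) := by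
    have : s ≤ 1 / (8 * R * M) := min_le_right _ _
    rw [le_div_iff₀ (by positivity)] at this ⊢
    linarith
  set A2 := (L * K) ^ n * L ^ n with hA2
  have hA2' : 0 < A2 := by positivity
  set a := 2 * R + 8 with ha
  have ha0 : 0 < a := by positivity
  set G := lam * (s / 4) ^ n / (A2 * (2 * a) ^ n) with hG
  have hG0 : 0 < G := by positivity
  set θ := min 1 (G / 2) with hθdef
  have hθ : 0 < θ := by positivity
  have hθ1 : θ ≤ 1 := min_le_left _ _
  have hθG : θ ^ 2 < G := by
    have : θ ≤ G / 2 := min_le_right _ _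
    nlinarith
  set D := 2 * s + 4 * K * M * s ^ 2 + 2 with hD
  have hD0 : 0 < D := by positivity
  set δ := s * θ ^ 2 / D with hδ
  have hδ0 : 0 < δ := by positivity
  have hδs : δ * D ≤ s * θ ^ 2 := by rw [hδ, div_mul_cancel₀ _ hD0.ne']
  obtain ⟨y', hy', hp', hc'⟩ := C.approx_bdry hx0 h0.2.1 hδ0
  obtain ⟨E, hE, hEs, hEζ, hEv⟩ := C.unif_surj h hρ hρU hρK hy' hs0.le hsρ (cyl_compact hν hθ1 hs0.le)
    (fun z hz => cyl_bd hν hθ1 hs0.le hz)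
  have hEb : E ⊆ ball x0 ρ0 := hEs.trans (closedBall_subset_ball hsρ)
  have key : ∀ y ∈ P.Gam E, C.p x0 y - C.p x0 y0 ∈
      {P : Euc n | ‖P‖ ≤ a * θ ∧ |⟪ν, P⟫| ≤ a * θ ^ 2} := by
    rintro y ⟨x, hx, hxy⟩
    obtain ⟨ζ, hζ, hζe⟩ := hEζ x hx
    have q1 := C.QQ hK1 hL1 (convex_ball x0 ρ0) hρU (mem_ball_self hρ) (hEb hx) hy' hxy.2.1 hK3 hK4 hL hζe
    have q2 := P.mono_c h0 hxy
    have q3 := (abs_le.1 (hc' x hxy.1)).1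
    have q4 := (abs_le.1 (hc' x0 h0.1)).2
    have hxs : ‖x - x0‖ ≤ 4 * K * L * s := by
      have := hEs hx
      rwa [mem_closedBall, dist_eq_norm] at this
    have q5 : 2 * K ^ 2 * L ^ 3 * ‖x - x0‖ ^ 2 * ‖C.p x0 y - C.p x0 y'‖ ^ 2 ≤
        M * s ^ 2 * ‖C.p x0 y - C.p x0 y'‖ ^ 2 := by
      calc _ ≤ 2 * K ^ 2 * L ^ 3 * (4 * K * L * s) ^ 2 * ‖C.p x0 y - C.p x0 y'‖ ^ 2 := by gcongr
        _ = _ := by rw [hMdef]; ring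
    have n1 : ∀ b ∈ closure C.V, ‖C.p x0 y - C.p x0 b‖ ≤ 2 * K := fun b hb =>
      (norm_sub_le _ _).trans (by
        have := h.hp x0 hx0 y hxy.2.1
        have := h.hp x0 hx0 b hb
        linarith)
    refine bdry_alg hν hK1 hR hs0 hθ hθ1 hδ0 hM.le hMs hδs (n1 y0 h0.2.1) (n1 y' (subset_closure hy')) ?_
      (hsc y hxy.2.1) hζ ?_
    · rw [sub_sub_sub_cancel_left, norm_sub_rev]; exact hp'
    · linarith
  have v1 : volume (P.Gam E) ≤ ENNReal.ofReal (L ^ n) *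
      volume ((fun y => C.p x0 y - C.p x0 y0) '' P.Gam E) :=
    vol_colip (by linarith) fun y hy y' hy' => by
      rw [sub_sub_sub_cancel_right]
      exact C.lip_of_nd (by linarith) hx0 hL y (P.Gam_sub E hy) y' (P.Gam_sub E hy')
  have v2 : volume ((fun y => C.p x0 y - C.p x0 y0) '' P.Gam E) ≤
      ENNReal.ofReal θ * volume (closedBall (0 : Euc n) (2 * a * θ)) :=
    (measure_mono (by rintro _ ⟨y, hy, rfl⟩; exact key y hy)).trans (slab_up hν hθ)
  have v3 := hlo E (hEb.trans (ball_subset_ball hρr)) hE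
  have v4 := cyl_low (s := s) hν hθ
  have v5 : ENNReal.ofReal lam * volume (closedBall (0 : Euc n) (θ * s / 4)) ≤
      ENNReal.ofReal (θ * A2) * (ENNReal.ofReal θ * volume (closedBall (0 : Euc n) (2 * a * θ))) := by
    calc _ ≤ ENNReal.ofReal lam * (ENNReal.ofReal θ * (ENNReal.ofReal ((L * K) ^ n) * volume E)) := by
          gcongr
          exact v4.trans (by gcongr)
      _ = ENNReal.ofReal θ * ENNReal.ofReal ((L * K) ^ n) * (ENNReal.ofReal lam * volume E) := by ring
      _ ≤ ENNReal.ofReal θ * ENNReal.ofReal ((L * K) ^ n) * (ENNReal.ofReal (L ^ n) *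
          (ENNReal.ofReal θ * volume (closedBall (0 : Euc n) (2 * a * θ)))) := by
          exact mul_le_mul_right (v3.trans (v1.trans (mul_le_mul_right v2 _))) _
      _ = _ := by
          rw [hA2, ENNReal.ofReal_mul hθ.le, ENNReal.ofReal_mul (by positivity)]; ring
  have v6 := vol_fin hlam hA2' hθ hs0 ha0 v5
  rw [hG, lt_div_iff₀ (by positivity)] at hθG
  linarith

end Pot
end FKM

open Set MeasureTheory Metric Bornology
open scoped ENNReal NNReal Pointwise
set_option linter.unusedVariables false
set_option linter.unusedSectionVars false
namespace FKM
open scoped RealInnerProductSpace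
open Filter Topology

namespace Pot
variable {n : ℕ} {C : Cost n} (P : Pot C)

lemma MAlo.mono {P : Pot C} {lam : ℝ} {N N' : Set (Euc n)} (h : P.MAlo lam N) (hN : N' ⊆ N) : P.MAlo lam N' :=
  fun A hA hc => h A (hA.trans hN) hc
lemma MAup.mono {P : Pot C} {lam : ℝ} {N N' : Set (Euc n)} (h : P.MAup lam N) (hN : N' ⊆ N) : P.MAup lam N' :=
  fun A hA hc => h A (hA.trans hN) hc

/-- the structure of the contact set over `U'`. -/
theorem core (hn : 0 < n) (hM : C.MTW) {U' : Set (Euc n)} (hU'o : IsOpen U') (hU' : U' ⊆ C.U)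
    {M : ℝ} (h1 : ∃ lam : ℝ, 0 < lam ∧ P.flip.MAlo lam C.V)
    (h2 : ∃ Lam : ℝ, 0 < Lam ∧ P.MAup Lam (closure C.U)) (h3 : P.MAlo (Real.exp (-(3 * M))) U')
    (h4 : ∀ N ⊆ closure C.V, P.flip.Gam N ⊆ U' →
      P.flip.MAlo (Real.exp (-(3 * M))) N ∧ P.flip.MAup (Real.exp (3 * M)) N)
    {x0 y0 : Euc n} (hx0 : x0 ∈ U') (h0 : P.Gm x0 y0) :
    y0 ∈ C.V ∧ (∀ x, P.Gm x y0 → x = x0) ∧ (∀ y, P.Gm x0 y → y = y0) ∧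
    ∃ N, IsOpen N ∧ y0 ∈ N ∧ P.flip.MAlo (Real.exp (-(3 * M))) N ∧ P.flip.MAup (Real.exp (3 * M)) N := by
  obtain ⟨lam, hlam, hlo⟩ := h1
  obtain ⟨Lam, hLam, hup⟩ := h2
  obtain ⟨r, hr, hrU⟩ := Metric.isOpen_iff.1 hU'o x0 hx0
  have hV : ∀ y, P.Gm x0 y → y ∈ C.V := P.partB (hU' hx0) (Real.exp_pos _) hr (h3.mono hrU)
  have hinv : ∀ y, P.Gm x0 y → ∀ x, P.Gm x y → x = x0 := fun y hy => by
    have hyV := hV y hy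
    obtain ⟨r', hr', hrV⟩ := Metric.isOpen_iff.1 C.hV y hyV
    have hU : ∀ x, P.Gm x y → x ∈ C.U := fun x hx =>
      P.flip.partB (C := C.flip) hyV hlam hr' (hlo.mono hrV) x (P.flip_Gm.2 hx)
    exact P.partI hn hM hyV hU hy (Real.exp_pos _) hLam hr (h3.mono hrU) C.hU hU
      (hup.mono subset_closure)
  set N : Set (Euc n) := C.V ∩ interior {y | ∀ x, P.Gm x y → x ∈ U'} with hN
  have hNo : IsOpen N := C.hV.inter isOpen_interior
  have hNm : ∀ y, P.Gm x0 y → y ∈ N := fun y hy => by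
    refine ⟨hV y hy, ?_⟩
    obtain ⟨ρ, hρ, h⟩ := P.Gm_small hy.2.1 hU'o (fun x hx => by rw [hinv y hy x hx]; exact hx0)
    rw [mem_interior_iff_mem_nhds, Metric.mem_nhds_iff]
    exact ⟨ρ, hρ, fun y' hy' x hx => h y' (by rwa [mem_ball, dist_eq_norm] at hy') x hx⟩
  have hNG : P.flip.Gam N ⊆ U' := by
    rintro x ⟨y, hy, hxy⟩
    exact interior_subset hy.2 x (P.flip_Gm.1 hxy)
  obtain ⟨k1, k2⟩ := h4 N (inter_subset_left.trans subset_closure) hNG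
  refine ⟨hV y0 h0, hinv y0 h0, ?_, N, hNo, hNm y0 h0, k1, k2⟩
  obtain ⟨r', hr', hrV⟩ := Metric.isOpen_iff.1 C.hV y0 (hV y0 h0)
  intro y hy
  exact P.flip.partI (C := C.flip) hn hM.flip (hU' hx0) (fun y hy => hV y (P.flip_Gm.1 hy))
    (P.flip_Gm.2 h0) hlam (Real.exp_pos _) hr' (hlo.mono hrV) hNo
    (fun y hy => hNm y (P.flip_Gm.1 hy)) k2 y (P.flip_Gm.2 hy)

end Pot

theorem final (n : ℕ) (M : ℝ) :
    ∃ α : ℝ, 0 < α ∧ α ≤ 1 ∧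
      ∀ (c : Euc n → Euc n → ℝ) (U V U' : Set (Euc n)) (fp fm : Euc n → ℝ),
        B0cond n c U V → B1cond n c U V → B2cond n c U V → B3cond n c U V →
        B2scond n c U V →
        IsOpen U' → U' ⊆ U →
        (∀ x, 0 ≤ fp x) → (∀ y, 0 ≤ fm y) →
        MeasureTheory.IntegrableOn fp U → MeasureTheory.IntegrableOn fm V →
        IsProbabilityMeasure (densMeasure n U fp) →
        IsProbabilityMeasure (densMeasure n V fm) →
        (∃ C : ℝ, ∀ x ∈ U, ∀ y ∈ V, fp x ≤ C * fm y) →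
        (∃ C : ℝ, ∀ x ∈ U', ∀ y ∈ V, fm y ≤ C * fp x) →
        (∀ x ∈ U', ∀ y ∈ V, |Real.log (fp x / fm y)| ≤ M) →
        ∃ G : Euc n → Euc n, Measurable G ∧ MapsTo G (closure U) (closure V) ∧
          Measure.map G (densMeasure n U fp) = densMeasure n V fm ∧
          (∀ H : Euc n → Euc n, Measurable H →
            Measure.map H (densMeasure n U fp) = densMeasure n V fm →
            ∫ x, c x (G x) ∂(densMeasure n U fp) ≤ ∫ x, c x (H x) ∂(densMeasure n U fp)) ∧
          Set.InjOn G U' ∧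
          ∀ x ∈ U', ∃ ε > 0, ∃ C : ℝ≥0, HolderOnWith C α.toNNReal G (ball x ε) := by
  rcases Nat.eq_zero_or_pos n with hn | hn
  · subst hn
    refine ⟨1, one_pos, le_rfl, ?_⟩
    intro c U V U' fp fm B0 B1 B2 B3 B2s hU'o hU' h0 h0' _ _ i1 i2 e1 e2 e3
    obtain ⟨P, G, g1, g2, g3, g4, -⟩ := exists_pot (⟨c, U, V, B0, B1, B2s⟩ : Cost 0) fp fm i1 i2
    refine ⟨G, g1, g2, g3, g4, fun x _ y _ _ => Subsingleton.elim _ _, fun x _ =>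
      ⟨1, one_pos, 0, fun x _ y _ => ?_⟩⟩
    rw [Subsingleton.elim (G x) (G y)]; simp
  · obtain ⟨α, ha, ha1, hQ⟩ := Pot.partQ hn (Real.exp_pos (6 * M))
    refine ⟨α, ha, ha1, ?_⟩
    intro c U V U' fp fm B0 B1 B2 B3 B2s hU'o hU' h0 h0' _ _ i1 i2 e1 e2 e3
    set C : Cost n := ⟨c, U, V, B0, B1, B2s⟩ with hC
    obtain ⟨P, G, g1, g2, g3, g4, g5, g6, g7⟩ := exists_pot C fp fm i1 i2
    have hM : C.MTW := C.MTW_of_B3 B3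
    rcases U'.eq_empty_or_nonempty with hU0 | hne
    · subst hU0
      exact ⟨G, g1, g2, g3, g4, injOn_empty G, fun x hx => absurd hx (notMem_empty x)⟩
    obtain ⟨m1, m2, m3, m4⟩ := MA_bounds P (C := C) hU' hne i1 i2 h0 h0' e1 e2 e3 g6 g7
    have hG : ∀ x ∈ U', P.Gm x (G x) := fun x hx => by
      rcases g5 x (subset_closure (hU' hx)) with h | ⟨y, y', hyy, hy, hy'⟩
      · exact h
      · exact absurd ((P.core hn hM hU'o hU' m1 m2 m3 m4 hx hy).2.2.1 y' hy').symm hyy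
    refine ⟨G, g1, g2, g3, g4, fun x hx x' hx' e => ?_, fun x0 hx0 => ?_⟩
    · have h := hG x' hx'
      exact ((P.core hn hM hU'o hU' m1 m2 m3 m4 hx (hG x hx)).2.1 x' (by rw [e]; exact h)).symm
    · obtain ⟨k1, k2, k3, N, hN, hyN, k4, k5⟩ := P.core hn hM hU'o hU' m1 m2 m3 m4 hx0 (hG x0 hx0)
      obtain ⟨r, H, hr, hH, hh⟩ := hQ C.flip P.flip hM.flip (G x0) x0 k1 (hU' hx0) (P.flip_Gm.2 (hG x0 hx0))
        (fun y hy => k3 y (P.flip_Gm.1 hy)) (fun x hx => k2 x (P.flip_Gm.1 hx))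
        (Real.exp (-(3 * M))) (Real.exp (3 * M)) (Real.exp_pos _) (Real.exp_pos _)
        (by rw [← Real.exp_add]; apply le_of_eq; congr 1; ring) N hN hyN k4 k5
      obtain ⟨r', hr', hrU⟩ := Metric.isOpen_iff.1 hU'o x0 hx0
      refine ⟨min r r', by positivity, H.toNNReal, fun x hx x' hx' => ?_⟩
      have b1 := hh x' (ball_subset_ball (min_le_left _ _) hx') x (ball_subset_ball (min_le_left _ _) hx)
        (G x') (G x) (P.flip_Gm.2 (hG x' (hrU (ball_subset_ball (min_le_right _ _) hx'))))
        (P.flip_Gm.2 (hG x (hrU (ball_subset_ball (min_le_right _ _) hx))))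
      rw [Real.coe_toNNReal _ ha.le, edist_dist, edist_dist, dist_eq_norm, dist_eq_norm,
        ENNReal.ofReal_rpow_of_nonneg (norm_nonneg _) ha.le]
      change _ ≤ ENNReal.ofReal H * _
      rw [← ENNReal.ofReal_mul hH]
      exact ENNReal.ofReal_le_ofReal b1

end FKM

/-- Theorem 2.1: interior Hölder continuity and injectivity of optimal maps.
The Hölder exponent `α` depends only on the dimension `n` and on the bound `M` for
`‖log(f⁺/f⁻)‖_{L∞(U'×V)}`. -/
theorem holder_continuity_and_injectivity_of_optimal_maps (n : ℕ) (M : ℝ) :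
    ∃ α : ℝ, 0 < α ∧ α ≤ 1 ∧
      ∀ (c : Euc n → Euc n → ℝ) (U V U' : Set (Euc n)) (fp fm : Euc n → ℝ),
        B0cond n c U V → B1cond n c U V → B2cond n c U V → B3cond n c U V →
        B2scond n c U V →
        IsOpen U' → U' ⊆ U →
        (∀ x, 0 ≤ fp x) → (∀ y, 0 ≤ fm y) →
        MeasureTheory.IntegrableOn fp U → MeasureTheory.IntegrableOn fm V →
        IsProbabilityMeasure (densMeasure n U fp) →
        IsProbabilityMeasure (densMeasure n V fm) →
        (∃ C : ℝ, ∀ x ∈ U, ∀ y ∈ V, fp x ≤ C * fm y) →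
        (∃ C : ℝ, ∀ x ∈ U', ∀ y ∈ V, fm y ≤ C * fp x) →
        (∀ x ∈ U', ∀ y ∈ V, |Real.log (fp x / fm y)| ≤ M) →
        ∃ G : Euc n → Euc n, Measurable G ∧ MapsTo G (closure U) (closure V) ∧
          Measure.map G (densMeasure n U fp) = densMeasure n V fm ∧
          (∀ H : Euc n → Euc n, Measurable H →
            Measure.map H (densMeasure n U fp) = densMeasure n V fm →
            ∫ x, c x (G x) ∂(densMeasure n U fp) ≤ ∫ x, c x (H x) ∂(densMeasure n U fp)) ∧
          Set.InjOn G U' ∧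
          ∀ x ∈ U', ∃ ε > 0, ∃ C : ℝ≥0, HolderOnWith C α.toNNReal G (ball x ε) := by
  exact FKM.final n M
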